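/- Let π(x) be the number of primes ≤ x, and let π'(x) be the number of primes p ≤ x such that p divides b n for some n ≥ 0. Then the limit as x → ∞ of π'(x)/π(x) exists and equals 179/336. -/

import Mathlib

/-- The ECHO sequence. -/
def echo : ℕ → ℚ
  | 0 => 1
  | 1 => 1
  | 2 => 2
  | 3 => 1
  | n + 4 =>
      (echo (n + 3) * echo (n + 1) - (if 3 ∣ (n + 4) then 3 else 1) * echo (n + 2) ^ 2) /
        echo n

section
open Real Set Filter Topology MeasureTheory

namespace EchoWI

/-- one step of the Tauberian argument -/
theorem step (H k : ℝ → ℝ) (M b η : ℝ) (hb : 0 < b) (h0 : ∀ u, 0 ≤ H u) (hM : ∀ u, H u ≤ M)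
    (hH : Measurable H)
    (hmono : ∀ u v, u ≤ v → H u * exp u ≤ H v * exp v)
    (k0 : ∀ v, 0 ≤ k v) (kint : Integrable k) (hη : 0 < η)
    (hconv : Tendsto (fun y => ∫ u in Ioi (0:ℝ), (H u - 1) * k (y - u)) atTop (𝓝 0)) :
    ∀ᶠ y in atTop,
      H y * exp (-(2*b)) * (∫ v in Icc (-b) b, k v) ≤ (∫ v, k v) + η ∧
      (∫ v in Icc (-b) b, k v) - η - M * ((∫ v, k v) - ∫ v in Icc (-b) b, k v)
        ≤ H y * exp (2*b) * (∫ v, k v) := by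
  have ki : ∀ y, Integrable (fun u => k (y - u)) := fun y => kint.comp_sub_left y
  have M0 : 0 ≤ M := (h0 0).trans (hM 0)
  have Hki : ∀ y, Integrable (fun u => H u * k (y - u)) := fun y =>
    (ki y).bdd_mul (c := M) hH.aestronglyMeasurable
      (ae_of_all _ fun u => by rw [norm_of_nonneg (h0 u)]; exact hM u)
  have tot : ∀ y, ∫ u, k (y - u) = ∫ v, k v := fun y => integral_sub_left_eq_self k volume y
  have seg : ∀ y, ∫ u in Icc (y - b) (y + b), k (y - u) = ∫ v in Icc (-b) b, k v := by
    intro y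
    rw [← integral_indicator measurableSet_Icc, ← integral_indicator measurableSet_Icc,
      ← integral_sub_left_eq_self (fun v => (Icc (-b) b).indicator k v) volume y]
    congr 1; ext u
    simp only [indicator, mem_Icc]
    have : (y - b ≤ u ∧ u ≤ y + b) ↔ (-b ≤ y - u ∧ y - u ≤ b) := by
      constructor <;> rintro ⟨h1, h2⟩ <;> constructor <;> linarith
    simp only [this]
  have split : ∀ y, ∫ u in Ioi (0:ℝ), (H u - 1) * k (y - u) =
      (∫ u in Ioi (0:ℝ), H u * k (y-u)) - ∫ u in Ioi (0:ℝ), k (y-u) := by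
    intro y
    rw [← integral_sub (Hki y).integrableOn (ki y).integrableOn]
    congr 1; ext u; ring
  have hk0 : ∀ y, ∀ u, 0 ≤ k (y - u) := fun y u => k0 _
  have hHk0 : ∀ y, ∀ u, 0 ≤ H u * k (y - u) := fun y u => mul_nonneg (h0 u) (k0 _)
  have ev : ∀ᶠ y in atTop, |∫ u in Ioi (0:ℝ), (H u - 1) * k (y - u)| < η := by
    have := hconv.eventually (Metric.ball_mem_nhds 0 hη)
    filter_upwards [this] with y hy
    simpa [dist_zero_right] using hy
  have ev1 := (tendsto_atTop_add_const_right atTop b tendsto_id).eventually ev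
  have ev2 := (tendsto_atTop_add_const_right atTop (-b) tendsto_id).eventually ev
  filter_upwards [ev1, ev2, eventually_gt_atTop (2*b)] with y e1 e2 hy
  simp only [id] at e1 e2
  have kb0 : 0 ≤ ∫ v in Icc (-b) b, k v := setIntegral_nonneg measurableSet_Icc fun v _ => k0 v
  have kle : ∫ v in Icc (-b) b, k v ≤ ∫ v, k v :=
    setIntegral_le_integral kint (ae_of_all _ k0)
  constructor
  · rw [split, abs_lt] at e1
    have h1 : ∫ u in Ioi (0:ℝ), k (y + b - u) ≤ ∫ v, k v := by
      rw [← tot (y+b)]; exact setIntegral_le_integral (ki _) (ae_of_all _ (hk0 _))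
    have h2 : ∫ u in Icc (y+b-b) (y+b+b), H u * k (y+b-u) ≤ ∫ u in Ioi (0:ℝ), H u * k (y+b-u) := by
      apply setIntegral_mono_set (Hki _).integrableOn (ae_of_all _ (hHk0 _))
      exact (Eventually.of_forall fun u hu => by
        have := hu.1; show (0:ℝ) < u; linarith)
    have h3 : ∫ u in Icc (y+b-b) (y+b+b), (H y * exp (-(2*b))) * k (y+b-u) ≤
        ∫ u in Icc (y+b-b) (y+b+b), H u * k (y+b-u) := by
      apply setIntegral_mono_on ((ki _).const_mul _).integrableOn (Hki _).integrableOn measurableSet_Icc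
      intro u hu
      apply mul_le_mul_of_nonneg_right _ (k0 _)
      have hu1 : y ≤ u := by have := hu.1; linarith
      have hu2 : u ≤ y + 2*b := by have := hu.2; linarith
      have := hmono y u hu1
      have e : H y * exp (-(2*b)) ≤ H y * exp (y - u) := by
        apply mul_le_mul_of_nonneg_left _ (h0 y); apply exp_le_exp.2; linarith
      refine e.trans ?_
      rw [exp_sub, ← mul_div_assoc, div_le_iff₀ (exp_pos u)]; exact this
    rw [integral_const_mul, seg] at h3
    linarith [e1.2]
  · rw [split, abs_lt] at e2
    have h1 : ∫ v in Icc (-b) b, k v ≤ ∫ u in Ioi (0:ℝ), k (y + -b - u) := by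
      rw [← seg (y + -b)]
      apply setIntegral_mono_set (ki _).integrableOn (ae_of_all _ (hk0 _))
      exact (Eventually.of_forall fun u hu => by
        have := hu.1; show (0:ℝ) < u; linarith)
    have h2 : ∫ u in Ioi (0:ℝ), H u * k (y + -b-u) ≤ ∫ u, H u * k (y + -b-u) :=
      setIntegral_le_integral (Hki _) (ae_of_all _ (hHk0 _))
    rw [← integral_add_compl (measurableSet_Icc (a := y + -b -b) (b := y + -b + b)) (Hki _)] at h2
    have h3 : ∫ u in Icc (y + -b-b) (y + -b+b), H u * k (y + -b-u) ≤
        ∫ u in Icc (y + -b-b) (y + -b+b), (H y * exp (2*b)) * k (y + -b-u) := by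
      apply setIntegral_mono_on (Hki _).integrableOn ((ki _).const_mul _).integrableOn measurableSet_Icc
      intro u hu
      apply mul_le_mul_of_nonneg_right _ (k0 _)
      have hu1 : y - 2*b ≤ u := by have := hu.1; linarith
      have hu2 : u ≤ y := by have := hu.2; linarith
      have := hmono u y hu2
      have e : H y * exp (y - u) ≤ H y * exp (2*b) := by
        apply mul_le_mul_of_nonneg_left _ (h0 y); apply exp_le_exp.2; linarith
      refine le_trans ?_ e
      rw [exp_sub, ← mul_div_assoc, le_div_iff₀ (exp_pos u)]; exact this
    rw [integral_const_mul, seg] at h3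
    have h4 : ∫ u in (Icc (y + -b-b) (y + -b+b))ᶜ, H u * k (y + -b-u) ≤
        ∫ u in (Icc (y + -b-b) (y + -b+b))ᶜ, M * k (y + -b-u) := by
      apply setIntegral_mono_on (Hki _).integrableOn ((ki _).const_mul _).integrableOn
        measurableSet_Icc.compl
      intro u hu
      exact mul_le_mul_of_nonneg_right (hM u) (k0 _)
    rw [integral_const_mul, setIntegral_compl measurableSet_Icc (ki _), seg, tot] at h4
    have h5 : H y * exp (2*b) * (∫ v in Icc (-b) b, k v) ≤ H y * exp (2*b) * (∫ v, k v) :=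
      mul_le_mul_of_nonneg_left kle (mul_nonneg (h0 y) (exp_pos _).le)
    linarith [e2.1]

theorem tauber (H K : ℝ → ℝ) (M : ℝ) (h0 : ∀ u, 0 ≤ H u) (hM : ∀ u, H u ≤ M)
    (hH : Measurable H)
    (hmono : ∀ u v, u ≤ v → H u * exp u ≤ H v * exp v)
    (k0 : ∀ v, 0 ≤ K v) (kint : Integrable K) (kpos : 0 < ∫ v, K v)
    (hconv : ∀ l : ℝ, 0 < l →
      Tendsto (fun y => ∫ u in Ioi (0:ℝ), (H u - 1) * K (l * (y - u))) atTop (𝓝 0)) :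
    Tendsto H atTop (𝓝 1) := by
  set c := ∫ v, K v with hc
  -- integrals over Icc (-a) a tend to c
  have hca : Tendsto (fun a : ℝ => ∫ v in Icc (-a) a, K v) atTop (𝓝 c) := by
    have := intervalIntegral_tendsto_integral (μ := volume) (f := K) kint tendsto_neg_atTop_atBot tendsto_id
    refine this.congr' ?_
    filter_upwards [eventually_ge_atTop 0] with a ha
    rw [intervalIntegral.integral_of_le (by simp; linarith), integral_Icc_eq_integral_Ioc]
    rfl
  have inv0 : Tendsto (fun a : ℝ => a⁻¹) atTop (𝓝 0) := tendsto_inv_atTop_zero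
  have hU : Tendsto (fun a : ℝ => (c + a⁻¹) * exp (2 * a⁻¹) / (∫ v in Icc (-a) a, K v)) atTop (𝓝 1) := by
    have h1 : Tendsto (fun a : ℝ => exp (2 * a⁻¹)) atTop (𝓝 1) := by
      have := (continuous_exp.tendsto (2*0)).comp (inv0.const_mul 2)
      simpa [Function.comp_def] using this
    have := ((inv0.const_add c).mul h1).div hca kpos.ne'
    simpa [kpos.ne', Pi.div_def] using this
  have hL : Tendsto (fun a : ℝ => ((∫ v in Icc (-a) a, K v) - a⁻¹ - M * (c - ∫ v in Icc (-a) a, K v)) *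
      exp (-(2 * a⁻¹)) / c) atTop (𝓝 1) := by
    have h1 : Tendsto (fun a : ℝ => exp (-(2 * a⁻¹))) atTop (𝓝 1) := by
      have := (continuous_exp.tendsto (-(2*0))).comp (inv0.const_mul 2).neg
      simpa [Function.comp_def] using this
    have := (((hca.sub inv0).sub ((hca.const_sub c).const_mul M)).mul h1).div_const c
    simpa [kpos.ne'] using this
  rw [Metric.tendsto_nhds]
  intro ε hε
  have E1 := hU.eventually (gt_mem_nhds (show (1:ℝ) < 1 + ε by linarith))
  have E2 := hL.eventually (lt_mem_nhds (show 1 - ε < (1:ℝ) by linarith))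
  have E3 := hca.eventually (lt_mem_nhds kpos)
  obtain ⟨a, ha1, ha2, ha3, ha⟩ := (E1.and (E2.and (E3.and (eventually_gt_atTop 0)))).exists
  have hl : 0 < a^2 := by positivity
  have kl : Integrable (fun v => K (a^2 * v)) := kint.comp_mul_left' hl.ne'
  have tot : ∫ v, K (a^2 * v) = (a^2)⁻¹ * c := by
    rw [Measure.integral_comp_mul_left, abs_of_pos (by positivity)]; rfl
  have seg : ∫ v in Icc (-a⁻¹) a⁻¹, K (a^2 * v) = (a^2)⁻¹ * ∫ v in Icc (-a) a, K v := by
    rw [integral_Icc_eq_integral_Ioc, integral_Icc_eq_integral_Ioc,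
      ← intervalIntegral.integral_of_le (by have := inv_pos.2 ha; linarith),
      ← intervalIntegral.integral_of_le (by linarith),
      intervalIntegral.integral_comp_mul_left _ hl.ne']
    have e1 : a^2 * -a⁻¹ = -a := by field_simp
    have e2 : a^2 * a⁻¹ = a := by field_simp
    rw [e1, e2]; rfl
  have S := step H (fun v => K (a^2*v)) M a⁻¹ ((a^2)⁻¹ * a⁻¹) (inv_pos.2 ha) h0 hM hH hmono
    (fun v => k0 _) kl (by positivity) (hconv _ hl)
  rw [tot, seg] at S
  filter_upwards [S] with y hy
  obtain ⟨s1, s2⟩ := hy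
  have s1' : H y * exp (-(2*a⁻¹)) * (∫ v in Icc (-a) a, K v) ≤ c + a⁻¹ := by
    have h : (a^2)⁻¹ * (H y * exp (-(2*a⁻¹)) * (∫ v in Icc (-a) a, K v)) ≤ (a^2)⁻¹ * (c + a⁻¹) := by
      linarith
    exact le_of_mul_le_mul_left h (by positivity)
  have s2' : (∫ v in Icc (-a) a, K v) - a⁻¹ - M * (c - ∫ v in Icc (-a) a, K v) ≤
      H y * exp (2*a⁻¹) * c := by
    have h : (a^2)⁻¹ * ((∫ v in Icc (-a) a, K v) - a⁻¹ - M * (c - ∫ v in Icc (-a) a, K v)) ≤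
        (a^2)⁻¹ * (H y * exp (2*a⁻¹) * c) := by
      linarith
    exact le_of_mul_le_mul_left h (by positivity)
  have pe : exp (-(2*a⁻¹)) * exp (2*a⁻¹) = 1 := by rw [← exp_add]; simp
  rw [dist_eq, abs_lt]
  constructor
  · have : ((∫ v in Icc (-a) a, K v) - a⁻¹ - M * (c - ∫ v in Icc (-a) a, K v)) *
      exp (-(2 * a⁻¹)) / c ≤ H y := by
      rw [div_le_iff₀ kpos]
      calc _ ≤ (H y * exp (2*a⁻¹) * c) * exp (-(2*a⁻¹)) :=
            mul_le_mul_of_nonneg_right s2' (exp_pos _).le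
        _ = H y * c * (exp (-(2*a⁻¹)) * exp (2*a⁻¹)) := by ring
        _ = _ := by rw [pe, mul_one]
    linarith
  · have : H y ≤ (c + a⁻¹) * exp (2 * a⁻¹) / (∫ v in Icc (-a) a, K v) := by
      rw [le_div_iff₀ ha3]
      calc H y * (∫ v in Icc (-a) a, K v) = (H y * exp (-(2*a⁻¹)) * (∫ v in Icc (-a) a, K v)) * exp (2*a⁻¹) := by
            linear_combination (-(H y * (∫ v in Icc (-a) a, K v))) * pe
        _ ≤ _ := mul_le_mul_of_nonneg_right s1' (exp_pos _).le
    linarith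

end EchoWI
end

section
open Real Set Filter Topology MeasureTheory
namespace EchoWI

noncomputable def fejer (v : ℝ) : ℝ := if v = 0 then 1 else 2 * (1 - cos v) / v^2

theorem fejer_nonneg (v : ℝ) : 0 ≤ fejer v := by
  unfold fejer; split_ifs
  · norm_num
  · have := cos_le_one v
    exact div_nonneg (by linarith) (sq_nonneg v)

theorem fejer_le_one (v : ℝ) : fejer v ≤ 1 := by
  unfold fejer; split_ifs with h
  · norm_num
  · have := one_sub_sq_div_two_le_cos (x := v)
    rw [div_le_one (by positivity)]; linarith

theorem fejer_le (v : ℝ) : fejer v ≤ 8 * (1 + v^2)⁻¹ := by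
  unfold fejer; split_ifs with h
  · subst h; norm_num
  · have h1 := one_sub_sq_div_two_le_cos (x := v)
    have h2 := neg_one_le_cos v
    have hv : 0 < v^2 := by positivity
    rw [← div_eq_mul_inv, div_le_div_iff₀ hv (by positivity)]
    nlinarith [cos_le_one v]

theorem fejer_measurable : Measurable fejer := by
  unfold fejer
  exact Measurable.ite (measurableSet_singleton 0) measurable_const (by fun_prop)

theorem fejer_integrable : Integrable fejer := by
  refine (integrable_inv_one_add_sq.const_mul 8).mono' fejer_measurable.aestronglyMeasurable ?_
  exact ae_of_all _ fun v => by rw [norm_of_nonneg (fejer_nonneg v)]; exact fejer_le v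

theorem fejer_pos : 0 < ∫ v, fejer v := by
  rw [integral_pos_iff_support_of_nonneg fejer_nonneg fejer_integrable]
  have : Ioo (0:ℝ) 1 ⊆ Function.support fejer := by
    intro v hv
    have h0 : v ≠ 0 := hv.1.ne'
    have : cos v < 1 := by
      have := cos_lt_cos_of_nonneg_of_le_pi (le_refl (0:ℝ)) (by linarith [hv.2, pi_gt_three]) hv.1
      simpa using this
    simp only [Function.mem_support, fejer, if_neg h0]
    have : 0 < 2 * (1 - cos v) / v^2 := div_pos (by linarith) (by positivity)
    exact this.ne'
  refine lt_of_lt_of_le ?_ (measure_mono this)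
  simp

open Complex in
theorem fejer_eq (v : ℝ) :
    ∫ t in (-1:ℝ)..1, ((1 - |t| : ℝ) : ℂ) * Complex.exp (Complex.I * (v * t)) = (fejer v : ℂ) := by
  have hi : ∀ a b : ℝ, IntervalIntegrable
      (fun t : ℝ => ((1 - |t| : ℝ) : ℂ) * Complex.exp (Complex.I * (v * t))) volume a b :=
    fun a b => (by fun_prop : Continuous _).intervalIntegrable a b
  rw [← intervalIntegral.integral_add_adjacent_intervals (hi (-1) 0) (hi 0 1)]
  by_cases hv : v = 0
  · subst hv
    have e1 : ∫ t in (-1:ℝ)..0, ((1 - |t| : ℝ) : ℂ) * Complex.exp (Complex.I * ((0:ℝ) * t)) = ((∫ t in (-1:ℝ)..0, (1 + t) : ℝ):ℂ) := by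
      rw [← intervalIntegral.integral_ofReal]
      apply intervalIntegral.integral_congr
      intro t ht
      rw [uIcc_of_le (by norm_num)] at ht
      simp [abs_of_nonpos ht.2]
    have e2 : ∫ t in (0:ℝ)..1, ((1 - |t| : ℝ) : ℂ) * Complex.exp (Complex.I * ((0:ℝ) * t)) = ((∫ t in (0:ℝ)..1, (1 - t) : ℝ):ℂ) := by
      rw [← intervalIntegral.integral_ofReal]
      apply intervalIntegral.integral_congr
      intro t ht
      rw [uIcc_of_le (by norm_num)] at ht
      simp [abs_of_nonneg ht.1]
    rw [e1, e2, ← ofReal_add]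
    congr 1
    rw [intervalIntegral.integral_add (by simp) (by simp), intervalIntegral.integral_sub (by simp) (by simp)]
    simp [fejer]
    norm_num
  · have hz : (v:ℂ) ≠ 0 := by exact_mod_cast hv
    have hI : (I:ℂ) * v ≠ 0 := mul_ne_zero I_ne_zero hz
    have dexp : ∀ t : ℝ, HasDerivAt (fun t : ℝ => Complex.exp (I * (v * t))) (I * v * Complex.exp (I * (v*t))) t := by
      intro t
      have h : HasDerivAt (fun t : ℝ => I * ((v:ℂ) * (t:ℂ))) (I * (v * 1)) t :=
        ((HasDerivAt.ofReal_comp (hasDerivAt_id t)).const_mul (v:ℂ)).const_mul I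
      have := h.cexp
      convert this using 1
      ring
    have e1 : ∫ t in (-1:ℝ)..0, ((1 - |t| : ℝ) : ℂ) * Complex.exp (Complex.I * (v * t)) =
        ((1 + ((0:ℝ):ℂ)) / (I*v) - 1/(I*v)^2) * Complex.exp (I * (v * (0:ℝ))) -
        ((1 + ((-1:ℝ):ℂ)) / (I*v) - 1/(I*v)^2) * Complex.exp (I * (v * (-1:ℝ))) := by
      rw [← intervalIntegral.integral_eq_sub_of_hasDerivAt
        (f := fun t : ℝ => ((1 + (t:ℂ)) / (I*v) - 1/(I*v)^2) * Complex.exp (I * (v * t)))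
        (f' := fun t : ℝ => (1 + (t:ℂ)) * Complex.exp (I * (v * t)))]
      · apply intervalIntegral.integral_congr
        intro t ht
        rw [uIcc_of_le (by norm_num)] at ht
        simp [abs_of_nonpos ht.2]
      · intro t _
        have h1 : HasDerivAt (fun t : ℝ => ((1 + (t:ℂ)) / (I*v) - 1/(I*v)^2)) (1/(I*v)) t :=
          (((HasDerivAt.ofReal_comp (hasDerivAt_id t)).const_add 1).div_const _).sub_const _
        refine (h1.mul (dexp t)).congr_deriv ?_
        field_simp; ring
      · exact (by fun_prop : Continuous _).intervalIntegrable _ _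
    have e2 : ∫ t in (0:ℝ)..1, ((1 - |t| : ℝ) : ℂ) * Complex.exp (Complex.I * (v * t)) =
        ((1 - ((1:ℝ):ℂ)) / (I*v) + 1/(I*v)^2) * Complex.exp (I * (v * (1:ℝ))) -
        ((1 - ((0:ℝ):ℂ)) / (I*v) + 1/(I*v)^2) * Complex.exp (I * (v * (0:ℝ))) := by
      rw [← intervalIntegral.integral_eq_sub_of_hasDerivAt
        (f := fun t : ℝ => ((1 - (t:ℂ)) / (I*v) + 1/(I*v)^2) * Complex.exp (I * (v * t)))
        (f' := fun t : ℝ => (1 - (t:ℂ)) * Complex.exp (I * (v * t)))]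
      · apply intervalIntegral.integral_congr
        intro t ht
        rw [uIcc_of_le (by norm_num)] at ht
        simp [abs_of_nonneg ht.1]
      · intro t _
        have h1 : HasDerivAt (fun t : ℝ => ((1 - (t:ℂ)) / (I*v) + 1/(I*v)^2)) (-1/(I*v)) t :=
          (((HasDerivAt.ofReal_comp (hasDerivAt_id t)).const_sub 1).div_const _).add_const _
        refine (h1.mul (dexp t)).congr_deriv ?_
        field_simp; ring
      · exact (by fun_prop : Continuous _).intervalIntegrable _ _
    rw [e1, e2]
    simp only [fejer, if_neg hv]
    have hc : Complex.cos v = (Complex.exp (v * I) + Complex.exp (-v * I)) / 2 := rfl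
    push_cast
    rw [hc]
    have a1 : I * (v * (-1:ℂ)) = -v * I := by ring
    have a2 : I * (v * (1:ℂ)) = v * I := by ring
    have a3 : I * (v * (0:ℂ)) = 0 := by ring
    rw [a1, a2, a3, Complex.exp_zero, mul_pow, I_sq]
    field_simp
    ring

end EchoWI
end

section
open Real Set Filter Topology MeasureTheory
namespace EchoWI

theorem fubini_step (h : ℝ → ℝ) (hm : Measurable h) (B : ℝ) (hB : ∀ u, |h u| ≤ B)
    (δ : ℝ) (hδ : 0 < δ) (l y : ℝ) :
    ∫ t in (-1:ℝ)..1, ((1 - |t| : ℝ) : ℂ) * Complex.exp (Complex.I * ((l * y : ℝ) * t)) *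
        (∫ u in Ioi (0:ℝ), (h u : ℂ) * Complex.exp (-(δ + Complex.I * (l * t : ℝ)) * u)) =
    ∫ u in Ioi (0:ℝ), ((h u * exp (-δ * u) * fejer (l * (y - u)) : ℝ) : ℂ) := by
  rw [intervalIntegral.integral_of_le (by norm_num)]
  simp_rw [← integral_const_mul]
  rw [integral_integral_swap]
  · congr 1
    ext u
    push_cast
    rw [← fejer_eq, ← intervalIntegral.integral_of_le (by norm_num),
      ← intervalIntegral.integral_const_mul]
    apply intervalIntegral.integral_congr
    intro t _
    have e : Complex.exp (Complex.I * ((l * y : ℝ) * t)) * Complex.exp (-(δ + Complex.I * (l * t : ℝ)) * u)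
      = Complex.exp (-δ*u) * Complex.exp (Complex.I * ((l * (y - u) : ℝ) * t)) := by
      rw [← Complex.exp_add, ← Complex.exp_add]; congr 1; push_cast; ring
    calc _ = ((1 - |t| : ℝ) : ℂ) * (h u) * (Complex.exp (Complex.I * ((l * y : ℝ) * t)) * Complex.exp (-(δ + Complex.I * (l * t : ℝ)) * u)) := by push_cast; ring
      _ = _ := by rw [e]; push_cast; ring
  · have h1 : Integrable (fun t : ℝ => (2:ℝ)) (volume.restrict (Ioc (-1) 1)) := by
      simp
    have h2 : Integrable (fun u : ℝ => B * exp (-δ * u)) (volume.restrict (Ioi 0)) :=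
      (integrableOn_exp_mul_Ioi (by linarith) 0).const_mul B
    refine (h1.mul_prod h2).mono' ?_ ?_
    · have : Measurable (fun p : ℝ × ℝ => (h p.2 : ℂ)) := by fun_prop
      apply Measurable.aestronglyMeasurable
      unfold Function.uncurry
      fun_prop
    · rw [Measure.prod_restrict]
      filter_upwards [ae_restrict_mem (measurableSet_Ioc.prod measurableSet_Ioi)] with p hp
      obtain ⟨⟨p1, p2⟩, p3⟩ := hp
      simp only [Function.uncurry, norm_mul, Complex.norm_exp, Complex.norm_real]
      have b0 : 0 ≤ B := (abs_nonneg _).trans (hB 0)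
      have n1 : ‖1 - |p.1|‖ ≤ 2 := by
        rw [norm_eq_abs, abs_le]
        have : |p.1| ≤ 1 := abs_le.2 ⟨p1.le, p2⟩
        have := abs_nonneg p.1
        constructor <;> linarith
      have n2 : (Complex.I * ((l * y : ℝ) * (p.1:ℂ))).re = 0 := by simp
      have n3 : (-(δ + Complex.I * (l * p.1 : ℝ)) * (p.2:ℂ)).re = -δ * p.2 := by simp
      rw [n2, n3, exp_zero, mul_one]
      apply mul_le_mul n1 _ (by positivity) (by norm_num)
      exact mul_le_mul_of_nonneg_right (hB _) (exp_pos _).le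

theorem conv_zero (h : ℝ → ℝ) (hm : Measurable h) (B : ℝ) (hB : ∀ u, |h u| ≤ B)
    (g : ℝ → ℝ → ℂ) (hg : ContinuousOn (Function.uncurry g) (Icc 0 1 ×ˢ univ))
    (hgh : ∀ δ t : ℝ, 0 < δ →
      ∫ u in Ioi (0:ℝ), (h u : ℂ) * Complex.exp (-(δ + Complex.I * t) * u) = g δ t)
    (l : ℝ) (hl : 0 < l) :
    Tendsto (fun y => ∫ u in Ioi (0:ℝ), h u * fejer (l * (y - u))) atTop (𝓝 0) := by
  have b0 : 0 ≤ B := (abs_nonneg _).trans (hB 0)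
  have fi : ∀ y, Integrable (fun u => fejer (l * (y - u))) := fun y =>
    (fejer_integrable.comp_mul_left' hl.ne').comp_sub_left y
  have key : ∀ y, ∫ t in (-1:ℝ)..1, ((1 - |t| : ℝ) : ℂ) * Complex.exp (Complex.I * ((l * y : ℝ) * t)) *
      g 0 (l*t) = ((∫ u in Ioi (0:ℝ), h u * fejer (l * (y - u)) : ℝ) : ℂ) := by
    intro y
    let d : ℕ → ℝ := fun n => 1 / ((n:ℝ) + 1)
    have dpos : ∀ n, 0 < d n := fun n => Nat.one_div_pos_of_nat
    have dle : ∀ n, d n ≤ 1 := fun n => by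
      simp only [d]; rw [div_le_one (by positivity)]; linarith [Nat.cast_nonneg (α := ℝ) n]
    have d0 : Tendsto d atTop (𝓝 0) := tendsto_one_div_add_atTop_nhds_zero_nat
    -- bound for g
    obtain ⟨D, hD⟩ := ((isCompact_Icc (a := (0:ℝ)) (b := 1)).prod
      (isCompact_Icc (a := -l) (b := l))).exists_bound_of_continuousOn
      (hg.mono (prod_mono_right (subset_univ _)))
    have mem : ∀ δ ∈ Icc (0:ℝ) 1, ∀ t ∈ Icc (-1:ℝ) 1, ‖g δ (l*t)‖ ≤ D := by
      intro δ hδ t ht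
      refine hD (δ, l*t) ⟨hδ, ?_, ?_⟩
      · nlinarith [ht.1]
      · nlinarith [ht.2]
    have gc : ∀ δ ∈ Icc (0:ℝ) 1, Continuous (fun t => g δ (l*t)) := by
      intro δ hδ
      rw [← continuousOn_univ]
      refine hg.comp (f := fun t : ℝ => (δ, l*t)) (by fun_prop) ?_
      intro t _; exact ⟨hδ, mem_univ _⟩
    have L1 : Tendsto (fun n => ∫ t in (-1:ℝ)..1, ((1 - |t| : ℝ) : ℂ) *
        Complex.exp (Complex.I * ((l * y : ℝ) * t)) * g (d n) (l*t)) atTop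
        (𝓝 (∫ t in (-1:ℝ)..1, ((1 - |t| : ℝ) : ℂ) *
        Complex.exp (Complex.I * ((l * y : ℝ) * t)) * g 0 (l*t))) := by
      apply intervalIntegral.tendsto_integral_filter_of_dominated_convergence (fun _ => 2 * D)
      · refine Eventually.of_forall fun n => ?_
        have := gc (d n) ⟨(dpos n).le, dle n⟩
        exact ((by fun_prop : Continuous fun t : ℝ => ((1 - |t| : ℝ) : ℂ) *
          Complex.exp (Complex.I * ((l * y : ℝ) * t))).mul this).aestronglyMeasurable
      · refine Eventually.of_forall fun n => ae_of_all _ fun t ht => ?_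
        rw [uIoc_of_le (by norm_num)] at ht
        simp only [norm_mul, Complex.norm_exp, Complex.norm_real]
        have n1 : ‖1 - |t|‖ ≤ 2 := by
          rw [norm_eq_abs, abs_le]
          have : |t| ≤ 1 := abs_le.2 ⟨ht.1.le, ht.2⟩
          have := abs_nonneg t
          constructor <;> linarith
        have n2 : (Complex.I * ((l * y : ℝ) * (t:ℂ))).re = 0 := by simp
        rw [n2, exp_zero, mul_one]
        exact mul_le_mul n1 (mem _ ⟨(dpos n).le, dle n⟩ _ ⟨ht.1.le, ht.2⟩) (norm_nonneg _) (by norm_num)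
      · exact intervalIntegrable_const
      · refine ae_of_all _ fun t ht => ?_
        apply Tendsto.const_mul
        have := (hg (0, l*t) ⟨⟨le_refl _, zero_le_one⟩, mem_univ _⟩).tendsto
        refine this.comp (f := fun n => (d n, l*t)) ?_
        rw [tendsto_nhdsWithin_iff]
        exact ⟨d0.prodMk_nhds tendsto_const_nhds,
          Eventually.of_forall fun n => ⟨⟨(dpos n).le, dle n⟩, mem_univ _⟩⟩
    have L2 : Tendsto (fun n => ∫ u in Ioi (0:ℝ), ((h u * exp (-d n * u) * fejer (l * (y - u)) : ℝ) : ℂ)) atTop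
        (𝓝 (∫ u in Ioi (0:ℝ), ((h u * fejer (l * (y - u)) : ℝ) : ℂ))) := by
      apply tendsto_integral_of_dominated_convergence (fun u => B * fejer (l * (y - u)))
      · intro n
        have := fejer_measurable
        apply Measurable.aestronglyMeasurable
        fun_prop
      · exact ((fi y).const_mul B).integrableOn
      · intro n
        filter_upwards [ae_restrict_mem measurableSet_Ioi] with u hu
        rw [Complex.norm_real, norm_mul, norm_mul, norm_of_nonneg (fejer_nonneg _), norm_of_nonneg (exp_pos _).le]
        apply mul_le_mul_of_nonneg_right _ (fejer_nonneg _)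
        have : exp (-d n * u) ≤ 1 := exp_le_one_iff.2 (by have := mul_pos (dpos n) (mem_Ioi.1 hu); linarith)
        calc ‖h u‖ * exp (-d n * u) ≤ B * 1 := mul_le_mul (hB u) this (exp_pos _).le b0
          _ = B := mul_one B
      · refine ae_of_all _ fun u => ?_
        refine (Complex.continuous_ofReal.tendsto _).comp ?_
        apply Tendsto.mul_const
        have : Tendsto (fun n => exp (-d n * u)) atTop (𝓝 (exp (-0 * u))) :=
          (continuous_exp.tendsto _).comp (d0.neg.mul_const u)
        simpa using this.const_mul (h u)
    rw [← integral_complex_ofReal]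
    refine tendsto_nhds_unique L1 (L2.congr fun n => ?_)
    rw [← fubini_step h hm B hB (d n) (dpos n) l y]
    apply intervalIntegral.integral_congr
    intro t _
    simp only
    rw [hgh _ _ (dpos n)]
  -- Riemann Lebesgue
  have RL := Real.tendsto_integral_exp_smul_cocompact
    (fun t : ℝ => (Ioc (-1:ℝ) 1).indicator (fun t => ((1 - |t| : ℝ) : ℂ) * g 0 (l*t)) t)
  have hw : Tendsto (fun y : ℝ => -(l / (2*π)) * y) atTop (cocompact ℝ) := by
    rw [cocompact_eq_atBot_atTop]
    refine Tendsto.mono_right ?_ le_sup_left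
    exact tendsto_id.const_mul_atTop_of_neg (by have := pi_pos; simp only [neg_lt_zero]; positivity)
  have R2 := RL.comp hw
  have R3 : Tendsto (fun y => ((∫ u in Ioi (0:ℝ), h u * fejer (l * (y - u)) : ℝ) : ℂ)) atTop (𝓝 0) := by
    refine R2.congr fun y => ?_
    rw [← key, intervalIntegral.integral_of_le (by norm_num), ← integral_indicator measurableSet_Ioc]
    simp only [Function.comp]
    congr 1; ext t
    by_cases ht : t ∈ Ioc (-1:ℝ) 1
    · rw [indicator_of_mem ht, indicator_of_mem ht, Circle.smul_def, Real.fourierChar_apply, smul_eq_mul]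
      have : ((2 * π * -(t * (-(l / (2*π)) * y)) : ℝ) : ℂ) * Complex.I = Complex.I * ((l * y : ℝ) * t) := by
        have : 2 * π * -(t * (-(l / (2*π)) * y)) = l * y * t := by field_simp
        rw [this]; push_cast; ring
      rw [this]; ring
    · rw [indicator_of_notMem ht, indicator_of_notMem ht, smul_zero]
  have R4 := (Complex.continuous_re.tendsto 0).comp R3
  simpa [Function.comp_def] using R4

theorem wiener_ikehara (a : ℕ → ℝ) (ha : ∀ n, 0 ≤ a n) (C : ℝ)
    (hC : ∀ n : ℕ, ∑ k ∈ Finset.Icc 1 n, a k ≤ C * n)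
    (G : ℂ → ℂ) (hG : ContinuousOn G {s | 1 ≤ s.re})
    (hF : ∀ s : ℂ, 1 < s.re → LSeries (fun n => (a n : ℂ)) s = 1 / (s - 1) + G s) :
    Tendsto (fun x : ℝ => (∑ k ∈ Finset.Icc 1 ⌊x⌋₊, a k) / x) atTop (𝓝 1) := by
  set S : ℝ → ℝ := fun x => ∑ k ∈ Finset.Icc 1 ⌊x⌋₊, a k with hS
  have S0 : ∀ x, 0 ≤ S x := fun x => Finset.sum_nonneg fun k _ => ha k
  have Smono : Monotone S := fun x y hxy =>
    Finset.sum_le_sum_of_subset_of_nonneg (Finset.Icc_subset_Icc_right (Nat.floor_mono hxy))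
      fun k _ _ => ha k
  have C0 : 0 ≤ C := by have := hC 1; simp at this; linarith [ha 1]
  have SC : ∀ x, 0 ≤ x → S x ≤ C * x := fun x hx =>
    (hC _).trans (mul_le_mul_of_nonneg_left (Nat.floor_le hx) C0)
  set H : ℝ → ℝ := fun u => S (exp u) * exp (-u) with hH
  have H0 : ∀ u, 0 ≤ H u := fun u => mul_nonneg (S0 _) (exp_pos _).le
  have HC : ∀ u, H u ≤ C := fun u => by
    have := mul_le_mul_of_nonneg_right (SC (exp u) (exp_pos u).le) (exp_pos (-u)).le
    rwa [mul_assoc, ← exp_add, add_neg_cancel, exp_zero, mul_one] at this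
  have Hm : Measurable H := (Smono.measurable.comp measurable_exp).mul (by fun_prop)
  have Hmono : ∀ u v, u ≤ v → H u * exp u ≤ H v * exp v := by
    intro u v huv
    simp only [hH, mul_assoc, ← exp_add, neg_add_cancel, exp_zero, mul_one]
    exact Smono (exp_le_exp.2 huv)
  have hB : ∀ u, |H u - 1| ≤ C + 1 := fun u => by
    rw [abs_le]; constructor <;> linarith [H0 u, HC u]
  have hgh : ∀ δ t : ℝ, 0 < δ →
      ∫ u in Ioi (0:ℝ), ((H u - 1 : ℝ) : ℂ) * Complex.exp (-(δ + Complex.I * t) * u) =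
      (G (1 + δ + Complex.I * t) - 1) / (1 + δ + Complex.I * t) := by
    intro δ t hδ
    set s : ℂ := 1 + δ + Complex.I * t with hs
    have sre : s.re = 1 + δ := by simp [hs]
    have hre : (-(δ + Complex.I * t) : ℂ).re < 0 := by simp [hδ]
    have s1 : s - 1 = δ + Complex.I * t := by rw [hs]; ring
    have s1ne : s - 1 ≠ 0 := by intro h; have := congrArg Complex.re h; simp [s1] at this; linarith
    have sne : s ≠ 0 := by intro h; have := congrArg Complex.re h; simp [sre] at this; linarith
    have I2 := integrableOn_exp_mul_complex_Ioi hre 0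
    have I1 : IntegrableOn (fun u : ℝ => ((H u : ℝ) : ℂ) * Complex.exp (-(δ + Complex.I * t) * u)) (Ioi 0) :=
      I2.bdd_mul (c := C) (by fun_prop)
        (ae_of_all _ fun u => by rw [Complex.norm_real, norm_of_nonneg (H0 u)]; exact HC u)
    have E2 := integral_exp_mul_complex_Ioi hre 0
    have E1 : LSeries (fun n => (a n : ℂ)) s =
        s * ∫ u in Ioi (0:ℝ), ((H u : ℝ) : ℂ) * Complex.exp (-(δ + Complex.I * t) * u) := by
      rw [LSeries_eq_mul_integral_of_nonneg a zero_le_one (by rw [sre]; linarith) ?_ ha]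
      · congr 1
        have im : exp '' Ioi (0:ℝ) = Ioi 1 := by
          ext x; simp only [mem_image, mem_Ioi]
          constructor
          · rintro ⟨u, hu, rfl⟩; exact one_lt_exp_iff.2 hu
          · intro hx; exact ⟨log x, log_pos hx, exp_log (by linarith)⟩
        rw [← im, integral_image_eq_integral_abs_deriv_smul measurableSet_Ioi
          (fun x _ => (hasDerivAt_exp x).hasDerivWithinAt) exp_injective.injOn]
        congr 1; ext u
        rw [abs_of_pos (exp_pos u), ← Complex.ofReal_sum, Complex.real_smul]
        change _ * (((S (exp u) : ℝ):ℂ) * _) = _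
        simp only [hH]
        rw [Complex.ofReal_mul, Complex.cpow_def_of_ne_zero (by exact_mod_cast (exp_pos u).ne'),
          ← Complex.ofReal_log (exp_pos u).le, log_exp, Complex.ofReal_exp, Complex.ofReal_exp]
        have : Complex.exp u * Complex.exp (u * -(s+1)) = Complex.exp ((-u : ℝ)) * Complex.exp (-(δ + Complex.I * t) * u) := by
          rw [← Complex.exp_add, ← Complex.exp_add, ← s1]; congr 1; push_cast; ring
        calc _ = ((S (exp u) : ℝ):ℂ) * (Complex.exp u * Complex.exp (u * -(s+1))) := by ring
          _ = _ := by rw [this]; ring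
      · simp only [rpow_one]
        refine Asymptotics.IsBigO.of_bound C (Eventually.of_forall fun n => ?_)
        rw [norm_of_nonneg (Finset.sum_nonneg fun k _ => ha k), norm_of_nonneg (Nat.cast_nonneg n)]
        exact hC n
    rw [hF s (by rw [sre]; linarith)] at E1
    have E3 : ∫ u in Ioi (0:ℝ), ((H u - 1 : ℝ) : ℂ) * Complex.exp (-(δ + Complex.I * t) * u) =
      (∫ u in Ioi (0:ℝ), ((H u : ℝ) : ℂ) * Complex.exp (-(δ + Complex.I * t) * u)) -
      ∫ u in Ioi (0:ℝ), Complex.exp (-(δ + Complex.I * t) * u) := by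
      rw [← integral_sub I1 I2]; congr 1; ext u; push_cast; ring
    rw [E3, E2, ← s1, eq_div_iff sne, sub_mul, mul_comm _ s, s1, ← E1]
    simp only [Complex.ofReal_zero, mul_zero, Complex.exp_zero]
    rw [← s1]
    field_simp
    ring
  have hgc : ContinuousOn (Function.uncurry fun δ t : ℝ =>
      (G (1 + δ + Complex.I * t) - 1) / (1 + δ + Complex.I * t)) (Icc 0 1 ×ˢ univ) := by
    apply ContinuousOn.div
    · apply ContinuousOn.sub _ continuousOn_const
      refine hG.comp (f := fun p : ℝ × ℝ => (1 + p.1 + Complex.I * p.2 : ℂ)) (by fun_prop) ?_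
      intro p hp
      have := hp.1.1
      simp [this]
    · exact Continuous.continuousOn (by fun_prop)
    · intro p hp h
      have := hp.1.1
      have h2 := congrArg Complex.re h
      simp at h2; linarith
  have T := tauber H fejer C H0 HC Hm Hmono fejer_nonneg fejer_integrable fejer_pos
    (fun l hl => conv_zero _ (Hm.sub_const 1) (C+1) hB _ hgc hgh l hl)
  refine (T.comp tendsto_log_atTop).congr' ?_
  filter_upwards [eventually_gt_atTop 0] with x hx
  simp only [Function.comp, hH]
  rw [exp_neg, exp_log hx, div_eq_mul_inv]

end EchoWI
end

section
open Real Set Filter Topology MeasureTheory Pointwise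
namespace EchoLat

/-- the points within `r` of a point on the other side of the boundary of `X` -/
def bdry {E : Type*} [PseudoMetricSpace E] (X : Set E) (r : ℝ) : Set E :=
  {x | ∃ y, dist x y ≤ r ∧ ¬ (x ∈ X ↔ y ∈ X)}

theorem lattice_count {E : Type*} [NormedAddCommGroup E] [NormedSpace ℝ E] [FiniteDimensional ℝ E]
    [MeasurableSpace E] [BorelSpace E] (μ : Measure E) [μ.IsAddHaarMeasure]
    (L : Submodule ℤ E) [DiscreteTopology L] [IsZLattice ℝ L] (X : Set E)
    (hX : Bornology.IsBounded X) (hXm : MeasurableSet X) :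
    ∃ d > (0:ℝ), ∃ c > (0:ℝ), ∀ t : ℝ, 0 < t →
      |(Nat.card {x : E // x ∈ L ∧ t⁻¹ • x ∈ X} : ℝ) * c - t ^ Module.finrank ℝ E * μ.real X| ≤
        t ^ Module.finrank ℝ E * μ.real (bdry X (d / t)) := by
  classical
  have : Module.Finite ℤ L := ZLattice.module_finite ℝ L
  have : Module.Free ℤ L := ZLattice.module_free ℝ L
  let b := (Module.Free.chooseBasis ℤ L).ofZLatticeBasis ℝ L
  have hbL : Submodule.span ℤ (Set.range b) = L := (Module.Free.chooseBasis ℤ L).ofZLatticeBasis_span ℝ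
  set F := ZSpan.fundamentalDomain b with hF
  have Fm : MeasurableSet F := ZSpan.fundamentalDomain_measurableSet b
  have Fb : Bornology.IsBounded F := ZSpan.fundamentalDomain_isBounded b
  obtain ⟨d, dpos, hd⟩ := Fb.exists_pos_norm_le
  have Fne : μ F ≠ 0 := ZSpan.measure_fundamentalDomain_ne_zero b
  have Ffin : μ F ≠ ⊤ := Fb.measure_lt_top.ne
  have Fpos : 0 < μ.real F := ENNReal.toReal_pos Fne Ffin
  refine ⟨d, dpos, μ.real F, Fpos, fun t ht => ?_⟩
  have tne : t ≠ 0 := ht.ne'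
  have sfin : {x : E | x ∈ L ∧ t⁻¹ • x ∈ X}.Finite := by
    have hb : Bornology.IsBounded ((fun x : E => t • x) '' X) := (hX.smul₀ t)
    have := Metric.finite_isBounded_inter_isClosed (K := ((fun x : E => t • x) '' X)) (s := (L : Set E))
      (isDiscrete_iff_discreteTopology.2 ‹_›) hb (by
        have : IsClosed ((L.toAddSubgroup : AddSubgroup E) : Set E) :=
          @AddSubgroup.isClosed_of_discrete _ _ _ _ _ L.toAddSubgroup (inferInstanceAs (DiscreteTopology L))
        exact this)
    refine this.subset ?_
    rintro x ⟨hx, hx2⟩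
    exact ⟨⟨_, hx2, by simp [smul_smul, tne]⟩, hx⟩
  let s : Finset E := sfin.toFinset
  have hs : ∀ x, x ∈ s ↔ x ∈ L ∧ t⁻¹ • x ∈ X := fun x => by simp [s]
  have hcard : Nat.card {x : E // x ∈ L ∧ t⁻¹ • x ∈ X} = s.card := by
    rw [← Nat.card_eq_card_finite_toFinset sfin]; rfl
  let cell : E → Set E := fun x => (fun p => p - x) ⁻¹' F
  have cm : ∀ x, MeasurableSet (cell x) := fun x => Fm.preimage (by fun_prop)
  have cv : ∀ x, μ (cell x) = μ F := fun x => by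
    simp only [cell, sub_eq_add_neg]; exact measure_preimage_add_right μ (-x) F
  have cuniq : ∀ p, ∀ x ∈ L, p ∈ cell x → x = p - ZSpan.fract b p := by
    intro p x hx hp
    have h1 : ZSpan.fract b (p - x) = p - x := (ZSpan.fract_eq_self (b := b)).2 hp
    have hx' : -x ∈ Submodule.span ℤ (Set.range b) := by rw [hbL]; exact L.neg_mem hx
    have h2 : ZSpan.fract b (p - x) = ZSpan.fract b p := by
      have := ZSpan.fract_zSpan_add b p hx'
      rw [← this]; congr 1; abel
    rw [← h2, h1]; abel
  let U : Set E := ⋃ x ∈ s, cell x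
  have Um : MeasurableSet U := Finset.measurableSet_biUnion _ fun x _ => cm x
  have Uv : μ U = s.card * μ F := by
    rw [measure_biUnion_finset _ fun x _ => cm x]
    · simp [cv]
    · intro x hx y hy hxy
      rw [Function.onFun, Set.disjoint_left]
      intro p hp hq
      exact hxy ((cuniq p x ((hs x).1 hx).1 hp).trans (cuniq p y ((hs y).1 hy).1 hq).symm)
  have sub : symmDiff U (t • X) ⊆ t • bdry X (d / t) := by
    have near : ∀ p x, p ∈ cell x → dist (t⁻¹ • p) (t⁻¹ • x) ≤ d / t := by
      intro p x hp
      rw [dist_smul₀, norm_inv, norm_of_nonneg ht.le, dist_eq_norm, inv_mul_eq_div]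
      exact div_le_div_of_nonneg_right (hd _ hp) ht.le
    intro p hp
    rw [Set.mem_smul_set_iff_inv_smul_mem₀ tne]
    rcases hp with ⟨hpU, hpX⟩ | ⟨hpX, hpU⟩
    · simp only [U, mem_iUnion] at hpU
      obtain ⟨x, hx, hpx⟩ := hpU
      refine ⟨t⁻¹ • x, near p x hpx, fun h => hpX ?_⟩
      rw [Set.mem_smul_set_iff_inv_smul_mem₀ tne]
      exact h.2 ((hs x).1 hx).2
    · rw [Set.mem_smul_set_iff_inv_smul_mem₀ tne] at hpX
      have hxL : (ZSpan.floor b p : E) ∈ L := by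
        exact hbL.le (SetLike.coe_mem (ZSpan.floor b p))
      have hpx : p ∈ cell (ZSpan.floor b p : E) := by
        change p - _ ∈ F
        rw [← ZSpan.fract_apply]
        exact ZSpan.fract_mem_fundamentalDomain b p
      refine ⟨t⁻¹ • (ZSpan.floor b p : E), near p _ hpx, fun h => hpU ?_⟩
      simp only [U, mem_iUnion]
      exact ⟨_, (hs _).2 ⟨hxL, h.1 hpX⟩, hpx⟩
  have bb : Bornology.IsBounded (bdry X (d / t)) := by
    obtain ⟨R, hR⟩ := hX.subset_closedBall (0:E)
    refine (Metric.isBounded_closedBall (x := (0:E)) (r := R + d / t)).subset ?_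
    rintro x ⟨y, hy, hxy⟩
    have dt : 0 < d / t := by positivity
    by_cases hx : x ∈ X
    · exact Metric.closedBall_subset_closedBall (by linarith) (hR hx)
    · have hyX : y ∈ X := by by_contra h; exact hxy ⟨fun h' => (hx h').elim, fun h' => (h h').elim⟩
      have h1 := hR hyX
      rw [Metric.mem_closedBall] at h1 ⊢
      linarith [dist_triangle x y 0]
  have bfin : μ (t • bdry X (d / t)) ≠ ⊤ := (bb.smul₀ t).measure_lt_top.ne
  have Xfin : μ (t • X) ≠ ⊤ := (hX.smul₀ t).measure_lt_top.ne
  have Ufin : μ U ≠ ⊤ := by rw [Uv]; exact ENNReal.mul_ne_top (by simp) Ffin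
  have tXm : MeasurableSet (t • X) := hXm.const_smul₀ t
  have e1 : μ.real (t • X) = t ^ Module.finrank ℝ E * μ.real X := by
    rw [measureReal_def, Measure.addHaar_smul, ENNReal.toReal_mul, ENNReal.toReal_ofReal (abs_nonneg _),
      abs_of_pos (by positivity)]; rfl
  have e2 : μ.real (t • bdry X (d / t)) = t ^ Module.finrank ℝ E * μ.real (bdry X (d / t)) := by
    rw [measureReal_def, Measure.addHaar_smul, ENNReal.toReal_mul, ENNReal.toReal_ofReal (abs_nonneg _),
      abs_of_pos (by positivity)]; rfl
  have e3 : μ.real U = s.card * μ.real F := by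
    rw [measureReal_def, Uv, ENNReal.toReal_mul]; simp [measureReal_def]
  rw [hcard, ← e3, ← e1, ← e2]
  have k1 : μ.real (U \ (t • X)) ≤ μ.real (t • bdry X (d / t)) :=
    measureReal_mono ((Set.subset_union_left).trans sub) bfin
  have k2 : μ.real ((t • X) \ U) ≤ μ.real (t • bdry X (d / t)) :=
    measureReal_mono ((Set.subset_union_right).trans sub) bfin
  have m1 := measureReal_sdiff_add_inter (μ := μ) (s := U) (t := t • X) tXm Ufin
  have m2 := measureReal_sdiff_add_inter (μ := μ) (s := t • X) (t := U) Um Xfin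
  rw [inter_comm] at m2
  have := measureReal_nonneg (μ := μ) (s := U \ (t • X))
  have := measureReal_nonneg (μ := μ) (s := (t • X) \ U)
  rw [abs_le]
  constructor <;> linarith

end EchoLat
end

section
open Real Set Filter Topology MeasureTheory Pointwise
open NumberField NumberField.mixedEmbedding NumberField.mixedEmbedding.fundamentalCone
open NumberField.Units NumberField.Units.dirichletUnitTheorem NumberField.InfinitePlace
namespace EchoLat
variable (K : Type*) [Field K] [NumberField K]

open scoped Classical in
theorem vol_image : ∃ c : ENNReal, c ≠ ⊤ ∧ ∀ P : Set (realSpace K), MeasurableSet P →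
    volume ((normAtAllPlaces : mixedSpace K → realSpace K) ⁻¹' (expMapBasis '' P)) =
      c * ∫⁻ x in P, ENNReal.ofReal (exp (x w₀ * Module.finrank ℚ K)) := by
  refine ⟨2 ^ nrRealPlaces K * ENNReal.ofReal (2 * π) ^ nrComplexPlaces K *
    ((2 : ENNReal)⁻¹ ^ nrComplexPlaces K * ENNReal.ofReal (regulator K) * (Module.finrank ℚ K)), ?_, ?_⟩
  · refine ENNReal.mul_ne_top (ENNReal.mul_ne_top ?_ ?_) (ENNReal.mul_ne_top (ENNReal.mul_ne_top ?_ ?_) ?_)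
    · exact ENNReal.pow_ne_top (by simp)
    · exact ENNReal.pow_ne_top ENNReal.ofReal_ne_top
    · exact ENNReal.pow_ne_top (by simp)
    · simp
    · simp
  · intro P hP
    rw [volume_eq_two_pow_mul_two_pi_pow_mul_integral (by rw [normAtAllPlaces_image_preimage_expMapBasis]),
      normAtAllPlaces_image_preimage_expMapBasis,
      setLIntegral_expMapBasis_image hP (by fun_prop)]
    · simp_rw [ENNReal.inv_mul_cancel_right
        (Finset.prod_ne_zero_iff.mpr fun _ _ ↦ ENNReal.ofReal_ne_zero_iff.mpr (expMapBasis_pos _ _))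
        (ENNReal.prod_ne_top fun _ _ ↦ ENNReal.ofReal_ne_top)]
      ring
    · have h1 : MeasurableSet (expMapBasis '' P) :=
        hP.image_of_continuousOn_injOn (continuous_expMapBasis K).continuousOn (injective_expMapBasis K).injOn
      exact h1.preimage (continuous_normAtAllPlaces K).measurable

open scoped Classical in
noncomputable def box (η : ℝ) : Set (realSpace K) :=
  Set.univ.pi fun w => if w = w₀ then Iic η else Icc (-η) (1 + η)

theorem box_meas (η : ℝ) : MeasurableSet (box K η) := by
  refine MeasurableSet.univ_pi fun _ ↦ ?_
  split_ifs
  · exact measurableSet_Iic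
  · exact measurableSet_Icc

open scoped Classical in
theorem box_int (η : ℝ) (hη : 0 ≤ 1 + 2 * η) :
    ∫⁻ x in box K η, ENNReal.ofReal (exp (x w₀ * Module.finrank ℚ K)) =
      ENNReal.ofReal (exp (Module.finrank ℚ K * η) / Module.finrank ℚ K *
        (1 + 2 * η) ^ (Finset.univ.erase (w₀ : InfinitePlace K)).card) := by
  classical
  have hn : 0 < (Module.finrank ℚ K : ℝ) := Nat.cast_pos.mpr Module.finrank_pos
  rw [volume_pi, box, Measure.restrict_pi_pi, lintegral_eq_lmarginal_univ 0,
    lmarginal_erase' _ (by fun_prop) (Finset.mem_univ w₀), if_pos rfl]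
  simp_rw [Function.update_self, lmarginal, lintegral_const, Measure.pi_univ, if_neg
    (Finset.ne_of_mem_erase (Subtype.prop _)), Measure.restrict_apply_univ, Real.volume_Icc,
    mul_comm _ (Module.finrank ℚ K : ℝ)]
  rw [← ofReal_integral_eq_lintegral_ofReal (integrableOn_exp_mul_Iic hn _), integral_exp_mul_Iic hn]
  · rw [Finset.prod_const, ← ENNReal.ofReal_pow (by linarith), ← ENNReal.ofReal_mul (by positivity)]
    have e : (1 + η - -η) = 1 + 2 * η := by ring
    rw [e]
    congr 2
    rw [Finset.card_univ, Fintype.card_coe]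
  · filter_upwards with _ using Real.exp_nonneg _

open scoped Classical in
theorem normAtPlace_le_norm (w : InfinitePlace K) (x : mixedSpace K) : normAtPlace w x ≤ ‖x‖ := by
  rw [norm_eq_sup'_normAtPlace]
  exact Finset.le_sup' (fun w => normAtPlace w x) (Finset.mem_univ w)

open scoped Classical in
theorem normAtPlace_sub_abs (w : InfinitePlace K) (x y : mixedSpace K) :
    |normAtPlace w x - normAtPlace w y| ≤ dist x y := by
  rw [abs_le, dist_eq_norm]
  have h1 := normAtPlace_add_le w (x - y) y
  have h2 := normAtPlace_add_le w (-(x - y)) x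
  rw [normAtPlace_neg] at h2
  have e1 : x - y + y = x := by abel
  have e2 : -(x - y) + x = y := by abel
  rw [e1] at h1
  rw [e2] at h2
  have h3 := normAtPlace_le_norm K w (x - y)
  constructor <;> linarith

noncomputable def lg (x : realSpace K) : realSpace K :=
  (completeBasis K).equivFunL (fun w => (w.mult : ℝ) * log (x w))

theorem exp_lg (x : realSpace K) (hx : ∀ w, 0 < x w) : expMapBasis (lg K x) = x := by
  rw [expMapBasis_apply]
  have h : (completeBasis K).equivFun.symm (lg K x) = expMap.symm x := by
    have : lg K x = (completeBasis K).equivFun (expMap.symm x) := by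
      rw [lg]; exact congrArg _ (funext fun w => by simp [expMap_symm_apply])
    rw [this, LinearEquiv.symm_apply_apply]
  rw [h]
  exact expMap.right_inv (by rw [expMap_target]; exact fun w _ => hx w)

theorem lg_exp (ξ : realSpace K) : lg K (expMapBasis ξ) = ξ :=
  injective_expMapBasis K (exp_lg K _ (expMapBasis_pos ξ))

theorem log_sub_le {a b m r : ℝ} (hm : 0 < m) (ha : m ≤ a) (hb : m ≤ b) (h : |a - b| ≤ r) :
    |log a - log b| ≤ r / m := by
  wlog hab : b ≤ a generalizing a b
  · rw [abs_sub_comm] at h ⊢; exact this hb ha h (by linarith)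
  have b0 : 0 < b := by linarith
  have a0 : 0 < a := by linarith
  rw [abs_of_nonneg (by linarith [log_le_log b0 hab]), ← log_div a0.ne' b0.ne']
  have h1 := log_le_sub_one_of_pos (div_pos a0 b0)
  have h2 : a / b - 1 = (a - b) / b := by field_simp
  rw [h2] at h1
  refine h1.trans ?_
  have h3 := (le_abs_self _).trans h
  exact div_le_div₀ ((abs_nonneg _).trans h) h3 hm hb

theorem lg_lip : ∃ M : ℝ, 0 < M ∧ ∀ (x y : realSpace K) (m r : ℝ), 0 < m → 0 ≤ r → (∀ w, m ≤ x w) →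
    (∀ w, m ≤ y w) → (∀ w, |x w - y w| ≤ r) → ∀ w, |lg K x w - lg K y w| ≤ M * (r / m) := by
  set T : realSpace K →L[ℝ] realSpace K := (completeBasis K).equivFunL.toContinuousLinearMap with hT
  refine ⟨(‖T‖ + 1) * 2, by positivity, fun x y m r hm hr hx hy hxy w => ?_⟩
  have h1 : lg K x - lg K y = T (fun w => (w.mult : ℝ) * (log (x w) - log (y w))) := by
    have : (fun w : InfinitePlace K => (w.mult : ℝ) * (log (x w) - log (y w))) =
      (fun w => (w.mult : ℝ) * log (x w)) - fun w => (w.mult : ℝ) * log (y w) := by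
        ext w; simp [mul_sub]
    rw [this, map_sub]; rfl
  have h2 : ‖lg K x - lg K y‖ ≤ ‖T‖ * (2 * (r / m)) := by
    rw [h1]
    refine (T.le_opNorm _).trans (mul_le_mul_of_nonneg_left ?_ (norm_nonneg _))
    rw [pi_norm_le_iff_of_nonneg (by positivity)]
    intro w
    rw [norm_mul, norm_eq_abs, norm_eq_abs]
    have m2 : |(w.mult : ℝ)| ≤ 2 := by
      unfold InfinitePlace.mult
      split_ifs <;> norm_num
    exact mul_le_mul m2 (log_sub_le hm (hx w) (hy w) (hxy w)) (abs_nonneg _) (by norm_num)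
  have h3 := norm_le_pi_norm (lg K x - lg K y) w
  rw [norm_eq_abs, Pi.sub_apply] at h3
  have : 0 ≤ r / m := by positivity
  nlinarith

theorem exp_bounds : ∃ c C : ℝ, 0 < c ∧ 0 < C ∧ ∀ ξ ∈ paramSet K, ∀ w,
    c * exp (ξ w₀) ≤ expMapBasis ξ w ∧ expMapBasis ξ w ≤ C * exp (ξ w₀) := by
  classical
  have hk : IsCompact (Set.univ.pi fun _ => Icc (0:ℝ) 1 : Set (realSpace K)) :=
    isCompact_univ_pi fun _ => isCompact_Icc
  have ne : (Set.univ.pi fun _ => Icc (0:ℝ) 1 : Set (realSpace K)).Nonempty :=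
    ⟨0, fun w _ => ⟨le_refl _, zero_le_one⟩⟩
  have cont : ∀ w, ContinuousOn (fun ξ : realSpace K => expMapBasis ξ w) (Set.univ.pi fun _ => Icc (0:ℝ) 1) :=
    fun w => ((continuous_apply w).comp (continuous_expMapBasis K)).continuousOn
  choose lo hlo1 hlo2 using fun w => hk.exists_isMinOn ne (cont w)
  choose hi hhi1 hhi2 using fun w => hk.exists_isMaxOn ne (cont w)
  have : Nonempty (InfinitePlace K) := ⟨w₀⟩
  obtain ⟨wl, hwl⟩ := Finite.exists_min (fun w => expMapBasis (lo w) w)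
  obtain ⟨wh, hwh⟩ := Finite.exists_max (fun w => expMapBasis (hi w) w)
  refine ⟨expMapBasis (lo wl) wl, expMapBasis (hi wh) wh, expMapBasis_pos _ _, expMapBasis_pos _ _, ?_⟩
  intro ξ hξ w
  have mem : (fun i => if i = w₀ then 0 else ξ i) ∈ (Set.univ.pi fun _ => Icc (0:ℝ) 1 : Set (realSpace K)) := by
    intro i _
    have := hξ i (mem_univ i)
    by_cases h : i = w₀
    · simp [h]
    · simp only [h, if_false] at this ⊢
      exact ⟨this.1, this.2.le⟩
  rw [expMapBasis_apply'' ξ, Pi.smul_apply, smul_eq_mul, mul_comm (exp _)]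
  constructor
  · exact mul_le_mul_of_nonneg_right ((hwl w).trans (hlo2 w mem)) (exp_pos _).le
  · exact mul_le_mul_of_nonneg_right ((hhi2 w mem).trans (hwh w)) (exp_pos _).le

open scoped Classical in
theorem bdry_sub : ∃ A B r₀ : ℝ, 0 < A ∧ 0 < B ∧ 0 < r₀ ∧ ∀ r : ℝ, 0 < r → r < r₀ →
    bdry (normLeOne K) r ⊆ Metric.closedBall 0 (A * √r) ∪
      (normAtAllPlaces : mixedSpace K → realSpace K) ⁻¹' (expMapBasis '' (box K (B * √r) \ box K (-(2 * (B * √r))))) := by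
  classical
  obtain ⟨c, C, hc, hC, hcC⟩ := exp_bounds K
  obtain ⟨M, hM, hlip⟩ := lg_lip K
  refine ⟨C + 1, M * (2 / c), min 1 ((c/2)^2), by positivity, by positivity, by positivity, ?_⟩
  intro r hr hr0
  have r1 : r < 1 := hr0.trans_le (min_le_left _ _)
  have s0 : 0 < √r := sqrt_pos.2 hr
  have s1 : √r ≤ 1 := by rw [sqrt_le_one]; exact r1.le
  have ss : √r * √r = r := mul_self_sqrt hr.le
  have s2 : √r ≤ c / 2 := by
    rw [sqrt_le_left (by positivity)]; exact (hr0.trans_le (min_le_right _ _)).le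
  -- key claim
  have key : ∀ z z' : mixedSpace K, z ∈ normLeOne K → z' ∉ normLeOne K → dist z z' ≤ r →
      (‖z‖ ≤ C * √r) ∨ ∃ ξ ξ' : realSpace K, normAtAllPlaces z = expMapBasis ξ ∧
        normAtAllPlaces z' = expMapBasis ξ' ∧ ξ ∈ paramSet K ∧ ξ' ∉ paramSet K ∧
        ∀ w, |ξ w - ξ' w| ≤ M * (2/c) * √r := by
    intro z z' hz hz' hd
    rw [normLeOne_eq_preimage] at hz hz'
    obtain ⟨ξ, hξ, hξz⟩ := hz
    by_cases hsm : exp (ξ w₀) ≤ √r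
    · left
      rw [norm_eq_sup'_normAtPlace, Finset.sup'_le_iff]
      intro w _
      rw [← normAtAllPlaces_apply, ← hξz]
      exact ((hcC ξ hξ w).2).trans (mul_le_mul_of_nonneg_left hsm hC.le)
    · right
      push Not at hsm
      have lz : ∀ w, c * √r ≤ normAtAllPlaces z w := fun w => by
        rw [← hξz]; exact (mul_le_mul_of_nonneg_left hsm.le hc.le).trans (hcC ξ hξ w).1
      have dz : ∀ w, |normAtAllPlaces z w - normAtAllPlaces z' w| ≤ r := fun w => by
        rw [normAtAllPlaces_apply, normAtAllPlaces_apply]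
        exact (normAtPlace_sub_abs K w z z').trans hd
      have hrc : r ≤ c / 2 * √r := ss.symm.le.trans (mul_le_mul_of_nonneg_right s2 s0.le)
      have lz2 : ∀ w, c / 2 * √r ≤ normAtAllPlaces z w := fun w => (by nlinarith : c/2*√r ≤ c * √r).trans (lz w)
      have lz' : ∀ w, c / 2 * √r ≤ normAtAllPlaces z' w := fun w => by
        have := (abs_le.1 (dz w)).2
        have := lz w
        linarith
      have m0 : 0 < c / 2 * √r := by positivity
      have e' : expMapBasis (lg K (normAtAllPlaces z')) = normAtAllPlaces z' :=
        exp_lg K _ fun w => m0.trans_le (lz' w)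
      refine ⟨ξ, lg K (normAtAllPlaces z'), hξz.symm, e'.symm, hξ, fun h => hz' ⟨_, h, e'⟩, fun w => ?_⟩
      have := hlip _ _ _ _ m0 hr.le lz2 lz' dz w
      rw [← hξz, lg_exp] at this
      refine this.trans_eq ?_
      rw [mul_assoc]; congr 1
      rw [div_eq_iff m0.ne']
      have : 2 / c * √r * (c / 2 * √r) = (√r * √r) := by field_simp
      rw [this, ss]
  set η := M * (2 / c) * √r with hη
  have η0 : 0 < η := by positivity
  have inbox : ∀ ξ ∈ paramSet K, ∀ ξ', (∀ w, |ξ w - ξ' w| ≤ η) → ξ ∈ box K η ∧ ξ' ∈ box K η := by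
    intro ξ hξ ξ' h
    constructor
    · intro w _
      have h1 := hξ w (mem_univ w)
      by_cases hw : w = w₀
      · simp only [hw, if_true, mem_Iic] at h1 ⊢; linarith
      · simp only [hw, if_false, mem_Icc, mem_Ico] at h1 ⊢; constructor <;> linarith
    · intro w _
      have h1 := hξ w (mem_univ w)
      have h2 := abs_le.1 (h w)
      by_cases hw : w = w₀
      · subst hw; simp only [if_true, mem_Iic] at h1 ⊢; linarith
      · simp only [hw, if_false, mem_Icc, mem_Ico] at h1 ⊢; constructor <;> linarith
  have notin : ∀ ξ ξ' : realSpace K, ξ ∈ box K (-(2*η)) → (∀ w, |ξ w - ξ' w| ≤ η) → ξ ∈ paramSet K ∧ ξ' ∈ paramSet K := by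
    intro ξ ξ' hξ h
    constructor
    · intro w _
      have h1 := hξ w (mem_univ w)
      by_cases hw : w = w₀
      · simp only [hw, if_true, mem_Iic] at h1 ⊢; linarith
      · simp only [hw, if_false, mem_Icc, mem_Ico] at h1 ⊢; constructor <;> linarith
    · intro w _
      have h1 := hξ w (mem_univ w)
      have h2 := abs_le.1 (h w)
      by_cases hw : w = w₀
      · subst hw; simp only [if_true, mem_Iic] at h1 ⊢; linarith
      · simp only [hw, if_false, mem_Icc, mem_Ico] at h1 ⊢; constructor <;> linarith
  rintro x ⟨y, hxy, hiff⟩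
  by_cases hx : x ∈ normLeOne K
  · have hy : y ∉ normLeOne K := fun h => hiff ⟨fun _ => h, fun _ => hx⟩
    rcases key x y hx hy hxy with h | ⟨ξ, ξ', e1, e2, p1, p2, p3⟩
    · left; rw [mem_closedBall_zero_iff]; nlinarith
    · right
      exact ⟨ξ, ⟨(inbox ξ p1 ξ' p3).1, fun h => p2 (notin ξ ξ' h p3).2⟩, e1.symm⟩
  · have hy : y ∈ normLeOne K := by by_contra h; exact hiff ⟨fun h' => (hx h').elim, fun h' => (h h').elim⟩
    rw [dist_comm] at hxy
    rcases key y x hy hx hxy with h | ⟨ξ, ξ', e1, e2, p1, p2, p3⟩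
    · left; rw [mem_closedBall_zero_iff]
      have h1 : ‖x‖ ≤ ‖y‖ + r := by
        have := norm_sub_norm_le x y
        rw [← dist_eq_norm, dist_comm] at this; linarith
      nlinarith
    · right
      exact ⟨ξ', ⟨(inbox ξ p1 ξ' p3).2, fun h => p2 (notin ξ' ξ h fun w => by rw [abs_sub_comm]; exact p3 w).1⟩, e2.symm⟩

end EchoLat
end

section
open Real Set Filter Topology MeasureTheory Pointwise
open NumberField NumberField.mixedEmbedding NumberField.mixedEmbedding.fundamentalCone
open NumberField.Units NumberField.Units.dirichletUnitTheorem NumberField.InfinitePlace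
namespace EchoLat
variable (K : Type*) [Field K] [NumberField K]

theorem V_bound (n : ℝ) (k : ℕ) : ∃ C η₀ : ℝ, 0 < C ∧ 0 < η₀ ∧ ∀ η, 0 < η → η < η₀ →
    exp (n * η) / n * (1 + 2 * η) ^ k - exp (n * (-(2*η))) / n * (1 + 2 * (-(2*η))) ^ k ≤ C * η := by
  set V : ℝ → ℝ := fun η => exp (n * η) / n * (1 + 2 * η) ^ k with hV
  have hd : DifferentiableAt ℝ V 0 := by fun_prop
  obtain ⟨C, hC, h⟩ := (hd.hasDerivAt.isBigO_sub).exists_pos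
  rw [Asymptotics.IsBigOWith] at h
  rw [Metric.eventually_nhds_iff] at h
  obtain ⟨ε, hε, h⟩ := h
  refine ⟨3 * C, ε / 2, by positivity, by positivity, fun η h0 h1 => ?_⟩
  have a1 := h (y := η) (by rw [dist_zero_right, norm_eq_abs, abs_of_pos h0]; linarith)
  have a2 := h (y := -(2*η)) (by rw [dist_zero_right, norm_eq_abs, abs_neg, abs_of_pos (by linarith)]; linarith)
  simp only [sub_zero, norm_eq_abs, abs_neg] at a1 a2
  rw [abs_of_pos h0] at a1
  rw [abs_of_pos (by linarith : 0 < 2 * η)] at a2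
  have b1 := (abs_le.1 a1).2
  have b2 := (abs_le.1 a2).1
  change V η - V (-(2*η)) ≤ _
  linarith

open scoped Classical in
theorem vol_bdry : ∃ C r₀ : ℝ, 0 < C ∧ 0 < r₀ ∧ ∀ r : ℝ, 0 < r → r < r₀ →
    volume.real (bdry (normLeOne K) r) ≤ C * √r := by
  obtain ⟨A, B, r₁, hA, hB, hr1, hsub⟩ := bdry_sub K
  obtain ⟨c, hc, hvol⟩ := vol_image K
  obtain ⟨D, η₀, hD, hη₀, hV⟩ := V_bound (Module.finrank ℚ K) (Finset.univ.erase (w₀ : InfinitePlace K)).card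
  have hn : 0 < (Module.finrank ℚ K : ℝ) := Nat.cast_pos.mpr Module.finrank_pos
  have hN : 0 < Module.finrank ℝ (mixedSpace K) := by
    rw [mixedEmbedding.finrank]; exact Module.finrank_pos
  set β := (volume (Metric.closedBall (0 : mixedSpace K) A)).toReal with hβ
  refine ⟨β + c.toReal * (D * B) + 1, min (min r₁ 1) ((min η₀ (1/4) / B)^2), by positivity, by positivity, ?_⟩
  intro r h0 hr
  have hrr1 : r < r₁ := hr.trans_le ((min_le_left _ _).trans (min_le_left _ _))
  have hr1' : r < 1 := hr.trans_le ((min_le_left _ _).trans (min_le_right _ _))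
  have hr2 : r < (min η₀ (1/4) / B)^2 := hr.trans_le (min_le_right _ _)
  have s0 : 0 < √r := sqrt_pos.2 h0
  have s1 : √r ≤ 1 := by rw [sqrt_le_one]; exact hr1'.le
  have s2 : √r < min η₀ (1/4) / B := (sqrt_lt' (by positivity)).2 hr2
  rw [lt_div_iff₀ hB, mul_comm] at s2
  set η := B * √r with hη
  have η0 : 0 < η := by positivity
  have η1 : η < η₀ := s2.trans_le (min_le_left _ _)
  have η2 : η < 1/4 := s2.trans_le (min_le_right _ _)
  have hball : (volume (Metric.closedBall (0 : mixedSpace K) (A * √r))) =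
      ENNReal.ofReal (√r ^ Module.finrank ℝ (mixedSpace K)) * volume (Metric.closedBall (0 : mixedSpace K) A) := by
    have : Metric.closedBall (0 : mixedSpace K) (A * √r) = √r • Metric.closedBall (0 : mixedSpace K) A := by
      rw [smul_closedBall _ _ hA.le, smul_zero, norm_eq_abs, abs_of_pos s0, mul_comm]
    rw [this, Measure.addHaar_smul, abs_of_nonneg (by positivity)]
  have hbt : volume (Metric.closedBall (0 : mixedSpace K) A) ≠ ⊤ :=
    (isCompact_closedBall _ _).measure_lt_top.ne
  have bm : MeasurableSet (box K η \ box K (-(2*η))) := (box_meas K _).diff (box_meas K _)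
  have hs : box K (-(2*η)) ⊆ box K η := by
    intro ξ hξ w hw
    have h1 := hξ w hw
    by_cases hw : w = w₀
    · simp only [hw, if_true, mem_Iic] at h1 ⊢; linarith
    · simp only [hw, if_false, mem_Icc] at h1 ⊢; constructor <;> linarith
  set f : realSpace K → ENNReal := fun x => ENNReal.ofReal (exp (x w₀ * Module.finrank ℚ K)) with hf
  have int : ∫⁻ x in box K η \ box K (-(2*η)), f x ≤ ENNReal.ofReal (D * η) := by
    have h1 : (∫⁻ x in box K η \ box K (-(2*η)), f x) + ∫⁻ x in box K (-(2*η)), f x = ∫⁻ x in box K η, f x := by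
      rw [add_comm]
      have := lintegral_inter_add_sdiff f (μ := volume) (box K η) (box_meas K (-(2*η)))
      rwa [inter_eq_self_of_subset_right hs] at this
    rw [box_int K η (by linarith), box_int K (-(2*η)) (by linarith)] at h1
    have h2 := hV η η0 η1
    set v1 := exp (Module.finrank ℚ K * η) / Module.finrank ℚ K * (1 + 2 * η) ^ (Finset.univ.erase (w₀ : InfinitePlace K)).card
    set v2 := exp (Module.finrank ℚ K * (-(2*η))) / Module.finrank ℚ K * (1 + 2 * (-(2*η))) ^ (Finset.univ.erase (w₀ : InfinitePlace K)).card with hv2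
    have v20 : 0 ≤ v2 := by
      have : 0 ≤ 1 + 2 * (-(2*η)) := by linarith
      positivity
    have h3 : (∫⁻ x in box K η \ box K (-(2*η)), f x) + ENNReal.ofReal v2 ≤ ENNReal.ofReal (D * η) + ENNReal.ofReal v2 := by
      rw [h1, ← ENNReal.ofReal_add (by positivity) v20]
      exact ENNReal.ofReal_le_ofReal (by linarith)
    exact (ENNReal.add_le_add_iff_right ENNReal.ofReal_ne_top).1 h3
  have main : volume (bdry (normLeOne K) r) ≤
      ENNReal.ofReal (√r ^ Module.finrank ℝ (mixedSpace K)) * volume (Metric.closedBall (0 : mixedSpace K) A) +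
      c * ENNReal.ofReal (D * η) := by
    refine (measure_mono (hsub r h0 hrr1)).trans ((measure_union_le _ _).trans ?_)
    rw [hball, hvol _ bm]
    gcongr
  have fin : ENNReal.ofReal (√r ^ Module.finrank ℝ (mixedSpace K)) * volume (Metric.closedBall (0 : mixedSpace K) A) +
      c * ENNReal.ofReal (D * η) ≠ ⊤ :=
    ENNReal.add_ne_top.2 ⟨ENNReal.mul_ne_top ENNReal.ofReal_ne_top hbt, ENNReal.mul_ne_top hc ENNReal.ofReal_ne_top⟩
  have := ENNReal.toReal_mono fin main
  rw [ENNReal.toReal_add (ENNReal.mul_ne_top ENNReal.ofReal_ne_top hbt) (ENNReal.mul_ne_top hc ENNReal.ofReal_ne_top),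
    ENNReal.toReal_mul, ENNReal.toReal_mul, ENNReal.toReal_ofReal (by positivity), ENNReal.toReal_ofReal (by positivity), ← hβ] at this
  rw [measureReal_def]
  refine this.trans ?_
  have p : √r ^ Module.finrank ℝ (mixedSpace K) ≤ √r := by
    calc _ ≤ √r ^ 1 := pow_le_pow_of_le_one s0.le s1 hN
      _ = _ := pow_one _
  have β0 : 0 ≤ β := ENNReal.toReal_nonneg
  have : √r ^ Module.finrank ℝ (mixedSpace K) * β ≤ √r * β := mul_le_mul_of_nonneg_right p β0
  rw [hη]
  nlinarith

open scoped nonZeroDivisors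
open Ideal

variable {K} in
theorem aux₁ {C : ClassGroup (𝓞 K)} {J : (Ideal (𝓞 K))⁰} {s : ℝ} (hJ : ClassGroup.mk0 J = C⁻¹) :
    Nat.card {I : (Ideal (𝓞 K))⁰ // absNorm (I : Ideal (𝓞 K)) ≤ s ∧ ClassGroup.mk0 I = C}
      = Nat.card {I : (Ideal (𝓞 K))⁰ // (J : Ideal (𝓞 K)) ∣ I ∧ Submodule.IsPrincipal (I : Ideal (𝓞 K)) ∧
        absNorm (I : Ideal (𝓞 K)) ≤ s * absNorm (J : Ideal (𝓞 K))} := by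
  simp_rw [← nonZeroDivisors_dvd_iff_dvd_coe]
  refine Nat.card_congr ?_
  refine ((Equiv.dvd J).subtypeEquiv fun I ↦ ?_).trans
    (Equiv.subtypeSubtypeEquivSubtypeInter (fun I : (Ideal (𝓞 K))⁰ ↦ J ∣ I) _)
  rw [← ClassGroup.mk0_eq_one_iff (SetLike.coe_mem _)]
  simp_rw [Equiv.dvd_apply, Submonoid.coe_mul, ← Submonoid.mul_def, _root_.map_mul, hJ,
    inv_mul_eq_one, Nat.cast_mul, mul_comm s, eq_comm, and_comm, and_congr_left_iff]
  exact fun _ ↦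
    (mul_le_mul_iff_of_pos_left (Nat.cast_pos.mpr (absNorm_pos_of_nonZeroDivisors J))).symm

theorem aux₂ (J : (Ideal (𝓞 K))⁰) (t : ℝ) (ht : 0 < t) :
    Nat.card {a : idealSet K J // mixedEmbedding.norm (a : mixedSpace K) ≤ t ^ Module.finrank ℚ K} =
    Nat.card {x : mixedSpace K // x ∈ mixedEmbedding.idealLattice K (FractionalIdeal.mk0 K J) ∧ t⁻¹ • x ∈ normLeOne K} := by
  refine Nat.card_congr ((Equiv.subtypeSubtypeEquivSubtypeInter _ (fun x : mixedSpace K => mixedEmbedding.norm x ≤ t ^ Module.finrank ℚ K)).trans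
    (Equiv.subtypeEquivRight fun x => ?_))
  have h1 : x ∈ idealSet K J ↔ x ∈ fundamentalCone K ∧ x ∈ mixedEmbedding.idealLattice K (FractionalIdeal.mk0 K J) := Iff.rfl
  have h2 : t⁻¹ • x ∈ normLeOne K ↔ x ∈ fundamentalCone K ∧ mixedEmbedding.norm x ≤ t ^ Module.finrank ℚ K := by
    change (t⁻¹ • x ∈ fundamentalCone K ∧ mixedEmbedding.norm (t⁻¹ • x) ≤ 1) ↔ _
    rw [smul_mem_iff_mem (inv_ne_zero ht.ne'), mixedEmbedding.norm_smul, abs_of_pos (inv_pos.2 ht), inv_pow,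
      inv_mul_le_iff₀ (by positivity), mul_one]
  rw [h1, h2]
  tauto

theorem class_count (C : ClassGroup (𝓞 K)) : ∃ κ > (0:ℝ),
    (fun s : ℝ => (Nat.card {I : (Ideal (𝓞 K))⁰ // absNorm (I : Ideal (𝓞 K)) ≤ s ∧ ClassGroup.mk0 I = C} : ℝ) - κ * s)
      =O[atTop] fun s : ℝ => s ^ (1 - 1 / (2 * (Module.finrank ℚ K : ℝ))) := by
  classical
  obtain ⟨J, hJ⟩ := ClassGroup.mk0_surjective C⁻¹
  set j : ℝ := ((absNorm (J : Ideal (𝓞 K)) : ℕ) : ℝ) with hj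
  have j0 : 0 < j := Nat.cast_pos.mpr (absNorm_pos_of_nonZeroDivisors J)
  obtain ⟨d, hd, c, hc, hL⟩ := lattice_count (volume : Measure (mixedSpace K))
    (mixedEmbedding.idealLattice K (FractionalIdeal.mk0 K J)) (normLeOne K) (isBounded_normLeOne K) (measurableSet_normLeOne K)
  obtain ⟨B, r₀, hB, hr₀, hbd⟩ := vol_bdry K
  rw [mixedEmbedding.finrank] at hL
  set n := Module.finrank ℚ K with hn
  have n0 : 0 < n := Module.finrank_pos
  have n0' : (0:ℝ) < n := Nat.cast_pos.2 n0
  have w0 : (0:ℝ) < torsionOrder K := Nat.cast_pos.2 (torsionOrder_pos K)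
  set v := volume.real (normLeOne K) with hv
  have v0 : 0 < v := by
    rw [hv, measureReal_def, volume_normLeOne]
    refine ENNReal.toReal_pos ?_ ?_
    · refine mul_ne_zero (mul_ne_zero (by simp) ?_) ?_
      · exact pow_ne_zero _ (by simp [NNReal.pi_ne_zero])
      · rw [ENNReal.ofReal_ne_zero_iff]; exact regulator_pos K
    · exact ENNReal.mul_ne_top (ENNReal.mul_ne_top (ENNReal.pow_ne_top (by simp)) (ENNReal.pow_ne_top (by simp))) ENNReal.ofReal_ne_top
  refine ⟨v * j / (c * torsionOrder K), by positivity, ?_⟩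
  refine Asymptotics.IsBigO.of_bound (j * B * √d / (c * torsionOrder K) * (j ^ (-(1 / (2 * (n:ℝ)))))) ?_
  filter_upwards [eventually_gt_atTop 0, eventually_gt_atTop ((d / r₀) ^ n / j)] with s hs0 hs1
  set t : ℝ := (s * j) ^ (1 / (n:ℝ)) with ht
  have t0 : 0 < t := by positivity
  have tn : t ^ n = s * j := by
    rw [ht, ← rpow_natCast, ← rpow_mul (by positivity), one_div_mul_cancel n0'.ne', rpow_one]
  have tr : d / t < r₀ := by
    rw [div_lt_iff₀ t0]
    have : (d / r₀) ^ n < t ^ n := by rw [tn]; rwa [div_lt_iff₀ j0] at hs1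
    have := lt_of_pow_lt_pow_left₀ n t0.le this
    rw [div_lt_iff₀ hr₀] at this; linarith
  have h1 := hL t t0
  have h2 := hbd (d / t) (by positivity) tr
  have h3 := card_isPrincipal_dvd_norm_le K J (t ^ n)
  rw [aux₂ K J t t0, tn, ← aux₁ hJ] at h3
  rw [← h3] at h1
  push_cast at h1
  set N : ℝ := (Nat.card {I : (Ideal (𝓞 K))⁰ // absNorm (I : Ideal (𝓞 K)) ≤ s ∧ ClassGroup.mk0 I = C} : ℝ) with hN
  have h4 : |N * torsionOrder K * c - t ^ n * v| ≤ t ^ n * (B * √(d / t)) :=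
    h1.trans (mul_le_mul_of_nonneg_left h2 (by positivity))
  have e1 : N - v * j / (c * torsionOrder K) * s = (N * torsionOrder K * c - t ^ n * v) / (c * torsionOrder K) := by
    rw [tn]; field_simp
  rw [e1, norm_div, norm_eq_abs, norm_eq_abs, abs_of_pos (by positivity : 0 < c * (torsionOrder K : ℝ)), norm_eq_abs (s ^ _), abs_of_pos (rpow_pos_of_pos hs0 _),
    div_le_iff₀ (by positivity)]
  refine h4.trans_eq ?_
  have e2 : √(d / t) = √d * ((s * j) ^ (-(1 / (2 * (n:ℝ))))) := by
    rw [sqrt_div hd.le, div_eq_mul_inv, sqrt_eq_rpow t, ht, ← rpow_mul (by positivity), ← rpow_neg (by positivity)]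
    congr 2
    field_simp
  rw [e2, tn, mul_rpow hs0.le j0.le, sub_eq_add_neg, rpow_add hs0, rpow_one]
  field_simp

theorem ideal_count : ∃ κ > (0:ℝ), (fun s : ℝ => (Nat.card {I : (Ideal (𝓞 K))⁰ // absNorm (I : Ideal (𝓞 K)) ≤ s} : ℝ) - κ * s)
      =O[atTop] fun s : ℝ => s ^ (1 - 1 / (2 * (Module.finrank ℚ K : ℝ))) := by
  classical
  choose κ hκ h using class_count K
  refine ⟨∑ C, κ C, Finset.sum_pos (fun C _ => hκ C) Finset.univ_nonempty, ?_⟩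
  have := Asymptotics.IsBigO.sum (s := Finset.univ) fun C _ => h C
  refine this.congr' ?_ (EventuallyEq.refl _ _)
  filter_upwards [eventually_ge_atTop 0] with s hs
  rw [Finset.sum_apply, Finset.sum_sub_distrib, Finset.sum_mul]
  congr 1
  have : Fintype {I : (Ideal (𝓞 K))⁰ // absNorm (I : Ideal (𝓞 K)) ≤ s} := by
      simp_rw [← Nat.le_floor_iff hs]
      refine @Fintype.ofFinite _ (finite_setOfPred_absNorm_le₀ ⌊s⌋₊)
  let e := fun C : ClassGroup (𝓞 K) ↦ Equiv.subtypeSubtypeEquivSubtypeInter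
      (fun I : (Ideal (𝓞 K))⁰ ↦ absNorm I.1 ≤ s) (fun I ↦ ClassGroup.mk0 I = C)
  simp_rw [← Nat.card_congr (e _), Nat.card_eq_fintype_card, Fintype.subtype_card]
  rw [Fintype.card, Finset.card_eq_sum_card_fiberwise (f := fun I ↦ ClassGroup.mk0 I.1)
      (t := Finset.univ) (fun _ _ ↦ Finset.mem_univ _), Nat.cast_sum]

end EchoLat
end

section
open Real Set Filter Topology MeasureTheory
namespace EchoZ

theorem order_lim {g : ℂ → ℂ} {s₀ : ℂ} (hg : AnalyticAt ℂ g s₀) (h : ¬ ∀ᶠ z in 𝓝 s₀, g z = 0) :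
    ∃ m : ℕ, (m = 0 → g s₀ ≠ 0) ∧ (g s₀ ≠ 0 → m = 0) ∧ (∀ᶠ z in 𝓝[≠] s₀, g z ≠ 0) ∧
      Tendsto (fun s => (s - s₀) * (deriv g s / g s)) (𝓝[≠] s₀) (𝓝 (m : ℂ)) := by
  obtain ⟨m, h1⟩ := (AnalyticAt.exists_eventuallyEq_pow_smul_nonzero_iff hg).2 h
  obtain ⟨k, hk, hk0, hgk⟩ := h1
  have kne : ∀ᶠ z in 𝓝 s₀, k z ≠ 0 := hk.continuousAt.eventually_ne hk0
  have hgs : g s₀ = (0:ℂ) ^ m * k s₀ := by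
    have := hgk.self_of_nhds
    simpa using this
  refine ⟨m, ?_, ?_, ?_, ?_⟩
  · rintro rfl; rw [hgs]; simpa using hk0
  · intro h0; by_contra hm; exact h0 (by rw [hgs, zero_pow hm, zero_mul])
  · filter_upwards [hgk.filter_mono nhdsWithin_le_nhds, kne.filter_mono nhdsWithin_le_nhds, self_mem_nhdsWithin] with z h1 h2 h3
    rw [h1, smul_eq_mul]
    exact mul_ne_zero (pow_ne_zero _ (sub_ne_zero.2 h3)) h2
  · have lim : Tendsto (fun s => (m:ℂ) + (s - s₀) * (deriv k s / k s)) (𝓝[≠] s₀) (𝓝 ((m : ℂ) + (s₀ - s₀) * (deriv k s₀ / k s₀))) := by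
      refine Tendsto.mono_left ?_ nhdsWithin_le_nhds
      have : ContinuousAt (fun s => (m:ℂ) + (s - s₀) * (deriv k s / k s)) s₀ := by
        have h1 := hk.deriv.continuousAt
        have h2 := hk.continuousAt
        fun_prop (disch := assumption)
      exact this
    rw [sub_self, zero_mul, add_zero] at lim
    refine lim.congr' ?_
    have hgk2 : ∀ᶠ z in 𝓝 s₀, g =ᶠ[𝓝 z] fun z => (z - s₀) ^ m • k z := Filter.Eventually.eventually_nhds hgk
    have kd : ∀ᶠ z in 𝓝 s₀, AnalyticAt ℂ k z := hk.eventually_analyticAt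
    filter_upwards [hgk2.filter_mono nhdsWithin_le_nhds, kne.filter_mono nhdsWithin_le_nhds, self_mem_nhdsWithin,
      kd.filter_mono nhdsWithin_le_nhds] with z h1 h2 h3 h4
    have hz : z - s₀ ≠ 0 := sub_ne_zero.2 h3
    have hd : HasDerivAt (fun z => (z - s₀) ^ m • k z) (((m : ℂ) * (z - s₀) ^ (m - 1) * 1) * k z + (z - s₀) ^ m * deriv k z) z :=
      (((hasDerivAt_id z).sub_const s₀).pow m).mul h4.differentiableAt.hasDerivAt
    rw [h1.deriv_eq, hd.deriv, h1.self_of_nhds]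
    rcases m with _ | m
    · simp
    · simp only [Nat.add_sub_cancel, smul_eq_mul]
      field_simp
      ring

theorem continuation (a : ℕ → ℝ) (ha : ∀ n, 0 ≤ a n) (κ θ : ℝ) (hθ0 : 0 < θ) (hθ : θ < 1)
    (hO : (fun x : ℝ => (∑ k ∈ Finset.Icc 1 ⌊x⌋₊, a k) - κ * x) =O[atTop] fun x : ℝ => x ^ θ) :
    (∀ s : ℂ, 1 < s.re → LSeriesSummable (fun n => (a n : ℂ)) s) ∧
    ∃ g : ℂ → ℂ, (∀ s : ℂ, θ < s.re → AnalyticAt ℂ g s) ∧ g 1 = κ ∧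
      ∀ s : ℂ, 1 < s.re → g s = (s - 1) * LSeries (fun n => (a n : ℂ)) s := by
  have hA : (fun n : ℕ => ∑ k ∈ Finset.Icc 1 n, a k) =O[atTop] fun n : ℕ => (n:ℝ) ^ (1:ℝ) := by
    have h1 := hO.comp_tendsto tendsto_natCast_atTop_atTop
    have h2 : ((fun x : ℝ => x ^ θ) ∘ (Nat.cast : ℕ → ℝ)) =O[atTop] fun n : ℕ => (n:ℝ) ^ (1:ℝ) := by
      refine Asymptotics.IsBigO.of_bound 1 ?_
      filter_upwards [eventually_ge_atTop 1] with n hn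
      have hn' : (1:ℝ) ≤ n := by exact_mod_cast hn
      simp only [Function.comp, one_mul]
      rw [norm_of_nonneg (by positivity), norm_of_nonneg (by positivity)]
      exact rpow_le_rpow_of_exponent_le hn' hθ.le
    have h3 : (fun n : ℕ => κ * (n:ℝ)) =O[atTop] fun n : ℕ => (n:ℝ) ^ (1:ℝ) := by
      simp only [rpow_one]
      exact Asymptotics.isBigO_const_mul_self _ _ _
    refine ((h1.trans h2).add h3).congr_left fun n => ?_
    simp
  have hS : ∀ s : ℂ, 1 < s.re → LSeriesSummable (fun n => (a n : ℂ)) s := fun s hs =>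
    LSeriesSummable_of_sum_norm_bigO_and_nonneg hA ha zero_le_one hs
  refine ⟨hS, ?_⟩
  set E : ℝ → ℂ := (Ici (1:ℝ)).indicator fun x => (((∑ k ∈ Finset.Icc 1 ⌊x⌋₊, a k) - κ * x : ℝ) : ℂ) with hE
  have mono : Monotone fun x : ℝ => ∑ k ∈ Finset.Icc 1 ⌊x⌋₊, a k := by
    intro x y h
    refine Finset.sum_le_sum_of_subset_of_nonneg ?_ fun i _ _ => ha i
    exact Finset.Icc_subset_Icc_right (Nat.floor_mono h)
  have hloc0 : LocallyIntegrable (fun x : ℝ => (((∑ k ∈ Finset.Icc 1 ⌊x⌋₊, a k) - κ * x : ℝ) : ℂ)) := by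
    have : LocallyIntegrable (fun x : ℝ => ((∑ k ∈ Finset.Icc 1 ⌊x⌋₊, a k) - κ * x : ℝ)) :=
      mono.locallyIntegrable.sub (Continuous.locallyIntegrable (by fun_prop))
    intro x
    obtain ⟨u, hu, h⟩ := this x
    exact ⟨u, hu, h.ofReal⟩
  have hloc : LocallyIntegrableOn E (Ioi 0) := by
    refine LocallyIntegrable.locallyIntegrableOn ?_ _
    intro x
    obtain ⟨u, hu, h⟩ := hloc0 x
    exact ⟨u, hu, h.indicator measurableSet_Ici⟩
  have htop : E =O[atTop] fun x : ℝ => x ^ (-(-θ)) := by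
    rw [neg_neg]
    refine Asymptotics.IsBigO.trans ?_ hO
    refine Asymptotics.IsBigO.of_bound 1 (Eventually.of_forall fun x => ?_)
    rw [one_mul, hE]
    refine (norm_indicator_le_norm_self _ _).trans ?_
    rw [Complex.norm_real]
  have hbot : ∀ b : ℝ, E =O[𝓝[>] 0] fun x : ℝ => x ^ (-b) := by
    intro b
    refine Asymptotics.IsBigO.of_bound 1 ?_
    have : Iio (1:ℝ) ∈ 𝓝[>] (0:ℝ) := mem_nhdsWithin_of_mem_nhds (Iio_mem_nhds one_pos)
    filter_upwards [this] with x hx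
    rw [hE, indicator_of_notMem (by simpa using hx)]
    simp
  have md : ∀ s : ℂ, s.re < -θ → DifferentiableAt ℂ (mellin E) s := fun s hs =>
    mellin_differentiableAt_of_isBigO_rpow hloc htop hs (hbot (s.re - 1)) (by linarith)
  refine ⟨fun s => κ * s + (s - 1) * s * mellin E (-s), ?_, by simp, ?_⟩
  · intro s hs
    have hopen : IsOpen {s : ℂ | θ < s.re} := isOpen_lt continuous_const Complex.continuous_re
    refine DifferentiableOn.analyticAt (s := {s : ℂ | θ < s.re}) ?_ (hopen.mem_nhds hs)
    intro z hz
    have h1 : DifferentiableAt ℂ (fun s => mellin E (-s)) z :=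
      DifferentiableAt.comp (g := mellin E) (f := fun s : ℂ => -s) z (md (-z) (by simpa using hz)) differentiableAt_id.neg
    refine DifferentiableAt.differentiableWithinAt ?_
    fun_prop
  · intro s hs
    have hs0 : s - 1 ≠ 0 := by intro h; rw [sub_eq_zero] at h; rw [h] at hs; simp at hs
    rw [LSeries_eq_mul_integral_of_nonneg a zero_le_one hs hA ha]
    have conv : MellinConvergent E (-s) :=
      mellinConvergent_of_isBigO_rpow hloc htop (by simp; linarith) (hbot ((-s).re - 1)) (by linarith)
    have i1 : ∫ t in Ioi (1:ℝ), (κ * (t:ℂ) ^ (-s)) = κ * (1 / (s - 1)) := by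
      rw [integral_const_mul, integral_Ioi_cpow_of_lt (by simp; linarith) one_pos]
      congr 1
      simp only [Complex.ofReal_one, Complex.one_cpow]
      have : -s + 1 ≠ 0 := by intro h; apply hs0; linear_combination -h
      field_simp
      ring
    have i2 : IntegrableOn (fun t : ℝ => (κ * (t:ℂ) ^ (-s))) (Ioi 1) :=
      (integrableOn_Ioi_cpow_of_lt (by simp; linarith) one_pos).const_mul _
    have conv2 : IntegrableOn (fun t : ℝ => (t:ℂ) ^ (-s - 1) • E t) (Ioi 1) :=
      conv.mono_set (Ioi_subset_Ioi zero_le_one)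
    have i3 : mellin E (-s) = ∫ t in Ioi (1:ℝ), (t:ℂ) ^ (-s - 1) • E t := by
      rw [mellin]
      have e : ∀ t : ℝ, (t:ℂ) ^ (-s - 1) • E t = (Ici (1:ℝ)).indicator (fun t => (t:ℂ) ^ (-s - 1) • E t) t := by
        intro t
        by_cases ht : t ∈ Ici (1:ℝ)
        · rw [indicator_of_mem ht]
        · rw [indicator_of_notMem ht, hE, indicator_of_notMem ht, smul_zero]
      rw [integral_congr_ae (Eventually.of_forall e), setIntegral_indicator measurableSet_Ici, ← integral_Ici_eq_integral_Ioi]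
      congr 2
      ext t
      simp only [mem_inter_iff, mem_Ioi, mem_Ici]
      constructor
      · exact fun h => h.2
      · exact fun h => ⟨by linarith, h⟩
    have key : ∫ t in Ioi (1:ℝ), (∑ k ∈ Finset.Icc 1 ⌊t⌋₊, (a k : ℂ)) * (t:ℂ) ^ (-(s+1)) = κ * (1 / (s - 1)) + mellin E (-s) := by
      rw [← i1, i3, ← integral_add i2 conv2]
      refine setIntegral_congr_fun measurableSet_Ioi fun t ht => ?_
      have ht0 : (t:ℂ) ≠ 0 := by
        have : (0:ℝ) < t := by linarith [mem_Ioi.1 ht]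
        exact_mod_cast this.ne'
      simp only [hE, indicator_of_mem (mem_Ici.2 (mem_Ioi.1 ht).le), smul_eq_mul]
      have e1 : (t:ℂ) ^ (-s) = t * (t:ℂ) ^ (-s-1) := by
        rw [Complex.cpow_sub _ _ ht0, Complex.cpow_one]; field_simp
      rw [e1, show -(s+1) = -s - 1 by ring]
      push_cast
      ring
    rw [key]
    field_simp

end EchoZ
end

section
open Real Set Filter Topology MeasureTheory
namespace EchoZ

theorem lim_real {f : ℂ → ℂ} {s₀ L : ℂ} (h : Tendsto f (𝓝[≠] s₀) (𝓝 L)) :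
    Tendsto (fun ε : ℝ => f (s₀ + ε)) (𝓝[>] 0) (𝓝 L) := by
  refine h.comp ?_
  refine tendsto_nhdsWithin_iff.2 ⟨?_, ?_⟩
  · have : ContinuousAt (fun ε : ℝ => s₀ + (ε:ℂ)) 0 := by fun_prop
    have h2 := this.tendsto
    simp only [Complex.ofReal_zero, add_zero] at h2
    exact h2.mono_left nhdsWithin_le_nhds
  · filter_upwards [self_mem_nhdsWithin] with ε hε
    have : (ε:ℂ) ≠ 0 := by exact_mod_cast (mem_Ioi.1 hε).ne'
    simpa using this

theorem re_term (Λ : ℕ → ℝ) (σ t : ℝ) (n : ℕ) (hn : n ≠ 0) :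
    (LSeries.term (fun n => (Λ n : ℂ)) (σ + t * Complex.I) n).re = Λ n * (n:ℝ) ^ (-σ) * cos (t * log n) := by
  rw [LSeries.term_of_ne_zero hn]
  have n0 : (0:ℝ) < n := Nat.cast_pos.2 (Nat.pos_of_ne_zero hn)
  have : (n:ℂ) ^ ((σ:ℂ) + t * Complex.I) = ((n:ℝ) ^ σ : ℝ) * Complex.exp (((t * log n : ℝ) : ℂ) * Complex.I) := by
    rw [Complex.cpow_add _ _ (by exact_mod_cast hn), Complex.ofReal_cpow n0.le]
    congr 1
    rw [Complex.cpow_def_of_ne_zero (by exact_mod_cast hn), ← Complex.ofReal_natCast, ← Complex.ofReal_log n0.le]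
    congr 1; push_cast; ring
  rw [this, div_eq_mul_inv, mul_inv, ← Complex.exp_neg, ← mul_assoc, ← Complex.ofReal_inv, ← Complex.ofReal_mul, Complex.re_ofReal_mul,
    rpow_neg n0.le]
  congr 1
  have : -(((t * log n : ℝ) : ℂ) * Complex.I) = ((-(t * log n) : ℝ) : ℂ) * Complex.I := by push_cast; ring
  rw [this, Complex.exp_ofReal_mul_I_re, cos_neg]

theorem three_four_one (Λ : ℕ → ℝ) (hΛ : ∀ n, 0 ≤ Λ n)
    (hS : ∀ s : ℂ, 1 < s.re → LSeriesSummable (fun n => (Λ n : ℂ)) s) (σ t : ℝ) (hσ : 1 < σ) :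
    0 ≤ 3 * (LSeries (fun n => (Λ n : ℂ)) (σ + (0:ℝ) * Complex.I)).re + 4 * (LSeries (fun n => (Λ n : ℂ)) (σ + t * Complex.I)).re +
      (LSeries (fun n => (Λ n : ℂ)) (σ + (2 * t : ℝ) * Complex.I)).re := by
  have hs : ∀ u : ℝ, HasSum (fun n => (LSeries.term (fun n => (Λ n : ℂ)) (σ + u * Complex.I) n).re)
      (LSeries (fun n => (Λ n : ℂ)) (σ + u * Complex.I)).re := fun u =>
    Complex.hasSum_re ((hS (σ + u * Complex.I) (by simpa using hσ)).hasSum)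
  have := (((hs 0).mul_left 3).add ((hs t).mul_left 4)).add (hs (2*t))
  refine this.nonneg fun n => ?_
  rcases eq_or_ne n 0 with rfl | hn
  · simp
  · rw [re_term _ _ _ _ hn, re_term _ _ _ _ hn, re_term _ _ _ _ hn]
    have h1 : 0 ≤ Λ n * (n:ℝ) ^ (-σ) := mul_nonneg (hΛ n) (by positivity)
    have e : 2 * t * log n = 2 * (t * log n) := by ring
    rw [zero_mul, cos_zero, e, cos_two_mul]
    have h2 : 0 ≤ 2 * (cos (t * log n) + 1) ^ 2 := by positivity
    nlinarith

theorem nonvanish (g : ℂ → ℂ) (θ : ℝ) (hθ : θ < 1) (hg : ∀ s : ℂ, θ < s.re → AnalyticAt ℂ g s) (hg1 : g 1 ≠ 0)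
    (Λ : ℕ → ℝ) (hΛ : ∀ n, 0 ≤ Λ n)
    (hS : ∀ s : ℂ, 1 < s.re → LSeriesSummable (fun n => (Λ n : ℂ)) s)
    (hc : ∀ s : ℂ, 1 < s.re → ContinuousAt (LSeries (fun n => (Λ n : ℂ))) s)
    (hd : ∀ s : ℂ, 1 < s.re → deriv g s = g s * (1 / (s - 1) - LSeries (fun n => (Λ n : ℂ)) s)) :
    ∀ s : ℂ, 1 ≤ s.re → g s ≠ 0 := by
  have pre : IsPreconnected {s : ℂ | θ < s.re} := (convex_halfSpace_re_gt θ).isPreconnected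
  have ev : ∀ s : ℂ, θ < s.re → ¬ ∀ᶠ z in 𝓝 s, g z = 0 := by
    intro s hs h
    have : AnalyticOnNhd ℂ g {s : ℂ | θ < s.re} := fun z hz => hg z hz
    exact hg1 (this.eqOn_zero_of_preconnected_of_eventuallyEq_zero pre hs h (by simpa using hθ))
  have gt : ∀ s : ℂ, 1 < s.re → g s ≠ 0 := by
    intro s hs
    obtain ⟨m, h1, -, h3, h4⟩ := order_lim (hg s (hθ.trans hs)) (ev s (hθ.trans hs))
    have s1 : s - 1 ≠ 0 := by intro h; rw [sub_eq_zero] at h; rw [h] at hs; simp at hs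
    have hop : {z : ℂ | 1 < z.re} ∈ 𝓝 s := (isOpen_lt continuous_const Complex.continuous_re).mem_nhds hs
    have h5 : Tendsto (fun z => (z - s) * (1 / (z - 1) - LSeries (fun n => (Λ n : ℂ)) z)) (𝓝[≠] s) (𝓝 0) := by
      refine Tendsto.mono_left ?_ nhdsWithin_le_nhds
      have hc' := hc s hs
      have : ContinuousAt (fun z => (z - s) * (1 / (z - 1) - LSeries (fun n => (Λ n : ℂ)) z)) s := by
        fun_prop (disch := assumption)
      have := this.tendsto
      simpa using this
    have h6 : Tendsto (fun z => (z - s) * (deriv g z / g z)) (𝓝[≠] s) (𝓝 0) := by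
      refine h5.congr' ?_
      filter_upwards [h3, mem_nhdsWithin_of_mem_nhds hop] with z hz hz2
      rw [hd z hz2, mul_div_cancel_left₀ _ hz]
    have := tendsto_nhds_unique h4 h6
    exact h1 (by exact_mod_cast this)
  -- limits on the line
  have lim : ∀ t : ℝ, ∃ m : ℕ, (m = 0 → g (1 + t * Complex.I) ≠ 0) ∧ (g (1 + t * Complex.I) ≠ 0 → m = 0) ∧
      Tendsto (fun ε : ℝ => (ε:ℂ) * (1 / (ε + t * Complex.I) - LSeries (fun n => (Λ n : ℂ)) (((1 + ε : ℝ):ℂ) + t * Complex.I))) (𝓝[>] 0) (𝓝 (m:ℂ)) := by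
    intro t
    have ht : θ < (1 + t * Complex.I).re := by simpa using hθ
    obtain ⟨m, h1, h2, h3, h4⟩ := order_lim (hg _ ht) (ev _ ht)
    refine ⟨m, h1, h2, (lim_real h4).congr' ?_⟩
    filter_upwards [self_mem_nhdsWithin] with ε hε
    have hε' : (0:ℝ) < ε := hε
    have hr : 1 < (1 + t * Complex.I + ε).re := by simpa using hε'
    rw [hd _ hr, mul_div_cancel_left₀ _ (gt _ hr), add_sub_cancel_left]
    congr 3
    · ring
    · push_cast; ring
  have limne : ∀ t : ℝ, t ≠ 0 → ∃ m : ℕ, (m = 0 → g (1 + t * Complex.I) ≠ 0) ∧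
      Tendsto (fun ε : ℝ => ε * (LSeries (fun n => (Λ n : ℂ)) (((1 + ε : ℝ):ℂ) + t * Complex.I)).re) (𝓝[>] 0) (𝓝 (-(m:ℝ))) := by
    intro t ht
    obtain ⟨m, h1, -, h2⟩ := lim t
    refine ⟨m, h1, ?_⟩
    have h3 : Tendsto (fun ε : ℝ => (ε:ℂ) * (1 / (ε + t * Complex.I))) (𝓝[>] 0) (𝓝 0) := by
      refine Tendsto.mono_left ?_ nhdsWithin_le_nhds
      have h0 : (((0:ℝ):ℂ) + t * Complex.I) ≠ 0 := by simpa using ht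
      have : ContinuousAt (fun ε : ℝ => (ε:ℂ) * (1 / (ε + t * Complex.I))) 0 := by
        fun_prop (disch := assumption)
      simpa using this.tendsto
    have h4 := h3.sub h2
    have h5 := (Complex.continuous_re.tendsto _).comp h4
    have e : (0 - (m:ℂ)).re = -(m:ℝ) := by simp
    rw [e] at h5
    refine h5.congr fun ε => ?_
    simp only [Function.comp]
    rw [← mul_sub, sub_sub_cancel, Complex.re_ofReal_mul]
  have lim0 : Tendsto (fun ε : ℝ => ε * (LSeries (fun n => (Λ n : ℂ)) (((1 + ε : ℝ):ℂ) + (0:ℝ) * Complex.I)).re) (𝓝[>] 0) (𝓝 1) := by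
    obtain ⟨m, -, h1, h2⟩ := lim 0
    have hm : m = 0 := h1 (by simpa using hg1)
    subst hm
    have h3 : Tendsto (fun ε : ℝ => (ε:ℂ) * (1 / (ε + (0:ℝ) * Complex.I))) (𝓝[>] 0) (𝓝 1) := by
      refine (tendsto_const_nhds (x := (1:ℂ))).congr' ?_
      filter_upwards [self_mem_nhdsWithin] with ε hε
      have : (ε:ℂ) ≠ 0 := by exact_mod_cast (mem_Ioi.1 hε).ne'
      simp [this]
    have h4 := h3.sub h2
    have h5 := (Complex.continuous_re.tendsto _).comp h4
    have e : (1 - ((0:ℕ):ℂ)).re = 1 := by simp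
    rw [e] at h5
    refine h5.congr fun ε => ?_
    simp only [Function.comp]
    rw [← mul_sub, sub_sub_cancel, Complex.re_ofReal_mul]
  intro s hs
  rcases hs.lt_or_eq with h | h
  · exact gt s h
  have es : s = 1 + s.im * Complex.I := by
    apply Complex.ext <;> simp [← h]
  rcases eq_or_ne s.im 0 with h0 | h0
  · rw [es, h0]; simpa using hg1
  obtain ⟨m, h1, h2⟩ := limne s.im h0
  obtain ⟨m', -, h2'⟩ := limne (2 * s.im) (by simpa using h0)
  rw [es]
  apply h1
  have tot := ((lim0.const_mul 3).add (h2.const_mul 4)).add h2'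
  have : (0:ℝ) ≤ 3 * 1 + 4 * (-(m:ℝ)) + -(m':ℝ) := by
    refine ge_of_tendsto tot ?_
    filter_upwards [self_mem_nhdsWithin] with ε hε
    have hε' : (0:ℝ) < ε := hε
    have := three_four_one Λ hΛ hS (1 + ε) s.im (by linarith)
    have := mul_nonneg hε'.le this
    linarith
  by_contra hm
  have h1 : (1:ℝ) ≤ m := by exact_mod_cast Nat.one_le_iff_ne_zero.2 hm
  have h2 : (0:ℝ) ≤ m' := by positivity
  linarith

/-- abstract prime ideal theorem -/
theorem abstract_pit (a Λ : ℕ → ℝ) (ha : ∀ n, 0 ≤ a n) (hΛ : ∀ n, 0 ≤ Λ n) (κ θ : ℝ) (hκ : 0 < κ) (hθ0 : 0 < θ) (hθ : θ < 1)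
    (hO : (fun x : ℝ => (∑ k ∈ Finset.Icc 1 ⌊x⌋₊, a k) - κ * x) =O[atTop] fun x : ℝ => x ^ θ)
    (hconv : ∀ m : ℕ, m ≠ 0 → a m * log m = ∑ x ∈ m.divisorsAntidiagonal, Λ x.1 * a x.2)
    (C : ℝ) (hC : ∀ n, ∑ k ∈ Finset.Icc 1 n, Λ k ≤ C * n) :
    Tendsto (fun x:ℝ => (∑ k ∈ Finset.Icc 1 ⌊x⌋₊, Λ k)/x) atTop (𝓝 1) := by
  obtain ⟨haS, g, hg, hg1, hga⟩ := continuation a ha κ θ hθ0 hθ hO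
  have hΛO : (fun n : ℕ => ∑ k ∈ Finset.Icc 1 n, Λ k) =O[atTop] fun n : ℕ => (n:ℝ) ^ (1:ℝ) := by
    refine Asymptotics.IsBigO.of_bound C (Eventually.of_forall fun n => ?_)
    rw [rpow_one, norm_of_nonneg (Finset.sum_nonneg fun i _ => hΛ i), norm_of_nonneg (by positivity)]
    exact hC n
  have hΛS : ∀ s : ℂ, 1 < s.re → LSeriesSummable (fun n => (Λ n : ℂ)) s := fun s hs =>
    LSeriesSummable_of_sum_norm_bigO_and_nonneg hΛO hΛ zero_le_one hs
  have absc : ∀ f : ℕ → ℂ, (∀ s : ℂ, 1 < s.re → LSeriesSummable f s) → ∀ s : ℂ, 1 < s.re → LSeries.abscissaOfAbsConv f < s.re := by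
    intro f hf s hs
    refine lt_of_le_of_lt (LSeries.abscissaOfAbsConv_le_of_forall_lt_LSeriesSummable (x := 1) fun y hy => hf y (by simpa using hy)) ?_
    exact_mod_cast hs
  have hΛc : ∀ s : ℂ, 1 < s.re → ContinuousAt (LSeries (fun n => (Λ n : ℂ))) s := fun s hs =>
    (LSeries_hasDerivAt (absc _ hΛS s hs)).continuousAt
  have hconvL : ∀ s : ℂ, 1 < s.re → LSeries (fun n => (Λ n : ℂ)) s * LSeries (fun n => (a n : ℂ)) s = LSeries (LSeries.logMul (fun n => (a n:ℂ))) s := by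
    intro s hs
    rw [← LSeries_convolution' (hΛS s hs) (haS s hs)]
    refine LSeries_congr (fun {n} hn => ?_) s
    rw [LSeries.convolution_def]
    simp only [LSeries.logMul]
    have := congrArg (fun x : ℝ => (x:ℂ)) (hconv n hn)
    push_cast at this
    rw [← this, mul_comm]
  have hd : ∀ s : ℂ, 1 < s.re → deriv g s = g s * (1 / (s - 1) - LSeries (fun n => (Λ n : ℂ)) s) := by
    intro s hs
    have s1 : s - 1 ≠ 0 := by intro h; rw [sub_eq_zero] at h; rw [h] at hs; simp at hs
    have hop : {z : ℂ | 1 < z.re} ∈ 𝓝 s := (isOpen_lt continuous_const Complex.continuous_re).mem_nhds hs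
    have e : g =ᶠ[𝓝 s] fun s => (s - 1) * LSeries (fun n => (a n : ℂ)) s := by
      filter_upwards [hop] with z hz using hga z hz
    have hD : HasDerivAt (fun s => (s - 1) * LSeries (fun n => (a n : ℂ)) s) _ s :=
      ((hasDerivAt_id s).sub_const 1).mul (LSeries_hasDerivAt (absc _ haS s hs))
    rw [e.deriv_eq, hD.deriv, hga s hs, ← hconvL s hs]
    simp only [id]
    field_simp
    ring
  have nv := nonvanish g θ hθ hg (by rw [hg1]; exact_mod_cast hκ.ne') Λ hΛ hΛS hΛc hd
  refine EchoWI.wiener_ikehara Λ hΛ C hC (fun s => - (deriv g s / g s)) ?_ ?_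
  · intro s hs
    have h1 := (hg s (hθ.trans_le hs)).deriv.continuousAt
    have h2 := (hg s (hθ.trans_le hs)).continuousAt
    have h3 := nv s hs
    refine ContinuousAt.continuousWithinAt ?_
    fun_prop (disch := assumption)
  · intro s hs
    rw [hd s hs, mul_div_cancel_left₀ _ (nv s hs.le)]
    ring

end EchoZ
end

section
open Ideal NumberField Real
open scoped Classical

namespace EchoP
variable (K : Type*) [Field K] [NumberField K]

/-- ideals of norm m -/
noncomputable def S (m : ℕ) : Finset (Ideal (𝓞 K)) := (finite_setOfPred_absNorm_eq m).toFinset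

variable {K}
lemma mem_S {m : ℕ} {I : Ideal (𝓞 K)} : I ∈ S K m ↔ absNorm I = m := by
  simp [S]

/-- von Mangoldt -/
noncomputable def lam (I : Ideal (𝓞 K)) : ℝ := if IsPrimePow I then log (absNorm I.radical) else 0

lemma lam_nonneg (I : Ideal (𝓞 K)) : 0 ≤ lam I := by
  unfold lam; split_ifs
  · exact log_natCast_nonneg _
  · exact le_rfl

lemma lam_pow {P : Ideal (𝓞 K)} (hP : Prime P) {k : ℕ} (hk : k ≠ 0) : lam (P ^ k) = log (absNorm P) := by
  have h : IsPrimePow (P ^ k) := hP.isPrimePow.pow hk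
  rw [lam, if_pos h, Ideal.radical_pow _ hk, (Ideal.isPrime_of_prime hP).radical]

/-- divisors of an ideal -/
lemma finite_dvd {I : Ideal (𝓞 K)} (hI : I ≠ 0) : {D | D ∣ I}.Finite := by
  refine (finite_setOfPred_absNorm_le (S := 𝓞 K) (absNorm I)).subset fun D hD => ?_
  have h : absNorm D ∣ absNorm I := map_dvd _ hD
  exact Nat.le_of_dvd (Nat.pos_of_ne_zero fun h => hI (absNorm_eq_zero_iff.1 h)) h

noncomputable def divs (I : Ideal (𝓞 K)) : Finset (Ideal (𝓞 K)) := if h : I ≠ 0 then (finite_dvd h).toFinset else ∅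

lemma mem_divs {I D : Ideal (𝓞 K)} (hI : I ≠ 0) : D ∈ divs I ↔ D ∣ I := by
  rw [divs, dif_pos hI]; simp

lemma pp_dvd_mul {x y D : Ideal (𝓞 K)} (h : IsRelPrime x y) (hD : IsPrimePow D) (hd : D ∣ x * y) : D ∣ x ∨ D ∣ y := by
  obtain ⟨P, k, hP, hk, rfl⟩ := hD
  by_cases hx : P ∣ x
  · have : ¬ P ∣ y := fun hy => hP.not_isUnit (h hx hy)
    left; exact hP.pow_dvd_of_dvd_mul_right k this hd
  · right; exact hP.pow_dvd_of_dvd_mul_left k hx hd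

lemma sum_lam (I : Ideal (𝓞 K)) (hI : I ≠ 0) : ∑ D ∈ divs I, lam D = log (absNorm I) := by
  induction I using UniqueFactorizationMonoid.induction_on_coprime with
  | h0 => exact absurd rfl hI
  | h1 hx =>
    rename_i x
    have : x = 1 := by rwa [Ideal.isUnit_iff, ← Ideal.one_eq_top] at hx
    subst this
    rw [show (absNorm (1 : Ideal (𝓞 K))) = 1 from map_one _]
    simp only [Nat.cast_one, log_one]
    refine Finset.sum_eq_zero fun D hD => ?_
    rw [mem_divs hI, ← isUnit_iff_dvd_one] at hD
    rw [lam, if_neg]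
    intro h
    exact h.not_isUnit hD
  | hpr i hP =>
    rename_i P
    have e : divs (P ^ i) = (Finset.range (i + 1)).image (P ^ ·) := by
      ext D
      rw [mem_divs hI, dvd_prime_pow hP]
      simp only [Finset.mem_image, Finset.mem_range, associated_iff_eq]
      constructor
      · rintro ⟨j, h1, h2⟩; exact ⟨j, by omega, h2.symm⟩
      · rintro ⟨j, h1, h2⟩; exact ⟨j, by omega, h2.symm⟩
    rw [e, Finset.sum_image, Finset.sum_range_succ']
    · rw [Finset.sum_congr rfl fun j _ => lam_pow hP (Nat.succ_ne_zero j)]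
      have : lam (P ^ 0) = 0 := by
        rw [lam, if_neg]; intro h; exact h.not_isUnit (by simp)
      rw [this]
      simp
    · intro a _ b _ h
      exact pow_injective_of_not_isUnit hP.not_isUnit hP.ne_zero h
  | hcp h ihx ihy =>
    rename_i x y
    have hx : x ≠ 0 := by rintro rfl; simp at hI
    have hy : y ≠ 0 := by rintro rfl; simp at hI
    rw [map_mul, Nat.cast_mul, log_mul, ← ihx hx, ← ihy hy]
    · have key : ∀ J : Ideal (𝓞 K), ∑ D ∈ divs J, lam D = ∑ D ∈ (divs J).filter IsPrimePow, lam D := by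
        intro J
        rw [Finset.sum_filter]
        refine Finset.sum_congr rfl fun D _ => ?_
        split_ifs with h
        · rfl
        · rw [lam, if_neg h]
      rw [key, key x, key y, ← Finset.sum_union]
      · congr 1
        ext D
        simp only [Finset.mem_filter, Finset.mem_union, mem_divs hI, mem_divs hx, mem_divs hy]
        constructor
        · rintro ⟨h1, h2⟩
          rcases pp_dvd_mul h h2 h1 with h3 | h3
          · exact Or.inl ⟨h3, h2⟩
          · exact Or.inr ⟨h3, h2⟩
        · rintro (⟨h1, h2⟩ | ⟨h1, h2⟩)
          · exact ⟨h1.mul_right _, h2⟩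
          · exact ⟨h1.mul_left _, h2⟩
      · rw [Finset.disjoint_left]
        intro D h1 h2
        simp only [Finset.mem_filter, mem_divs hx, mem_divs hy] at h1 h2
        exact h1.2.not_isUnit (h h1.1 h2.1)
    · simpa [absNorm_eq_zero_iff] using hx
    · simpa [absNorm_eq_zero_iff] using hy

variable (K) in
noncomputable def a (m : ℕ) : ℝ := (S K m).card
variable (K) in
noncomputable def L (m : ℕ) : ℝ := ∑ I ∈ S K m, lam I

lemma a_conv (m : ℕ) (hm : m ≠ 0) : a K m * log m = ∑ x ∈ m.divisorsAntidiagonal, L K x.1 * a K x.2 := by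
  have ne : ∀ I ∈ S K m, I ≠ 0 := by
    rintro I hI rfl
    rw [mem_S, Ideal.zero_eq_bot, absNorm_bot] at hI
    exact hm hI.symm
  have h1 : a K m * log m = ∑ I ∈ S K m, ∑ D ∈ divs I, lam D := by
    rw [Finset.sum_congr rfl fun I hI => (sum_lam I (ne I hI)).trans (by rw [mem_S.1 hI])]
    simp [a]
  rw [h1, Finset.sum_sigma']
  have h2 : ∀ x : ℕ × ℕ, L K x.1 * a K x.2 = ∑ y ∈ S K x.1 ×ˢ S K x.2, lam y.1 := by
    intro x
    rw [Finset.sum_product, L, a, Finset.sum_mul]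
    refine Finset.sum_congr rfl fun I _ => ?_
    simp [mul_comm]
  simp_rw [h2]
  rw [Finset.sum_sigma']
  symm
  refine Finset.sum_bij (fun z _ => ⟨z.2.1 * z.2.2, z.2.1⟩) ?_ ?_ ?_ ?_
  · rintro ⟨⟨d, e⟩, ⟨D, J⟩⟩ h
    simp only [Finset.mem_sigma, Nat.mem_divisorsAntidiagonal, Finset.mem_product, mem_S] at h ⊢
    have hh : absNorm (D * J) = m := by rw [map_mul, h.2.1, h.2.2, h.1.1]
    refine ⟨hh, ?_⟩
    rw [mem_divs (ne _ (mem_S.2 hh))]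
    exact dvd_mul_right _ _
  · rintro ⟨⟨d, e⟩, ⟨D, J⟩⟩ h ⟨⟨d', e'⟩, ⟨D', J'⟩⟩ h' heq
    simp only [Finset.mem_sigma, Nat.mem_divisorsAntidiagonal, Finset.mem_product, mem_S] at h h'
    simp only [Sigma.mk.injEq, heq_eq_eq] at heq
    obtain ⟨h1, rfl⟩ := heq
    have hD : D ≠ 0 := by
      rintro rfl
      have h3 := h.2.1
      rw [Ideal.zero_eq_bot, absNorm_bot] at h3
      have h4 := h.1.1
      rw [← h3, zero_mul] at h4
      exact hm h4.symm
    have := mul_left_cancel₀ hD h1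
    subst this
    obtain ⟨-, rfl, rfl⟩ := h
    obtain ⟨-, rfl, rfl⟩ := h'
    rfl
  · rintro ⟨I, D⟩ h
    simp only [Finset.mem_sigma] at h
    obtain ⟨h1, h2⟩ := h
    rw [mem_divs (ne _ h1)] at h2
    obtain ⟨J, rfl⟩ := h2
    rw [mem_S, map_mul] at h1
    refine ⟨⟨(absNorm D, absNorm J), (D, J)⟩, ?_, rfl⟩
    simp [mem_S, h1, hm]
  · rintro ⟨⟨d, e⟩, ⟨D, J⟩⟩ h
    rfl

lemma L_nonneg (m : ℕ) : 0 ≤ L K m := Finset.sum_nonneg fun I _ => lam_nonneg I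

lemma L_le (d : ℕ) : L K d ≤ Module.finrank ℚ K * ArithmeticFunction.vonMangoldt d := by
  have e : L K d = ∑ I ∈ (S K d).filter IsPrimePow, lam I := by
    rw [Finset.sum_filter, L]
    refine Finset.sum_congr rfl fun D _ => ?_
    split_ifs with h
    · rfl
    · rw [lam, if_neg h]
  rcases ((S K d).filter IsPrimePow).eq_empty_or_nonempty with h | ⟨I, hI⟩
  · rw [e, h, Finset.sum_empty]
    have := ArithmeticFunction.vonMangoldt_nonneg (n := d)
    positivity
  rw [Finset.mem_filter] at hI
  obtain ⟨hI1, P, k, hP, hk, rfl⟩ := hI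
  have hPp := Ideal.isPrime_of_prime hP
  have hPm : P.IsMaximal := hPp.isMaximal hP.ne_zero
  have : NeZero P := ⟨hP.ne_zero⟩
  -- norm of P is a prime power
  set p := absNorm (P.under ℤ) with hp
  have pp : p.Prime := Nat.absNorm_under_prime P
  have norm_pow : ∃ f, f ≠ 0 ∧ absNorm P = p ^ f := by
    have h1 : (p : 𝓞 K) ∈ P := by
      have := Int.absNorm_under_mem P
      simpa using this
    have h2 : absNorm P ∣ absNorm (Ideal.span {(p : 𝓞 K)}) := absNorm_dvd_absNorm_of_le (by rwa [Ideal.span_singleton_le_iff_mem])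
    have h3 : absNorm (Ideal.span {(p : 𝓞 K)}) = p ^ Module.finrank ℤ (𝓞 K) := by
      rw [absNorm_span_singleton, ← map_natCast (algebraMap ℤ (𝓞 K)), Algebra.norm_algebraMap]
      simp
    rw [h3] at h2
    obtain ⟨f, -, hf⟩ := (Nat.dvd_prime_pow pp).1 h2
    refine ⟨f, ?_, hf⟩
    rintro rfl
    rw [pow_zero, absNorm_eq_one_iff] at hf
    exact hPp.ne_top hf
  obtain ⟨f, hf, hPf⟩ := norm_pow
  have hd : d = p ^ (f * k) := by
    rw [mem_S, map_pow, hPf, ← pow_mul] at hI1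
    exact hI1.symm
  have hfk : f * k ≠ 0 := by positivity
  rw [e, hd, ArithmeticFunction.vonMangoldt_apply_pow hfk, ArithmeticFunction.vonMangoldt_apply_prime pp]
  have pne : Ideal.span {(p : 𝓞 K)} ≠ 0 := by
    simp [pp.ne_zero]
  have hn : absNorm (Ideal.span {(p : 𝓞 K)}) = p ^ Module.finrank ℚ K := by
    rw [absNorm_span_singleton, ← map_natCast (algebraMap ℤ (𝓞 K)), Algebra.norm_algebraMap]
    simp [RingOfIntegers.rank]
  rw [← log_pow, ← Nat.cast_pow, ← hn, ← sum_lam _ pne, ← hd]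
  have hinj : Set.InjOn (fun I : Ideal (𝓞 K) => I.radical) ((S K d).filter IsPrimePow) := by
    intro A hA B hB hAB
    simp only [Finset.coe_filter, Set.mem_ofPred_eq, mem_S] at hA hB
    obtain ⟨hA, PA, a, hPA, ha, rfl⟩ := hA
    obtain ⟨hB, PB, b, hPB, hb, rfl⟩ := hB
    simp only at hAB
    rw [Ideal.radical_pow _ ha.ne', Ideal.radical_pow _ hb.ne', (Ideal.isPrime_of_prime hPA).radical, (Ideal.isPrime_of_prime hPB).radical] at hAB
    subst hAB
    rw [← hB, map_pow, map_pow] at hA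
    have : 2 ≤ absNorm PA := by
      have h0 : absNorm PA ≠ 0 := by rw [Ne, absNorm_eq_zero_iff]; exact hPA.ne_zero
      have h1 : absNorm PA ≠ 1 := by rw [Ne, absNorm_eq_one_iff]; exact (Ideal.isPrime_of_prime hPA).ne_top
      omega
    rw [Nat.pow_right_injective this hA]
  rw [show ∑ I ∈ (S K d).filter IsPrimePow, lam I = ∑ J ∈ ((S K d).filter IsPrimePow).image (fun I => I.radical), lam J by
    rw [Finset.sum_image hinj]
    refine Finset.sum_congr rfl fun I hI => ?_
    rw [Finset.mem_filter] at hI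
    obtain ⟨-, Q, j, hQ, hj, rfl⟩ := hI
    rw [lam_pow hQ hj.ne', Ideal.radical_pow _ hj.ne', (Ideal.isPrime_of_prime hQ).radical]
    simpa using (lam_pow hQ one_ne_zero).symm]
  refine Finset.sum_le_sum_of_subset_of_nonneg ?_ fun I _ _ => lam_nonneg I
  intro J hJ
  rw [Finset.mem_image] at hJ
  obtain ⟨I, hI, rfl⟩ := hJ
  rw [Finset.mem_filter, mem_S] at hI
  obtain ⟨hI, hI2⟩ := hI
  rw [mem_divs pne, Ideal.dvd_iff_le, Ideal.span_singleton_le_iff_mem]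
  refine ⟨f * k, ?_⟩
  have := absNorm_mem I
  rw [hI, hd] at this
  exact_mod_cast this

lemma L_prime {p : ℕ} (hp : p.Prime) : L K p = a K p * log p := by
  rw [L, a, Finset.sum_congr rfl (g := fun _ => log p)]
  · simp
  · intro I hI
    rw [mem_S] at hI
    have hP : I.IsPrime := isPrime_of_irreducible_absNorm (by rw [hI]; exact hp)
    have h0 : I ≠ ⊥ := by rintro rfl; rw [absNorm_bot] at hI; exact hp.ne_zero hI.symm
    have := lam_pow (Ideal.prime_of_isPrime h0 hP) one_ne_zero
    rwa [pow_one, hI] at this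

lemma sum_a (x : ℝ) (hx : 0 ≤ x) : ∑ k ∈ Finset.Icc 1 ⌊x⌋₊, a K k = (Nat.card {I : nonZeroDivisors (Ideal (𝓞 K)) // absNorm (I : Ideal (𝓞 K)) ≤ x} : ℝ) := by
  have h1 : ∑ k ∈ Finset.Icc 1 ⌊x⌋₊, a K k = (((Finset.Icc 1 ⌊x⌋₊).biUnion (S K)).card : ℝ) := by
    rw [Finset.card_biUnion]
    · simp [a]
    · intro i _ j _ hij
      rw [Function.onFun, Finset.disjoint_left]
      intro I h1 h2
      rw [mem_S] at h1 h2
      exact hij (h1.symm.trans h2)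
  rw [h1, ← Nat.card_eq_finsetCard]
  congr 1
  refine Nat.card_congr ⟨fun I => ⟨⟨I.1, ?_⟩, ?_⟩, fun I => ⟨I.1.1, ?_⟩, fun _ => rfl, fun _ => rfl⟩
  · have := I.2
    simp only [Finset.mem_biUnion, Finset.mem_Icc, mem_S] at this
    obtain ⟨k, ⟨h1, h2⟩, h3⟩ := this
    rw [← absNorm_ne_zero_iff_mem_nonZeroDivisors]
    omega
  · have := I.2
    simp only [Finset.mem_biUnion, Finset.mem_Icc, mem_S] at this
    obtain ⟨k, ⟨h1, h2⟩, h3⟩ := this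
    simp only [h3]
    exact (Nat.le_floor_iff hx).1 h2
  · simp only [Finset.mem_biUnion, Finset.mem_Icc, mem_S]
    refine ⟨_, ⟨absNorm_pos_of_nonZeroDivisors I.1, ?_⟩, rfl⟩
    exact Nat.le_floor I.2
end EchoP
end

section
open NumberField Real Filter Topology Chebyshev
open scoped Classical

namespace EchoP

/-- mean value over primes -/
def HasMean (f : ℕ → ℝ) (c : ℝ) : Prop :=
  Tendsto (fun n : ℕ => (∑ p ∈ Nat.primesLE n, f p) / (Nat.primesLE n).card) atTop (𝓝 c)

/-- from psi to theta -/
lemma theta_of_psi (Λ : ℕ → ℝ) (B : ℝ) (h0 : ∀ n, 0 ≤ Λ n) (hB : ∀ n, Λ n ≤ B * ArithmeticFunction.vonMangoldt n)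
    (h : Tendsto (fun x:ℝ => (∑ k ∈ Finset.Icc 1 ⌊x⌋₊, Λ k)/x) atTop (𝓝 1)) :
    Tendsto (fun n : ℕ => (∑ p ∈ Nat.primesLE n, Λ p) / n) atTop (𝓝 1) := by
  have h1 := h.comp tendsto_natCast_atTop_atTop
  obtain ⟨C, hC⟩ := psi_sub_theta_le_mul_sqrt
  have hd : Tendsto (fun n : ℕ => (∑ k ∈ (Finset.Icc 1 n).filter (fun k => ¬ k.Prime), Λ k) / n) atTop (𝓝 0) := by
    have hz : Tendsto (fun n : ℕ => (B * C) * (√(n:ℝ))⁻¹) atTop (𝓝 0) := by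
      have := (tendsto_sqrt_atTop.comp tendsto_natCast_atTop_atTop).inv_tendsto_atTop.const_mul (B * C)
      simpa using this
    have hBn : 0 ≤ B := by
      have := hB 2
      rw [ArithmeticFunction.vonMangoldt_apply_prime Nat.prime_two] at this
      have h2 := (h0 2).trans this
      have := log_pos (by norm_num : (1:ℝ) < 2)
      push_cast at h2
      exact nonneg_of_mul_nonneg_left h2 this
    refine squeeze_zero' (Eventually.of_forall fun n => div_nonneg (Finset.sum_nonneg fun i _ => h0 i) (by positivity)) ?_ hz
    filter_upwards [eventually_gt_atTop 0] with n hn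
    have hn' : (0:ℝ) < n := by exact_mod_cast hn
    rw [div_le_iff₀ hn']
    have e := psi_sub_theta_eq_sum_not_prime (n:ℝ)
    rw [Nat.floor_natCast] at e
    calc _ ≤ ∑ k ∈ (Finset.Icc 1 n).filter (fun k => ¬ k.Prime), B * ArithmeticFunction.vonMangoldt k := Finset.sum_le_sum fun i _ => hB i
      _ = B * (ψ n - θ n) := by rw [← Finset.mul_sum, e]; rfl
      _ ≤ B * (C * √n) := by gcongr; exact hC n
      _ = _ := by
        have : (n:ℝ) = √n * √n := (mul_self_sqrt hn'.le).symm
        have h2 : √(n:ℝ) ≠ 0 := by positivity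
        rw [mul_assoc, mul_assoc]
        congr 2
        rw [show (√(n:ℝ))⁻¹ * (n:ℝ) = (√(n:ℝ))⁻¹ * (√n * √n) by rw [← this], inv_mul_cancel_left₀ h2]
  have h3 := h1.sub hd
  rw [sub_zero] at h3
  refine h3.congr fun n => ?_
  simp only [Function.comp, Nat.floor_natCast]
  rw [← sub_div, Nat.primesLE_eq_filter_Icc_one, ← Finset.sum_filter_add_sum_filter_not (Finset.Icc 1 n) Nat.Prime]
  congr 1
  ring

lemma pnt_psi : Tendsto (fun x:ℝ => (∑ k ∈ Finset.Icc 1 ⌊x⌋₊, ArithmeticFunction.vonMangoldt k)/x) atTop (𝓝 1) := by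
  refine EchoZ.abstract_pit (fun _ => 1) (fun n => ArithmeticFunction.vonMangoldt n) (fun _ => zero_le_one) (fun n => ArithmeticFunction.vonMangoldt_nonneg) 1 (1/2) one_pos (by norm_num) (by norm_num) ?_ ?_ (log 4 + 4) ?_
  · refine Asymptotics.IsBigO.of_bound 1 ?_
    filter_upwards [eventually_ge_atTop 1] with x hx
    simp only [Finset.sum_const, Nat.card_Icc, Nat.add_sub_cancel, nsmul_eq_mul, mul_one, one_mul]
    have h1 := Nat.floor_le (zero_le_one.trans hx)
    have h2 := Nat.lt_floor_add_one x
    have h3 : (1:ℝ) ≤ x ^ (1/2:ℝ) := one_le_rpow hx (by norm_num)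
    rw [norm_eq_abs, norm_eq_abs, abs_of_nonneg (by linarith : 0 ≤ x ^ (1/2:ℝ)), abs_le]
    constructor <;> linarith
  · intro m hm
    simp only [one_mul, mul_one]
    rw [Nat.sum_divisorsAntidiagonal (fun d _ => (ArithmeticFunction.vonMangoldt d : ℝ)), ArithmeticFunction.vonMangoldt_sum]
  · intro n
    have := psi_le_const_mul_self (x := n) (by positivity)
    rw [psi, Nat.floor_natCast] at this
    exact this

lemma pnt_theta : Tendsto (fun n : ℕ => θ n / n) atTop (𝓝 1) := by
  refine (theta_of_psi _ 1 (fun n => ArithmeticFunction.vonMangoldt_nonneg) (fun n => by rw [one_mul]) pnt_psi).congr fun n => ?_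
  rw [theta_eq_sum_primesLE_log]
  congr 1
  exact Finset.sum_congr rfl fun p hp => ArithmeticFunction.vonMangoldt_apply_prime (Nat.prime_of_mem_primesLE hp)

lemma card_primesLE (n : ℕ) : (Nat.primesLE n).card = Nat.primeCounting n := by
  simp [Nat.primesLE, Nat.primeCounting, Nat.primesBelow_card_eq_primeCounting']

lemma pi_sub : Tendsto (fun n : ℕ => ((Nat.primesLE n).card - θ n / log n) * (log n / n)) atTop (𝓝 0) := by
  have h := primeCounting_sub_theta_div_log_isBigO.comp_tendsto tendsto_natCast_atTop_atTop
  have h2 := h.mul (Asymptotics.isBigO_refl (fun n : ℕ => log n / n) atTop)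
  have h3 : Tendsto (fun n : ℕ => (log n)⁻¹) atTop (𝓝 0) := (tendsto_log_atTop.comp tendsto_natCast_atTop_atTop).inv_tendsto_atTop
  refine ((h2.congr' ?_ ?_).trans_tendsto h3)
  · refine Eventually.of_forall fun n => ?_
    simp only [Function.comp, Nat.floor_natCast, card_primesLE]
  · filter_upwards [eventually_gt_atTop 1] with n hn
    have hl : log (n:ℝ) ≠ 0 := (log_pos (by exact_mod_cast hn)).ne'
    have hn0 : (n:ℝ) ≠ 0 := by positivity
    simp only [Function.comp]
    field_simp

lemma pnt : Tendsto (fun n : ℕ => (Nat.primesLE n).card * (log n / n)) atTop (𝓝 1) := by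
  have := pi_sub.add pnt_theta
  rw [zero_add] at this
  refine this.congr' ?_
  filter_upwards [eventually_gt_atTop 1] with n hn
  have hl : log (n:ℝ) ≠ 0 := (log_pos (by exact_mod_cast hn)).ne'
  have hn0 : (n:ℝ) ≠ 0 := by positivity
  field_simp
  ring

lemma hasMean_of_theta (f : ℕ → ℝ) (B : ℝ) (h0 : ∀ p, p.Prime → 0 ≤ f p) (hB : ∀ p, p.Prime → f p ≤ B)
    (h : Tendsto (fun n : ℕ => (∑ p ∈ Nat.primesLE n, f p * log p) / n) atTop (𝓝 1)) : HasMean f 1 := by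
  have err : Tendsto (fun n : ℕ => (∑ p ∈ Nat.primesLE n, f p - (∑ p ∈ Nat.primesLE n, f p * log p) / log n) * (log n / n)) atTop (𝓝 0) := by
    have hz := pi_sub.const_mul B
    rw [mul_zero] at hz
    have aux : ∀ n : ℕ, 1 < n → ∑ p ∈ Nat.primesLE n, f p - (∑ p ∈ Nat.primesLE n, f p * log p) / log n = ∑ p ∈ Nat.primesLE n, f p * (1 - log p / log n) := by
      intro n hn
      rw [Finset.sum_div, ← Finset.sum_sub_distrib]
      refine Finset.sum_congr rfl fun p _ => ?_
      ring
    have pos : ∀ n : ℕ, 1 < n → ∀ p ∈ Nat.primesLE n, 0 ≤ 1 - log p / log n := by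
      intro n hn p hp
      have hl : 0 < log (n:ℝ) := (log_pos (by exact_mod_cast hn))
      rw [sub_nonneg, div_le_one hl]
      have := Nat.mem_primesLE.1 hp
      exact log_le_log (by exact_mod_cast this.2.pos) (by exact_mod_cast this.1)
    refine squeeze_zero' ?_ ?_ hz
    · filter_upwards [eventually_gt_atTop 1] with n hn
      rw [aux n hn]
      have hl : 0 < log (n:ℝ) := (log_pos (by exact_mod_cast hn))
      refine mul_nonneg (Finset.sum_nonneg fun p hp => mul_nonneg (h0 p (Nat.prime_of_mem_primesLE hp)) (pos n hn p hp)) (by positivity)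
    · filter_upwards [eventually_gt_atTop 1] with n hn
      rw [aux n hn, ← mul_assoc]
      have hl : 0 < log (n:ℝ) := (log_pos (by exact_mod_cast hn))
      refine mul_le_mul_of_nonneg_right ?_ (by positivity)
      calc _ ≤ ∑ p ∈ Nat.primesLE n, B * (1 - log p / log n) := Finset.sum_le_sum fun p hp =>
            mul_le_mul_of_nonneg_right (hB p (Nat.prime_of_mem_primesLE hp)) (pos n hn p hp)
        _ = _ := by
          rw [← Finset.mul_sum, Finset.sum_sub_distrib, theta_eq_sum_primesLE_log, Finset.sum_div]
          simp
  have h2 := (err.add h).div pnt one_ne_zero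
  rw [zero_add, div_one] at h2
  refine h2.congr' ?_
  filter_upwards [eventually_gt_atTop 1] with n hn
  have hl : log (n:ℝ) ≠ 0 := (log_pos (by exact_mod_cast hn)).ne'
  have hn0 : (n:ℝ) ≠ 0 := by positivity
  have hc : ((Nat.primesLE n).card : ℝ) ≠ 0 := by
    rw [Nat.cast_ne_zero, Finset.card_ne_zero]
    exact ⟨2, Nat.mem_primesLE.2 ⟨hn, Nat.prime_two⟩⟩
  simp only [Pi.div_apply]
  field_simp
  ring

variable (K : Type*) [Field K] [NumberField K]

lemma a_eq_homs {p : ℕ} (hp : p.Prime) : a K p = Nat.card (𝓞 K →+* ZMod p) := by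
  have : Fact p.Prime := ⟨hp⟩
  rw [a, ← Nat.card_eq_finsetCard]
  congr 1
  symm
  have surj : ∀ φ : 𝓞 K →+* ZMod p, Function.Surjective φ := fun φ => ZMod.ringHom_surjective φ
  have mem : ∀ φ : 𝓞 K →+* ZMod p, RingHom.ker φ ∈ S K p := by
    intro φ
    rw [mem_S, Ideal.absNorm_apply, Submodule.cardQuot_apply]
    have e := RingHom.quotientKerEquivOfSurjective (surj φ)
    exact (Nat.card_congr e.toEquiv).trans (Nat.card_zmod p)
  refine Nat.card_congr (Equiv.ofBijective (fun φ => ⟨RingHom.ker φ, mem φ⟩) ⟨?_, ?_⟩)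
  · intro φ φ' h
    simp only [Subtype.mk.injEq] at h
    ext x
    obtain ⟨k, hk⟩ := ZMod.natCast_zmod_surjective (φ x)
    have h1 : x - (k : 𝓞 K) ∈ RingHom.ker φ := by
      rw [RingHom.mem_ker, map_sub, map_natCast, hk, sub_self]
    rw [h, RingHom.mem_ker, map_sub, map_natCast, hk, sub_eq_zero] at h1
    exact h1.symm
  · rintro ⟨I, hI⟩
    rw [mem_S, Ideal.absNorm_apply, Submodule.cardQuot_apply] at hI
    have : Finite (𝓞 K ⧸ I) := Nat.finite_of_card_ne_zero (by rw [hI]; exact hp.ne_zero)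
    have := Fintype.ofFinite (𝓞 K ⧸ I)
    rw [Nat.card_eq_fintype_card] at hI
    let e := ZMod.ringEquivOfPrime (𝓞 K ⧸ I) hp hI
    refine ⟨e.symm.toRingHom.comp (Ideal.Quotient.mk I), ?_⟩
    apply Subtype.ext
    ext x
    simp only [RingHom.mem_ker, RingHom.comp_apply]
    change e.symm _ = 0 ↔ _
    rw [EmbeddingLike.map_eq_zero_iff, Ideal.Quotient.eq_zero_iff_mem]

theorem prime_ideal : HasMean (fun p => (Nat.card (𝓞 K →+* ZMod p) : ℝ)) 1 := by
  obtain ⟨κ, hκ, hO⟩ := EchoLat.ideal_count K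
  have hn : (1:ℝ) ≤ Module.finrank ℚ K := by exact_mod_cast Nat.one_le_iff_ne_zero.2 Module.finrank_pos.ne'
  have hpsi := EchoZ.abstract_pit (a K) (L K) (fun n => Nat.cast_nonneg _) L_nonneg κ (1 - 1 / (2 * (Module.finrank ℚ K : ℝ))) hκ
    (by rw [sub_pos, div_lt_one (by positivity)]; linarith) (by have : 0 < 1 / (2 * (Module.finrank ℚ K : ℝ)) := by positivity
                                                                linarith)
    (hO.congr' (by filter_upwards [eventually_ge_atTop 0] with x hx; rw [sum_a x hx]) (by rfl)) a_conv
    (Module.finrank ℚ K * (log 4 + 4)) (by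
      intro n
      have := psi_le_const_mul_self (x := n) (by positivity)
      rw [psi, Nat.floor_natCast] at this
      calc _ ≤ ∑ k ∈ Finset.Icc 1 n, (Module.finrank ℚ K) * ArithmeticFunction.vonMangoldt k := Finset.sum_le_sum fun i _ => L_le i
        _ = (Module.finrank ℚ K) * ∑ k ∈ Finset.Ioc 0 n, ArithmeticFunction.vonMangoldt k := by rw [← Finset.mul_sum]; rfl
        _ ≤ _ := by rw [mul_assoc]; gcongr)
  have hth := theta_of_psi (L K) _ L_nonneg L_le hpsi
  have key : HasMean (a K) 1 := by
    refine hasMean_of_theta (a K) (Module.finrank ℚ K) (fun p _ => Nat.cast_nonneg _) (fun p hp => ?_) (hth.congr fun n => ?_)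
    · have := L_le (K := K) p
      rw [L_prime hp, ArithmeticFunction.vonMangoldt_apply_prime hp] at this
      exact le_of_mul_le_mul_right this (log_pos (by exact_mod_cast hp.one_lt))
    · congr 1
      exact Finset.sum_congr rfl fun p hp => L_prime (Nat.prime_of_mem_primesLE hp)
  refine key.congr fun n => ?_
  congr 1
  exact Finset.sum_congr rfl fun p hp => a_eq_homs K (Nat.prime_of_mem_primesLE hp)
end EchoP
end

section
open NumberField Polynomial
open scoped Classical

namespace EchoF

section eta
variable (F : Type*) [Field F] [NumberField F]

lemma exists_eta : ∃ (η : 𝓞 F) (m : ℤ), m ≠ 0 ∧ (∀ x : 𝓞 F, ∃ q : ℤ[X], (m : 𝓞 F) * x = aeval η q) := by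
  let B := Field.powerBasisOfFiniteOfSeparable ℚ F
  have halg : IsAlgebraic ℤ B.gen := by
    rw [IsFractionRing.isAlgebraic_iff ℤ ℚ F]
    exact Algebra.IsAlgebraic.isAlgebraic _
  obtain ⟨y, hy, hintg⟩ := halg.exists_integral_multiple
  have hyF : (y : ℚ) ≠ 0 := by exact_mod_cast hy
  have hmem : B.gen ∈ Algebra.adjoin ℚ {y • B.gen} := by
    have h1 : y • B.gen ∈ Algebra.adjoin ℚ {y • B.gen} := Algebra.subset_adjoin rfl
    have h2 := Subalgebra.smul_mem _ h1 ((y : ℚ)⁻¹)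
    rw [← Int.cast_smul_eq_zsmul ℚ y B.gen] at h2 ⊢
    rwa [inv_smul_smul₀ hyF] at h2
  have htop : Algebra.adjoin ℚ {y • B.gen} = ⊤ := by
    rw [eq_top_iff, ← B.adjoin_gen_eq_top]
    exact Algebra.adjoin_le (by simpa using hmem)
  let B' := PowerBasis.ofAdjoinEqTop (hintg.tower_top (A := ℚ)) htop
  have hg : B'.gen = y • B.gen := PowerBasis.ofAdjoinEqTop_gen ..
  have hintg' : IsIntegral ℤ B'.gen := by rw [hg]; exact hintg
  have hd : IsIntegral ℤ (Algebra.discr ℚ B'.basis) := by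
    refine Algebra.discr_isIntegral _ fun i => ?_
    rw [PowerBasis.basis_eq_pow]
    exact hintg'.pow _
  obtain ⟨m, hm⟩ := IsIntegrallyClosed.isIntegral_iff.1 hd
  have hm0 : m ≠ 0 := by
    rintro rfl
    apply Algebra.discr_not_zero_of_basis ℚ B'.basis
    rw [← hm]; simp
  obtain ⟨η, hη⟩ : ∃ η : 𝓞 F, algebraMap (𝓞 F) F η = B'.gen := ⟨⟨B'.gen, hintg'⟩, rfl⟩
  refine ⟨η, m, hm0, fun x => ?_⟩
  have h := Algebra.discr_mul_isIntegral_mem_adjoin (R := ℤ) ℚ hintg' (RingOfIntegers.isIntegral_coe x)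
  rw [Algebra.adjoin_singleton_eq_range_aeval] at h
  obtain ⟨q, hq⟩ := h
  refine ⟨q, ?_⟩
  apply RingOfIntegers.coe_injective
  have hq' : aeval B'.gen q = Algebra.discr ℚ B'.basis • (algebraMap (𝓞 F) F) x := hq
  rw [← aeval_algebraMap_apply, hη, hq', ← hm]
  simp [Algebra.smul_def]

variable {F} (L : Type*) [Field L] [NumberField L] [IsGalois ℚ L] [Algebra F L]

lemma coe_smul' (σ : Gal(L/ℚ)) (x : 𝓞 L) : ((σ • x : 𝓞 L) : L) = σ (x : L) := rfl

variable (F) in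
lemma eta_main : ∃ m : ℕ, m ≠ 0 ∧ ∀ (κ : Type) [Field κ], (m : κ) ≠ 0 →
    (∀ (φ : 𝓞 F →+* κ) (α : 𝓞 L →+* κ), ∃ σ : Gal(L/ℚ), ∀ x, φ x = α (σ • algebraMap (𝓞 F) (𝓞 L) x)) ∧
    (∀ (α : 𝓞 L →+* κ) (σ : Gal(L/ℚ)), (∀ x, α (σ • algebraMap (𝓞 F) (𝓞 L) x) = α (algebraMap (𝓞 F) (𝓞 L) x)) →
      ∀ x : F, σ (algebraMap F L x) = algebraMap F L x) := by
  obtain ⟨η, m, hm, hη⟩ := exists_eta F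
  set e : 𝓞 L := algebraMap (𝓞 F) (𝓞 L) η with he
  let D : 𝓞 L := ∏ σ ∈ (Finset.univ : Finset Gal(L/ℚ)).filter (fun σ => σ • e ≠ e), (σ • e - e)
  have hD : D ≠ 0 := Finset.prod_ne_zero_iff.2 fun σ hσ => sub_ne_zero.2 (Finset.mem_filter.1 hσ).2
  have hDn : Ideal.absNorm (Ideal.span {D}) ≠ 0 := by
    rw [Ne, Ideal.absNorm_eq_zero_iff]; simpa using hD
  refine ⟨m.natAbs * Ideal.absNorm (Ideal.span {D}), mul_ne_zero (by simpa using hm) hDn, ?_⟩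
  intro κ _ hκ
  rw [Nat.cast_mul] at hκ
  have hκ1 : (m : κ) ≠ 0 := by
    have := left_ne_zero_of_mul hκ
    rw [← Int.cast_natCast, Int.natCast_natAbs] at this
    intro h
    rcases abs_choice m with h' | h' <;> rw [h'] at this <;> simp [h] at this
  have hκ2 := right_ne_zero_of_mul hκ
  -- a hom is determined by its value at η
  have det : ∀ φ ψ : 𝓞 F →+* κ, φ η = ψ η → φ = ψ := by
    intro φ ψ h
    ext x
    obtain ⟨q, hq⟩ := hη x
    have h1 : ∀ φ : 𝓞 F →+* κ, (m : κ) * φ x = eval₂ (Int.castRingHom κ) (φ η) q := by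
      intro φ
      rw [← map_intCast φ, ← map_mul, hq, aeval_def, hom_eval₂]
      congr 1
      ext; simp
    exact mul_left_cancel₀ hκ1 (by rw [h1, h1, h])
  constructor
  · intro φ α
    obtain ⟨q, hq⟩ := (Algebra.IsInvariant.charpoly_mem_lifts ℤ (𝓞 L) Gal(L/ℚ) e)
    rw [coe_mapRingHom] at hq
    have h0 : aeval η q = 0 := by
      have h1 : eval e (q.map (algebraMap ℤ (𝓞 L))) = 0 := by rw [hq, MulSemiringAction.eval_charpoly]
      rw [eval_map, ← aeval_def, he, aeval_algebraMap_apply] at h1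
      have inj : Function.Injective (algebraMap (𝓞 F) (𝓞 L)) := FaithfulSMul.algebraMap_injective _ _
      exact inj (by rw [h1, map_zero])
    have h2 : eval₂ (Int.castRingHom κ) (φ η) q = 0 := by
      have := congrArg φ h0
      rw [aeval_def, hom_eval₂, map_zero] at this
      rw [← this]; congr 1; ext; simp
    have h3 : eval (φ η) ((q.map (algebraMap ℤ (𝓞 L))).map α) = 0 := by
      rw [Polynomial.map_map, eval_map, ← h2]; congr 1; ext; simp
    rw [hq, MulSemiringAction.charpoly_eq, Polynomial.map_prod, eval_prod, Finset.prod_eq_zero_iff] at h3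
    obtain ⟨σ, -, h3⟩ := h3
    simp only [Polynomial.map_sub, map_X, map_C, eval_sub, eval_X, eval_C, sub_eq_zero] at h3
    refine ⟨σ, fun x => ?_⟩
    have := det φ (α.comp ((MulSemiringAction.toRingHom Gal(L/ℚ) (𝓞 L) σ).comp (algebraMap (𝓞 F) (𝓞 L)))) h3
    exact RingHom.congr_fun this x
  · intro α σ h
    have hαD : α D ≠ 0 := by
      intro h0
      apply hκ2
      have := Ideal.absNorm_mem (Ideal.span {D})
      rw [Ideal.mem_span_singleton] at this
      obtain ⟨c, hc⟩ := this
      have := congrArg α hc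
      rwa [map_mul, h0, zero_mul, map_natCast] at this
    have hσ : σ • e = e := by
      by_contra hne
      apply hαD
      rw [map_prod, Finset.prod_eq_zero_iff]
      exact ⟨σ, by simpa using hne, by rw [map_sub, h, sub_self]⟩
    have hintg : ∀ x : 𝓞 F, σ • algebraMap (𝓞 F) (𝓞 L) x = algebraMap (𝓞 F) (𝓞 L) x := by
      intro x
      obtain ⟨q, hq⟩ := hη x
      have h1 := congrArg (algebraMap (𝓞 F) (𝓞 L)) hq
      rw [map_mul, map_intCast, ← aeval_algebraMap_apply, ← he] at h1
      have h2 := congrArg (MulSemiringAction.toRingHom Gal(L/ℚ) (𝓞 L) σ) h1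
      rw [map_mul, map_intCast, aeval_def, hom_eval₂] at h2
      have h3 : (MulSemiringAction.toRingHom Gal(L/ℚ) (𝓞 L) σ) e = e := hσ
      rw [h3, show ((MulSemiringAction.toRingHom Gal(L/ℚ) (𝓞 L)) σ).comp (algebraMap ℤ (𝓞 L)) = algebraMap ℤ (𝓞 L) by ext; simp, ← aeval_def, ← h1] at h2
      exact mul_left_cancel₀ (by exact_mod_cast hm) h2
    intro x
    obtain ⟨a, b, hb, rfl⟩ := IsFractionRing.div_surjective (A := 𝓞 F) x
    have h3 : ∀ a : 𝓞 F, σ (algebraMap F L (algebraMap (𝓞 F) F a)) = algebraMap F L (algebraMap (𝓞 F) F a) := by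
      intro a
      have := congrArg (algebraMap (𝓞 L) L) (hintg a)
      exact this
    rw [map_div₀, map_div₀, h3, h3]
end eta

section exist
variable (L : Type*) [Field L] [NumberField L] [IsGalois ℚ L]

/-- existence of a place and a Frobenius -/
lemma exists_frob (p : ℕ) [Fact p.Prime] : ∃ (α : 𝓞 L →+* AlgebraicClosure (ZMod p)) (σ : Gal(L/ℚ)), ∀ x, α x ^ p = α (σ • x) := by
  have hp : p.Prime := Fact.out
  have hP : (Ideal.span {(p : ℤ)}).IsPrime := by
    rw [Ideal.span_singleton_prime (by exact_mod_cast hp.ne_zero)]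
    exact Nat.prime_iff_prime_int.1 hp
  have hne : (Ideal.span {(p : ℤ)}) ≠ ⊥ := by simpa using hp.ne_zero
  obtain ⟨⟨Q, hQp, hQ⟩⟩ := (inferInstance : Nonempty (Ideal.primesOver (Ideal.span {(p : ℤ)}) (𝓞 L)))
  have hQne : Q ≠ ⊥ := Ideal.ne_bot_of_liesOver_of_ne_bot hne Q
  have : Finite (𝓞 L ⧸ Q) := Ideal.finiteQuotientOfFreeOfNeBot Q hQne
  have hQm : Q.IsMaximal := hQp.isMaximal hQne
  obtain ⟨σ, hσ⟩ := IsArithFrobAt.exists_of_isInvariant ℤ Gal(L/ℚ) Q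
  let _ := Ideal.Quotient.field Q
  have hpQ : ((p : ℕ) : 𝓞 L ⧸ Q) = 0 := by
    have h1 : (p : ℤ) ∈ Q.under ℤ := by rw [← hQ.over]; exact Ideal.mem_span_singleton_self _
    rw [← map_natCast (Ideal.Quotient.mk Q), Ideal.Quotient.eq_zero_iff_mem]
    have : algebraMap ℤ (𝓞 L) p ∈ Q := h1
    simpa using this
  have : CharP (𝓞 L ⧸ Q) p := by
    obtain ⟨c, hc⟩ := CharP.exists (𝓞 L ⧸ Q)
    have h1 : c ∣ p := (CharP.cast_eq_zero_iff _ c p).1 hpQ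
    have h2 : c ≠ 1 := CharP.char_ne_one (𝓞 L ⧸ Q) c
    rwa [((Nat.dvd_prime hp).1 h1).resolve_left h2] at hc
  let _ := ZMod.algebra (𝓞 L ⧸ Q) p
  have : Algebra.IsAlgebraic (ZMod p) (𝓞 L ⧸ Q) := Algebra.IsAlgebraic.of_finite _ _
  let f : (𝓞 L ⧸ Q) →ₐ[ZMod p] AlgebraicClosure (ZMod p) := IsAlgClosed.lift
  refine ⟨f.toRingHom.comp (Ideal.Quotient.mk Q), σ, fun x => ?_⟩
  have h2 := hσ x
  rw [← hQ.over] at h2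
  have hc : Nat.card (ℤ ⧸ Ideal.span {(p : ℤ)}) = p := by
    rw [Nat.card_congr (Int.quotientSpanNatEquivZMod p).toEquiv, Nat.card_zmod]
  rw [hc, ← Ideal.Quotient.eq] at h2
  rw [← map_pow, RingHom.comp_apply, RingHom.comp_apply, ← h2]
  rfl
end exist
end EchoF
end

section
open Filter Topology NumberField EchoP
open scoped Pointwise
namespace EchoP
lemma card_primesLE_tendsto : Tendsto (fun n : ℕ => ((Nat.primesLE n).card : ℝ)) atTop atTop := by
  refine tendsto_natCast_atTop_atTop.comp ?_
  have := Nat.tendsto_primeCounting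
  simpa [Function.comp_def, card_primesLE] using this

lemma HasMean.add {f g : ℕ → ℝ} {a b : ℝ} (hf : HasMean f a) (hg : HasMean g b) : HasMean (fun p => f p + g p) (a+b) := by
  unfold HasMean at *
  refine (hf.add hg).congr fun n => ?_
  rw [Finset.sum_add_distrib, add_div]

lemma HasMean.mul {f : ℕ → ℝ} {a : ℝ} (c : ℝ) (hf : HasMean f a) : HasMean (fun p => c * f p) (c*a) := by
  unfold HasMean at *
  refine (hf.const_mul c).congr fun n => ?_
  rw [← Finset.mul_sum, mul_div_assoc]

lemma HasMean.sub {f g : ℕ → ℝ} {a b : ℝ} (hf : HasMean f a) (hg : HasMean g b) : HasMean (fun p => f p - g p) (a-b) := by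
  unfold HasMean at *
  refine (Tendsto.sub hf hg).congr fun n => ?_
  rw [Finset.sum_sub_distrib, sub_div]

lemma HasMean.sum {ι : Type*} (s : Finset ι) {f : ι → ℕ → ℝ} {a : ι → ℝ} (hf : ∀ i ∈ s, HasMean (f i) (a i)) :
    HasMean (fun p => ∑ i ∈ s, f i p) (∑ i ∈ s, a i) := by
  unfold HasMean at *
  refine (tendsto_finsetSum s hf).congr fun n => ?_
  rw [Finset.sum_comm, Finset.sum_div]

lemma HasMean.zero_of_large {f : ℕ → ℝ} (N : ℕ) (hf : ∀ p, p.Prime → N ≤ p → f p = 0) : HasMean f 0 := by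
  unfold HasMean
  refine Tendsto.congr' (f₁ := fun n => (∑ p ∈ Nat.primesLE N, f p) / ((Nat.primesLE n).card : ℝ)) ?_ (tendsto_const_nhds.div_atTop card_primesLE_tendsto)
  filter_upwards [eventually_ge_atTop N] with n hn
  congr 1
  refine Finset.sum_subset (fun p hp => ?_) (fun p hp h => ?_)
  · rw [Nat.mem_primesLE] at hp ⊢
    exact ⟨hp.1.trans hn, hp.2⟩
  · rw [Nat.mem_primesLE] at hp h
    refine hf p hp.2 ?_
    by_contra h2
    exact h ⟨by omega, hp.2⟩

lemma HasMean.congr {f g : ℕ → ℝ} {a : ℝ} (hf : HasMean f a) (N : ℕ) (h : ∀ p, p.Prime → N ≤ p → f p = g p) : HasMean g a := by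
  have h1 := hf.sub (HasMean.zero_of_large (f := fun p => f p - g p) N (fun p h1 h2 => by rw [h p h1 h2, sub_self]))
  simpa using h1
end EchoP

namespace EchoF
section count
variable (L : Type) [Field L] [NumberField L] [IsGalois ℚ L]

open Classical in
lemma pow_p_mem (p : ℕ) [Fact p.Prime] (x : AlgebraicClosure (ZMod p)) (hx : x ^ p = x) : ∃ y : ZMod p, algebraMap _ _ y = x := by
  have := FiniteField.roots_X_pow_card_sub_X (ZMod p)
  have hne : (Polynomial.X ^ p - Polynomial.X : Polynomial (AlgebraicClosure (ZMod p))) ≠ 0 := FiniteField.X_pow_card_sub_X_ne_zero _ (Fact.out : p.Prime).one_lt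
  have hs : (Finset.univ.image (algebraMap (ZMod p) (AlgebraicClosure (ZMod p)))) ⊆ (Polynomial.X ^ p - Polynomial.X : Polynomial (AlgebraicClosure (ZMod p))).roots.toFinset := by
    intro z hz
    obtain ⟨y, -, rfl⟩ := Finset.mem_image.1 hz
    rw [Multiset.mem_toFinset, Polynomial.mem_roots hne]
    simp [← map_pow, ZMod.pow_card]
  have h2 := Finset.eq_of_subset_of_card_le hs (by
    rw [Finset.card_image_of_injective _ (algebraMap (ZMod p) _).injective, Finset.card_univ, ZMod.card]
    refine (Multiset.toFinset_card_le _).trans ((Polynomial.card_roots' _).trans ?_)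
    rw [FiniteField.X_pow_card_sub_X_natDegree_eq _ (Fact.out : p.Prime).one_lt])
  have : x ∈ (Polynomial.X ^ p - Polynomial.X : Polynomial (AlgebraicClosure (ZMod p))).roots.toFinset := by
    rw [Multiset.mem_toFinset, Polynomial.mem_roots hne]
    simp [hx]
  rw [← h2] at this
  obtain ⟨y, -, hy⟩ := Finset.mem_image.1 this
  exact ⟨y, hy⟩

open IntermediateField in
lemma subgroup_count (C : Subgroup Gal(L/ℚ)) : ∃ m : ℕ, m ≠ 0 ∧ ∀ (p : ℕ) [Fact p.Prime], m < p →
    ∀ (α : 𝓞 L →+* AlgebraicClosure (ZMod p)) (σ : Gal(L/ℚ)), (∀ x, α x ^ p = α (σ • x)) →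
    Nat.card {τ : Gal(L/ℚ) // τ⁻¹ * σ * τ ∈ C} = Nat.card (𝓞 (fixedField C) →+* ZMod p) * Nat.card C := by
  obtain ⟨m, hm, H⟩ := eta_main (fixedField C) L
  refine ⟨m, hm, fun p _ hp α σ hσ => ?_⟩
  have hp0 : ((m : ℕ) : AlgebraicClosure (ZMod p)) ≠ 0 := by
    rw [Ne, CharP.cast_eq_zero_iff _ p]
    exact fun h => absurd (Nat.le_of_dvd (by omega) h) (by omega)
  obtain ⟨Ha, Hb⟩ := H (AlgebraicClosure (ZMod p)) hp0
  set ι := algebraMap (𝓞 (fixedField C)) (𝓞 L) with hι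
  -- twisted places
  let tw : Gal(L/ℚ) → (𝓞 L →+* AlgebraicClosure (ZMod p)) := fun τ => α.comp (MulSemiringAction.toRingHom Gal(L/ℚ) (𝓞 L) τ)
  have htw : ∀ τ x, tw τ x = α (τ • x) := fun _ _ => rfl
  have hC : ∀ τ ρ : Gal(L/ℚ), (∀ x, α (τ • ρ • ι x) = α (τ • ι x)) ↔ ρ ∈ C := by
    intro τ ρ
    constructor
    · intro h
      have := Hb (tw τ) ρ h
      rw [← fixingSubgroup_fixedField C]
      rw [IntermediateField.mem_fixingSubgroup_iff]
      intro x hx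
      exact this ⟨x, hx⟩
    · intro h x
      congr 2
      ext
      have := x.1.2
      rw [mem_fixedField_iff] at this
      exact this ρ h
  have hval : ∀ τ : Gal(L/ℚ), (∀ x, α (τ • ι x) ^ p = α (τ • ι x)) ↔ τ⁻¹ * σ * τ ∈ C := by
    intro τ
    rw [← hC τ]
    refine forall_congr' fun x => ?_
    rw [hσ, smul_smul τ, smul_smul, mul_assoc, mul_inv_cancel_left]
  let emb := algebraMap (ZMod p) (AlgebraicClosure (ZMod p))
  have hemb : Function.Injective emb := emb.injective
  choose s hs using fun ψ : 𝓞 (fixedField C) →+* ZMod p => Ha (emb.comp ψ) α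
  have hs' : ∀ ψ x, emb (ψ x) = α (s ψ • ι x) := fun ψ x => hs ψ x
  have hcx : ∀ (c : C) x, (c : Gal(L/ℚ)) • ι x = ι x := by
    intro c x
    ext
    have := x.1.2
    rw [mem_fixedField_iff] at this
    exact this c c.2
  rw [← Nat.card_prod]
  symm
  refine Nat.card_eq_of_bijective (fun x => ⟨s x.1 * x.2, ?_⟩) ⟨?_, ?_⟩
  · rw [← hval]
    intro y
    show α ((s x.1 * (x.2 : Gal(L/ℚ))) • ι y) ^ p = α ((s x.1 * (x.2 : Gal(L/ℚ))) • ι y)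
    rw [mul_smul, hcx, ← hs', ← map_pow, ZMod.pow_card]
  · rintro ⟨ψ, c⟩ ⟨ψ', c'⟩ h
    have h : s ψ * c = s ψ' * c' := congrArg Subtype.val h
    have h1 : ψ = ψ' := by
      ext x
      apply hemb
      rw [hs', hs', ← hcx c, smul_smul, h, mul_smul, hcx, hcx]
    subst h1
    rw [mul_right_inj] at h
    rw [Subtype.ext h]
  · rintro ⟨τ, hτ⟩
    rw [← hval] at hτ
    choose f hf using fun x => pow_p_mem p _ (hτ x)
    let ψ : 𝓞 (fixedField C) →+* ZMod p :=
      { toFun := f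
        map_one' := hemb (by simp [emb, hf])
        map_zero' := hemb (by simp [emb, hf])
        map_mul' := fun x y => hemb (by simp [emb, hf])
        map_add' := fun x y => hemb (by simp [emb, hf]) }
    have hψ : ∀ x, emb (ψ x) = α (τ • ι x) := hf
    have hc : (s ψ)⁻¹ * τ ∈ C := by
      rw [← hC (s ψ)]
      intro x
      rw [smul_smul, mul_inv_cancel_left, ← hψ, hs']
    exact ⟨⟨ψ, ⟨_, hc⟩⟩, by simp⟩
end count

section density
variable (L : Type) [Field L] [NumberField L] [IsGalois ℚ L]
open Classical in
/-- Frobenius density theorem -/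
theorem frob_density (φ : ℕ → Gal(L/ℚ)) (hφ : ∀ (p : ℕ) [Fact p.Prime], ∃ α : 𝓞 L →+* AlgebraicClosure (ZMod p), ∀ x, α x ^ p = α (φ p • x))
    (T : Set Gal(L/ℚ)) (hconj : ∀ g h, g ∈ T → h * g * h⁻¹ ∈ T)
    (hgen : ∀ g h : Gal(L/ℚ), Subgroup.zpowers g = Subgroup.zpowers h → g ∈ T → h ∈ T) :
    HasMean (fun p => if φ p ∈ T then 1 else 0) ((Nat.card T : ℝ) / Nat.card Gal(L/ℚ)) := by
  have _ : Fintype Gal(L/ℚ) := Fintype.ofFinite _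
  have _ : Fintype (Subgroup Gal(L/ℚ)) := Fintype.ofFinite _
  let nn : (Set Gal(L/ℚ)) → ℕ → ℝ := fun T p => ∑ τ : Gal(L/ℚ), if τ⁻¹ * φ p * τ ∈ T then 1 else 0
  let cc : (Set Gal(L/ℚ)) → ℝ := fun T => ∑ g : Gal(L/ℚ), if g ∈ T then 1 else 0
  have hcc : ∀ T : Set Gal(L/ℚ), cc T = Nat.card T := by
    intro T
    simp [cc, Nat.card_eq_fintype_card, Fintype.card_subtype]
  have hsub : ∀ C : Subgroup Gal(L/ℚ), HasMean (nn C) (cc C) := by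
    intro C
    obtain ⟨m, -, H⟩ := subgroup_count L C
    have h1 := (prime_ideal (IntermediateField.fixedField C)).mul (Nat.card C : ℝ)
    rw [mul_one] at h1
    rw [hcc]
    refine h1.congr (m+1) fun p hp hmp => ?_
    have : Fact p.Prime := ⟨hp⟩
    obtain ⟨α, hα⟩ := hφ p
    have := H p hmp α _ hα
    simp only [nn]
    rw [Finset.sum_ite, Finset.sum_const_zero, add_zero, Finset.sum_const, nsmul_eq_mul, mul_one, mul_comm]
    rw [Nat.card_eq_fintype_card, Fintype.card_subtype] at this
    rw [← Nat.cast_mul, ← this]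
    rfl
  let gn : Subgroup Gal(L/ℚ) → Set Gal(L/ℚ) := fun D => {g | Subgroup.zpowers g = D}
  have key : ∀ (P : Subgroup Gal(L/ℚ) → Prop) (T : Set Gal(L/ℚ)), (∀ g, g ∈ T ↔ P (Subgroup.zpowers g)) → ∀ g, (if g ∈ T then (1:ℝ) else 0) = ∑ D : Subgroup Gal(L/ℚ) with P D, if g ∈ gn D then 1 else 0 := by
    intro P T h g
    simp [gn, h]
  have key2 : ∀ (P : Subgroup Gal(L/ℚ) → Prop) (T : Set Gal(L/ℚ)), (∀ g, g ∈ T ↔ P (Subgroup.zpowers g)) →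
      nn T = (fun p => ∑ D : Subgroup Gal(L/ℚ) with P D, nn (gn D) p) ∧ cc T = ∑ D : Subgroup Gal(L/ℚ) with P D, cc (gn D) := by
    intro P T h
    constructor
    · ext p
      simp only [nn]
      rw [Finset.sum_comm]
      exact Finset.sum_congr rfl fun τ _ => key P T h _
    · simp only [cc]
      rw [Finset.sum_comm]
      exact Finset.sum_congr rfl fun τ _ => key P T h _
  have hgn : ∀ D : Subgroup Gal(L/ℚ), HasMean (nn (gn D)) (cc (gn D)) := by
    intro D
    induction D using WellFoundedLT.induction with
    | ind D ih =>
    obtain ⟨h1, h2⟩ := key2 (fun X => X ≤ D) (D : Set _) (by intro g; simp)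
    have h3 := hsub D
    have h4 : (Finset.univ.filter (fun X : Subgroup Gal(L/ℚ) => X ≤ D)) = insert D (Finset.univ.filter (fun X => X < D)) := by
      ext X; simp [le_iff_eq_or_lt]
    rw [h1, h2, h4, Finset.sum_insert (by simp)] at h3
    have h5 := h3.sub (HasMean.sum (Finset.univ.filter (fun X : Subgroup Gal(L/ℚ) => X < D)) (f := fun X => nn (gn X)) (a := fun X => cc (gn X)) (fun X hX => ih X (by simpa using hX)))
    rw [add_sub_cancel_right] at h5
    refine h5.congr 0 fun p _ _ => ?_
    rw [Finset.sum_insert (by simp), add_sub_cancel_right]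
  have hT : HasMean (nn T) (cc T) := by
    obtain ⟨h1, h2⟩ := key2 (fun X => ∃ g ∈ T, Subgroup.zpowers g = X) T (by
      intro g
      exact ⟨fun h => ⟨g, h, rfl⟩, fun ⟨h, hh, e⟩ => hgen _ _ e hh⟩)
    rw [h1, h2]
    exact HasMean.sum _ fun D _ => hgn D
  rw [hcc] at hT
  have h6 := hT.mul (1 / (Nat.card Gal(L/ℚ) : ℝ))
  rw [one_div_mul_eq_div] at h6
  refine h6.congr 0 fun p _ _ => ?_
  have h7 : ∀ τ : Gal(L/ℚ), τ⁻¹ * φ p * τ ∈ T ↔ φ p ∈ T := by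
    intro τ
    constructor
    · intro h
      have := hconj _ τ h
      simpa [mul_assoc] using this
    · intro h
      have := hconj _ τ⁻¹ h
      simpa [mul_assoc] using this
  simp only [nn, h7, Finset.sum_const, nsmul_eq_mul, Finset.card_univ, ← Nat.card_eq_fintype_card]
  have : (Nat.card Gal(L/ℚ) : ℝ) ≠ 0 := by exact_mod_cast Nat.card_pos.ne'
  field_simp
end density
end EchoF
end

section
open scoped Classical
namespace EchoG
variable {G A : Type} [Group G] [AddCommGroup A] [DistribMulAction G A]

lemma smul_nsmul (g : G) (n : ℕ) (a : A) : g • (n • a) = n • (g • a) := smul_comm g n a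

/-- averaging over a group hom -/
lemma sum_hom {H M : Type*} [Group H] [Fintype H] [AddCommGroup M] [Fintype M] (δ : H → M) (hδ : ∀ a b, δ (a * b) = δ a + δ b)
    (hs : Function.Surjective δ) (F : M → ℝ) : (Fintype.card M : ℝ) * ∑ h, F (δ h) = Fintype.card H * ∑ m, F m := by
  have h1 : ∀ m : M, ∑ h, F (δ h) = ∑ h, F (δ h + m) := by
    intro m
    obtain ⟨h0, rfl⟩ := hs m
    rw [← Equiv.sum_comp (Equiv.mulRight h0) (fun h => F (δ h))]
    simp [hδ]
  have h2 : ∑ m : M, ∑ h, F (δ h) = ∑ h : H, ∑ m, F m := by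
    rw [Finset.sum_congr rfl fun m _ => h1 m, Finset.sum_comm]
    refine Finset.sum_congr rfl fun h _ => ?_
    exact Equiv.sum_comp (Equiv.addLeft (δ h)) F
  simpa using h2

/-- averaging over cosets -/
lemma sum_coset [Fintype G] (Γ : Subgroup G) (F c : G → ℝ) (h : ∀ g, ∑ γ : Γ, F (g * γ) = Fintype.card Γ * c g) :
    ∑ g, F g = ∑ g, c g := by
  have h1 : ∑ γ : Γ, ∑ g, F g = ∑ γ : Γ, ∑ g, F (g * γ) := by
    refine Finset.sum_congr rfl fun γ _ => ?_
    rw [← Equiv.sum_comp (Equiv.mulRight (γ : G)) F]; rfl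
  rw [Finset.sum_comm (s := Finset.univ) (t := Finset.univ) (f := fun (γ : Γ) g => F (g * γ))] at h1
  simp only [h, Finset.sum_const, Finset.card_univ, nsmul_eq_mul, ← Finset.mul_sum] at h1
  exact mul_left_cancel₀ (by exact_mod_cast Fintype.card_ne_zero) h1

variable (A) in
def V : AddSubgroup A where
  carrier := {v | (2:ℕ) • v = 0}
  zero_mem' := by simp
  add_mem' := by intro a b ha hb; simp only [Set.mem_ofPred_eq] at *; rw [smul_add, ha, hb, add_zero]
  neg_mem' := by intro a ha; simp only [Set.mem_ofPred_eq] at *; rw [smul_neg, ha, neg_zero]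

lemma mem_V {v : A} : v ∈ V A ↔ (2:ℕ) • v = 0 := Iff.rfl

lemma V_add_self {v : A} (hv : v ∈ V A) : v + v = 0 := by rw [← two_nsmul]; exact hv
lemma V_neg {v : A} (hv : v ∈ V A) : -v = v := by rw [neg_eq_iff_add_eq_zero]; exact V_add_self hv
lemma V_sub {v w : A} (hw : w ∈ V A) : v - w = v + w := by rw [sub_eq_add_neg, V_neg hw]

lemma smul_mem_V (g : G) {v : A} (hv : v ∈ V A) : g • v ∈ V A := by
  rw [mem_V] at *; rw [← smul_nsmul, hv, smul_zero]

def U (n : ℕ) (g : G) : AddSubgroup A where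
  carrier := {v | (2:ℕ) • v = 0 ∧ ∃ y, g • y = y ∧ 2 ^ n • y = v}
  zero_mem' := ⟨by simp, 0, by simp, by simp⟩
  add_mem' := by
    rintro a b ⟨ha, y, hy, rfl⟩ ⟨hb, z, hz, rfl⟩
    exact ⟨by rw [smul_add, ha, hb, add_zero], y + z, by rw [smul_add, hy, hz], by rw [smul_add]⟩
  neg_mem' := by
    rintro a ⟨ha, y, hy, rfl⟩
    exact ⟨by rw [smul_neg, ha, neg_zero], -y, by rw [smul_neg, hy], by rw [smul_neg]⟩

def K (n : ℕ) (g : G) : AddSubgroup A where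
  carrier := {v | (2:ℕ) • v = 0 ∧ ∃ y, 2 ^ (n+1) • y = 0 ∧ g • y - y = v}
  zero_mem' := ⟨by simp, 0, by simp, by simp⟩
  add_mem' := by
    rintro a b ⟨ha, y, hy, rfl⟩ ⟨hb, z, hz, rfl⟩
    exact ⟨by rw [smul_add, ha, hb, add_zero], y + z, by rw [smul_add, hy, hz, add_zero], by rw [smul_add]; abel⟩
  neg_mem' := by
    rintro a ⟨ha, y, hy, rfl⟩
    exact ⟨by rw [smul_neg, ha, neg_zero], -y, by rw [smul_neg, hy, neg_zero], by rw [smul_neg]; abel⟩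

lemma mem_U {n : ℕ} {g : G} {v : A} : v ∈ U n g ↔ (2:ℕ) • v = 0 ∧ ∃ y, g • y = y ∧ 2 ^ n • y = v := Iff.rfl
lemma mem_K {n : ℕ} {g : G} {v : A} : v ∈ K n g ↔ (2:ℕ) • v = 0 ∧ ∃ y, 2 ^ (n+1) • y = 0 ∧ g • y - y = v := Iff.rfl

lemma U_le_V {n : ℕ} {g : G} : U n g ≤ V A := fun _ h => h.1
lemma K_le_V {n : ℕ} {g : G} : K n g ≤ V A := fun _ h => h.1

lemma U_succ_le {n : ℕ} {g : G} : U (A := A) (n+1) g ≤ U n g := by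
  rintro v ⟨h, y, hy, rfl⟩
  exact ⟨h, 2 • y, by rw [smul_nsmul, hy], by rw [smul_smul, pow_succ]⟩

lemma K_le_succ {n : ℕ} {g : G} : K (A := A) n g ≤ K (n+1) g := by
  rintro v ⟨h, y, hy, e⟩
  exact ⟨h, y, by rw [pow_succ', mul_smul, hy, smul_zero], e⟩

def Al (R : A) (n : ℕ) (g : G) : Prop := ∃ q : A, 2 ^ (n+1) • q = R ∧ g • q = q

lemma Al_of_succ {R : A} {n : ℕ} {g : G} (h : Al R (n+1) g) : Al R n g := by
  obtain ⟨q, hq, e⟩ := h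
  exact ⟨2 • q, by rw [smul_smul, ← pow_succ, hq], by rw [smul_nsmul, e]⟩

variable (G) in
def Γ (R : A) (n : ℕ) : Subgroup G where
  carrier := {g | ∀ q : A, 2 ^ (n+1) • q = R → g • q = q}
  one_mem' := by simp
  mul_mem' := by intro a b ha hb q hq; rw [mul_smul, hb q hq, ha q hq]
  inv_mem' := by intro a ha q hq; rw [inv_smul_eq_iff, ha q hq]

/-- the standing hypotheses -/
structure Base (G : Type) [Group G] {A : Type} [AddCommGroup A] [DistribMulAction G A] (R : A) (N : ℕ) : Prop where
  fixR : ∀ g : G, g • R = R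
  cardV : Nat.card (V A) = 4
  half : ∀ k, k < N → ∀ Q : A, (2 ^ k • Q = 0 ∨ 2 ^ k • Q = R) → ∃ Q', 2 • Q' = Q

section base
variable {R : A} {N : ℕ} (B : Base G R N)
include B

lemma finV : Finite (V A) := Nat.finite_of_card_ne_zero (by rw [B.cardV]; norm_num)

lemma exX (n : ℕ) (hn : n < N) : ∃ q : A, 2 ^ (n+1) • q = R := by
  induction n with
  | zero =>
    obtain ⟨q, hq⟩ := B.half 0 hn R (by simp)
    exact ⟨q, by simpa using hq⟩
  | succ n ih =>
    obtain ⟨q, hq⟩ := ih (by omega)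
    obtain ⟨q', hq'⟩ := B.half (n+1) hn q (Or.inr hq)
    exact ⟨q', by rw [pow_succ, mul_smul, hq', hq]⟩

/-- elements of Γ fix torsion -/
lemma fix_tors {n : ℕ} (hn : n < N) {γ : G} (hγ : γ ∈ Γ G R n) {y : A} (hy : 2 ^ (n+1) • y = 0) : γ • y = y := by
  obtain ⟨q, hq⟩ := exX B n hn
  have h1 := hγ q hq
  have h2 := hγ (q + y) (by rw [smul_add, hq, hy, add_zero])
  rw [smul_add, h1] at h2
  exact add_left_cancel h2

lemma Γ_succ_le (n : ℕ) (hn : n + 1 < N) : Γ G R (n+1) ≤ Γ G R n := by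
  intro γ hγ q hq
  obtain ⟨q', rfl⟩ := B.half (n+1) (by omega) q (Or.inr hq)
  rw [smul_nsmul, hγ q' (by rw [pow_succ, mul_smul, hq])]

lemma fin_tors (n : ℕ) : Finite {y : A // 2 ^ n • y = 0} := by
  induction n with
  | zero =>
    have : Subsingleton {y : A // 2 ^ 0 • y = 0} := ⟨fun a b => by
      have h1 := a.2; have h2 := b.2
      simp only [pow_zero, one_smul] at h1 h2
      exact Subtype.ext (h1.trans h2.symm)⟩
    infer_instance
  | succ n ih =>
    have := finV B
    let f : {y : A // 2 ^ (n+1) • y = 0} → {y : A // 2 ^ n • y = 0} := fun y => ⟨2 • y.1, by rw [smul_smul, ← pow_succ, y.2]⟩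
    suffices hs : ∀ z, Finite (f ⁻¹' {z}) by
      by_contra hc
      rw [not_finite_iff_infinite] at hc
      obtain ⟨z, hz⟩ := Finite.exists_infinite_fiber f
      exact hz.not_finite (hs z)
    intro z
    by_cases hz : ∃ y, f y = z
    · obtain ⟨y, hy⟩ := hz
      refine Finite.of_injective (β := V A) (fun x => ⟨x.1.1 - y.1, ?_⟩) ?_
      · rw [mem_V, smul_sub, sub_eq_zero]
        exact congrArg Subtype.val ((x.2 : f x.1 = z).trans hy.symm)
      · intro a b h
        have := congrArg Subtype.val h
        exact Subtype.ext (Subtype.ext (sub_left_injective this))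
    · have : IsEmpty (f ⁻¹' {z}) := ⟨fun x => hz ⟨x.1, x.2⟩⟩
      infer_instance

omit B in
lemma card_range_ker {H H' : Type*} [AddGroup H] [AddGroup H'] (f : H →+ H') : Nat.card H = Nat.card f.range * Nat.card f.ker := by
  rw [AddSubgroup.card_eq_card_quotient_mul_card_addSubgroup f.ker, Nat.card_congr (QuotientAddGroup.quotientKerEquivRange f).toEquiv]

lemma card_KU (n : ℕ) (hn : n < N) (g : G) : Nat.card (K (A := A) n g) * Nat.card (U (A := A) n g) = 4 := by
  -- fixed torsion
  let Fx : ℕ → AddSubgroup A := fun k =>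
    { carrier := {y | 2 ^ k • y = 0 ∧ g • y = y}
      zero_mem' := by simp
      add_mem' := by rintro a b ⟨h1, h2⟩ ⟨h3, h4⟩; exact ⟨by rw [smul_add, h1, h3, add_zero], by rw [smul_add, h2, h4]⟩
      neg_mem' := by rintro a ⟨h1, h2⟩; exact ⟨by rw [smul_neg, h1, neg_zero], by rw [smul_neg, h2]⟩ }
  have hFx : ∀ k (y : A), y ∈ Fx k ↔ 2 ^ k • y = 0 ∧ g • y = y := fun _ _ => Iff.rfl
  let T : AddSubgroup A :=
    { carrier := {y | 2 ^ (n+1) • y = 0 ∧ g • (2 • y) = 2 • y}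
      zero_mem' := by simp
      add_mem' := by rintro a b ⟨h1, h2⟩ ⟨h3, h4⟩; exact ⟨by rw [smul_add, h1, h3, add_zero], by rw [smul_add, smul_add, h2, h4]⟩
      neg_mem' := by rintro a ⟨h1, h2⟩; exact ⟨by rw [smul_neg, h1, neg_zero], by rw [smul_neg, smul_neg, h2]⟩ }
  have hT : ∀ (y : A), y ∈ T ↔ 2 ^ (n+1) • y = 0 ∧ g • (2 • y) = 2 • y := fun _ => Iff.rfl
  let f1 : T →+ A := (AddMonoidHom.mk' (fun y : A => g • y - y) (by intro a b; simp only [smul_add]; abel)).comp T.subtype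
  have hf1 : ∀ y, f1 y = g • y.1 - y.1 := fun _ => rfl
  let f2 : T →+ A := (AddMonoidHom.mk' (fun y : A => 2 • y) (by intro a b; rw [smul_add])).comp T.subtype
  have hf2 : ∀ y, f2 y = 2 • y.1 := fun _ => rfl
  let f3 : Fx (n+1) →+ A := (AddMonoidHom.mk' (fun y : A => 2^n • y) (by intro a b; rw [smul_add])).comp (Fx (n+1)).subtype
  have hf3 : ∀ y, f3 y = 2^n • y.1 := fun _ => rfl
  have e1 := card_range_ker f1
  have e2 := card_range_ker f2
  have e3 := card_range_ker f3
  have r1 : f1.range = K n g := by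
    ext v
    rw [AddMonoidHom.mem_range, mem_K]
    constructor
    · rintro ⟨y, rfl⟩
      have := (hT y).1 y.2
      exact ⟨by rw [hf1, smul_sub, ← smul_nsmul, this.2, sub_self], y, this.1, rfl⟩
    · rintro ⟨h, y, hy, e⟩
      refine ⟨⟨y, (hT y).2 ⟨hy, ?_⟩⟩, e⟩
      rw [← e, smul_sub, sub_eq_zero] at h
      rw [smul_nsmul, h]
  have r2 : f2.range = Fx n := by
    ext v
    rw [AddMonoidHom.mem_range, hFx]
    constructor
    · rintro ⟨y, rfl⟩
      have := (hT y).1 y.2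
      exact ⟨by rw [hf2, smul_smul, ← pow_succ, this.1], this.2⟩
    · rintro ⟨h1, h2⟩
      obtain ⟨y, rfl⟩ := B.half n hn v (Or.inl h1)
      exact ⟨⟨y, (hT y).2 ⟨by rw [pow_succ, mul_smul, h1], h2⟩⟩, rfl⟩
  have r3 : f3.range = U n g := by
    ext v
    rw [AddMonoidHom.mem_range, mem_U]
    constructor
    · rintro ⟨y, rfl⟩
      have := (hFx _ y).1 y.2
      exact ⟨by rw [hf3, smul_smul, ← pow_succ', this.1], y, this.2, rfl⟩
    · rintro ⟨h, y, hy, rfl⟩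
      exact ⟨⟨y, (hFx _ y).2 ⟨by rw [pow_succ', mul_smul, h], hy⟩⟩, rfl⟩
  have k1 : Nat.card f1.ker = Nat.card (Fx (n+1)) := by
    refine Nat.card_congr ⟨fun y => ⟨y.1.1, (hFx _ _).2 ⟨((hT _).1 y.1.2).1, sub_eq_zero.1 y.2⟩⟩, fun y => ⟨⟨y.1, (hT _).2 ⟨((hFx _ _).1 y.2).1, ?_⟩⟩, ?_⟩, fun _ => rfl, fun _ => rfl⟩
    · rw [smul_nsmul, ((hFx _ _).1 y.2).2]
    · exact sub_eq_zero.2 ((hFx _ _).1 y.2).2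
  have k2 : Nat.card f2.ker = 4 := by
    rw [← B.cardV]
    refine Nat.card_congr ⟨fun y => ⟨y.1.1, y.2⟩, fun y => ⟨⟨y.1, (hT _).2 ⟨?_, ?_⟩⟩, y.2⟩, fun _ => rfl, fun _ => rfl⟩
    · rw [pow_succ, mul_smul, mem_V.1 y.2, smul_zero]
    · rw [mem_V.1 y.2, smul_zero]
  have k3 : Nat.card f3.ker = Nat.card (Fx n) := by
    refine Nat.card_congr ⟨fun y => ⟨y.1.1, (hFx _ _).2 ⟨y.2, ((hFx _ _).1 y.1.2).2⟩⟩, fun y => ⟨⟨y.1, (hFx _ _).2 ⟨?_, ((hFx _ _).1 y.2).2⟩⟩, ((hFx _ _).1 y.2).1⟩, fun _ => rfl, fun _ => rfl⟩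
    rw [pow_succ', mul_smul, ((hFx _ _).1 y.2).1, smul_zero]
  have hfin : Nat.card (Fx n) ≠ 0 := by
    have := fin_tors B n
    have : Finite (Fx n) := Finite.of_injective (β := {y : A // 2 ^ n • y = 0}) (fun y => ⟨y.1, ((hFx _ _).1 y.2).1⟩) (fun a b h => Subtype.ext (by simpa using h))
    exact Nat.card_pos.ne'
  rw [r1, k1, e3, r3, k3] at e1
  rw [r2, k2] at e2
  have : (Nat.card (K (A := A) n g) * Nat.card (U (A := A) n g)) * Nat.card (Fx n) = 4 * Nat.card (Fx n) := by
    rw [mul_assoc, ← e1, e2, mul_comm]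
  exact Nat.eq_of_mul_eq_mul_right (Nat.pos_of_ne_zero hfin) this

omit B in
lemma card_one_iff {H : AddSubgroup A} : Nat.card H = 1 ↔ H = ⊥ := by
  rw [AddSubgroup.card_eq_one]

lemma eqV_of_card {H : AddSubgroup A} (hH : H ≤ V A) (h : Nat.card H = 4) : H = V A := by
  have := finV B
  refine SetLike.coe_injective (Set.eq_of_subset_of_ncard_le hH ?_ (Set.toFinite (V A : Set A)))
  have h1 : (H : Set A).ncard = 4 := h
  have h2 : (V A : Set A).ncard = 4 := B.cardV
  omega

lemma eq_of_card {H H' : AddSubgroup A} (hH : H ≤ H') (hV : H' ≤ V A) (h : Nat.card H = Nat.card H') : H = H' := by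
  have := finV B
  have h3 : (H' : Set A).Finite := (Set.toFinite (V A : Set A)).subset hV
  refine SetLike.coe_injective (Set.eq_of_subset_of_ncard_le hH ?_ h3)
  have h1 : (H : Set A).ncard = Nat.card H := rfl
  have h2 : (H' : Set A).ncard = Nat.card H' := rfl
  omega

lemma cardU_cases (n : ℕ) (hn : n < N) (g : G) : Nat.card (U (A := A) n g) = 1 ∨ Nat.card (U (A := A) n g) = 2 ∨ Nat.card (U (A := A) n g) = 4 := by
  have h := card_KU B n hn g
  have h1 : Nat.card (U (A := A) n g) ∣ 4 := ⟨_, by rw [mul_comm]; exact h.symm⟩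
  have h2 := Nat.le_of_dvd (by norm_num) h1
  generalize Nat.card (U (A := A) n g) = x at *
  interval_cases x <;> simp_all

omit B in
/-- aliveness criterion -/
lemma alive_succ_iff {n : ℕ} {h : G} {q q' : A} (hq' : 2 • q' = q) (hq : 2 ^ (n+1) • q = R) (hf : h • q = q) :
    Al R (n+1) h ↔ h • q' - q' ∈ K (n+1) h := by
  constructor
  · rintro ⟨w, hw, e⟩
    refine ⟨by rw [smul_sub, ← smul_nsmul, hq', hf, sub_self], q' - w, ?_, ?_⟩
    · rw [smul_sub, hw, pow_succ, mul_smul, hq', hq, sub_self]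
    · rw [smul_sub, e]; abel
  · rintro ⟨-, y, hy, e⟩
    refine ⟨q' - y, ?_, ?_⟩
    · rw [smul_sub, hy, pow_succ, mul_smul, hq', hq, sub_zero]
    · have e' : h • q' = h • y - y + q' := by rw [e]; abel
      rw [smul_sub, e']; abel

lemma halfX {n : ℕ} (hn : n + 1 < N) {q : A} (hq : 2 ^ (n+1) • q = R) : ∃ q', 2 • q' = q := B.half (n+1) hn q (Or.inr hq)

lemma caseS {n : ℕ} (hn : n + 1 < N) {h : G} (ha : Al R n h) (hU : Nat.card (U (A := A) n h) = 1) :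
    Al R (n+1) h ∧ Nat.card (U (A := A) (n+1) h) = 1 := by
  have h1 : U (A := A) n h = ⊥ := card_one_iff.1 hU
  refine ⟨?_, ?_⟩
  · obtain ⟨q, hq, hf⟩ := ha
    obtain ⟨q', hq'⟩ := halfX B hn hq
    rw [alive_succ_iff hq' hq hf]
    apply K_le_succ
    rw [eqV_of_card B K_le_V (by have := card_KU B n (by omega) h; rwa [hU, mul_one] at this), mem_V, smul_sub, ← smul_nsmul, hq', hf, sub_self]
  · rw [card_one_iff, eq_bot_iff, ← h1]
    exact U_succ_le

lemma caseC1 {n : ℕ} (hn : n + 1 < N) {h : G} {q z' : A} (hq : 2 ^ (n+1) • q = R) (hf : h • q = q)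
    (hU : Nat.card (U (A := A) n h) = 2) (hz : h • (2 • z') = 2 • z') (hz1 : 2 ^ (n+1) • z' ≠ 0) (hz2 : 2 ^ (n+2) • z' = 0)
    (hv : h • z' - z' ∉ K n h) : Al R (n+1) h ∧ Nat.card (U (A := A) (n+1) h) = 1 := by
  have hUe : ∀ v ∈ U n h, v = 0 ∨ v = 2 ^ (n+1) • z' := by
    have he : 2 ^ (n+1) • z' ∈ U n h := ⟨by rw [smul_smul, ← pow_succ', hz2], 2 • z', hz, by rw [smul_smul, pow_succ]⟩
    intro v hv
    by_contra! hc
    have h3 : ({0, 2 ^ (n+1) • z', v} : Set A).ncard = 3 := by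
      rw [Set.ncard_eq_three]; exact ⟨_, _, _, hz1.symm, hc.1.symm, hc.2.symm, rfl⟩
    have hs : ({0, 2 ^ (n+1) • z', v} : Set A) ⊆ ((U n h : AddSubgroup A) : Set A) := by
      rintro x (rfl | rfl | rfl)
      exacts [zero_mem _, he, hv]
    have hfin0 : Finite (U (A := A) n h) := Nat.finite_of_card_ne_zero (by rw [hU]; norm_num)
    have hfin : ((U n h : AddSubgroup A) : Set A).Finite := Set.toFinite _
    have := Set.ncard_le_ncard hs hfin
    have h4 : ((U n h : AddSubgroup A) : Set A).ncard = 2 := hU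
    omega
  have hU1 : U (A := A) (n+1) h = ⊥ := by
    rw [eq_bot_iff]
    rintro v hv'
    rcases hUe v (U_succ_le hv') with rfl | rfl
    · exact zero_mem _
    · exfalso
      obtain ⟨-, y, hy, e⟩ := hv'
      refine hv ⟨by rw [smul_sub, ← smul_nsmul, hz, sub_self], z' - y, by rw [smul_sub, e, sub_self], ?_⟩
      rw [smul_sub, hy]; abel
  have hc := card_one_iff.2 hU1
  refine ⟨?_, hc⟩
  obtain ⟨q', hq'⟩ := halfX B hn hq
  rw [alive_succ_iff hq' hq hf]
  rw [eqV_of_card B K_le_V (by have := card_KU B (n+1) (by omega) h; rwa [hc, mul_one] at this), mem_V, smul_sub, ← smul_nsmul, hq', hf, sub_self]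

lemma caseC2 {n : ℕ} (hn : n + 1 < N) {h : G} {q q' z' : A} (hq' : 2 • q' = q) (hq : 2 ^ (n+1) • q = R) (hf : h • q = q)
    (hU : Nat.card (U (A := A) n h) = 2) (hz1 : 2 ^ (n+1) • z' ≠ 0) (hz2 : 2 ^ (n+2) • z' = 0)
    (hv : h • z' - z' ∈ K n h) : (Al R (n+1) h ↔ h • q' - q' ∈ K n h) ∧ Nat.card (U (A := A) (n+1) h) = 2 := by
  have hc : Nat.card (U (A := A) (n+1) h) = 2 := by
    have he : 2 ^ (n+1) • z' ∈ U (n+1) h := by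
      obtain ⟨-, y, hy, e⟩ := hv
      refine ⟨by rw [smul_smul, ← pow_succ', hz2], z' - y, ?_, by rw [smul_sub, hy, sub_zero]⟩
      have e' : h • z' = h • y - y + z' := by rw [e]; abel
      rw [smul_sub, e']; abel
    have hfin : Finite (U (A := A) n h) := Nat.finite_of_card_ne_zero (by rw [hU]; norm_num)
    have hle : Nat.card (U (A := A) (n+1) h) ≤ 2 := by rw [← hU]; exact Set.ncard_le_ncard U_succ_le (Set.toFinite (U (A := A) n h : Set A))
    have h1 : Nat.card (U (A := A) (n+1) h) ≠ 1 := by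
      rw [Ne, card_one_iff]
      intro h0
      rw [h0, AddSubgroup.mem_bot] at he
      exact hz1 he
    rcases cardU_cases B (n+1) (by omega) h with h2 | h2 | h2 <;> omega
  refine ⟨?_, hc⟩
  rw [alive_succ_iff hq' hq hf]
  have h1 := card_KU B n (by omega) h
  have h2 := card_KU B (n+1) (by omega) h
  rw [eq_of_card B (K_le_succ (n := n) (g := h)) K_le_V (by rw [hU] at h1; rw [hc] at h2; omega)]
end base
end EchoG
end

section
open scoped Classical
namespace EchoG
variable {G A : Type} [Group G] [AddCommGroup A] [DistribMulAction G A]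

def Pair (G : Type) [Group G] {A : Type} [AddCommGroup A] [DistribMulAction G A] (R : A) (n : ℕ) : Prop :=
  ∀ z q : A, 2 ^ (n+1) • z ≠ 0 → 2 ^ (n+2) • z = 0 → 2 ^ (n+2) • q = R → ∀ v ∈ V A, ∀ u ∈ V A,
    ∃ γ ∈ Γ G R n, γ • z - z = v ∧ γ • q - q = u

def Trip (G : Type) [Group G] {A : Type} [AddCommGroup A] [DistribMulAction G A] (R : A) (n : ℕ) : Prop :=
  ∀ z w q : A, 2 ^ (n+1) • z ≠ 0 → 2 ^ (n+2) • z = 0 → 2 ^ (n+1) • w ≠ 0 → 2 ^ (n+2) • w = 0 →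
    2 ^ (n+1) • z ≠ 2 ^ (n+1) • w → 2 ^ (n+2) • q = R → ∀ v ∈ V A, ∀ v' ∈ V A, ∀ u ∈ V A,
    ∃ γ ∈ Γ G R n, γ • z - z = v ∧ γ • w - w = v' ∧ γ • q - q = u

noncomputable def Φ (R : A) (wt : ℕ → ℝ) (n : ℕ) (g : G) : ℝ := if Al R n g then wt (Nat.card (U (A := A) n g)) else 0

section base
variable {R : A} {N : ℕ} (B : Base G R N)

lemma Al_mul {n : ℕ} {g γ : G} (hγ : γ ∈ Γ G R n) : Al R n (g * γ) ↔ Al R n g := by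
  refine exists_congr fun q => and_congr_right fun hq => ?_
  rw [mul_smul, hγ q hq]

include B
lemma U_mul {n : ℕ} (hn : n < N) {g γ : G} (hγ : γ ∈ Γ G R n) : U (A := A) n (g * γ) = U n g := by
  ext v
  refine and_congr_right fun hv => exists_congr fun y => ?_
  rw [and_congr_left_iff]
  intro hy
  rw [mul_smul, fix_tors B hn hγ (by rw [pow_succ', mul_smul, hy, hv])]

lemma K_mul {n : ℕ} (hn : n < N) {g γ : G} (hγ : γ ∈ Γ G R n) : K (A := A) n (g * γ) = K n g := by
  ext v
  refine and_congr_right fun hv => exists_congr fun y => and_congr_right fun hy => ?_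
  rw [mul_smul, fix_tors B hn hγ hy]

omit B in
lemma dead_succ (wt : ℕ → ℝ) {n : ℕ} {g : G} (h : ¬ Al R n g) : Φ R wt (n+1) g = 0 := by
  rw [Φ, if_neg fun h1 => h (Al_of_succ h1)]

/-- difference lies in V -/
lemma diff_mem {n : ℕ} (hn : n < N) {γ : G} (hγ : γ ∈ Γ G R n) {q : A} (hq : 2 ^ (n+2) • q = R ∨ 2 ^ (n+2) • q = 0) : γ • q - q ∈ V A := by
  rw [mem_V, smul_sub, ← smul_nsmul, sub_eq_zero]
  rcases hq with hq | hq
  · exact hγ _ (by rw [smul_smul, ← pow_succ, hq])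
  · exact fix_tors B hn hγ (by rw [smul_smul, ← pow_succ, hq])

lemma V_fix {n : ℕ} (hn : n < N) {γ : G} (hγ : γ ∈ Γ G R n) {v : A} (hv : v ∈ V A) : γ • v = v :=
  fix_tors B hn hγ (by rw [pow_succ, mul_smul, mem_V.1 hv, smul_zero])

lemma diff_mul {n : ℕ} (hn : n < N) {γ γ' : G} (hγ : γ ∈ Γ G R n) (hγ' : γ' ∈ Γ G R n) {q : A} (hq : 2 ^ (n+2) • q = R ∨ 2 ^ (n+2) • q = 0) :
    (γ * γ') • q - q = (γ • q - q) + (γ' • q - q) := by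
  have h := V_fix B hn hγ (diff_mem B hn hγ' hq)
  rw [smul_sub] at h
  rw [mul_smul, ← h]; abel

omit B in
lemma card_eq_sum [Fintype (V A)] (H : AddSubgroup A) (hH : H ≤ V A) : ∑ v : V A, (if (v : A) ∈ H then (1:ℝ) else 0) = Nat.card H := by
  rw [Finset.sum_ite, Finset.sum_const_zero, add_zero, Finset.sum_const, nsmul_eq_mul, mul_one, ← Fintype.card_subtype, ← Nat.card_eq_fintype_card]
  congr 1
  exact Nat.card_congr ⟨fun x => ⟨x.1.1, x.2⟩, fun x => ⟨⟨x.1, hH x.2⟩, x.2⟩, fun _ => rfl, fun _ => rfl⟩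

omit B in
def affV (g : G) (c : V A) : V A ≃ V A where
  toFun x := c + ⟨g • (x : A), smul_mem_V g x.2⟩
  invFun x := ⟨g⁻¹ • ((x : A) - c), smul_mem_V g⁻¹ (sub_mem x.2 c.2)⟩
  left_inv x := by ext; simp
  right_inv x := by ext; simp

lemma sumC [Fintype G] (wt : ℕ → ℝ) {n : ℕ} (hn : n + 1 < N) (hP : Pair G R n) {g : G} (ha : Al R n g) (hU : Nat.card (U (A := A) n g) = 2) :
    ∑ γ : Γ G R n, Φ R wt (n+1) (g * γ) = Fintype.card (Γ G R n) * (wt 1 / 2 + wt 2 / 4) := by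
  have _ := finV B
  let _ : Fintype (V A) := Fintype.ofFinite _
  obtain ⟨q, hq, hf⟩ := ha
  obtain ⟨q', hq'⟩ := halfX B hn hq
  have hex : ∃ v ∈ U (A := A) n g, v ≠ 0 := by
    by_contra! h
    have : U (A := A) n g = ⊥ := by rw [eq_bot_iff]; intro v hv; exact AddSubgroup.mem_bot.2 (h v hv)
    rw [card_one_iff.2 this] at hU; omega
  obtain ⟨v0, ⟨hv0, z, hz, hzv⟩, hne⟩ := hex
  have hz0 : 2 ^ (n+1) • z = 0 := by rw [pow_succ', mul_smul, hzv, hv0]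
  obtain ⟨z', hz'⟩ := B.half (n+1) hn z (Or.inl hz0)
  have hz1 : 2 ^ (n+1) • z' ≠ 0 := by rw [pow_succ, mul_smul, hz', hzv]; exact hne
  have hz2 : 2 ^ (n+2) • z' = 0 := by rw [pow_succ, mul_smul, hz', hz0]
  have hq2 : 2 ^ (n+2) • q' = R := by rw [pow_succ, mul_smul, hq', hq]
  let δ : Γ G R n → V A × V A := fun γ => (⟨γ.1 • z' - z', diff_mem B (by omega) γ.2 (Or.inr hz2)⟩, ⟨γ.1 • q' - q', diff_mem B (by omega) γ.2 (Or.inl hq2)⟩)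
  have hδ : ∀ a b, δ (a * b) = δ a + δ b := by
    intro a b
    ext
    · exact diff_mul B (by omega) a.2 b.2 (Or.inr hz2)
    · exact diff_mul B (by omega) a.2 b.2 (Or.inl hq2)
  have hsu : Function.Surjective δ := by
    rintro ⟨⟨v, hv⟩, ⟨u, hu⟩⟩
    obtain ⟨γ, hγ, h1, h2⟩ := hP z' q' hz1 hz2 hq2 v hv u hu
    refine ⟨⟨γ, hγ⟩, ?_⟩
    ext
    · exact h1
    · exact h2
  let c1 : V A := ⟨g • z' - z', by rw [mem_V, smul_sub, ← smul_nsmul, hz', hz, sub_self]⟩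
  let c2 : V A := ⟨g • q' - q', by rw [mem_V, smul_sub, ← smul_nsmul, hq', hf, sub_self]⟩
  let χ : V A → ℝ := fun v => if (v : A) ∈ K (A := A) n g then 1 else 0
  let W : V A × V A → ℝ := fun m => wt 1 * (1 - χ m.1) + wt 2 * (χ m.1 * χ m.2)
  have hΦ : ∀ γ : Γ G R n, Φ R wt (n+1) (g * γ) = W (affV g c1 (δ γ).1, affV g c2 (δ γ).2) := by
    intro γ
    have e1 : ((affV g c1 (δ γ).1 : V A) : A) = (g * γ.1) • z' - z' := by
      show (g • z' - z') + g • (γ.1 • z' - z') = _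
      rw [smul_sub, mul_smul]; abel
    have e2 : ((affV g c2 (δ γ).2 : V A) : A) = (g * γ.1) • q' - q' := by
      show (g • q' - q') + g • (γ.1 • q' - q') = _
      rw [smul_sub, mul_smul]; abel
    have hf' : (g * γ.1) • q = q := by rw [mul_smul, γ.2 q hq, hf]
    have hU' : Nat.card (U (A := A) n (g * γ.1)) = 2 := by rw [U_mul B (by omega) γ.2, hU]
    have hK' := K_mul B (show n < N by omega) (g := g) γ.2
    have hzz : (g * γ.1) • (2 • z') = 2 • z' := by
      rw [hz', mul_smul, fix_tors B (by omega) γ.2 hz0, hz]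
    simp only [W, χ, e1, e2]
    by_cases h1 : (g * γ.1) • z' - z' ∈ K (A := A) n g
    · obtain ⟨h2, h3⟩ := caseC2 B hn hq' hq hf' hU' hz1 hz2 (by rw [hK']; exact h1)
      rw [hK'] at h2
      simp only [Φ, h2, h3, h1, if_true]
      split_ifs <;> simp
    · obtain ⟨h2, h3⟩ := caseC1 B hn hq hf' hU' hzz hz1 hz2 (by rw [hK']; exact h1)
      simp [Φ, h2, h3, h1]
  have h1 := sum_hom δ hδ hsu (fun m => W (affV g c1 m.1, affV g c2 m.2))
  have h2 : ∑ m : V A × V A, W (affV g c1 m.1, affV g c2 m.2) = ∑ m, W m :=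
    Equiv.sum_comp ((affV g c1).prodCongr (affV g c2)) W
  have hχ : ∑ v, χ v = 2 := by
    rw [card_eq_sum _ K_le_V]
    have := card_KU B n (by omega) g
    rw [hU] at this
    exact_mod_cast (show Nat.card (K (A := A) n g) = 2 by omega)
  have hc : Fintype.card (V A) = 4 := by rw [← Nat.card_eq_fintype_card, B.cardV]
  have h3 : ∑ m, W m = 8 * wt 1 + 4 * wt 2 := by
    simp only [W]
    rw [Finset.sum_add_distrib, ← Finset.mul_sum, ← Finset.mul_sum, Finset.sum_sub_distrib, Fintype.sum_prod_type, Fintype.sum_prod_type, Fintype.sum_prod_type]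
    simp only [Finset.sum_const, Finset.card_univ, hc, ← Finset.mul_sum, hχ, nsmul_eq_mul, ← Finset.sum_mul]
    norm_num; ring
  rw [h2, h3, Fintype.card_prod, hc] at h1
  rw [Finset.sum_congr rfl fun γ _ => hΦ γ]
  push_cast at h1
  linarith

lemma mem_Γ_of_I {n : ℕ} (hn : n < N) {g : G} (ha : Al R n g) (hU : Nat.card (U (A := A) n g) = 4) : g ∈ Γ G R n := by
  have hV := eqV_of_card B U_le_V hU
  have key : ∀ k, k ≤ n + 1 → ∀ y : A, 2 ^ k • y = 0 → g • y = y := by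
    intro k
    induction k with
    | zero => intro _ y hy; rw [pow_zero, one_smul] at hy; rw [hy, smul_zero]
    | succ k ih =>
      intro hk y hy
      have h1 : 2 ^ k • y ∈ V A := by rw [mem_V, smul_smul, ← pow_succ', hy]
      rw [← hV] at h1
      obtain ⟨-, w, hw, e⟩ := h1
      have h2 : 2 ^ k • (y - 2 ^ (n - k) • w) = 0 := by
        rw [smul_sub, smul_smul, ← pow_add, show k + (n - k) = n by omega, e, sub_self]
      have h3 := ih (by omega) _ h2
      rw [smul_sub, smul_nsmul, hw] at h3
      exact sub_left_injective h3
  obtain ⟨q, hq, hf⟩ := ha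
  intro q1 hq1
  have := key (n+1) le_rfl (q1 - q) (by rw [smul_sub, hq, hq1, sub_self])
  rw [smul_sub, hf] at this
  exact sub_left_injective this

omit B in
lemma sum_shift [Fintype G] {n : ℕ} {g : G} (hg : g ∈ Γ G R n) (F : G → ℝ) : ∑ γ : Γ G R n, F (g * γ) = ∑ γ : Γ G R n, F γ := by
  exact Equiv.sum_comp (Equiv.mulLeft (⟨g, hg⟩ : Γ G R n)) (fun γ => F γ)

lemma exTors {n : ℕ} (hn : n < N) {v : A} (hv : v ∈ V A) : ∃ z, 2 ^ n • z = v := by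
  induction n with
  | zero => exact ⟨v, by simp⟩
  | succ n ih =>
    obtain ⟨z, hz⟩ := ih (by omega)
    obtain ⟨z', hz'⟩ := B.half (n+1) hn z (Or.inl (by rw [pow_succ', mul_smul, hz, mem_V.1 hv]))
    exact ⟨z', by rw [pow_succ, mul_smul, hz', hz]⟩

lemma exV : ∃ T ∈ V A, ∃ T' ∈ V A, T ≠ 0 ∧ T' ≠ 0 ∧ T ≠ T' := by
  have _ := finV B
  let _ : Fintype (V A) := Fintype.ofFinite _
  have hc : Fintype.card (V A) = 4 := by rw [← Nat.card_eq_fintype_card, B.cardV]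
  obtain ⟨a, b, c, h1, h2, h3⟩ := Fintype.two_lt_card_iff.1 (show 2 < Fintype.card (V A) by omega)
  have e : ∀ x y : V A, x ≠ y → (x : A) ≠ y := fun x y h h' => h (Subtype.ext h')
  refine ⟨a - c, sub_mem a.2 c.2, b - c, sub_mem b.2 c.2, sub_ne_zero.2 (e _ _ h2), sub_ne_zero.2 (e _ _ h3), fun h => e _ _ h1 (sub_left_injective h)⟩

omit B in
lemma cnt16 (wt : ℕ → ℝ) [Fintype (V A)] (hc : Fintype.card (V A) = 4) : ∑ m : V A × V A, (if m.1 ≠ 0 then wt 1 else if m.2 = 0 then wt 4 else 0) = 12 * wt 1 + wt 4 := by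
  rw [Fintype.sum_prod_type]
  have : ∀ x : V A, ∑ y : V A, (if x ≠ 0 then wt 1 else if y = 0 then wt 4 else 0) = 4 * wt 1 + (if x = 0 then wt 4 - 4 * wt 1 else 0) := by
    intro x
    by_cases hx : x = 0 <;> simp [hx, hc]
  simp only [this, Finset.sum_add_distrib, Finset.sum_const, Finset.card_univ, hc, Finset.sum_ite_eq', Finset.mem_univ, if_true]
  norm_num; ring

/-- transition at the bottom level for the identity state -/
lemma sumI0 [Fintype G] (wt : ℕ → ℝ) (hn : 1 < N) (hP : Pair G R 0)
    (hF : ∀ γ ∈ Γ G R 0, ∀ z w : A, 4 • z = 0 → 2 • z ≠ 0 → 4 • w = 0 → γ • z = z → γ • w = w)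
    {g : G} (ha : Al R 0 g) (hU : Nat.card (U (A := A) 0 g) = 4) :
    ∑ γ : Γ G R 0, Φ R wt 1 (g * γ) = Fintype.card (Γ G R 0) * ((12 * wt 1 + wt 4) / 16) := by
  have _ := finV B
  let _ : Fintype (V A) := Fintype.ofFinite _
  have hc : Fintype.card (V A) = 4 := by rw [← Nat.card_eq_fintype_card, B.cardV]
  rw [sum_shift (mem_Γ_of_I B (by omega) ha hU) (Φ R wt 1)]
  obtain ⟨T, hT, -, -, hT0, -, -⟩ := exV B
  obtain ⟨z, hz⟩ := exTors B hn hT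
  obtain ⟨q, hq⟩ := exX B 1 hn
  have hz1 : 2 ^ (0+1) • z ≠ 0 := by rw [show 0 + 1 = 1 by rfl, hz]; exact hT0
  have hz1' : 2 • z ≠ 0 := by simpa using hz1
  have hz2 : 2 ^ (0+2) • z = 0 := by
    rw [show 0 + 2 = 1 + 1 by rfl, pow_succ', mul_smul, hz, mem_V.1 hT]
  have hz2' : 4 • z = 0 := by simpa using hz2
  have hq2 : 2 ^ (0+2) • q = R := hq
  let δ : Γ G R 0 → V A × V A := fun γ => (⟨γ.1 • z - z, diff_mem B (by omega) γ.2 (Or.inr hz2)⟩, ⟨γ.1 • q - q, diff_mem B (by omega) γ.2 (Or.inl hq2)⟩)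
  have hδ : ∀ a b, δ (a * b) = δ a + δ b := by
    intro a b
    ext
    · exact diff_mul B (by omega) a.2 b.2 (Or.inr hz2)
    · exact diff_mul B (by omega) a.2 b.2 (Or.inl hq2)
  have hsu : Function.Surjective δ := by
    rintro ⟨⟨v, hv⟩, ⟨u, hu⟩⟩
    obtain ⟨γ, hγ, h1, h2⟩ := hP z q hz1 hz2 hq2 v hv u hu
    refine ⟨⟨γ, hγ⟩, ?_⟩
    ext
    · exact h1
    · exact h2
  have h1 := sum_hom δ hδ hsu (fun m => if m.1 ≠ 0 then wt 1 else if m.2 = 0 then wt 4 else 0)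
  rw [cnt16 wt hc, Fintype.card_prod, hc] at h1
  have hΦ : ∀ γ : Γ G R 0, Φ R wt 1 γ.1 = (fun m : V A × V A => if m.1 ≠ 0 then wt 1 else if m.2 = 0 then wt 4 else 0) (δ γ) := by
    intro γ
    have e1 : (δ γ).1 = 0 ↔ γ.1 • z = z := by
      rw [← sub_eq_zero (a := γ.1 • z)]
      exact ⟨fun h => congrArg Subtype.val h, fun h => Subtype.ext h⟩
    have e2 : (δ γ).2 = 0 ↔ γ.1 • q = q := by
      rw [← sub_eq_zero (a := γ.1 • q)]
      exact ⟨fun h => congrArg Subtype.val h, fun h => Subtype.ext h⟩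
    simp only [ne_eq, e1, e2]
    have hq2' : 2 ^ (0+1) • (2 • q) = R := by rw [smul_smul]; exact hq
    have hal := alive_succ_iff (n := 0) (h := γ.1) (q := 2 • q) (q' := q) rfl hq2' (γ.2 _ hq2')
    by_cases hzz : γ.1 • z = z
    · have hall : ∀ w : A, 4 • w = 0 → γ.1 • w = w := fun w hw => hF γ.1 γ.2 z w hz2' hz1' hw hzz
      have hU1 : U (A := A) 1 γ.1 = V A := by
        refine le_antisymm U_le_V fun v hv => ?_
        obtain ⟨y, hy⟩ := exTors B hn hv
        exact ⟨hv, y, hall y (by rw [show 4 = 2 * 2 ^ 1 by rfl, mul_smul, hy, mem_V.1 hv]), hy⟩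
      have hA : Al R 1 γ.1 ↔ γ.1 • q = q := by
        rw [hal]
        constructor
        · rintro ⟨-, y, hy, e⟩
          rw [hall y (by simpa using hy), sub_self] at e
          exact sub_eq_zero.1 e.symm
        · intro h; rw [h, sub_self]; exact zero_mem _
      simp only [Φ, hA, hU1, B.cardV, hzz, not_true, if_false]
    · have hU1 : U (A := A) 1 γ.1 = ⊥ := by
        rw [eq_bot_iff]
        rintro v ⟨hv, y, hy, e⟩
        rw [AddSubgroup.mem_bot]
        by_contra hne
        exact hzz (hF γ.1 γ.2 y z (by rw [show 4 = 2 * 2 ^ 1 by rfl, mul_smul, e, hv]) (by rw [pow_one] at e; rw [e]; exact hne) hz2' hy)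
      have hc1 := card_one_iff.2 hU1
      have hA : Al R 1 γ.1 := by
        rw [hal, eqV_of_card B K_le_V (by have := card_KU B 1 hn γ.1; rwa [hc1, mul_one] at this)]
        exact diff_mem B (by omega) γ.2 (Or.inl hq2)
      simp [Φ, hA, hc1, hzz]
  rw [Finset.sum_congr rfl fun γ _ => hΦ γ]
  push_cast at h1
  linarith
end base
end EchoG
end

section
open scoped Classical
namespace EchoG
variable {G A : Type} [Group G] [AddCommGroup A] [DistribMulAction G A]

abbrev E := ZMod 2 × ZMod 2

def alE (m : E × E × E) : Prop := ∃ i : E, m.1 + i.1.val • m.2.1 + i.2.val • m.2.2 = 0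
instance (m) : Decidable (alE m) := by unfold alE; infer_instance
def cE (m : E × E × E) : ℕ := (Finset.univ.filter (fun i : E => i.1.val • m.2.1 + i.2.val • m.2.2 = 0)).card

lemma cE_counts : (Finset.univ.filter (fun m : E × E × E => alE m ∧ cE m = 1)).card = 24 ∧
   (Finset.univ.filter (fun m : E × E × E => alE m ∧ cE m = 2)).card = 18 ∧
   (Finset.univ.filter (fun m : E × E × E => alE m ∧ cE m = 4)).card = 1 ∧ ∀ m : E × E × E, cE m = 1 ∨ cE m = 2 ∨ cE m = 4 := by
  refine ⟨?_, ?_, ?_, ?_⟩ <;> decide +kernel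

lemma cE_sum (wt : ℕ → ℝ) : ∑ m : E × E × E, (if alE m then wt (cE m) else 0) = 24 * wt 1 + 18 * wt 2 + wt 4 := by
  obtain ⟨h1, h2, h3, h4⟩ := cE_counts
  have : ∀ m : E × E × E, (if alE m then wt (cE m) else 0) = (if alE m ∧ cE m = 1 then wt 1 else 0) + (if alE m ∧ cE m = 2 then wt 2 else 0) + (if alE m ∧ cE m = 4 then wt 4 else 0) := by
    intro m
    rcases h4 m with h | h | h <;> simp [h]
  rw [Finset.sum_congr rfl fun m _ => this m, Finset.sum_add_distrib, Finset.sum_add_distrib]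
  rw [← Finset.sum_filter, ← Finset.sum_filter, ← Finset.sum_filter]
  simp only [Finset.sum_const, nsmul_eq_mul]
  rw [h1, h2, h3]; norm_num

lemma z2_cases : ∀ a : ZMod 2, a = 0 ∨ a = 1 := by decide

section base
variable {R : A} {N : ℕ} (B : Base G R N)
include B

/-- coordinates on V -/
lemma exE {T T' : A} (hT : T ∈ V A) (hT' : T' ∈ V A) (h0 : T ≠ 0) (h0' : T' ≠ 0) (hne : T ≠ T') :
    ∃ e : E ≃+ V A, ∀ i, (e i : A) = i.1.val • T + i.2.val • T' := by
  have _ := finV B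
  let _ : Fintype (V A) := Fintype.ofFinite _
  have hc : Fintype.card (V A) = 4 := by rw [← Nat.card_eq_fintype_card, B.cardV]
  let f : E → V A := fun i => ⟨i.1.val • T + i.2.val • T', add_mem (nsmul_mem hT _) (nsmul_mem hT' _)⟩
  have hTT := V_add_self hT
  have hTT' := V_add_self hT'
  have c00 : ((0:ZMod 2)).val = 0 := rfl
  have c11 : ((1:ZMod 2)).val = 1 := rfl
  have hv : ∀ (X : A), X + X = 0 → ∀ a b : ZMod 2, (a + b).val • X = a.val • X + b.val • X := by
    intro X hX a b
    have h2 : (1 + 1 : ZMod 2) = 0 := rfl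
    rcases z2_cases a with rfl | rfl <;> rcases z2_cases b with rfl | rfl <;> simp [hX, h2, c00, c11]
  have hadd : ∀ a b, f (a + b) = f a + f b := by
    intro a b
    ext
    show (a.1 + b.1).val • T + (a.2 + b.2).val • T' = (a.1.val • T + a.2.val • T') + (b.1.val • T + b.2.val • T')
    rw [hv T hTT, hv T' hTT']; abel
  let F : E →+ V A := AddMonoidHom.mk' f hadd
  have hinj : Function.Injective F := by
    rw [injective_iff_map_eq_zero]
    rintro ⟨a, b⟩ h
    have h : a.val • T + b.val • T' = 0 := congrArg Subtype.val h
    have hs : T + T' ≠ 0 := fun h => hne (by rw [← V_neg hT', ← add_eq_zero_iff_eq_neg]; exact h)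
    rcases z2_cases a with rfl | rfl <;> rcases z2_cases b with rfl | rfl
    · rfl
    · simp only [c00, c11, zero_smul, one_smul, zero_add] at h; exact absurd h h0'
    · simp only [c00, c11, zero_smul, one_smul, add_zero] at h; exact absurd h h0
    · simp only [c11, one_smul] at h; exact absurd h hs
  have hbij : Function.Bijective F := by
    rw [Fintype.bijective_iff_injective_and_card]
    exact ⟨hinj, by rw [hc]; rfl⟩
  exact ⟨AddEquiv.ofBijective F hbij, fun i => rfl⟩

lemma sumI [Fintype G] (wt : ℕ → ℝ) {n : ℕ} (hn : n + 1 < N) (hP : Trip G R n)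
    {g : G} (ha : Al R n g) (hU : Nat.card (U (A := A) n g) = 4) :
    ∑ γ : Γ G R n, Φ R wt (n+1) (g * γ) = Fintype.card (Γ G R n) * ((24 * wt 1 + 18 * wt 2 + wt 4) / 64) := by
  have _ := finV B
  let _ : Fintype (V A) := Fintype.ofFinite _
  have hc : Fintype.card (V A) = 4 := by rw [← Nat.card_eq_fintype_card, B.cardV]
  rw [sum_shift (mem_Γ_of_I B (by omega) ha hU) (Φ R wt (n+1))]
  obtain ⟨T, hT, T', hT', hT0, hT0', hne⟩ := exV B
  obtain ⟨z, hz⟩ := exTors B hn hT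
  obtain ⟨w, hw⟩ := exTors B hn hT'
  obtain ⟨q, hq⟩ := exX B (n+1) hn
  obtain ⟨e, he⟩ := exE B hT hT' hT0 hT0' hne
  have hz2 : 2 ^ (n+2) • z = 0 := by rw [pow_succ', mul_smul, hz, mem_V.1 hT]
  have hw2 : 2 ^ (n+2) • w = 0 := by rw [pow_succ', mul_smul, hw, mem_V.1 hT']
  let δ0 : Γ G R n → V A × V A × V A := fun γ => (⟨γ.1 • q - q, diff_mem B (by omega) γ.2 (Or.inl hq)⟩, ⟨γ.1 • z - z, diff_mem B (by omega) γ.2 (Or.inr hz2)⟩, ⟨γ.1 • w - w, diff_mem B (by omega) γ.2 (Or.inr hw2)⟩)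
  have hδ0 : ∀ a b, δ0 (a * b) = δ0 a + δ0 b := by
    intro a b
    ext
    · exact diff_mul B (by omega) a.2 b.2 (Or.inl hq)
    · exact diff_mul B (by omega) a.2 b.2 (Or.inr hz2)
    · exact diff_mul B (by omega) a.2 b.2 (Or.inr hw2)
  let δ : Γ G R n → E × E × E := fun γ => (e.symm (δ0 γ).1, e.symm (δ0 γ).2.1, e.symm (δ0 γ).2.2)
  have hδ : ∀ a b, δ (a * b) = δ a + δ b := by
    intro a b
    simp only [δ, hδ0, Prod.fst_add, Prod.snd_add, map_add, Prod.mk_add_mk]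
  have hsu : Function.Surjective δ := by
    rintro ⟨u, v, v'⟩
    obtain ⟨γ, hγ, h1, h2, h3⟩ := hP z w q (by rwa [hz]) hz2 (by rwa [hw]) hw2 (by rwa [hz, hw]) hq (e v) (e v).2 (e v') (e v').2 (e u) (e u).2
    refine ⟨⟨γ, hγ⟩, ?_⟩
    simp only [δ, Prod.mk.injEq, AddEquiv.symm_apply_eq]
    exact ⟨Subtype.ext h3, Subtype.ext h1, Subtype.ext h2⟩
  have h1 := sum_hom δ hδ hsu (fun m => if alE m then wt (cE m) else 0)
  rw [cE_sum, show Fintype.card (E × E × E) = 64 by rfl] at h1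
  have hΦ : ∀ γ : Γ G R n, Φ R wt (n+1) γ.1 = (fun m : E × E × E => if alE m then wt (cE m) else 0) (δ γ) := by
    intro γ
    have hb : ∀ (i : E) (y : A), 2 ^ (n+1) • y = e i → γ.1 • y - y = i.1.val • (γ.1 • z - z) + i.2.val • (γ.1 • w - w) := by
      intro i y hy
      have h3 : 2 ^ (n+1) • (y - (i.1.val • z + i.2.val • w)) = 0 := by
        rw [smul_sub, smul_add, smul_comm _ i.1.val, smul_comm _ i.2.val, hz, hw, hy, he, sub_self]
      have h4 := fix_tors B (by omega) γ.2 h3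
      rw [smul_sub, smul_add, smul_nsmul, smul_nsmul] at h4
      rw [smul_sub, smul_sub]
      have h5 : γ.1 • y = y - (i.1.val • z + i.2.val • w) + (i.1.val • γ.1 • z + i.2.val • γ.1 • w) := by rw [← h4]; abel
      rw [h5]; abel
    have hd1 : ((e (δ γ).1 : V A) : A) = γ.1 • q - q := by simp [δ, δ0]
    have hd2 : ((e (δ γ).2.1 : V A) : A) = γ.1 • z - z := by simp [δ, δ0]
    have hd3 : ((e (δ γ).2.2 : V A) : A) = γ.1 • w - w := by simp [δ, δ0]
    have hz0 : ∀ x : E, ((e x : V A) : A) = 0 ↔ x = 0 := by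
      intro x
      rw [← map_eq_zero_iff e e.injective]
      exact ⟨fun h => Subtype.ext h, fun h => congrArg Subtype.val h⟩
    have hal : Al R (n+1) γ.1 ↔ alE (δ γ) := by
      unfold alE
      constructor
      · rintro ⟨x, hx, hfx⟩
        have h3 : 2 ^ (n+1) • (x - q) ∈ V A := by
          rw [mem_V, smul_smul, ← pow_succ', smul_sub, hx, hq, sub_self]
        refine ⟨e.symm ⟨_, h3⟩, ?_⟩
        rw [← hz0, map_add, map_add, map_nsmul, map_nsmul]
        have h4 := hb (e.symm ⟨_, h3⟩) (x - q) (by simp)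
        simp only [AddSubgroup.coe_add, AddSubgroup.coe_nsmul, hd1, hd2, hd3]
        rw [add_assoc, ← h4, smul_sub, hfx]; abel
      · rintro ⟨i, hi⟩
        rw [← hz0, map_add, map_add, map_nsmul, map_nsmul] at hi
        simp only [AddSubgroup.coe_add, AddSubgroup.coe_nsmul, hd1, hd2, hd3] at hi
        obtain ⟨y, hy⟩ := exTors B hn (e i).2
        have h4 := hb i y hy
        refine ⟨q + y, by rw [smul_add, hq, pow_succ', mul_smul, hy, mem_V.1 (e i).2, add_zero], ?_⟩
        rw [add_assoc, ← h4] at hi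
        rw [smul_add, ← sub_eq_zero, ← hi]; abel
    have hcu : Nat.card (U (A := A) (n+1) γ.1) = cE (δ γ) := by
      unfold cE
      rw [← Fintype.card_subtype, ← Nat.card_eq_fintype_card]
      symm
      have hiff : ∀ i : E, i.1.val • (δ γ).2.1 + i.2.val • (δ γ).2.2 = 0 ↔ (e i : A) ∈ U (A := A) (n+1) γ.1 := by
        intro i
        rw [← hz0, map_add, map_nsmul, map_nsmul]
        simp only [AddSubgroup.coe_add, AddSubgroup.coe_nsmul, hd2, hd3]
        constructor
        · intro h
          obtain ⟨y, hy⟩ := exTors B hn (e i).2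
          refine ⟨(e i).2, y, ?_, hy⟩
          rw [← sub_eq_zero, hb i y hy, h]
        · rintro ⟨-, y, hy, h⟩
          rw [← hb i y h, hy, sub_self]
      refine Nat.card_eq_of_bijective (fun i => ⟨(e i.1 : A), (hiff i.1).1 i.2⟩) ⟨?_, ?_⟩
      · intro a b h
        have := congrArg Subtype.val h
        exact Subtype.ext (e.injective (Subtype.ext this))
      · rintro ⟨v, hv⟩
        refine ⟨⟨e.symm ⟨v, U_le_V hv⟩, (hiff _).2 (by simpa using hv)⟩, by simp⟩
    simp only [Φ, hal, hcu]
  rw [Finset.sum_congr rfl fun γ _ => hΦ γ]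
  push_cast at h1
  linarith

lemma trip_pair {n : ℕ} (hn : n + 1 < N) (h : Trip G R n) : Pair G R n := by
  intro z q hz1 hz2 hq v hv u hu
  have : ∃ T ∈ V A, T ≠ 0 ∧ 2 ^ (n+1) • z ≠ T := by
    obtain ⟨T, hT, T', hT', h1, h2, h3⟩ := exV B
    by_cases h4 : 2 ^ (n+1) • z = T
    · exact ⟨T', hT', h2, by rw [h4]; exact h3⟩
    · exact ⟨T, hT, h1, h4⟩
  obtain ⟨T, hT, h0, hne⟩ := this
  obtain ⟨w, hw⟩ := exTors B hn hT
  obtain ⟨γ, h1, h2, h3, h4⟩ := h z w q hz1 hz2 (by rwa [hw]) (by rw [pow_succ', mul_smul, hw, mem_V.1 hT]) (by rwa [hw]) hq v hv 0 (zero_mem _) u hu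
  exact ⟨γ, h1, h2, h4⟩

lemma trip_succ {n : ℕ} (h1 : 1 ≤ n) (hn : n + 2 < N) (h : Trip G R n) : Trip G R (n+1) := by
  intro z w q hz1 hz2 hw1 hw2 hne hq v hv v' hv' u hu
  obtain ⟨γ, hγ, e1, e2, e3⟩ := h (2 • z) (2 • w) (2 • q) (by rwa [smul_smul, ← pow_succ]) (by rwa [smul_smul, ← pow_succ])
    (by rwa [smul_smul, ← pow_succ]) (by rwa [smul_smul, ← pow_succ]) (by rwa [smul_smul, smul_smul, ← pow_succ]) (by rwa [smul_smul, ← pow_succ]) v hv v' hv' u hu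
  have key : ∀ (x t : A), t ∈ V A → γ • (2 • x) - 2 • x = t → (γ * γ) • x - x = t := by
    intro x t ht e
    have h2 : 2 • (γ • x - x) = t := by rw [smul_sub, ← smul_nsmul, e]
    have h3 : γ • (γ • x - x) = γ • x - x := by
      refine fix_tors B (by omega) hγ ?_
      obtain ⟨k, rfl⟩ := Nat.exists_eq_add_of_le h1
      rw [show 1 + k + 1 = k + 1 + 1 by ring, pow_succ, mul_smul, h2, pow_succ, mul_smul, mem_V.1 ht, smul_zero]
    rw [smul_sub] at h3
    rw [mul_smul, ← h2, two_nsmul, ← h3]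
    nth_rewrite 2 [h3]
    abel
  refine ⟨γ * γ, ?_, key z v hv e1, key w v' hv' e2, key q u hu e3⟩
  intro x hx
  have h4 := diff_mul B (show n < N by omega) hγ hγ (q := x) (Or.inl hx)
  rw [V_add_self (diff_mem B (by omega) hγ (Or.inl hx))] at h4
  exact sub_eq_zero.1 h4
end base
end EchoG
end

section
open scoped Classical
namespace EchoG
variable {G A : Type} [Group G] [AddCommGroup A] [DistribMulAction G A]

/-- The arithmetic input. -/
structure Arith (G : Type) [Group G] {A : Type} [AddCommGroup A] [DistribMulAction G A] (R : A) : Prop where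
  h7 : ∃ g : G, ∀ v : A, 2 • v = 0 → g • v = v → v = 0
  h11 : ∃ g : G, (∀ x : A, 2 • x = R → g • x ≠ x) ∧ ∃ v : A, 2 • v = 0 ∧ g • v ≠ v
  hF4 : ∀ γ ∈ Γ G R 0, ∀ z w : A, 4 • z = 0 → 2 • z ≠ 0 → 4 • w = 0 → 2 • w ≠ 0 →
    (γ • z = z ∨ γ • z = z + 2 • z) → (γ • w = w ∨ γ • w = w + 2 • w)
  h307 : ∃ γ ∈ Γ G R 0, ∀ z : A, 4 • z = 0 → 2 • z ≠ 0 → γ • z ≠ z ∧ γ • z ≠ z + 2 • z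
  h8629 : ∃ γ ∈ Γ G R 1, ∃ e f : A, 2 • e = 0 ∧ 2 • f = 0 ∧ e ≠ 0 ∧ f ≠ 0 ∧ e ≠ f ∧
    (∀ z : A, 4 • z = f → γ • z = z) ∧ (∀ z : A, 4 • z = e → γ • z = z + e)

lemma permE_facts : (∀ a : Equiv.Perm E, (∀ i, a i = a 0 + i → i = 0) → a ^ 3 = 1 ∧ a ≠ 1) ∧
    (∀ a : Equiv.Perm E, (∀ i, a i ≠ i) → (∃ i, a i ≠ a 0 + i) → a ^ 4 = 1 ∧ a ^ 2 ≠ 1 ∧ Equiv.Perm.sign a = -1) := by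
  constructor <;> decide +kernel

def aP (a : Equiv.Perm E) : Prop := ∃ i, a i = i
instance (a) : Decidable (aP a) := by unfold aP; infer_instance
def cP (a : Equiv.Perm E) : ℕ := (Finset.univ.filter (fun i : E => a i = a 0 + i)).card

lemma cP_counts : (Finset.univ.filter (fun m : Equiv.Perm E => aP m ∧ cP m = 1)).card = 8 ∧
   (Finset.univ.filter (fun m : Equiv.Perm E => aP m ∧ cP m = 2)).card = 6 ∧
   (Finset.univ.filter (fun m : Equiv.Perm E => aP m ∧ cP m = 4)).card = 1 ∧ ∀ m : Equiv.Perm E, cP m = 1 ∨ cP m = 2 ∨ cP m = 4 := by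
  refine ⟨?_, ?_, ?_, ?_⟩ <;> decide +kernel

lemma cP_sum (wt : ℕ → ℝ) : ∑ m : Equiv.Perm E, (if aP m then wt (cP m) else 0) = 8 * wt 1 + 6 * wt 2 + wt 4 := by
  obtain ⟨h1, h2, h3, h4⟩ := cP_counts
  have : ∀ m : Equiv.Perm E, (if aP m then wt (cP m) else 0) = (if aP m ∧ cP m = 1 then wt 1 else 0) + (if aP m ∧ cP m = 2 then wt 2 else 0) + (if aP m ∧ cP m = 4 then wt 4 else 0) := by
    intro m
    rcases h4 m with h | h | h <;> simp [h]
  rw [Finset.sum_congr rfl fun m _ => this m, Finset.sum_add_distrib, Finset.sum_add_distrib]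
  rw [← Finset.sum_filter, ← Finset.sum_filter, ← Finset.sum_filter]
  simp only [Finset.sum_const, nsmul_eq_mul]
  rw [h1, h2, h3]; norm_num

lemma perm_top (H : Subgroup (Equiv.Perm E)) (a b : Equiv.Perm E) (ha : a ∈ H) (hb : b ∈ H)
    (ha' : ∀ i, a i = a 0 + i → i = 0) (hb1 : ∀ i, b i ≠ i) (hb2 : ∃ i, b i ≠ b 0 + i) : H = ⊤ := by
  obtain ⟨a1, a2⟩ := permE_facts.1 a ha'
  obtain ⟨b1, b2, b3⟩ := permE_facts.2 b hb1 hb2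
  have oa : orderOf a = 3 := orderOf_eq_prime a1 a2
  have ob : orderOf b = 4 := orderOf_eq_prime_pow (p := 2) (n := 1) (by simpa using b2) (by simpa using b1)
  have d3 : 3 ∣ Nat.card H := by rw [← oa, ← Subgroup.orderOf_mk a ha]; exact orderOf_dvd_natCard _
  have d4 : 4 ∣ Nat.card H := by rw [← ob, ← Subgroup.orderOf_mk b hb]; exact orderOf_dvd_natCard _
  have d12 : 12 ∣ Nat.card H := by omega
  have hc : Nat.card H * H.index = 24 := by
    rw [Subgroup.card_mul_index, Nat.card_eq_fintype_card, Fintype.card_perm]; rfl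
  obtain ⟨k, hk⟩ := d12
  rw [hk, mul_assoc] at hc
  have hki : k * H.index = 2 := by omega
  have : H.index ∣ 2 := ⟨k, by rw [mul_comm]; exact hki.symm⟩
  rcases (Nat.dvd_prime Nat.prime_two).1 this with h | h
  · exact Subgroup.index_eq_one.1 h
  · have := Equiv.Perm.eq_alternatingGroup_of_index_eq_two h
    rw [this, Equiv.Perm.mem_alternatingGroup, b3] at hb
    exact absurd hb (by decide)

lemma val0 : ((0:ZMod 2)).val = 0 := rfl
lemma val1 : ((1:ZMod 2)).val = 1 := rfl

def X0 (R : A) : Type := {q : A // 2 • q = R}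

section base
variable {R : A} {N : ℕ} (B : Base G R N)
include B

@[reducible] def actX : MulAction G (X0 R) where
  smul g x := ⟨g • x.1, by rw [← smul_nsmul, x.2, B.fixR]⟩
  one_smul x := Subtype.ext (one_smul G x.1)
  mul_smul g h x := Subtype.ext (mul_smul g h x.1)

lemma exX0 {q T T' : A} (hq : 2 • q = R) (hT : T ∈ V A) (hT' : T' ∈ V A) (h0 : T ≠ 0) (h0' : T' ≠ 0) (hne : T ≠ T') :
    ∃ (e : E ≃+ V A) (e' : E ≃ X0 R), (∀ i, (e i : A) = i.1.val • T + i.2.val • T') ∧ ∀ i, (e' i).1 = q + e i := by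
  obtain ⟨e, he⟩ := exE B hT hT' h0 h0' hne
  refine ⟨e, ⟨fun i => ⟨q + e i, ?_⟩, fun x => e.symm ⟨x.1 - q, ?_⟩, ?_, ?_⟩, he, fun i => rfl⟩
  · rw [smul_add, hq, mem_V.1 (e i).2, add_zero]
  · rw [mem_V, smul_sub, x.2, hq, sub_self]
  · intro i
    simp
  · intro x
    apply Subtype.ext
    simp

/-- the permutation representation in coordinates -/
lemma exRho {q T T' : A} (hq : 2 • q = R) (hT : T ∈ V A) (hT' : T' ∈ V A) (h0 : T ≠ 0) (h0' : T' ≠ 0) (hne : T ≠ T') :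
    ∃ (e : E ≃+ V A) (ρ : G →* Equiv.Perm E), (∀ i, (e i : A) = i.1.val • T + i.2.val • T') ∧
      (∀ x : A, 2 • x = R → ∃ i, x = q + e i) ∧ ∀ g i, q + (e (ρ g i) : A) = g • (q + (e i : A)) := by
  obtain ⟨e, e', he, he'⟩ := exX0 B hq hT hT' h0 h0' hne
  let _ := actX B
  refine ⟨e, (e'.symm.permCongrHom.toMonoidHom).comp (MulAction.toPermHom G (X0 R)), he, ?_, ?_⟩
  · intro x hx
    exact ⟨e'.symm ⟨x, hx⟩, by rw [← he']; exact (congrArg Subtype.val (e'.apply_symm_apply ⟨x, hx⟩)).symm⟩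
  · intro g i
    rw [← he', ← he']
    simp only [MonoidHom.comp_apply, MulEquiv.toMonoidHom_eq_coe, MonoidHom.coe_coe, Equiv.permCongrHom_coe, Equiv.permCongr_apply,
      Equiv.symm_symm, Equiv.apply_symm_apply]
    rfl

omit B in
lemma rho_surj (H : Arith G R) {q : A} {e : E ≃+ V A} {ρ : G →* Equiv.Perm E} (hq : 2 • q = R)
    (hρ : ∀ g i, q + (e (ρ g i) : A) = g • (q + (e i : A))) : Function.Surjective ρ := by
  have hlin : ∀ g i, ρ g i = ρ g 0 + i ↔ g • (e i : A) = e i := by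
    intro g i
    have h1 := hρ g i
    have h2 := hρ g 0
    simp only [map_zero, ZeroMemClass.coe_zero, add_zero] at h2
    rw [smul_add, ← h2, add_assoc, add_right_inj] at h1
    rw [← e.injective.eq_iff, map_add, ← Subtype.coe_inj, AddSubgroup.coe_add, h1, add_right_inj]
  have : ρ.range = ⊤ := by
    obtain ⟨g, hg⟩ := H.h7
    obtain ⟨g', hg', v, hv, hgv⟩ := H.h11
    refine perm_top _ (ρ g) (ρ g') ⟨g, rfl⟩ ⟨g', rfl⟩ ?_ ?_ ?_
    · intro i hi
      rw [hlin] at hi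
      have := hg _ (e i).2 hi
      simpa using this
    · intro i hi
      have := hρ g' i
      rw [hi] at this
      exact hg' _ (by rw [smul_add, hq, mem_V.1 (e i).2, add_zero]) this.symm
    · refine ⟨e.symm ⟨v, hv⟩, ?_⟩
      rw [Ne, hlin]; simpa using hgv
  exact MonoidHom.range_eq_top.1 this

lemma S0sum [Fintype G] (hN : 0 < N) (H : Arith G R) (wt : ℕ → ℝ) :
    ∑ g : G, Φ R wt 0 g = Fintype.card G * ((8 * wt 1 + 6 * wt 2 + wt 4) / 24) := by
  obtain ⟨T, hT, T', hT', hT0, hT0', hne⟩ := exV B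
  obtain ⟨q, hq⟩ := exX B 0 hN
  rw [zero_add, pow_one] at hq
  obtain ⟨e, ρ, he, hX, hρ⟩ := exRho B hq hT hT' hT0 hT0' hne
  have hs := rho_surj H hq hρ
  have hlin : ∀ g i, ρ g i = ρ g 0 + i ↔ g • (e i : A) = e i := by
    intro g i
    have h1 := hρ g i
    have h2 := hρ g 0
    simp only [map_zero, ZeroMemClass.coe_zero, add_zero] at h2
    rw [smul_add, ← h2, add_assoc, add_right_inj] at h1
    rw [← e.injective.eq_iff, map_add, ← Subtype.coe_inj, AddSubgroup.coe_add, h1, add_right_inj]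
  have hΦ : ∀ g, Φ R wt 0 g = if aP (ρ g) then wt (cP (ρ g)) else 0 := by
    intro g
    have h1 : Al R 0 g ↔ aP (ρ g) := by
      constructor
      · rintro ⟨x, hx, hgx⟩
        obtain ⟨i, rfl⟩ := hX x (by simpa using hx)
        refine ⟨i, ?_⟩
        have := hρ g i
        rw [hgx, add_right_inj, Subtype.coe_inj, e.injective.eq_iff] at this
        exact this
      · rintro ⟨i, hi⟩
        refine ⟨q + e i, by rw [zero_add, pow_one, smul_add, hq, mem_V.1 (e i).2, add_zero], ?_⟩
        rw [← hρ, hi]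
    have h2 : Nat.card (U (A := A) 0 g) = cP (ρ g) := by
      rw [cP, ← Fintype.card_subtype, ← Nat.card_eq_fintype_card]
      have hback : ∀ v : U (A := A) 0 g, ρ g (e.symm ⟨v.1, v.2.1⟩) = ρ g 0 + e.symm ⟨v.1, v.2.1⟩ := by
        rintro ⟨v, hv, y, hy, rfl⟩
        rw [hlin]; simpa using hy
      let F : {i : E // ρ g i = ρ g 0 + i} ≃ U (A := A) 0 g :=
        { toFun := fun i => ⟨e i.1, (e i.1).2, e i.1, (hlin g _).1 i.2, by simp⟩
          invFun := fun v => ⟨e.symm ⟨v.1, v.2.1⟩, hback v⟩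
          left_inv := by intro i; exact Subtype.ext (e.symm_apply_apply i.1)
          right_inv := by intro v; simp }
      exact (Nat.card_congr F).symm
    rw [Φ, h2]
    exact if_congr h1 rfl rfl
  rw [Finset.sum_congr rfl fun g _ => hΦ g]
  have h24 : (Fintype.card (Equiv.Perm E) : ℝ) = 24 := by rw [Fintype.card_perm]; norm_num [Nat.factorial, E]
  have key : (24 : ℝ) * ∑ g : G, (if aP (ρ g) then wt (cP (ρ g)) else 0) = Fintype.card G * ∑ m : Equiv.Perm E, (if aP m then wt (cP m) else 0) := by
    let F : Equiv.Perm E → ℝ := fun m => if aP m then wt (cP m) else 0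
    show (24 : ℝ) * ∑ g : G, F (ρ g) = Fintype.card G * ∑ m, F m
    have h1 : ∀ m : Equiv.Perm E, ∑ h, F (ρ h) = ∑ h, F (ρ h * m) := by
      intro m
      obtain ⟨h0, rfl⟩ := hs m
      rw [← Equiv.sum_comp (Equiv.mulRight h0) (fun h => F (ρ h))]
      simp
    have h2 : ∑ m : Equiv.Perm E, ∑ h, F (ρ h) = ∑ h : G, ∑ m, F m := by
      rw [Finset.sum_congr rfl fun m _ => h1 m, Finset.sum_comm]
      refine Finset.sum_congr rfl fun h _ => ?_
      exact Equiv.sum_comp (Equiv.mulLeft (ρ h)) F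
    rw [Finset.sum_const, Finset.sum_const, Finset.card_univ, Finset.card_univ, nsmul_eq_mul, nsmul_eq_mul, h24] at h2
    exact h2
  rw [cP_sum] at key
  linarith


/-- full affine group is realised -/
lemma surjA (H : Arith G R) {q q' T T' W W' : A} (hq : 2 • q = R) (hq' : 2 • q' = R)
    (hT : T ∈ V A) (hT' : T' ∈ V A) (h0 : T ≠ 0) (h0' : T' ≠ 0) (hne : T ≠ T')
    (hW : W ∈ V A) (hW' : W' ∈ V A) (k0 : W ≠ 0) (k0' : W' ≠ 0) (kne : W ≠ W') :
    ∃ g : G, g • q = q' ∧ g • T = W ∧ g • T' = W' := by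
  obtain ⟨e, ρ, he, hX, hρ⟩ := exRho B hq hT hT' h0 h0' hne
  have hs := rho_surj H hq hρ
  obtain ⟨f, hf⟩ := exE B hW hW' k0 k0' kne
  let c : V A := ⟨q' - q, by rw [mem_V, smul_sub, hq, hq', sub_self]⟩
  let π : Equiv.Perm E := (f.toEquiv.trans (Equiv.addLeft c)).trans e.symm.toEquiv
  obtain ⟨g, hg⟩ := hs π
  have hπ : ∀ i, g • (q + (e i : A)) = q' + f i := by
    intro i
    rw [← hρ, hg]
    simp only [π, c, Equiv.trans_apply, Equiv.coe_addLeft, AddEquiv.toEquiv_eq_coe, AddEquiv.coe_toEquiv, AddEquiv.apply_symm_apply, AddSubgroup.coe_add]; abel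
  have e0 : g • q = q' := by simpa using hπ 0
  have e1 := hπ (1, 0)
  have e2 := hπ (0, 1)
  simp only [he, hf, val0, val1, zero_smul, one_smul, add_zero, zero_add, smul_add, e0, add_right_inj] at e1 e2
  exact ⟨g, e0, e1, e2⟩

lemma V_cases {T T' : A} (hT : T ∈ V A) (hT' : T' ∈ V A) (h0 : T ≠ 0) (h0' : T' ≠ 0) (hne : T ≠ T') {v : A} (hv : v ∈ V A) :
    v = 0 ∨ v = T ∨ v = T' ∨ v = T + T' := by
  obtain ⟨e, he⟩ := exE B hT hT' h0 h0' hne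
  have h := he (e.symm ⟨v, hv⟩)
  rw [AddEquiv.apply_symm_apply] at h
  generalize e.symm ⟨v, hv⟩ = i at h
  obtain ⟨a, b⟩ := i
  simp only at h
  rcases z2_cases a with rfl | rfl <;> rcases z2_cases b with rfl | rfl <;>
    simp only [val0, val1, zero_smul, one_smul, add_zero, zero_add] at h <;> simp [h]

lemma other {T : A} : ∃ T' ∈ V A, T' ≠ 0 ∧ T ≠ T' := by
  obtain ⟨T1, hT, T', hT', h1, h2, h3⟩ := exV B
  by_cases h4 : T = T1
  · exact ⟨T', hT', h2, by rw [h4]; exact h3⟩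
  · exact ⟨T1, hT, h1, h4⟩

end base
end EchoG
end

section
open scoped Classical
namespace EchoG
variable {G A : Type} [Group G] [AddCommGroup A] [DistribMulAction G A]

lemma diff_conj (g γ : G) (y : A) : (g * γ * g⁻¹) • y - y = g • (γ • (g⁻¹ • y) - g⁻¹ • y) := by
  rw [smul_sub, smul_inv_smul, mul_smul, mul_smul]

section base
variable {R : A} {N : ℕ} (B : Base G R N)
include B

lemma inv_fix (g : G) : g⁻¹ • R = R := B.fixR _

lemma Γ_conj {n : ℕ} {γ : G} (hγ : γ ∈ Γ G R n) (g : G) : g * γ * g⁻¹ ∈ Γ G R n := by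
  intro q hq
  have h : γ • (g⁻¹ • q) = g⁻¹ • q := hγ _ (by rw [← smul_nsmul, hq, B.fixR])
  rw [← sub_eq_zero, diff_conj, h, sub_self, smul_zero]

omit B in
lemma add_diff {γ : G} {y y' : A} (h : γ • y = y) : γ • (y' + y) - (y' + y) = γ • y' - y' := by
  rw [smul_add, h]; abel

lemma hF_of (hN : 0 < N) (H : Arith G R) : ∀ γ ∈ Γ G R 0, ∀ z w : A, 4 • z = 0 → 2 • z ≠ 0 → 4 • w = 0 → γ • z = z → γ • w = w := by
  intro γ hγ z w hz hz2 hw hf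
  have f2 : ∀ v : A, (2:ℕ) • v = 0 → γ • v = v := fun v hv => V_fix B hN hγ hv
  by_cases h1 : 2 • w = 0
  · exact f2 w h1
  by_cases h2 : 2 • w = 2 • z
  · have := f2 (w - z) (by rw [smul_sub, h2, sub_self])
    rw [smul_sub, hf, sub_left_inj] at this
    exact this
  have h3 := H.hF4 γ hγ z w hz hz2 hw h1 (Or.inl hf)
  have h4 : 2 • (z + w) ≠ 0 := by
    rw [smul_add]
    intro h
    apply h2
    have : (2 • w : A) = - (2 • z) := by rw [eq_neg_iff_add_eq_zero, add_comm]; exact h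
    rw [this, V_neg]
    rw [mem_V, smul_smul]; exact hz
  have h5 := H.hF4 γ hγ z (z + w) hz hz2 (by rw [smul_add, hz, hw, add_zero]) h4 (Or.inl hf)
  rw [smul_add, hf] at h5
  rcases h3 with h3 | h3
  · exact h3
  · rw [h3] at h5
    rcases h5 with h5 | h5
    · exfalso; apply h1
      rw [add_right_inj] at h5
      simpa using h5
    · exfalso; apply hz2
      rw [smul_add] at h5
      have : z + (w + 2 • w) + 2 • z = z + (w + 2 • w) := by
        conv_rhs => rw [h5]
        abel
      simpa using this

/-- translations -/
lemma exTrans (H : Arith G R) {q v : A} (hq : 2 • q = R) (hv : v ∈ V A) : ∃ g : G, g • q = q + v ∧ ∀ w ∈ V A, g • w = w := by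
  obtain ⟨T, hT, T', hT', hT0, hT0', hne⟩ := exV B
  obtain ⟨g, h1, h2, h3⟩ := surjA B H hq (q' := q + v) (by rw [smul_add, hq, mem_V.1 hv, add_zero]) hT hT' hT0 hT0' hne hT hT' hT0 hT0' hne
  refine ⟨g, h1, fun w hw => ?_⟩
  rcases V_cases B hT hT' hT0 hT0' hne hw with rfl | rfl | rfl | rfl
  · simp
  · exact h2
  · exact h3
  · rw [smul_add, h2, h3]

lemma const_gen (H : Arith G R) {n : ℕ} (hn : n + 1 < N) {γ : G} (hγ : γ ∈ Γ G R n) {q ζ v : A} (hq : 2 ^ (n+2) • q = R)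
    (hv : v ∈ V A) (hζ : 2 ^ (n+1) • ζ = v) :
    ∃ γ' ∈ Γ G R n, (∀ z : A, 2 ^ (n+2) • z = 0 → γ' • z = z) ∧ γ' • q - q = γ • ζ - ζ := by
  have hn' : n < N := by omega
  have h2q : (2:ℕ) • (2 ^ (n+1) • q) = R := by rw [smul_smul, ← pow_succ', hq]
  obtain ⟨g, hg1, hg2⟩ := exTrans B H h2q hv
  have hi1 : g⁻¹ • (2 ^ (n+1) • q) = 2 ^ (n+1) • q + v := by
    rw [inv_smul_eq_iff, smul_add, hg1, hg2 v hv, add_assoc, V_add_self hv, add_zero]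
  have hi2 : ∀ w ∈ V A, g⁻¹ • w = w := fun w hw => by rw [inv_smul_eq_iff, hg2 w hw]
  refine ⟨(g * γ * g⁻¹) * γ, mul_mem (Γ_conj B hγ g) hγ, ?_, ?_⟩
  · intro z hz
    have h1 : γ • (g⁻¹ • z - z) = g⁻¹ • z - z := by
      apply fix_tors B hn' hγ
      rw [smul_sub, ← smul_nsmul, hi2, sub_self]
      rw [mem_V, smul_smul, ← pow_succ', hz]
    have h2 : γ • (g⁻¹ • z) - g⁻¹ • z = γ • z - z := by
      have := add_diff (y' := z) h1
      rwa [add_sub_cancel] at this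
    rw [← sub_eq_zero, diff_mul B hn' (Γ_conj B hγ g) hγ (Or.inr hz), diff_conj, h2, hg2 _ (diff_mem B hn' hγ (Or.inr hz))]
    exact V_add_self (diff_mem B hn' hγ (Or.inr hz))
  · have hd : γ • ζ - ζ ∈ V A := diff_mem B hn' hγ (Or.inr (by rw [pow_succ', mul_smul, hζ, mem_V.1 hv]))
    have hdq := diff_mem B hn' hγ (Or.inl hq)
    have h1 : γ • (g⁻¹ • q - (q + ζ)) = g⁻¹ • q - (q + ζ) := by
      apply fix_tors B hn' hγ
      rw [smul_sub, ← smul_nsmul, hi1, smul_add, hζ, sub_self]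
    have h2 : γ • (g⁻¹ • q) - g⁻¹ • q = (γ • q - q) + (γ • ζ - ζ) := by
      have := add_diff (y' := q + ζ) h1
      rw [add_sub_cancel] at this
      rw [this, smul_add]; abel
    rw [diff_mul B hn' (Γ_conj B hγ g) hγ (Or.inl hq), diff_conj, h2, hg2 _ (add_mem hdq hd), add_right_comm, V_add_self hdq, zero_add]

lemma pair0 (hN : 1 < N) (H : Arith G R) : Pair G R 0 := by
  intro z q hz1 hz2 hq v hv u hu
  obtain ⟨γ0, hγ0, h307⟩ := H.h307
  simp only [zero_add, pow_one, show (2:ℕ)^2 = 4 by norm_num] at hz1 hz2 hq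
  have hN0 : 0 < N := by omega
  -- constants
  have hconst : ∃ ζ : A, 4 • ζ = 0 ∧ ∀ u ∈ V A, ∃ γ' ∈ Γ G R 0, γ' • z - z = 0 ∧ γ' • q - q = u := by
    refine ⟨0, by simp, ?_⟩
    have hh : ∀ w : V A, ∃ ζ : A, (2:ℕ) • ζ = w := fun w => by
      obtain ⟨ζ, h⟩ := exTors B hN w.2
      exact ⟨ζ, by simpa using h⟩
    choose ζ hζ using hh
    have hζ4 : ∀ w, 4 • ζ w = 0 := fun w => by
      rw [show 4 = 2 * 2 by norm_num, mul_smul, hζ, mem_V.1 w.2]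
    let f : V A → V A := fun w => ⟨γ0 • ζ w - ζ w, diff_mem B hN0 hγ0 (Or.inr (hζ4 w))⟩
    have _ := finV B
    have hf : Function.Injective f := by
      intro a b hab
      have h1 : γ0 • ζ a - ζ a = γ0 • ζ b - ζ b := congrArg Subtype.val hab
      by_contra hne
      refine (h307 (ζ a - ζ b) (by rw [smul_sub, hζ4, hζ4, sub_self]) ?_).1 ?_
      · rw [smul_sub, hζ, hζ, sub_ne_zero]
        exact fun h => hne (Subtype.ext h)
      · rw [smul_sub, ← sub_eq_zero]
        rw [← sub_eq_zero] at h1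
        rw [← h1]; abel
    have hs := Finite.injective_iff_surjective.1 hf
    intro u hu
    obtain ⟨w, hw⟩ := hs ⟨u, hu⟩
    obtain ⟨γ', m, k1, k2⟩ := const_gen B H (n := 0) hN hγ0 (q := q) (by simpa using hq) w.2 (by simpa using hζ w)
    refine ⟨γ', m, by rw [k1 z (by simpa using hz2), sub_self], ?_⟩
    rw [k2]; exact congrArg Subtype.val hw
  obtain ⟨_, _, hconst⟩ := hconst
  have hT : 2 • z ∈ V A := by rw [mem_V, smul_smul]; exact hz2
  have hzb : ∃ γ ∈ Γ G R 0, γ • z - z = v := by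
    set w1 := γ0 • z - z with hw1
    have hw1V : w1 ∈ V A := diff_mem B hN0 hγ0 (Or.inr hz2)
    have hw10 : w1 ≠ 0 := by rw [hw1, Ne, sub_eq_zero]; exact (h307 z hz2 hz1).1
    have hw11 : 2 • z ≠ w1 := by rw [hw1]; intro h; apply (h307 z hz2 hz1).2; rw [h]; abel
    have hsum : 2 • z + w1 ≠ 0 := fun h => hw11 (by rw [add_eq_zero_iff_eq_neg, V_neg hw1V] at h; exact h)
    obtain ⟨g, _, g1, g2⟩ := surjA B H (q := 2 • q) (q' := 2 • q) (by rw [smul_smul]; exact hq) (by rw [smul_smul]; exact hq) hT hw1V hz1 hw10 hw11 hT (add_mem hT hw1V) hz1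
      hsum (by simpa using hw10)
    have hc : (g * γ0 * g⁻¹) • z - z = 2 • z + w1 := by
      rw [diff_conj]
      have h1 : γ0 • (g⁻¹ • z - z) = g⁻¹ • z - z := by
        apply V_fix B hN0 hγ0
        rw [mem_V, smul_sub, ← smul_nsmul, sub_eq_zero, inv_smul_eq_iff, g1]
      have h2 := add_diff (y' := z) h1
      rw [add_sub_cancel] at h2
      rw [h2, ← hw1, g2]
    rcases V_cases B hT hw1V hz1 hw10 hw11 hv with rfl | rfl | rfl | rfl
    · exact ⟨1, one_mem _, by simp⟩
    · refine ⟨_, mul_mem (Γ_conj B hγ0 g) hγ0, ?_⟩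
      rw [diff_mul B hN0 (Γ_conj B hγ0 g) hγ0 (Or.inr hz2), hc, ← hw1, add_assoc, V_add_self hw1V, add_zero]
    · exact ⟨γ0, hγ0, rfl⟩
    · exact ⟨_, Γ_conj B hγ0 g, hc⟩
  obtain ⟨γ, hγ, hγz⟩ := hzb
  have hd := diff_mem B hN0 hγ (Or.inl hq)
  obtain ⟨γ', hγ', k1, k2⟩ := hconst (u - (γ • q - q)) (sub_mem hu hd)
  refine ⟨γ * γ', mul_mem hγ hγ', ?_, ?_⟩
  · rw [diff_mul B hN0 hγ hγ' (Or.inr hz2), hγz, k1, add_zero]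
  · rw [diff_mul B hN0 hγ hγ' (Or.inl hq), k2]; abel

lemma trip1 (hN : 2 < N) (H : Arith G R) : Trip G R 1 := by
  intro z w q hz1 hz2 hw1 hw2 hne hq v hv v' hv' u hu
  simp only [show (2:ℕ)^(1+1) = 4 by norm_num] at hz1 hw1 hne
  obtain ⟨γ1, hγ1, e0, f0, he0, hf0, hee, hff, hef, kf, ke⟩ := H.h8629
  have hN1 : 1 < N := by omega
  have e8 : (2:ℕ)^(1+2) = 2 * 4 := by norm_num
  have h2q : (2:ℕ) • (4 • q) = R := by rw [smul_smul, ← e8]; exact hq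
  have step1 : ∀ e f : A, e ∈ V A → f ∈ V A → e ≠ 0 → f ≠ 0 → e ≠ f → ∃ γ ∈ Γ G R 1, (∀ z : A, 4 • z = f → γ • z = z) ∧ (∀ z : A, 4 • z = e → γ • z = z + e) := by
    intro e f he hf h0 h0' hef'
    obtain ⟨g, _, g1, g2⟩ := surjA B H h2q h2q he0 hf0 hee hff hef he hf h0 h0' hef'
    refine ⟨g * γ1 * g⁻¹, Γ_conj B hγ1 g, fun z hz => ?_, fun z hz => ?_⟩
    · rw [← sub_eq_zero, diff_conj, kf, sub_self, smul_zero]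
      rw [← smul_nsmul, hz, inv_smul_eq_iff, g2]
    · rw [← sub_eq_iff_eq_add', diff_conj, ke, add_sub_cancel_left, g1]
      rw [← smul_nsmul, hz, inv_smul_eq_iff, g1]
  have hconst : ∀ u ∈ V A, ∃ γ' ∈ Γ G R 1, γ' • z - z = 0 ∧ γ' • w - w = 0 ∧ γ' • q - q = u := by
    intro u hu
    by_cases hu0 : u = 0
    · exact ⟨1, one_mem _, by simp [hu0]⟩
    obtain ⟨f, hf, hf0, huf⟩ := other B (T := u)
    obtain ⟨γ, hγ, k1, k2⟩ := step1 u f hu hf hu0 hf0 huf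
    obtain ⟨ζ, hζ⟩ := exTors B (n := 2) hN hu
    obtain ⟨γ', m, l1, l2⟩ := const_gen B H (n := 1) hN hγ (q := q) hq hu hζ
    refine ⟨γ', m, by rw [l1 z hz2, sub_self], by rw [l1 w hw2, sub_self], ?_⟩
    rw [l2, k2 ζ (by simpa using hζ), add_sub_cancel_left]
  have hT : 4 • z ∈ V A := by rw [mem_V, smul_smul, ← e8]; exact hz2
  have hT' : 4 • w ∈ V A := by rw [mem_V, smul_smul, ← e8]; exact hw2
  have hTs : 4 • z + 4 • w ≠ 0 := fun h => hne (by rw [add_eq_zero_iff_eq_neg, V_neg hT'] at h; exact h)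
  let S : A → A → Prop := fun v v' => ∃ γ ∈ Γ G R 1, γ • z - z = v ∧ γ • w - w = v'
  have hS : ∀ {a b c d}, S a b → S c d → S (a + c) (b + d) := by
    rintro a b c d ⟨γ, hγ, rfl, rfl⟩ ⟨γ', hγ', rfl, rfl⟩
    exact ⟨γ * γ', mul_mem hγ hγ', diff_mul B hN1 hγ hγ' (Or.inr hz2), diff_mul B hN1 hγ hγ' (Or.inr hw2)⟩
  have S1 : S (4 • z) 0 := by
    obtain ⟨γ, hγ, k1, k2⟩ := step1 _ _ hT hT' hz1 hw1 hne
    exact ⟨γ, hγ, by rw [k2 z rfl, add_sub_cancel_left], by rw [k1 w rfl, sub_self]⟩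
  have S2 : S 0 (4 • w) := by
    obtain ⟨γ, hγ, k1, k2⟩ := step1 _ _ hT' hT hw1 hz1 hne.symm
    exact ⟨γ, hγ, by rw [k1 z rfl, sub_self], by rw [k2 w rfl, add_sub_cancel_left]⟩
  have S3 : S (4 • z) (4 • z) := by
    obtain ⟨γ, hγ, k1, k2⟩ := step1 _ _ hT (add_mem hT hT') hz1 hTs (by simpa using hw1)
    refine ⟨γ, hγ, by rw [k2 z rfl, add_sub_cancel_left], ?_⟩
    have := k1 (z + w) (smul_add _ _ _)
    rw [smul_add, k2 z rfl] at this
    rw [← neg_eq_iff_eq_neg.2 (V_neg hT).symm, eq_comm, neg_eq_iff_add_eq_zero, ← sub_eq_zero.2 this]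
    abel
  have S4 : S (4 • w) (4 • w) := by
    obtain ⟨γ, hγ, k1, k2⟩ := step1 _ _ hT' (add_mem hT hT') hw1 hTs (by simpa using hz1)
    refine ⟨γ, hγ, ?_, by rw [k2 w rfl, add_sub_cancel_left]⟩
    have := k1 (z + w) (smul_add _ _ _)
    rw [smul_add, k2 w rfl] at this
    rw [← neg_eq_iff_eq_neg.2 (V_neg hT').symm, eq_comm, neg_eq_iff_add_eq_zero, ← sub_eq_zero.2 this]
    abel
  have S5 : S 0 (4 • z) := by
    have := hS S1 S3
    rwa [V_add_self hT, zero_add] at this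
  have S6 : S (4 • w) 0 := by
    have := hS S2 S4
    rwa [V_add_self hT', zero_add] at this
  have S0 : S 0 0 := ⟨1, one_mem _, by simp⟩
  have SL : S v 0 := by
    rcases V_cases B hT hT' hz1 hw1 hne hv with rfl | rfl | rfl | rfl
    · exact S0
    · exact S1
    · exact S6
    · simpa using hS S1 S6
  have SR : S 0 v' := by
    rcases V_cases B hT hT' hz1 hw1 hne hv' with rfl | rfl | rfl | rfl
    · exact S0
    · exact S5
    · exact S2
    · simpa using hS S5 S2
  obtain ⟨γ, hγ, hγz, hγw⟩ := hS SL SR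
  rw [add_zero] at hγz
  rw [zero_add] at hγw
  have hd := diff_mem B hN1 hγ (Or.inl hq)
  obtain ⟨γ', hγ', k1, k2, k3⟩ := hconst (u - (γ • q - q)) (sub_mem hu hd)
  refine ⟨γ * γ', mul_mem hγ hγ', ?_, ?_, ?_⟩
  · rw [diff_mul B hN1 hγ hγ' (Or.inr hz2), hγz, k1, add_zero]
  · rw [diff_mul B hN1 hγ hγ' (Or.inr hw2), hγw, k2, add_zero]
  · rw [diff_mul B hN1 hγ hγ' (Or.inl hq), k3]; abel

lemma tripn (H : Arith G R) : ∀ n, n + 2 < N → Trip G R (n + 1) := by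
  intro n
  induction n with
  | zero => intro h; exact trip1 B h H
  | succ n ih => intro h; exact trip_succ B (by omega) (by omega) (ih (by omega))

lemma trans_gen [Fintype G] (wt : ℕ → ℝ) {n : ℕ} (hn : n + 1 < N) (hP : Pair G R n) (c4 : ℝ)
    (h4 : ∀ g : G, Al R n g → Nat.card (U (A := A) n g) = 4 → ∑ γ : Γ G R n, Φ R wt (n+1) (g * γ) = Fintype.card (Γ G R n) * c4) (wt' : ℕ → ℝ) (w1 : wt' 1 = wt 1) (w2 : wt' 2 = wt 1 / 2 + wt 2 / 4) (w4 : wt' 4 = c4) :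
    ∑ g : G, Φ R wt (n+1) g = ∑ g : G, Φ R wt' n g := by
  refine sum_coset (Γ G R n) _ _ fun g => ?_
  by_cases ha : Al R n g
  · rw [Φ, if_pos ha]
    rcases cardU_cases B n (by omega) g with h | h | h
    · rw [h, w1]
      have : ∀ γ : Γ G R n, Φ R wt (n+1) (g * γ) = wt 1 := by
        intro γ
        obtain ⟨k1, k2⟩ := caseS B hn ((Al_mul (g := g) γ.2).2 ha) (by rw [U_mul B (by omega) γ.2]; exact h)
        rw [Φ, if_pos k1, k2]
      rw [Finset.sum_congr rfl fun γ _ => this γ]; simp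
    · rw [h, w2]
      exact sumC B wt hn hP ha h
    · rw [h, w4]; exact h4 g ha h
  · rw [Φ, if_neg ha, mul_zero]
    refine Finset.sum_eq_zero fun γ _ => dead_succ wt ?_
    rwa [Al_mul γ.2]

noncomputable def wφ (k : ℕ) : ℝ := if k = 1 then 1 else if k = 2 then 2/3 else 4/7
noncomputable def wφ0 (k : ℕ) : ℝ := if k = 1 then 1 else if k = 2 then 2/3 else 11/14
def wψ (k : ℕ) : ℝ := if k = 1 then 0 else 1

lemma sumφ [Fintype G] (H : Arith G R) : ∀ n, n + 1 < N → ∑ g : G, Φ R wφ (n+1) g = 179/336 * Fintype.card G := by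
  intro n
  induction n with
  | zero =>
    intro h
    rw [trans_gen B wφ h (pair0 B h H) _ (fun g ha hU => sumI0 B wφ h (pair0 B h H) (hF_of B (by omega) H) ha hU) wφ0
      (by norm_num [wφ, wφ0]) (by norm_num [wφ, wφ0]) (by norm_num [wφ, wφ0]), S0sum B (by omega) H]
    norm_num [wφ0]; ring
  | succ n ih =>
    intro h
    rw [trans_gen B wφ h (trip_pair B (by omega) (tripn B H n (by omega))) _ (fun g ha hU => sumI B wφ h (tripn B H n (by omega)) ha hU) wφ
      (by norm_num [wφ]) (by norm_num [wφ]) (by norm_num [wφ])]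
    exact ih (by omega)

lemma sumψ [Fintype G] (H : Arith G R) : ∀ n, n < N → ∑ g : G, Φ R wψ n g ≤ (1/2)^n * Fintype.card G := by
  have mono : ∀ n, n < N → ∀ wt' : ℕ → ℝ, wt' 1 = 0 → wt' 2 ≤ 1/2 → wt' 4 ≤ 1/2 → ∑ g : G, Φ R wt' n g ≤ 1/2 * ∑ g : G, Φ R wψ n g := by
    intro n hn wt' h1 h2 h4
    rw [Finset.mul_sum]
    refine Finset.sum_le_sum fun g _ => ?_
    unfold Φ
    by_cases ha : Al R n g
    · rw [if_pos ha, if_pos ha]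
      rcases cardU_cases B n hn g with h | h | h <;> rw [h] <;> norm_num [wψ]
      · rw [h1]
      · exact h2
      · exact h4
    · simp [ha]
  intro n
  induction n with
  | zero =>
    intro h
    rw [pow_zero, one_mul]
    calc ∑ g : G, Φ R wψ 0 g ≤ ∑ g : G, (1:ℝ) := Finset.sum_le_sum fun g _ => by
            unfold Φ wψ; split_ifs <;> norm_num
      _ = _ := by simp
  | succ n ih =>
    intro h
    have ih := ih (by omega)
    rw [pow_succ]
    cases n with
    | zero =>
      rw [trans_gen B wψ h (pair0 B h H) _ (fun g ha hU => sumI0 B wψ h (pair0 B h H) (hF_of B (by omega) H) ha hU) (fun k => if k = 1 then 0 else if k = 2 then 1/4 else 1/16)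
        (by norm_num [wψ]) (by norm_num [wψ]) (by norm_num [wψ])]
      have := mono 0 (by omega) (fun k => if k = 1 then 0 else if k = 2 then 1/4 else 1/16) (by norm_num) (by norm_num) (by norm_num)
      linarith
    | succ n =>
      rw [trans_gen B wψ h (trip_pair B (by omega) (tripn B H n (by omega))) _ (fun g ha hU => sumI B wψ h (tripn B H n (by omega)) ha hU) (fun k => if k = 1 then 0 else if k = 2 then 1/4 else 19/64)
        (by norm_num [wψ]) (by norm_num [wψ]) (by norm_num [wψ])]
      have := mono (n+1) (by omega) (fun k => if k = 1 then 0 else if k = 2 then 1/4 else 19/64) (by norm_num) (by norm_num) (by norm_num)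
      linarith

omit B in
lemma card_filter_sum [Fintype G] (P : G → Prop) : (Nat.card {g : G // P g} : ℝ) = ∑ g : G, if P g then (1:ℝ) else 0 := by
  rw [Nat.card_eq_fintype_card, Fintype.card_subtype, Finset.sum_boole]

theorem main [Fintype G] (H : Arith G R) {n : ℕ} (hn : n + 1 < N) :
    (Nat.card {g : G // Al R (n+1) g} : ℝ) ≤ (179/336 + (1/2)^(n+1)) * Nat.card G ∧
    (179/336 - (1/2)^(n+1)) * Nat.card G ≤ (Nat.card {g : G // Al R (n+1) g ∧ Nat.card (U (A := A) (n+1) g) = 1} : ℝ) := by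
  have h1 := sumφ B H n hn
  have h2 := sumψ B H (n+1) hn
  have hG : (Nat.card G : ℝ) = Fintype.card G := by rw [Nat.card_eq_fintype_card]
  rw [card_filter_sum, card_filter_sum, hG]
  have k1 : ∑ g : G, (if Al R (n+1) g then (1:ℝ) else 0) ≤ ∑ g : G, Φ R wφ (n+1) g + ∑ g : G, Φ R wψ (n+1) g := by
    rw [← Finset.sum_add_distrib]
    refine Finset.sum_le_sum fun g _ => ?_
    unfold Φ wφ wψ; split_ifs <;> norm_num
  have k2 : ∑ g : G, Φ R wφ (n+1) g ≤ ∑ g : G, (if Al R (n+1) g ∧ Nat.card (U (A := A) (n+1) g) = 1 then (1:ℝ) else 0) + ∑ g : G, Φ R wψ (n+1) g := by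
    rw [← Finset.sum_add_distrib]
    refine Finset.sum_le_sum fun g _ => ?_
    by_cases ha : Al R (n+1) g
    · by_cases hu : Nat.card (U (A := A) (n+1) g) = 1
      · simp [Φ, wφ, wψ, ha, hu]
      · rw [Φ, Φ, if_pos ha, if_pos ha, if_neg (fun h => hu h.2)]
        unfold wφ wψ
        rw [if_neg hu, if_neg hu]
        split_ifs <;> norm_num
    · simp [Φ, ha]
  refine ⟨by linarith, le_trans (b := ∑ g : G, Φ R wφ (n+1) g - ∑ g : G, Φ R wψ (n+1) g) (by linarith) ?_⟩
  rw [sub_le_iff_le_add]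
  refine k2.trans (le_of_eq ?_)
  congr 1
  exact Finset.sum_congr rfl fun g _ => by congr

end base
end EchoG
end

section
open scoped Classical
namespace EchoE

def Wz : WeierstrassCurve ℤ := ⟨0, 0, 0, -48, 272⟩

class Good (F : Type*) [Field F] : Prop where
  ne : (30 : F) ≠ 0

variable {F K : Type*} [Field F] [Field K]

lemma Good.two [Good F] : (2 : F) ≠ 0 := fun h => Good.ne (F := F) (by rw [show (30:F) = 2 * 15 by norm_num, h, zero_mul])
lemma Good.three [Good F] : (3 : F) ≠ 0 := fun h => Good.ne (F := F) (by rw [show (30:F) = 3 * 10 by norm_num, h, zero_mul])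
lemma Good.five [Good F] : (5 : F) ≠ 0 := fun h => Good.ne (F := F) (by rw [show (30:F) = 5 * 6 by norm_num, h, zero_mul])

instance (priority := 100) [CharZero F] : Good F := ⟨by norm_num⟩

variable (F) in
def Pt : Type _ := (Wz.map (Int.castRingHom F)).toAffine.Point

noncomputable instance : AddCommGroup (Pt F) := inferInstanceAs (AddCommGroup (Wz.map (Int.castRingHom F)).toAffine.Point)

/-- cubic -/
def cub (x : F) : F := x ^ 3 - 48 * x + 272

lemma ns [Good F] {x y : F} (h : y ^ 2 = cub x) : (Wz.map (Int.castRingHom F)).toAffine.Nonsingular x y := by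
  rw [WeierstrassCurve.Affine.nonsingular_iff, WeierstrassCurve.Affine.equation_iff]
  simp only [WeierstrassCurve.map, Wz, cub, eq_intCast] at *
  push_cast at *
  refine ⟨by linear_combination h, ?_⟩
  by_contra hc
  push Not at hc
  obtain ⟨h1, h2⟩ := hc
  have hy : y = 0 := by
    have : 2 * y = 0 := by linear_combination h2
    exact (mul_eq_zero.1 this).resolve_left Good.two
  subst hy
  have h3 : 3 * x ^ 2 = 48 := by linear_combination -h1
  have hx : x ^ 2 = 16 := mul_left_cancel₀ (Good.three (F := F)) (by linear_combination h3)
  have e1 : 32 * x = 272 := by linear_combination h + x * hx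
  have h5 : (2:F) ^ 8 * (225) = 0 := by linear_combination -(32 * x + 272) * e1 + 1024 * hx
  have : (2:F) ^ 8 * (3 ^ 2 * 5 ^ 2) ≠ 0 := mul_ne_zero (pow_ne_zero _ Good.two) (mul_ne_zero (pow_ne_zero _ Good.three) (pow_ne_zero _ Good.five))
  apply this; rw [← h5]; norm_num

def pt [Good F] (x y : F) (h : y ^ 2 = cub x) : Pt F := WeierstrassCurve.Affine.Point.some x y (ns h)

lemma pt_ne_zero [Good F] {x y : F} (h : y ^ 2 = cub x) : pt x y h ≠ 0 := WeierstrassCurve.Affine.Point.some_ne_zero _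

lemma pt_inj [Good F] {x y x' y' : F} {h : y ^ 2 = cub x} {h' : y' ^ 2 = cub x'} : pt x y h = pt x' y' h' ↔ x = x' ∧ y = y' := by
  constructor
  · intro e
    injection e with e1 e2
    exact ⟨e1, e2⟩
  · rintro ⟨rfl, rfl⟩; rfl

lemma pt_cases [Good F] (P : Pt F) : P = 0 ∨ ∃ x y h, P = pt x y h := by
  rcases P with _ | ⟨x, y, h⟩
  · left; rfl
  · right
    refine ⟨x, y, ?_, rfl⟩
    have h1 := h.1
    rw [WeierstrassCurve.Affine.equation_iff] at h1
    simp only [WeierstrassCurve.map, Wz, cub, eq_intCast] at *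
    push_cast at *
    linear_combination h1

lemma neg_pt [Good F] {x y : F} (h : y ^ 2 = cub x) : - pt x y h = pt x (-y) (by rw [neg_sq, h]) := by
  have : (Wz.map (Int.castRingHom F)).toAffine.negY x y = -y := by
    simp [WeierstrassCurve.Affine.negY, Wz]
  unfold pt
  have h2 := WeierstrassCurve.Affine.Point.neg_some (ns h)
  refine h2.trans ?_
  simp only [this]

lemma add_pt [Good F] {x₁ y₁ x₂ y₂ x₃ y₃ : F} (h₁ : y₁ ^ 2 = cub x₁) (h₂ : y₂ ^ 2 = cub x₂) (h₃ : y₃ ^ 2 = cub x₃)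
    (hx : x₁ ≠ x₂) (e1 : (x₃ + x₁ + x₂) * (x₂ - x₁) ^ 2 = (y₂ - y₁) ^ 2)
    (e2 : y₃ * (x₂ - x₁) = (y₂ - y₁) * (x₁ - x₃) - y₁ * (x₂ - x₁)) : pt x₁ y₁ h₁ + pt x₂ y₂ h₂ = pt x₃ y₃ h₃ := by
  unfold pt
  refine (WeierstrassCurve.Affine.Point.add_of_X_ne hx).trans ?_
  have hx' : x₁ - x₂ ≠ 0 := sub_ne_zero.2 hx
  have hX : (Wz.map (Int.castRingHom F)).toAffine.addX x₁ x₂ ((Wz.map (Int.castRingHom F)).toAffine.slope x₁ x₂ y₁ y₂) = x₃ := by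
    rw [WeierstrassCurve.Affine.slope_of_X_ne hx]
    simp only [WeierstrassCurve.Affine.addX, WeierstrassCurve.map, Wz, eq_intCast]
    push_cast
    field_simp
    linear_combination -e1
  have hY : (Wz.map (Int.castRingHom F)).toAffine.addY x₁ x₂ y₁ ((Wz.map (Int.castRingHom F)).toAffine.slope x₁ x₂ y₁ y₂) = y₃ := by
    simp only [WeierstrassCurve.Affine.addY, WeierstrassCurve.Affine.negAddY, WeierstrassCurve.Affine.negY, hX]
    rw [WeierstrassCurve.Affine.slope_of_X_ne hx]
    simp only [WeierstrassCurve.map, Wz, eq_intCast]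
    push_cast
    field_simp
    linear_combination e2
  simp only [hX, hY]

lemma dbl_pt [Good F] {x₁ y₁ x₃ y₃ : F} (h₁ : y₁ ^ 2 = cub x₁) (h₃ : y₃ ^ 2 = cub x₃)
    (hy : y₁ ≠ 0) (e1 : (x₃ + 2 * x₁) * (2 * y₁) ^ 2 = (3 * x₁ ^ 2 - 48) ^ 2)
    (e2 : y₃ * (2 * y₁) = (3 * x₁ ^ 2 - 48) * (x₁ - x₃) - 2 * y₁ ^ 2) : 2 • pt x₁ y₁ h₁ = pt x₃ y₃ h₃ := by
  rw [two_nsmul]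
  unfold pt
  have hn : (Wz.map (Int.castRingHom F)).toAffine.negY x₁ y₁ = -y₁ := by
    simp [WeierstrassCurve.Affine.negY, Wz]
  have h2 := Good.two (F := F)
  have hyn : y₁ ≠ (Wz.map (Int.castRingHom F)).toAffine.negY x₁ y₁ := by
    rw [hn]; intro h
    apply hy
    have : 2 * y₁ = 0 := by linear_combination h
    exact (mul_eq_zero.1 this).resolve_left Good.two
  refine (WeierstrassCurve.Affine.Point.add_self_of_Y_ne hyn).trans ?_
  have hs : (Wz.map (Int.castRingHom F)).toAffine.slope x₁ x₁ y₁ y₁ = (3 * x₁ ^ 2 - 48) / (2 * y₁) := by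
    rw [WeierstrassCurve.Affine.slope_of_Y_ne rfl hyn, hn]
    simp only [WeierstrassCurve.map, Wz, eq_intCast]
    push_cast
    congr 1 <;> ring
  have hX : (Wz.map (Int.castRingHom F)).toAffine.addX x₁ x₁ ((Wz.map (Int.castRingHom F)).toAffine.slope x₁ x₁ y₁ y₁) = x₃ := by
    rw [hs]
    simp only [WeierstrassCurve.Affine.addX, WeierstrassCurve.map, Wz, eq_intCast]
    push_cast
    field_simp
    linear_combination -e1
  have hY : (Wz.map (Int.castRingHom F)).toAffine.addY x₁ x₁ y₁ ((Wz.map (Int.castRingHom F)).toAffine.slope x₁ x₁ y₁ y₁) = y₃ := by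
    simp only [WeierstrassCurve.Affine.addY, WeierstrassCurve.Affine.negAddY, WeierstrassCurve.Affine.negY, hX]
    rw [hs]
    simp only [WeierstrassCurve.map, Wz, eq_intCast]
    push_cast
    field_simp
    linear_combination -e2
  simp only [hX, hY]

lemma dbl_zero [Good F] {x : F} (h : (0:F) ^ 2 = cub x) : 2 • pt x 0 h = 0 := by
  rw [two_nsmul, ← eq_neg_iff_add_eq_zero, neg_pt, pt_inj]; simp

lemma pt_congr [Good F] {x y x' y' : F} {h : y ^ 2 = cub x} {h' : y' ^ 2 = cub x'} (e1 : x = x') (e2 : y = y') : pt x y h = pt x' y' h' :=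
  pt_inj.2 ⟨e1, e2⟩

lemma map_cub (f : F →+* K) {x y : F} (h : y ^ 2 = cub x) : (f y) ^ 2 = cub (f x) := by
  rw [← map_pow, h]; simp only [cub, map_add, map_sub, map_mul, map_pow, map_ofNat]

/-- functoriality -/
noncomputable def pmap (f : F →+* K) : Pt F →+ Pt K :=
  WeierstrassCurve.Affine.Point.map (W' := Wz.toAffine) (S := ℤ) (f.toIntAlgHom)

lemma pmap_pt [Good F] [Good K] (f : F →+* K) {x y : F} (h : y ^ 2 = cub x) : pmap f (pt x y h) = pt (f x) (f y) (map_cub f h) := by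
  rfl

lemma pmap_inj (f : F →+* K) : Function.Injective (pmap f) := WeierstrassCurve.Affine.Point.map_injective ..

end EchoE
end

section
open scoped Classical
namespace EchoE

section cast
variable {p : ℕ} [hp : Fact p.Prime]

def I (p : ℕ) (q : ℚ) : Prop := (q.den : ZMod p) ≠ 0

lemma I_of_dvd {q : ℚ} {m : ℕ} (h : q.den ∣ m) (hm : (m : ZMod p) ≠ 0) : I p q := by
  intro h0
  obtain ⟨k, rfl⟩ := h
  exact hm (by push_cast; rw [h0, zero_mul])

lemma I_mul {a b : ℚ} (ha : I p a) (hb : I p b) : I p (a * b) :=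
  I_of_dvd (Rat.mul_den_dvd a b) (by push_cast; exact mul_ne_zero ha hb)

lemma I_sub {a b : ℚ} (ha : I p a) (hb : I p b) : I p (a - b) :=
  I_of_dvd (Rat.sub_den_dvd a b) (by push_cast; exact mul_ne_zero ha hb)

lemma I_nat (n : ℕ) : I p (n : ℚ) := by simp [I]

lemma I_inv {a : ℚ} (ha : ¬ (p : ℤ) ∣ a.num) : I p a⁻¹ := by
  have h0 : a ≠ 0 := by rintro rfl; simp at ha
  rw [I, Rat.den_inv_of_ne_zero h0]
  intro h
  apply ha
  rw [ZMod.natCast_eq_zero_iff] at h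
  exact Int.natCast_dvd.2 h

lemma cast_zero_iff {a : ℚ} (ha : I p a) : ((a : ZMod p) = 0) ↔ (p : ℤ) ∣ a.num := by
  rw [Rat.cast_def, div_eq_zero_iff, or_iff_left ha, ZMod.intCast_zmod_eq_zero_iff_dvd]

lemma echo_rec (n : ℕ) : echo (n + 4) = (echo (n + 3) * echo (n + 1) - (if 3 ∣ (n + 4) then 3 else 1) * echo (n + 2) ^ 2) / echo n := by
  rw [echo]

def cc (n : ℕ) : ℕ := if 3 ∣ n then 3 else 1

lemma echo_rec' (n : ℕ) : echo (n + 4) = (echo (n + 3) * echo (n + 1) - (cc (n+4) : ℚ) * (echo (n + 2) * echo (n + 2))) * (echo n)⁻¹ := by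
  rw [echo_rec, cc, div_eq_mul_inv, sq]; push_cast; rfl

lemma I_echo (h2 : (2 : ZMod p) ≠ 0) : ∀ n, (∀ m < n, ¬ (p : ℤ) ∣ (echo m).num) → I p (echo n) := by
  intro n
  induction n using Nat.strong_induction_on with
  | _ n ih =>
    intro h
    match n, ih, h with
    | 0, _, _ => have := I_nat (p := p) 1; simpa [echo] using this
    | 1, _, _ => have := I_nat (p := p) 1; simpa [echo] using this
    | 2, _, _ => have := I_nat (p := p) 2; simpa [echo] using this
    | 3, _, _ => have := I_nat (p := p) 1; simpa [echo] using this
    | n + 4, ih, h =>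
      have k : ∀ m < n + 4, I p (echo m) := fun m hm => ih m hm fun j hj => h j (by omega)
      rw [echo_rec']
      exact I_mul (I_sub (I_mul (k _ (by omega)) (k _ (by omega))) (I_mul (I_nat _) (I_mul (k _ (by omega)) (k _ (by omega))))) (I_inv (h n (by omega)))

lemma beta_rec (h2 : (2 : ZMod p) ≠ 0) (n : ℕ) (h : ∀ m < n + 4, ¬ (p : ℤ) ∣ (echo m).num) :
    (echo (n + 4) : ZMod p) * (echo n : ZMod p) = (echo (n+3) : ZMod p) * (echo (n+1) : ZMod p) - (cc (n+4) : ZMod p) * (echo (n+2) : ZMod p)^2 := by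
  have k : ∀ m ≤ n + 4, I p (echo m) := fun m hm => I_echo h2 m fun j hj => h j (by omega)
  have e : echo (n+4) * echo n = echo (n + 3) * echo (n + 1) - (cc (n+4) : ℚ) * (echo (n + 2) * echo (n + 2)) := by
    rw [echo_rec', inv_mul_cancel_right₀]
    intro h0; apply h n (by omega); rw [h0]; simp
  have e2 := congrArg (fun q : ℚ => (q : ZMod p)) e
  beta_reduce at e2
  have i1 := I_mul (k (n+3) (by omega)) (k (n+1) (by omega))
  have i2 := I_mul (k (n+2) (by omega)) (k (n+2) (by omega))
  rw [Rat.cast_mul_of_ne_zero (k _ (by omega)) (k _ (by omega)), Rat.cast_sub_of_ne_zero i1 (I_mul (I_nat _) i2),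
    Rat.cast_mul_of_ne_zero (k _ (by omega)) (k _ (by omega)), Rat.cast_mul_of_ne_zero (show (((cc (n+4) : ℕ) : ℚ).den : ZMod p) ≠ 0 from I_nat _) i2,
    Rat.cast_mul_of_ne_zero (k _ (by omega)) (k _ (by omega)), ← sq] at e2
  rw [e2]; push_cast; rfl
end cast

section F
variable {F : Type*} [Field F] [Good F]

noncomputable def RR (F : Type*) [Field F] [Good F] : Pt F := pt 16 60 (by norm_num [cub])
noncomputable def SS (F : Type*) [Field F] [Good F] : Pt F := pt 4 12 (by norm_num [cub])

lemma two_RR : 2 • RR F = SS F := by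
  have h60 : (60 : F) ≠ 0 := by rw [show (60:F) = 2 * 30 by norm_num]; exact mul_ne_zero Good.two Good.ne
  exact dbl_pt _ _ h60 (by norm_num) (by norm_num)

/-- chord addition existence -/
lemma add_exists {x₁ y₁ x₂ y₂ : F} (h₁ : y₁ ^ 2 = cub x₁) (h₂ : y₂ ^ 2 = cub x₂) (hx : x₁ ≠ x₂) :
    ∃ x₃ y₃ h₃, pt x₁ y₁ h₁ + pt x₂ y₂ h₂ = pt x₃ y₃ h₃ ∧ (x₃ + x₁ + x₂) * (x₂ - x₁) ^ 2 = (y₂ - y₁) ^ 2 := by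
  have hx' : x₂ - x₁ ≠ 0 := sub_ne_zero.2 hx.symm
  let l := (y₂ - y₁) / (x₂ - x₁)
  have hl : l * (x₂ - x₁) = y₂ - y₁ := by simp only [l]; field_simp
  have h3 : (l * (x₁ - (l ^ 2 - x₁ - x₂)) - y₁) ^ 2 = cub (l ^ 2 - x₁ - x₂) := by
    apply mul_right_cancel₀ hx'
    have hy : y₂ = y₁ + l * (x₂ - x₁) := by rw [hl]; ring
    rw [hy] at h₂
    unfold cub at *
    generalize l = l at *
    have h4 : (x₂ - x₁) * (2 * y₁ * l + l^2 * (x₂ - x₁)) = (x₂ - x₁) * (x₂^2 + x₁ * x₂ + x₁^2 - 48) := by linear_combination h₂ - h₁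
    have h5 := mul_left_cancel₀ hx' h4
    linear_combination (x₂ - x₁) * h₁ - (x₂ - x₁) * (2 * x₁ + x₂ - l^2) * h5
  refine ⟨_, _, h3, add_pt _ _ _ hx ?_ ?_, ?_⟩
  · rw [← hl]; ring
  · rw [← hl]; ring
  · rw [← hl]; ring

/-- the key relation for adding and subtracting `S` -/
lemma key_rel {x y a b a' b' : F} (h : y ^ 2 = cub x) (ha : b ^ 2 = cub a) (ha' : b' ^ 2 = cub a') (hx : x ≠ 4)
    (e1 : pt x y h + SS F = pt a b ha) (e2 : pt a' b' ha' + SS F = pt x y h) : (a - 4) * (a' - 4) * (x - 4)^2 = -576 * (x - 4 + 12) := by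
  have h4 : (12 : F) ^ 2 = cub 4 := by norm_num [cub]
  obtain ⟨x₃, y₃, h₃, k1, k2⟩ := add_exists h h4 hx
  have e1' : pt x₃ y₃ h₃ = pt a b ha := by rw [← k1]; exact e1
  obtain ⟨rfl, rfl⟩ := pt_inj.1 e1'
  have e3 : pt x y h + pt 4 (-12) (by norm_num [cub]) = pt a' b' ha' := by
    rw [← e2, ← neg_pt h4]; exact add_neg_cancel_right _ _
  obtain ⟨x₄, y₄, h₄, k3, k4⟩ := add_exists h (y₂ := -12) (x₂ := 4) (by norm_num [cub]) hx
  rw [k3] at e3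
  obtain ⟨rfl, rfl⟩ := pt_inj.1 e3
  have hx' : (x - 4) ^ 2 ≠ 0 := pow_ne_zero _ (sub_ne_zero.2 hx)
  apply mul_right_cancel₀ hx'
  have l1 : (x₃ - 4) * (x - 4) ^ 2 = 24 * (12 - y) := by
    unfold cub at h; linear_combination k2 + h
  have l2 : (x₄ - 4) * (x - 4) ^ 2 = 24 * (12 + y) := by
    unfold cub at h; linear_combination k4 + h
  calc _ = ((x₃ - 4) * (x - 4) ^ 2) * ((x₄ - 4) * (x - 4) ^ 2) := by ring
    _ = _ := by rw [l1, l2]; unfold cub at h; linear_combination -576 * h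

def lam (n : ℕ) : F := if n % 3 = 1 then -4 else -12

lemma main_ind (β : ℕ → F) (N : ℕ) (b0 : β 0 = 1) (b1 : β 1 = 1) (b2 : β 2 = 2) (b3 : β 3 = 1)
    (hne : ∀ m ≤ N, β m ≠ 0) (hrec : ∀ m, m + 4 ≤ N + 1 → β (m+4) * β m = β (m+3) * β (m+1) - (cc (m+4) : F) * β (m+2) ^ 2) :
    ∀ n, n + 2 ≤ N → ∃ x y h a b h', (2 * (n + 1) + 1) • RR F = pt x y h ∧ (2 * (n + 2) + 1) • RR F = pt a b h' ∧
      (x - 4) * β (n+1) ^ 2 = lam (n+1) * (β (n+2) * β n) ∧ (a - 4) * β (n+2) ^ 2 = lam (n+2) * (β (n+3) * β (n+1)) := by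
  have n2 := Good.two (F := F)
  have n3 := Good.three (F := F)
  have stepS : ∀ n, (2 * (n + 1) + 1) • RR F = (2 * n + 1) • RR F + SS F := by
    intro n; rw [← two_RR, ← add_smul]; congr 1
  have hS : SS F = pt 4 12 (by norm_num [cub]) := rfl
  intro n
  induction n with
  | zero =>
    intro h
    have h12 : (16 : F) ≠ 4 := by
      rw [← sub_ne_zero]; rw [show (16:F) - 4 = 2 * 2 * 3 by norm_num]; exact mul_ne_zero (mul_ne_zero n2 n2) n3
    have e3 : (2 * (0 + 1) + 1) • RR F = pt (-4 : F) 20 (by norm_num [cub]) := by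
      rw [stepS, hS]
      simp only [mul_zero, zero_add, one_smul]
      exact add_pt _ _ _ h12 (by norm_num) (by norm_num)
    have h44 : (-4 : F) ≠ 4 := by
      rw [← sub_ne_zero]; rw [show (-4:F) - 4 = -(2 * 2 * 2) by norm_num]; exact neg_ne_zero.2 (mul_ne_zero (mul_ne_zero n2 n2) n2)
    have e5 : (2 * (0 + 2) + 1) • RR F = pt (1 : F) (-15) (by norm_num [cub]) := by
      rw [show 0 + 2 = 1 + 1 by rfl, stepS, hS]
      rw [zero_add] at e3
      rw [e3]
      exact add_pt _ _ _ h44 (by norm_num) (by norm_num)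
    refine ⟨_, _, _, _, _, _, e3, e5, ?_, ?_⟩
    · simp only [zero_add, b0, b1, b2, lam]; norm_num
    · simp only [zero_add, b1, b2, b3, lam]; norm_num
  | succ n ih =>
    intro h
    obtain ⟨x, y, hxy, a, b, hab, e1, e2, k1, k2⟩ := ih (by omega)
    have m0 := hne n (by omega)
    have m1 := hne (n+1) (by omega)
    have m2 := hne (n+2) (by omega)
    have m3 := hne (n+3) (by omega)
    have lne : ∀ j, (lam j : F) ≠ 0 := by
      intro j; unfold lam; split_ifs
      · rw [show (-4:F) = -(2 * 2) by norm_num]; exact neg_ne_zero.2 (mul_ne_zero n2 n2)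
      · rw [show (-12:F) = -(2 * 2 * 3) by norm_num]; exact neg_ne_zero.2 (mul_ne_zero (mul_ne_zero n2 n2) n3)
    have ha : a - 4 ≠ 0 := by
      intro h0; rw [h0, zero_mul] at k2
      exact (mul_ne_zero (lne _) (mul_ne_zero m3 m1)) k2.symm
    have hx : x - 4 ≠ 0 := by
      intro h0; rw [h0, zero_mul] at k1
      exact (mul_ne_zero (lne _) (mul_ne_zero m2 m0)) k1.symm
    obtain ⟨u, v, huv, e3, -⟩ := add_exists hab (x₂ := 4) (y₂ := 12) (by norm_num [cub]) (sub_ne_zero.1 ha)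
    have e4 : (2 * (n + 2 + 1) + 1) • RR F = pt u v huv := by rw [stepS, e2, ← e3]; rfl
    refine ⟨_, _, _, _, _, _, e2, e4, k2, ?_⟩
    have rel := key_rel hab huv hxy (sub_ne_zero.1 ha) e3 (by rw [← e1, ← e2]; exact (stepS (n+1)).symm)
    have rc := hrec n (by omega)
    -- lam relations
    have l1 : (lam (n+1) * lam (n+2) * lam (n+3) : F) = -576 := by
      unfold lam
      have : n % 3 = 0 ∨ n % 3 = 1 ∨ n % 3 = 2 := by omega
      rcases this with h | h | h
      · rw [if_pos (by omega), if_neg (by omega), if_neg (by omega)]; norm_num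
      · rw [if_neg (by omega), if_neg (by omega), if_pos (by omega)]; norm_num
      · rw [if_neg (by omega), if_pos (by omega), if_neg (by omega)]; norm_num
    have l2 : (lam (n+2) * (cc (n+4) : F)) = -12 := by
      unfold lam cc
      by_cases h3 : 3 ∣ n + 4
      · rw [if_pos h3, if_pos (by omega)]; norm_num
      · rw [if_neg h3, if_neg (by omega)]; norm_num
    show (u - 4) * β (n+3) ^ 2 = lam (n+3) * (β (n+4) * β (n+2))
    have lA := lne (n+2)
    have lX := lne (n+1)
    generalize (lam (n+1) : F) = L1 at *
    generalize (lam (n+2) : F) = L2 at *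
    generalize (lam (n+3) : F) = L3 at *
    have hK : L1 * L2 ^ 2 * β n * β (n+2) * β (n+1) ^ 2 ≠ 0 := by
      have := pow_ne_zero 2 lA
      have := pow_ne_zero 2 m1
      simp [*]
    apply mul_right_cancel₀ hK
    calc _ = (u - 4) * (L2 * (β (n+3) * β (n+1)))^2 * (L1 * (β (n+2) * β n)) := by ring
      _ = ((u - 4) * (x - 4) * (a - 4)^2) * β (n+2)^4 * β (n+1)^2 := by rw [← k1, ← k2]; ring
      _ = -576 * β (n+1)^2 * β (n+2)^2 * (L2 * (β (n+3) * β (n+1)) + 12 * β (n+2)^2) := by rw [rel, ← k2]; ring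
      _ = -576 * β (n+1)^2 * β (n+2)^2 * L2 * (β (n+4) * β n) := by rw [rc]; linear_combination 576 * β (n+1)^2 * β (n+2)^4 * (-l2)
      _ = _ := by rw [← l1]; ring

end F

theorem echo_iff (p : ℕ) [Fact p.Prime] [Good (ZMod p)] :
    (∃ n, (p : ℤ) ∣ (echo n).num) ↔ ∃ m : ℕ, (2 * m + 1) • RR (ZMod p) = 0 := by
  have n2 := Good.two (F := ZMod p)
  have nd0 : ¬ (p : ℤ) ∣ (echo 0).num := by
    have : echo 0 = 1 := by rw [echo]
    rw [this]; intro h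
    have h1 : (p : ℤ) ∣ 1 := by simpa using h
    have h2 := Int.eq_one_of_dvd_one (by positivity) h1
    exact (Fact.out : p.Prime).one_lt.ne' (by exact_mod_cast h2)
  have nd1 : ¬ (p : ℤ) ∣ (echo 1).num := by
    have : echo 1 = echo 0 := by rw [echo, echo]
    rw [this]; exact nd0
  have nd3 : ¬ (p : ℤ) ∣ (echo 3).num := by
    have : echo 3 = echo 0 := by rw [echo, echo]
    rw [this]; exact nd0
  have nd2 : ¬ (p : ℤ) ∣ (echo 2).num := by
    have e : echo 2 = (2 : ℕ) := by rw [echo]; norm_num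
    intro h
    rw [← cast_zero_iff (p := p) (by rw [e]; exact I_nat 2), e] at h
    exact n2 (by simpa using h)
  let β : ℕ → ZMod p := fun n => (echo n : ZMod p)
  have b0 : β 0 = 1 := by simp [β, echo]
  have b1 : β 1 = 1 := by simp [β, echo]
  have b2 : β 2 = 2 := by simp [β, echo]
  have b3 : β 3 = 1 := by simp [β, echo]
  have hb : ∀ N, (∀ m ≤ N, ¬ (p : ℤ) ∣ (echo m).num) → ∀ m ≤ N, β m ≠ 0 := by
    intro N hN m hm h0
    exact hN m hm ((cast_zero_iff (I_echo n2 m fun j hj => hN j (by omega))).1 h0)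
  have hr : ∀ N, (∀ m ≤ N, ¬ (p : ℤ) ∣ (echo m).num) → ∀ m, m + 4 ≤ N + 1 → β (m+4) * β m = β (m+3) * β (m+1) - (cc (m+4) : ZMod p) * β (m+2) ^ 2 := by
    intro N hN m hm
    exact beta_rec n2 m fun j hj => hN j (by omega)
  constructor
  · intro hex
    let n := Nat.find hex
    have hn : (p : ℤ) ∣ (echo n).num := Nat.find_spec hex
    have hlt : ∀ m < n, ¬ (p : ℤ) ∣ (echo m).num := fun m hm => Nat.find_min hex hm
    have h4 : 4 ≤ n := by
      by_contra hc
      have : n = 0 ∨ n = 1 ∨ n = 2 ∨ n = 3 := by omega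
      rcases this with h | h | h | h <;> rw [h] at hn <;> contradiction
    obtain ⟨k, hk⟩ : ∃ k, n = k + 3 := ⟨n - 3, by omega⟩
    have hN : ∀ m ≤ k + 2, ¬ (p : ℤ) ∣ (echo m).num := fun m hm => hlt m (by omega)
    obtain ⟨x, y, h, a, b, h', -, e2, -, k2⟩ := main_ind β (k+2) b0 b1 b2 b3 (hb _ hN) (hr _ hN) k le_rfl
    have hz : β (k+3) = 0 := by
      rw [← hk]; exact (cast_zero_iff (I_echo n2 n hlt)).2 hn
    rw [hz, zero_mul, mul_zero] at k2
    have ha : a = 4 := by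
      have := (mul_eq_zero.1 k2).resolve_right (pow_ne_zero 2 (hb _ hN _ le_rfl))
      exact sub_eq_zero.1 this
    subst ha
    have hb2 : (b - 12) * (b + 12) = 0 := by unfold cub at h'; linear_combination h'
    rcases mul_eq_zero.1 hb2 with hb' | hb'
    · have : b = 12 := sub_eq_zero.1 hb'
      subst this
      refine ⟨k + 1, ?_⟩
      have e3 : (2 * (k + 1) + 1) • RR (ZMod p) + 2 • RR (ZMod p) = 0 + 2 • RR (ZMod p) := by
        rw [← add_smul, zero_add, two_RR]; exact e2
      exact add_right_cancel e3
    · have : b = -12 := eq_neg_of_add_eq_zero_left hb'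
      subst this
      refine ⟨k + 3, ?_⟩
      rw [show 2 * (k + 3) + 1 = (2 * (k+2) + 1) + 2 by ring, add_smul, e2, two_RR]
      rw [← neg_neg (SS (ZMod p)), SS, neg_pt, add_neg_cancel]
  · rintro ⟨m, hm⟩
    by_contra hc
    push Not at hc
    rcases m with _ | m
    · simp only [mul_zero, zero_add, one_smul] at hm
      exact pt_ne_zero _ hm
    · obtain ⟨x, y, h, a, b, h', e1, -, -, k2⟩ := main_ind β (m+2) b0 b1 b2 b3 (hb _ fun m _ => hc m) (hr _ fun m _ => hc m) m le_rfl
      rw [hm] at e1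
      exact pt_ne_zero _ e1.symm

end EchoE
end

section
open scoped Classical
namespace EchoE

variable {F K : Type*} [Field F] [Field K] [Good F] [Good K]

lemma sing {x : F} (h : cub x = 0) (h1 : 3 * x ^ 2 - 48 = 0) : False := by
  unfold cub at h
  have hx : x ^ 2 = 16 := mul_left_cancel₀ (Good.three (F := F)) (by linear_combination h1)
  have e1 : 32 * x = 272 := by linear_combination -h + x * hx
  have h5 : (2:F) ^ 8 * (225) = 0 := by linear_combination -(32 * x + 272) * e1 + 1024 * hx
  have : (2:F) ^ 8 * (3 ^ 2 * 5 ^ 2) ≠ 0 := mul_ne_zero (pow_ne_zero _ Good.two) (mul_ne_zero (pow_ne_zero _ Good.three) (pow_ne_zero _ Good.five))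
  apply this; rw [← h5]; norm_num

lemma dbl_exists {x y : F} (h : y ^ 2 = cub x) (hy : y ≠ 0) :
    ∃ x₃ y₃ h₃, 2 • pt x y h = pt x₃ y₃ h₃ ∧ (x₃ + 2 * x) * (2 * y) ^ 2 = (3 * x ^ 2 - 48) ^ 2 ∧
     y₃ * (2 * y) = (3 * x ^ 2 - 48) * (x - x₃) - 2 * y ^ 2 := by
  have h2 := Good.two (F := F)
  let l := (3 * x ^ 2 - 48) / (2 * y)
  have hl : l * (2 * y) = 3 * x ^ 2 - 48 := by simp only [l]; field_simp
  have h3 : (l * (x - (l ^ 2 - 2 * x)) - y) ^ 2 = cub (l ^ 2 - 2 * x) := by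
    generalize l = l at *
    unfold cub at *
    linear_combination h + (l^2 - 3 * x) * hl
  refine ⟨_, _, h3, dbl_pt _ _ hy ?_ ?_, ?_, ?_⟩ <;> rw [← hl] <;> ring

lemma dbl_inv {x y x' y' : F} {h : y ^ 2 = cub x} {h' : y' ^ 2 = cub x'} (e : 2 • pt x y h = pt x' y' h') :
    y ≠ 0 ∧ (x' + 2 * x) * (2 * y) ^ 2 = (3 * x ^ 2 - 48) ^ 2 ∧
     y' * (2 * y) = (3 * x ^ 2 - 48) * (x - x') - 2 * y ^ 2 := by
  have hy : y ≠ 0 := by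
    rintro rfl
    rw [dbl_zero] at e
    exact pt_ne_zero _ e.symm
  obtain ⟨x₃, y₃, h₃, k, k1, k2⟩ := dbl_exists h hy
  rw [k] at e
  obtain ⟨rfl, rfl⟩ := pt_inj.1 e
  exact ⟨hy, k1, k2⟩

lemma dbl_quartic {x y x' y' : F} {h : y ^ 2 = cub x} {h' : y' ^ 2 = cub x'} (e : 2 • pt x y h = pt x' y' h') :
    x^4 + 96 * x^2 - 2176 * x + 2304 - 4 * x' * (x^3 - 48 * x + 272) = 0 := by
  obtain ⟨-, k1, -⟩ := dbl_inv e
  unfold cub at h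
  linear_combination -k1 + 4 * (x' + 2 * x) * h

lemma two_tors {P : Pt F} (h : 2 • P = 0) : P = 0 ∨ ∃ e, ∃ he : (0:F)^2 = cub e, P = pt e 0 he := by
  rcases pt_cases P with rfl | ⟨x, y, hxy, rfl⟩
  · left; rfl
  · right
    by_cases hy : y = 0
    · subst hy; exact ⟨x, hxy, rfl⟩
    · obtain ⟨x₃, y₃, h₃, k, -⟩ := dbl_exists hxy hy
      rw [k] at h
      exact absurd h (pt_ne_zero _)

/-- the three roots of the cubic -/
structure Spl (e1 e2 e3 : F) : Prop where
  s1 : e1 + e2 + e3 = 0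
  s2 : e1 * e2 + e1 * e3 + e2 * e3 = -48
  s3 : e1 * e2 * e3 = -272

namespace Spl
variable {e1 e2 e3 : F}

lemma fac (S : Spl e1 e2 e3) (x : F) : cub x = (x - e1) * (x - e2) * (x - e3) := by
  unfold cub; linear_combination x^2 * S.s1 - x * S.s2 + S.s3

lemma rot (S : Spl e1 e2 e3) : Spl e2 e3 e1 :=
  ⟨by linear_combination S.s1, by linear_combination S.s2, by linear_combination S.s3⟩

lemma swap (S : Spl e1 e2 e3) : Spl e1 e3 e2 :=
  ⟨by linear_combination S.s1, by linear_combination S.s2, by linear_combination S.s3⟩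

lemma root (S : Spl e1 e2 e3) : cub e1 = 0 := by rw [S.fac]; ring

lemma der (S : Spl e1 e2 e3) : 3 * e1 ^ 2 - 48 = (e1 - e2) * (e1 - e3) := by
  linear_combination 2 * e1 * S.s1 - S.s2

lemma ne (S : Spl e1 e2 e3) : e1 ≠ e2 := by
  rintro rfl
  exact sing S.root (by rw [S.der]; ring)

lemma roots (S : Spl e1 e2 e3) {x : F} (h : cub x = 0) : x = e1 ∨ x = e2 ∨ x = e3 := by
  rw [S.fac, mul_eq_zero, mul_eq_zero, sub_eq_zero, sub_eq_zero, sub_eq_zero, or_assoc] at h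
  exact h

lemma map (S : Spl e1 e2 e3) (f : F →+* K) : Spl (f e1) (f e2) (f e3) :=
  ⟨by have := congrArg f S.s1; simpa using this, by have := congrArg f S.s2; simpa [map_ofNat f] using this, by have := congrArg f S.s3; simpa [map_ofNat f] using this⟩

end Spl

/-- two torsion point -/
noncomputable def tw (e : F) (h : cub e = 0) : Pt F := pt e 0 (by rw [h]; ring)

lemma two_tw (e : F) (h : cub e = 0) : 2 • tw e h = 0 := dbl_zero _

lemma tw_ne (e : F) (h : cub e = 0) : tw e h ≠ 0 := pt_ne_zero _

lemma tw_inj {e e' : F} {h : cub e = 0} {h' : cub e' = 0} : tw e h = tw e' h' ↔ e = e' := by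
  unfold tw; rw [pt_inj]; simp

lemma Spl.tors {e1 e2 e3 : F} (S : Spl e1 e2 e3) (P : Pt F) :
    2 • P = 0 ↔ P = 0 ∨ P = tw e1 S.root ∨ P = tw e2 S.rot.root ∨ P = tw e3 S.rot.rot.root := by
  constructor
  · intro h
    rcases two_tors h with h | ⟨e, he, rfl⟩
    · left; exact h
    · right
      have : cub e = 0 := by rw [← he]; ring
      rcases S.roots this with rfl | rfl | rfl
      · left; rfl
      · right; left; rfl
      · right; right; rfl
  · rintro (rfl | rfl | rfl | rfl)
    · simp
    all_goals exact two_tw _ _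

/-- addition of 2-torsion point -/
lemma add_tw {x y e : F} (h : y ^ 2 = cub x) (he : cub e = 0) (hx : x ≠ e) :
    ∃ x' y' h', pt x y h + tw e he = pt x' y' h' ∧ (x - e) * (x' - e) = 3 * e^2 - 48 ∧
      y' * (x - e)^2 = -(3 * e^2 - 48) * y := by
  have hx' : x - e ≠ 0 := sub_ne_zero.2 hx
  let x' := e + (3 * e^2 - 48) / (x - e)
  let y' := -(3 * e^2 - 48) * y / (x - e)^2
  have k1 : (x - e) * (x' - e) = 3 * e^2 - 48 := by simp only [x']; field_simp; ring
  have k2 : y' * (x - e)^2 = -(3 * e^2 - 48) * y := by simp only [y']; field_simp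
  have k3 : y' * (x - e) = -(x' - e) * y := by
    apply mul_right_cancel₀ hx'
    linear_combination k2 + y * k1
  have hc : cub x = (x - e) * ((x-e)^2 + 3 * e * (x - e) + 3 * e^2 - 48) := by
    unfold cub at *; linear_combination he
  have hc' : cub x' = (x' - e) * ((x'-e)^2 + 3 * e * (x' - e) + 3 * e^2 - 48) := by
    unfold cub at *; linear_combination he
  have h' : y' ^ 2 = cub x' := by
    have : (x - e)^2 ≠ 0 := pow_ne_zero _ hx'
    apply mul_right_cancel₀ this
    calc y'^2 * (x - e)^2 = (y' * (x - e))^2 := by ring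
      _ = (x' - e)^2 * y^2 := by rw [k3]; ring
      _ = _ := by
        rw [h, hc, hc']
        generalize x' - e = b at *
        generalize x - e = a at *
        linear_combination -(b^2 * a - b * a^2) * k1
  refine ⟨x', y', h', ?_, k1, k2⟩
  unfold tw
  apply add_pt _ _ _ hx
  · apply mul_right_cancel₀ (show (1:F) ≠ 0 from one_ne_zero)
    rw [show (0 - y)^2 = y^2 by ring, h, hc]
    linear_combination (x - e) * k1
  · linear_combination -k3

section closed
variable [IsAlgClosed F]

lemma exists_spl : ∃ e1 e2 e3 : F, Spl e1 e2 e3 := by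
  obtain ⟨e1, h1⟩ : ∃ e : F, cub e = 0 := by
    let P : Polynomial F := .X ^ 3 - .C 48 * .X + .C 272
    have hd : P.degree ≠ 0 := by
      have : P.degree = 3 := by simp only [P]; compute_degree!
      rw [this]; norm_num
    obtain ⟨x, hx⟩ := IsAlgClosed.exists_root P hd
    exact ⟨x, by simpa [P, Polynomial.IsRoot, cub] using hx⟩
  have n2 := Good.two (F := F)
  obtain ⟨d, hd⟩ := IsAlgClosed.exists_pow_nat_eq (192 - 3 * e1^2) (n := 2) (by norm_num)
  refine ⟨e1, (-e1 + d)/2, (-e1 - d)/2, ?_, ?_, ?_⟩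
  · field_simp; ring
  · field_simp; linear_combination -hd
  · unfold cub at h1; field_simp; linear_combination 4 * h1 - e1 * hd

lemma exists_half (Q : Pt F) : ∃ Q', 2 • Q' = Q := by
  rcases pt_cases Q with rfl | ⟨x', y', h', rfl⟩
  · exact ⟨0, by simp⟩
  have n2 := Good.two (F := F)
  obtain ⟨x, hx⟩ : ∃ x : F, x^4 + 96 * x^2 - 2176 * x + 2304 - 4 * x' * (x^3 - 48 * x + 272) = 0 := by
    let P : Polynomial F := .X ^ 4 + .C 96 * .X^2 - .C 2176 * .X + .C 2304 - .C (4 * x') * (.X^3 - .C 48 * .X + .C 272)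
    have hd : P.degree ≠ 0 := by
      have : P.degree = 4 := by simp only [P]; compute_degree!
      rw [this]; norm_num
    obtain ⟨x, hx⟩ := IsAlgClosed.exists_root P hd
    exact ⟨x, by simpa [P, Polynomial.IsRoot] using hx⟩
  obtain ⟨y, hy⟩ := IsAlgClosed.exists_pow_nat_eq (cub x) (n := 2) (by norm_num)
  have hy0 : y ≠ 0 := by
    rintro rfl
    have hc : cub x = 0 := by rw [← hy]; ring
    apply sing hc
    unfold cub at hc
    have : (3 * x^2 - 48)^2 = 0 := by linear_combination hx + (4 * x' + 8 * x) * hc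
    exact pow_eq_zero_iff (by norm_num) |>.1 this
  obtain ⟨x₃, y₃, h₃, k, k1, k2⟩ := dbl_exists hy hy0
  have : x₃ = x' := by
    have h4 : (2 * y)^2 ≠ 0 := pow_ne_zero _ (mul_ne_zero n2 hy0)
    apply mul_right_cancel₀ h4
    unfold cub at hy
    linear_combination k1 + hx - (4 * x' + 8 * x) * hy
  subst this
  have : (y₃ - y') * (y₃ + y') = 0 := by linear_combination h₃ - h'
  rcases mul_eq_zero.1 this with h | h
  · exact ⟨_, k.trans (pt_congr rfl (sub_eq_zero.1 h))⟩
  · refine ⟨- pt x y hy, ?_⟩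
    rw [smul_neg, k, neg_pt]
    exact pt_congr rfl (by linear_combination -h)

end closed

lemma pmap_comp {M : Type*} [Field M] [Good M] (f : F →+* K) (g : K →+* M) (P : Pt F) : pmap g (pmap f P) = pmap (g.comp f) P := by
  rcases pt_cases P with rfl | ⟨x, y, h, rfl⟩
  · simp
  · rfl

lemma pmap_id (P : Pt F) : pmap (RingHom.id F) P = P := by
  rcases pt_cases P with rfl | ⟨x, y, h, rfl⟩
  · simp
  · rfl

lemma pmap_RR (f : F →+* K) : pmap f (RR F) = RR K := by
  unfold RR; rw [pmap_pt]; exact pt_congr (map_ofNat f _) (map_ofNat f _)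

lemma pmap_SS (f : F →+* K) : pmap f (SS F) = SS K := by
  unfold SS; rw [pmap_pt]; exact pt_congr (map_ofNat f _) (map_ofNat f _)

lemma pmap_tw (f : F →+* K) (e : F) (h : cub e = 0) : pmap f (tw e h) = tw (f e) (by rw [← zero_pow (two_ne_zero), ← map_zero f, map_cub f (x := e)]; rw [h]; ring) := by
  unfold tw; rw [pmap_pt]; exact pt_congr rfl (by simp)

end EchoE
end

section
open scoped Classical
namespace EchoE

lemma finite_tors (F : Type*) [Field F] [Good F] [IsAlgClosed F] : {Q : Pt F | 2 • Q = 0}.Finite := by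
  obtain ⟨e1, e2, e3, S⟩ := exists_spl (F := F)
  refine ((Set.finite_singleton (0 : Pt F)).union (Set.toFinite ({tw e1 S.root, tw e2 S.rot.root, tw e3 S.rot.rot.root} : Set (Pt F)))).subset ?_
  intro Q hQ
  have := (S.tors Q).1 hQ
  simp only [Set.mem_union, Set.mem_singleton_iff, Set.mem_insert_iff]
  exact this

lemma finite_fib (F : Type*) [Field F] [Good F] [IsAlgClosed F] (k : ℕ) (R : Pt F) : {Q : Pt F | 2 ^ k • Q = R}.Finite := by
  induction k with
  | zero => simp
  | succ k ih =>
    have : {Q : Pt F | 2 ^ (k+1) • Q = R} = (fun Q : Pt F => 2 • Q) ⁻¹' {Q : Pt F | 2 ^ k • Q = R} := by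
      ext Q; simp only [Set.mem_ofPred_eq, Set.mem_preimage, pow_succ, mul_smul]
    rw [this]
    refine Set.Finite.preimage' ih fun b _ => ?_
    by_cases h : ∃ Q₀ : Pt F, 2 • Q₀ = b
    · obtain ⟨Q₀, rfl⟩ := h
      refine ((finite_tors F).image (fun T => Q₀ + T)).subset ?_
      intro Q hQ
      refine ⟨Q - Q₀, ?_, by simp⟩
      have hQ : 2 • Q = 2 • Q₀ := hQ
      simp only [Set.mem_ofPred_eq, smul_sub, hQ, sub_self]
    · convert Set.finite_empty
      ext Q
      simp only [Set.mem_preimage, Set.mem_singleton_iff, Set.mem_empty_iff_false, iff_false]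
      exact fun hQ => h ⟨Q, hQ⟩

abbrev QQbar := AlgebraicClosure ℚ

lemma qqbar_closure : IsAlgClosure ℚ QQbar := by
  have h : @IsAlgClosure ℚ (AlgebraicClosure ℚ) _ _ (AlgebraicClosure.instAlgebra ℚ) _ := inferInstance
  convert h using 1
  exact Subsingleton.elim _ _

theorem exists_L (N : ℕ) : ∃ (L : Type) (_ : Field L) (_ : NumberField L) (_ : IsGalois ℚ L),
    (∃ e1 e2 e3 : L, Spl e1 e2 e3) ∧
    ∀ k < N, ∀ Q : Pt L, (2 ^ k • Q = 0 ∨ 2 ^ k • Q = RR L) → ∃ Q', 2 • Q' = Q := by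
  let P : Set (Pt QQbar) := ⋃ k : Fin (N+2), ({Q | 2 ^ (k:ℕ) • Q = 0} ∪ {Q | 2 ^ (k:ℕ) • Q = RR QQbar})
  have hP : P.Finite := Set.finite_iUnion fun k => (finite_fib QQbar k 0).union (finite_fib QQbar k (RR QQbar))
  let S : Set QQbar := ⋃ Q ∈ P, {x | (∃ y h, Q = pt x y h) ∨ ∃ y h, Q = pt y x h}
  have hS : S.Finite := by
    refine hP.biUnion fun Q _ => ?_
    rcases pt_cases Q with rfl | ⟨x, y, h, rfl⟩
    · convert Set.finite_empty
      ext x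
      simp only [Set.mem_ofPred_eq, Set.mem_empty_iff_false, iff_false]
      rintro (⟨y, h, h1⟩ | ⟨z, h2, h1⟩) <;> exact pt_ne_zero _ h1.symm
    · refine (Set.toFinite {x, y}).subset ?_
      rintro z (⟨y', h', h1⟩ | ⟨z, h2, h1⟩)
      · left; exact (pt_inj.1 h1).1.symm
      · right; exact (pt_inj.1 h1).2.symm
  have hcl := qqbar_closure
  have halg : Algebra.IsAlgebraic ℚ QQbar := IsAlgClosure.isAlgebraic
  have hno : Normal ℚ QQbar := IsAlgClosure.normal ℚ QQbar
  let K0 : IntermediateField ℚ QQbar := IntermediateField.adjoin ℚ S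
  have hK0 : FiniteDimensional ℚ K0 := by
    have : Finite S := hS
    exact IntermediateField.finiteDimensional_adjoin fun x _ => Algebra.IsIntegral.isIntegral x
  let L : IntermediateField ℚ QQbar := IntermediateField.normalClosure ℚ K0 QQbar
  have hle : K0 ≤ L := IntermediateField.le_normalClosure K0
  have hfin : FiniteDimensional ℚ L := normalClosure.is_finiteDimensional ℚ K0 QQbar
  have hnorm : Normal ℚ L := normalClosure.normal ℚ K0 QQbar
  have hnf : NumberField L := ⟨⟩
  have hgal : IsGalois ℚ L := ⟨⟩
  have hdesc : ∀ Q ∈ P, ∃ Q' : Pt L, pmap (algebraMap L QQbar) Q' = Q := by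
    intro Q hQ
    rcases pt_cases Q with rfl | ⟨x, y, h, rfl⟩
    · exact ⟨0, map_zero _⟩
    · have hx : x ∈ L := hle (IntermediateField.subset_adjoin _ _ (Set.mem_biUnion hQ (Or.inl ⟨y, h, rfl⟩)))
      have hy : y ∈ L := hle (IntermediateField.subset_adjoin _ _ (Set.mem_biUnion hQ (Or.inr ⟨_, _, rfl⟩)))
      refine ⟨pt ⟨x, hx⟩ ⟨y, hy⟩ (Subtype.ext h), rfl⟩
  refine ⟨L, inferInstance, hnf, hgal, ?_, ?_⟩
  · obtain ⟨e1, e2, e3, S⟩ := exists_spl (F := QQbar)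
    have : ∀ e : QQbar, cub e = 0 → ∃ e' : L, (e' : QQbar) = e := by
      intro e he
      obtain ⟨Q', hQ'⟩ := hdesc (tw e he) (Set.mem_iUnion.2 ⟨1, Or.inl (by simpa using two_tw e he)⟩)
      rcases pt_cases Q' with rfl | ⟨x, y, h, rfl⟩
      · rw [map_zero] at hQ'; exact absurd hQ'.symm (tw_ne _ _)
      · rw [pmap_pt, tw, pt_inj] at hQ'
        exact ⟨x, hQ'.1⟩
    obtain ⟨e1, rfl⟩ := this e1 S.root
    obtain ⟨e2, rfl⟩ := this e2 S.rot.root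
    obtain ⟨e3, rfl⟩ := this e3 S.rot.rot.root
    refine ⟨e1, e2, e3, ?_, ?_, ?_⟩
    · exact Subtype.ext S.s1
    · exact Subtype.ext S.s2
    · exact Subtype.ext S.s3
  · intro k hk Q hQ
    obtain ⟨Q', hQ'⟩ := exists_half (pmap (algebraMap L QQbar) Q)
    have hmem : Q' ∈ P := by
      refine Set.mem_iUnion.2 ⟨⟨k + 1, by omega⟩, ?_⟩
      simp only [Set.mem_union, Set.mem_ofPred_eq, pow_succ, mul_smul, hQ']
      rw [← map_nsmul]
      rcases hQ with h | h
      · left; rw [h, map_zero]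
      · right; rw [h, pmap_RR]
    obtain ⟨Q'', rfl⟩ := hdesc Q' hmem
    refine ⟨Q'', pmap_inj (algebraMap L QQbar) ?_⟩
    rw [map_nsmul, hQ']

section action
variable {L : Type} [Field L] [NumberField L]

noncomputable instance : DistribMulAction Gal(L/ℚ) (Pt L) where
  smul σ P := pmap (σ : L →+* L) P
  one_smul P := pmap_id P
  mul_smul σ τ P := (pmap_comp (τ : L →+* L) (σ : L →+* L) P).symm
  smul_zero σ := map_zero _
  smul_add σ := map_add _

lemma smul_def (σ : Gal(L/ℚ)) (P : Pt L) : σ • P = pmap (σ : L →+* L) P := rfl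

lemma smul_pt (σ : Gal(L/ℚ)) {x y : L} (h : y ^ 2 = cub x) : σ • pt x y h = pt (σ x) (σ y) (map_cub (σ : L →+* L) h) := rfl

lemma smul_RR (σ : Gal(L/ℚ)) : σ • RR L = RR L := pmap_RR _

lemma Spl.cardV {e1 e2 e3 : L} (S : Spl e1 e2 e3) : Nat.card (EchoG.V (Pt L)) = 4 := by
  have : (EchoG.V (Pt L) : Set (Pt L)) = (({0, tw e1 S.root, tw e2 S.rot.root, tw e3 S.rot.rot.root} : Finset (Pt L)) : Set (Pt L)) := by
    ext Q
    rw [SetLike.mem_coe, EchoG.mem_V, S.tors]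
    simp
  have h2 : Nat.card (EchoG.V (Pt L)) = Set.ncard (EchoG.V (Pt L) : Set (Pt L)) := rfl
  rw [h2, this, Set.ncard_coe_finset]
  have n12 := S.ne
  have n23 := S.rot.ne
  have n31 := S.rot.rot.ne
  rw [Finset.card_insert_of_notMem, Finset.card_insert_of_notMem, Finset.card_insert_of_notMem, Finset.card_singleton]
  · simp [tw_inj, n23]
  · simp [tw_inj, n12, n31.symm]
  · simp [(tw_ne _ _).symm]

lemma base_of {N : ℕ} {e1 e2 e3 : L} (S : Spl e1 e2 e3) (hh : ∀ k < N, ∀ Q : Pt L, (2 ^ k • Q = 0 ∨ 2 ^ k • Q = RR L) → ∃ Q', 2 • Q' = Q) :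
    EchoG.Base Gal(L/ℚ) (RR L) N := ⟨smul_RR, S.cardV, hh⟩

end action
end EchoE
end

section
open scoped Classical
open NumberField
namespace EchoE

section red
variable {L : Type} [Field L] [NumberField L] {k : Type*} [Field k] [Good k] (α : 𝓞 L →+* k)

lemma ok_eq {x y : 𝓞 L} (h : (y : L) ^ 2 = cub (x : L)) : y ^ 2 = x ^ 3 - 48 * x + 272 := by
  unfold cub at h
  apply RingOfIntegers.ext
  simpa [map_ofNat] using h

lemma red_eq {x y : 𝓞 L} (h : (y : L) ^ 2 = cub (x : L)) : (α y) ^ 2 = cub (α x) := by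
  have := congrArg α (ok_eq h)
  simp only [map_add, map_sub, map_mul, map_pow, map_ofNat] at this
  exact this

def Red (Q : Pt L) (Q' : Pt k) : Prop := ∃ (x y : 𝓞 L) (h : (y : L) ^ 2 = cub (x : L)), Q = pt (x : L) (y : L) h ∧ Q' = pt (α x) (α y) (red_eq α h)

variable {α}

lemma Red.fun {Q : Pt L} {Q1 Q2 : Pt k} (h1 : Red α Q Q1) (h2 : Red α Q Q2) : Q1 = Q2 := by
  obtain ⟨x, y, h, rfl, rfl⟩ := h1
  obtain ⟨x', y', h', e, rfl⟩ := h2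
  obtain ⟨e1, e2⟩ := pt_inj.1 e
  have e1' : x = x' := RingOfIntegers.ext e1
  have e2' : y = y' := RingOfIntegers.ext e2
  exact pt_congr (by rw [e1']) (by rw [e2'])

lemma isInt_of_sq {y : L} {c : 𝓞 L} (h : y ^ 2 = (c : L)) : ∃ y' : 𝓞 L, (y' : L) = y := by
  have : IsIntegral ℤ (y ^ 2) := by rw [h]; exact RingOfIntegers.isIntegral_coe c
  exact ⟨⟨y, IsIntegral.of_pow (by norm_num) this⟩, rfl⟩

lemma isInt_of_quartic {x : L} {c : 𝓞 L} (h : x^4 + 96 * x^2 - 2176 * x + 2304 - 4 * (c : L) * (x^3 - 48 * x + 272) = 0) : ∃ y' : 𝓞 L, (y' : L) = x := by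
  have hi : IsIntegral (𝓞 L) x := by
    let P : Polynomial (𝓞 L) := .X ^ 4 + .C 96 * .X^2 - .C 2176 * .X + .C 2304 - .C (4 * c) * (.X^3 - .C 48 * .X + .C 272)
    refine ⟨P, ?_, ?_⟩
    · simp only [P]; monicity!
    · simp only [P, Polynomial.eval₂_sub, Polynomial.eval₂_add, Polynomial.eval₂_mul, Polynomial.eval₂_pow, Polynomial.eval₂_X, Polynomial.eval₂_C, Polynomial.eval₂_ofNat, map_mul, map_ofNat]
      exact h
  exact ⟨⟨x, isIntegral_trans (A := 𝓞 L) x hi⟩, rfl⟩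

def IsI (Q : Pt L) : Prop := ∃ (x y : 𝓞 L) (h : (y : L) ^ 2 = cub (x : L)), Q = pt (x : L) (y : L) h

lemma isI_RR : IsI (RR L) := ⟨16, 60, by rw [show ((60 : 𝓞 L) : L) = 60 from map_ofNat _ _, show ((16 : 𝓞 L) : L) = 16 from map_ofNat _ _]; norm_num [cub], pt_congr (map_ofNat (algebraMap (𝓞 L) L) 16).symm (map_ofNat (algebraMap (𝓞 L) L) 60).symm⟩

lemma red_RR : Red α (RR L) (RR k) := ⟨16, 60, by rw [show ((60 : 𝓞 L) : L) = 60 from map_ofNat _ _, show ((16 : 𝓞 L) : L) = 16 from map_ofNat _ _]; norm_num [cub], pt_congr (map_ofNat (algebraMap (𝓞 L) L) 16).symm (map_ofNat (algebraMap (𝓞 L) L) 60).symm,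
   pt_congr (map_ofNat α 16).symm (map_ofNat α 60).symm⟩

lemma isInt_cub (x : 𝓞 L) : cub (x : L) = ((x ^ 3 - 48 * x + 272 : 𝓞 L) : L) := by
  simp [cub, map_ofNat]

lemma isI_half {Q : Pt L} (h : IsI (2 • Q)) : IsI Q := by
  obtain ⟨x', y', h', e⟩ := h
  rcases pt_cases Q with rfl | ⟨x, y, h, rfl⟩
  · rw [smul_zero] at e; exact absurd e.symm (pt_ne_zero _)
  obtain ⟨x, rfl⟩ := isInt_of_quartic (dbl_quartic e)
  obtain ⟨y, rfl⟩ := isInt_of_sq (h.trans (isInt_cub x))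
  exact ⟨x, y, h, rfl⟩

lemma isI_XB {B : Pt L} (hB : IsI B) {j : ℕ} : ∀ {Q : Pt L}, 2 ^ j • Q = B → IsI Q := by
  induction j with
  | zero => intro Q h; rw [pow_zero, one_smul] at h; rw [h]; exact hB
  | succ j ih => intro Q h; exact isI_half (ih (by rw [smul_smul, ← pow_succ, h]))

lemma isI_X {j : ℕ} {Q : Pt L} (h : 2 ^ j • Q = RR L) : IsI Q := isI_XB isI_RR h

lemma red_dbl {x y x' y' : 𝓞 L} {h : (y : L) ^ 2 = cub (x : L)} {h' : (y' : L) ^ 2 = cub (x' : L)}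
    (e : 2 • pt (x : L) y h = pt (x' : L) y' h') : α y ≠ 0 ∧ 2 • pt (α x) (α y) (red_eq α h) = pt (α x') (α y') (red_eq α h') := by
  obtain ⟨-, k1, k2⟩ := dbl_inv e
  have k1' : (x' + 2 * x) * (2 * y) ^ 2 = (3 * x ^ 2 - 48) ^ 2 := by
    apply RingOfIntegers.ext; simpa [map_ofNat] using k1
  have k2' : y' * (2 * y) = (3 * x ^ 2 - 48) * (x - x') - 2 * y ^ 2 := by
    apply RingOfIntegers.ext; simpa [map_ofNat] using k2
  have j1 := congrArg α k1'
  have j2 := congrArg α k2'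
  simp only [map_add, map_sub, map_mul, map_pow, map_ofNat] at j1 j2
  have hy : α y ≠ 0 := by
    intro h0
    have hc := red_eq α h
    rw [h0] at hc j1
    refine sing (x := α x) (by rw [← hc]; ring) ?_
    have : (3 * (α x) ^ 2 - 48) ^ 2 = 0 := by rw [← j1]; ring
    exact pow_eq_zero_iff (by norm_num) |>.1 this
  exact ⟨hy, dbl_pt _ _ hy j1 j2⟩

lemma red_double {Q : Pt L} {Q' : Pt k} (hr : Red α Q Q') (hi : IsI (2 • Q)) : Red α (2 • Q) (2 • Q') := by
  obtain ⟨x, y, h, rfl, rfl⟩ := hr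
  obtain ⟨x', y', h', e⟩ := hi
  exact ⟨x', y', h', e, (red_dbl e).2⟩

lemma red_powB {B : Pt L} (hB : IsI B) {j i : ℕ} : ∀ {Q : Pt L} {Q' : Pt k} (_ : 2 ^ (i + j) • Q = B) (_ : Red α Q Q'), Red α (2 ^ j • Q) (2 ^ j • Q') := by
  induction j with
  | zero => intro Q Q' _ h; simpa using h
  | succ j ih =>
    intro Q Q' h hr
    have hi : IsI (2 • Q) := isI_XB hB (j := i + j) (by rw [smul_smul, ← pow_succ]; exact h)
    have := ih (Q := 2 • Q) (Q' := 2 • Q') (by rw [smul_smul, ← pow_succ]; exact h) (red_double hr hi)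
    rwa [smul_smul, smul_smul, ← pow_succ] at this

lemma red_pow {j i : ℕ} {Q : Pt L} {Q' : Pt k} (h : 2 ^ (i + j) • Q = RR L) (h' : Red α Q Q') : Red α (2 ^ j • Q) (2 ^ j • Q') :=
  red_powB isI_RR h h'

lemma red_add {x y e : 𝓞 L} {h : (y : L) ^ 2 = cub (x : L)} (he : cub (e : L) = 0) (he' : cub (α e) = 0)
    (hy : α y ≠ 0) (hi : IsI (pt (x : L) y h + tw (e : L) he)) :
    Red α (pt (x : L) y h + tw (e : L) he) (pt (α x) (α y) (red_eq α h) + tw (α e) he') := by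
  have hxk : α x ≠ α e := by
    intro h0
    have := red_eq α h
    rw [h0, he'] at this
    exact hy (pow_eq_zero_iff (by norm_num) |>.1 this)
  have hx : (x : L) ≠ e := by
    intro h0
    have : x = e := RingOfIntegers.ext h0
    exact hxk (by rw [this])
  obtain ⟨x', y', h', e'⟩ := hi
  obtain ⟨x1, y1, h1, l1, l2, l3⟩ := add_tw h he hx
  rw [l1] at e'
  obtain ⟨rfl, rfl⟩ := pt_inj.1 e'
  obtain ⟨x2, y2, h2, m1, m2, m3⟩ := add_tw (red_eq α h) he' hxk
  have l2' : (x - e) * (x' - e) = 3 * e^2 - 48 := by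
    apply RingOfIntegers.ext; simpa [map_ofNat] using l2
  have l3' : y' * (x - e)^2 = -(3 * e^2 - 48) * y := by
    apply RingOfIntegers.ext; simpa [map_ofNat] using l3
  have j2 := congrArg α l2'
  have j3 := congrArg α l3'
  simp only [map_neg, map_sub, map_mul, map_pow, map_ofNat] at j2 j3
  refine ⟨x', y', h', l1, ?_⟩
  rw [m1]
  have hd : α x - α e ≠ 0 := sub_ne_zero.2 hxk
  refine pt_congr ?_ ?_
  · apply mul_left_cancel₀ hd; linear_combination m2 - j2
  · apply mul_right_cancel₀ (pow_ne_zero 2 hd); linear_combination m3 - j3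

/-- 2-torsion of `L` integral -/
lemma isInt_root {e : L} (h : cub e = 0) : ∃ e' : 𝓞 L, (e' : L) = e := by
  have hi : IsIntegral ℤ e := by
    let P : Polynomial ℤ := .X ^ 3 - .C 48 * .X + .C 272
    refine ⟨P, ?_, ?_⟩
    · simp only [P]; monicity!
    · simp only [P, Polynomial.eval₂_sub, Polynomial.eval₂_add, Polynomial.eval₂_mul, Polynomial.eval₂_pow, Polynomial.eval₂_X, Polynomial.eval₂_C, Polynomial.eval₂_ofNat, map_mul, map_ofNat]
      exact h
  exact ⟨⟨e, hi⟩, rfl⟩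

lemma red_root {e : 𝓞 L} (h : cub (e : L) = 0) : cub (α e) = 0 := by
  have : (e ^ 3 - 48 * e + 272 : 𝓞 L) = 0 := by
    apply RingOfIntegers.ext; rw [← isInt_cub]; simpa using h
  have := congrArg α this
  simp only [map_add, map_sub, map_mul, map_pow, map_ofNat, map_zero] at this
  exact this

lemma red_yB {B : Pt L} (hB : IsI B) {j : ℕ} {x y : 𝓞 L} {h : (y : L) ^ 2 = cub (x : L)} (hQ : 2 ^ (j+1) • pt (x:L) y h = B) : α y ≠ 0 := by
  obtain ⟨x', y', h', e⟩ := isI_XB hB (j := j) (Q := 2 • pt (x:L) y h) (by rw [smul_smul, ← pow_succ, hQ])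
  exact (red_dbl e).1

lemma red_uniqB {B : Pt L} (hB : IsI B) {j : ℕ} : ∀ {Q1 Q2 : Pt L} {Q' : Pt k}, 2 ^ j • Q1 = B → 2 ^ j • Q2 = B → Red α Q1 Q' → Red α Q2 Q' → Q1 = Q2 := by
  induction j with
  | zero => intro Q1 Q2 Q' h1 h2 _ _; simp only [pow_zero, one_smul] at h1 h2; rw [h1, h2]
  | succ j ih =>
    intro Q1 Q2 Q' h1 h2 r1 r2
    have d1 : 2 ^ j • (2 • Q1) = B := by rw [smul_smul, ← pow_succ, h1]
    have d2 : 2 ^ j • (2 • Q2) = B := by rw [smul_smul, ← pow_succ, h2]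
    have e := ih d1 d2 (red_double r1 (isI_XB hB d1)) (red_double r2 (isI_XB hB d2))
    have ht : 2 • (Q2 - Q1) = 0 := by rw [smul_sub, e, sub_self]
    rcases two_tors ht with h0 | ⟨t, ht0, hT⟩
    · exact (sub_eq_zero.1 h0).symm
    have htc : cub t = 0 := by rw [← ht0]; ring
    obtain ⟨t, rfl⟩ := isInt_root htc
    have hT' : Q2 - Q1 = tw (t : L) htc := hT
    have hQ2 : Q2 = Q1 + tw (t : L) htc := by rw [← hT']; abel
    obtain ⟨x, y, h, rfl, rfl⟩ := r1
    rw [hQ2] at r2 h2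
    have := (red_add htc (red_root htc) (red_yB hB h1) (isI_XB hB h2)).fun r2
    exact absurd (by simpa using this) (tw_ne (α t) (red_root htc))

lemma red_y {j : ℕ} {x y : 𝓞 L} {h : (y : L) ^ 2 = cub (x : L)} (hQ : 2 ^ (j+1) • pt (x:L) y h = RR L) : α y ≠ 0 := red_yB isI_RR hQ

lemma red_uniq {j : ℕ} {Q1 Q2 : Pt L} {Q' : Pt k} (h1 : 2 ^ j • Q1 = RR L) (h2 : 2 ^ j • Q2 = RR L) (h3 : Red α Q1 Q') (h4 : Red α Q2 Q') : Q1 = Q2 :=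
  red_uniqB isI_RR h1 h2 h3 h4

lemma isI_red {Q : Pt L} (h : IsI Q) : ∃ Q' : Pt k, Red α Q Q' := by
  obtain ⟨x, y, h, rfl⟩ := h
  exact ⟨_, x, y, h, rfl, rfl⟩

lemma isI_tw {e : L} (h : cub e = 0) : IsI (tw e h) := by
  obtain ⟨e, rfl⟩ := isInt_root h
  exact ⟨e, 0, by rw [h]; simp, pt_congr rfl (by simp)⟩

lemma red_tw {e : 𝓞 L} (h : cub (e : L) = 0) : Red α (tw (e : L) h) (tw (α e) (red_root h)) :=
  ⟨e, 0, by rw [h]; simp, pt_congr rfl (by simp), pt_congr rfl (by simp)⟩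

lemma Spl.red {e1 e2 e3 : 𝓞 L} (S : Spl (e1 : L) (e2 : L) (e3 : L)) (α : 𝓞 L →+* k) : Spl (α e1) (α e2) (α e3) := by
  have s1 : e1 + e2 + e3 = 0 := by apply RingOfIntegers.ext; simpa using S.s1
  have s2 : e1 * e2 + e1 * e3 + e2 * e3 = -48 := by apply RingOfIntegers.ext; simpa [map_ofNat] using S.s2
  have s3 : e1 * e2 * e3 = -272 := by apply RingOfIntegers.ext; simpa [map_ofNat] using S.s3
  refine ⟨?_, ?_, ?_⟩
  · have := congrArg α s1; simpa using this
  · have := congrArg α s2; simpa [map_ofNat α] using this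
  · have := congrArg α s3; simpa [map_ofNat α] using this

lemma Spl.int {e1 e2 e3 : L} (S : Spl e1 e2 e3) : ∃ a b c : 𝓞 L, (a : L) = e1 ∧ (b : L) = e2 ∧ (c : L) = e3 := by
  obtain ⟨a, ha⟩ := isInt_root S.root
  obtain ⟨b, hb⟩ := isInt_root S.rot.root
  obtain ⟨c, hc⟩ := isInt_root S.rot.rot.root
  exact ⟨a, b, c, ha, hb, hc⟩

variable {N : ℕ} {e1 e2 e3 : L} (S : Spl e1 e2 e3) (hh : ∀ k < N, ∀ Q : Pt L, (2 ^ k • Q = 0 ∨ 2 ^ k • Q = RR L) → ∃ Q', 2 • Q' = Q)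

include S hh in
lemma red_lift {j : ℕ} (hj : j ≤ N) : ∀ {Q' : Pt k}, 2 ^ j • Q' = RR k → ∃ Q, 2 ^ j • Q = RR L ∧ Red α Q Q' := by
  obtain ⟨e1, e2, e3, rfl, rfl, rfl⟩ := S.int
  induction j with
  | zero => intro Q' h; rw [pow_zero, one_smul] at h; exact ⟨RR L, by simp, by rw [h]; exact red_RR⟩
  | succ j ih =>
    intro Q' h
    obtain ⟨P, hP, rP⟩ := ih (by omega) (Q' := 2 • Q') (by rw [smul_smul, ← pow_succ, h])
    obtain ⟨Q, hQ⟩ := hh j (by omega) P (Or.inr hP)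
    have hQ1 : 2 ^ (j+1) • Q = RR L := by rw [pow_succ, mul_smul, hQ, hP]
    obtain ⟨x, y, hxy, rfl⟩ := isI_X hQ1
    have r0 : Red α (pt (x : L) y hxy) (pt (α x) (α y) (red_eq α hxy)) := ⟨x, y, hxy, rfl, rfl⟩
    have r1 := red_double r0 (by rw [hQ]; exact isI_X hP)
    rw [hQ] at r1
    have e2' := r1.fun rP
    have ht : 2 • (Q' - pt (α x) (α y) (red_eq α hxy)) = 0 := by rw [smul_sub, e2', sub_self]
    have key : ∀ (e : 𝓞 L) (he : cub (e : L) = 0), Q' - pt (α x) (α y) (red_eq α hxy) = tw (α e) (red_root he) → ∃ Q, 2 ^ (j+1) • Q = RR L ∧ Red α Q Q' := by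
      intro e he h0
      have hQ2 : 2 ^ (j+1) • (pt (x : L) y hxy + tw (e : L) he) = RR L := by
        rw [smul_add, hQ1, pow_succ, mul_smul, two_tw, smul_zero, add_zero]
      refine ⟨_, hQ2, ?_⟩
      have := red_add he (red_root he) (red_y (α := α) hQ1) (isI_X hQ2)
      rw [← h0, add_sub_cancel] at this
      exact this
    rcases ((S.red α).tors _).1 ht with h0 | h0 | h0 | h0
    · rw [sub_eq_zero.1 h0]; exact ⟨_, hQ1, r0⟩
    · exact key e1 S.root h0
    · exact key e2 S.rot.root h0
    · exact key e3 S.rot.rot.root h0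

end red
end EchoE
end

section
open scoped Classical
open NumberField
namespace EchoE

lemma good_closure (p : ℕ) [Fact p.Prime] [Good (ZMod p)] : Good (AlgebraicClosure (ZMod p)) := by
  refine ⟨fun h => Good.ne (F := ZMod p) ?_⟩
  apply (algebraMap (ZMod p) (AlgebraicClosure (ZMod p))).injective
  rw [map_ofNat, h, map_zero]

lemma finite_pt (F : Type*) [Field F] [Good F] [Finite F] : Finite (Pt F) := by
  let f : Option {z : F × F // z.2 ^ 2 = cub z.1} → Pt F := fun o => match o with
    | none => 0
    | some z => pt z.1.1 z.1.2 z.2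
  refine Finite.of_surjective f fun P => ?_
  rcases pt_cases P with rfl | ⟨x, y, h, rfl⟩
  · exact ⟨none, rfl⟩
  · exact ⟨some ⟨(x, y), h⟩, rfl⟩

section frob
variable {L : Type} [Field L] [NumberField L] {p : ℕ} [Fact p.Prime] [Good (ZMod p)] [Good (AlgebraicClosure (ZMod p))]
  {α : 𝓞 L →+* AlgebraicClosure (ZMod p)} {σ : Gal(L/ℚ)} (hα : ∀ x, α x ^ p = α (σ • x))

include hα in
lemma red_frob {Q : Pt L} {Q' : Pt (AlgebraicClosure (ZMod p))} (h : Red α Q Q') : Red α (σ • Q) (pmap (frobenius _ p) Q') := by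
  obtain ⟨x, y, h, rfl, rfl⟩ := h
  refine ⟨σ • x, σ • y, map_cub (σ : L →+* L) h, rfl, ?_⟩
  rw [pmap_pt]
  exact pt_congr (hα x) (hα y)

omit [Good (ZMod p)] in
lemma frob_fix (P : Pt (ZMod p)) [Good (ZMod p)] : pmap (frobenius _ p) (pmap (algebraMap (ZMod p) (AlgebraicClosure (ZMod p))) P) = pmap (algebraMap _ _) P := by
  rcases pt_cases P with rfl | ⟨x, y, h, rfl⟩
  · simp
  · rw [pmap_pt, pmap_pt]
    exact pt_congr (by rw [frobenius_def, ← map_pow, ZMod.pow_card]) (by rw [frobenius_def, ← map_pow, ZMod.pow_card])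

lemma fix_frob {Q : Pt (AlgebraicClosure (ZMod p))} (h : pmap (frobenius _ p) Q = Q) : ∃ P : Pt (ZMod p), pmap (algebraMap _ _) P = Q := by
  rcases pt_cases Q with rfl | ⟨x, y, hxy, rfl⟩
  · exact ⟨0, map_zero _⟩
  · rw [pmap_pt, pt_inj] at h
    obtain ⟨a, rfl⟩ := EchoF.pow_p_mem p x h.1
    obtain ⟨b, rfl⟩ := EchoF.pow_p_mem p y h.2
    have hab : b ^ 2 = cub a := by
      apply (algebraMap (ZMod p) (AlgebraicClosure (ZMod p))).injective
      rw [map_pow, hxy]; simp [cub, map_ofNat]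
    exact ⟨pt a b hab, pmap_pt _ _⟩

variable {N : ℕ} {e1 e2 e3 : L} (S : Spl e1 e2 e3) (hh : ∀ k < N, ∀ Q : Pt L, (2 ^ k • Q = 0 ∨ 2 ^ k • Q = RR L) → ∃ Q', 2 • Q' = Q)

include S hh hα in
lemma lift_fix {j : ℕ} (hj : j ≤ N) {P : Pt (ZMod p)} (hP : 2 ^ j • P = RR _) :
    ∃ Q, 2 ^ j • Q = RR L ∧ σ • Q = Q ∧ Red α Q (pmap (algebraMap _ _) P) := by
  obtain ⟨Q, hQ, r⟩ := red_lift (α := α) S hh hj (Q' := pmap (algebraMap _ _) P) (by rw [← map_nsmul, hP, pmap_RR])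
  refine ⟨Q, hQ, ?_, r⟩
  have r2 := red_frob hα r
  rw [frob_fix] at r2
  refine red_uniq (j := j) ?_ hQ r2 r
  rw [← EchoG.smul_nsmul, hQ, smul_RR]

include S hh hα in
lemma squeeze1 {n : ℕ} (hn : n + 1 ≤ N) (h : ∃ m : ℕ, (2 * m + 1) • RR (ZMod p) = 0) : EchoG.Al (RR L) n σ := by
  obtain ⟨m, hm⟩ := h
  obtain ⟨P, hP⟩ : ∃ P : Pt (ZMod p), 2 ^ (n+1) • P = RR _ := by
    -- 2 = m+1 inverse
    have h1 : 2 • ((m+1) • RR (ZMod p)) = RR (ZMod p) := by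
      rw [smul_smul, show 2 * (m+1) = (2 * m + 1) + 1 by ring, add_smul, hm, one_smul, zero_add]
    refine ⟨(m+1)^(n+1) • RR (ZMod p), ?_⟩
    generalize n + 1 = j
    induction j with
    | zero => simp
    | succ j ih =>
      calc _ = 2 ^ j • ((m+1)^j • (2 • ((m+1) • RR (ZMod p)))) := by simp only [smul_smul]; congr 1; ring
        _ = _ := by rw [h1, ih]
  obtain ⟨Q, hQ, hs, -⟩ := lift_fix hα S hh hn hP
  exact ⟨Q, hQ, hs⟩

include S hh hα in
lemma squeeze2 {n : ℕ} (hn : n + 1 ≤ N) (hA : EchoG.Al (RR L) n σ) (hU : Nat.card (EchoG.U (A := Pt L) n σ) = 1) :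
    ∃ m : ℕ, (2 * m + 1) • RR (ZMod p) = 0 := by
  obtain ⟨q, hq, hqs⟩ := hA
  -- reduce
  obtain ⟨x, y, hxy, rfl⟩ := isI_X hq
  have r0 : Red α (pt (x : L) y hxy) (pt (α x) (α y) (red_eq α hxy)) := ⟨x, y, hxy, rfl, rfl⟩
  have r1 := red_frob hα r0
  rw [hqs] at r1
  obtain ⟨P, hP⟩ := fix_frob (r1.fun r0)
  rw [← hP] at r0
  have hPR : 2 ^ (n+1) • P = RR (ZMod p) := by
    apply pmap_inj (algebraMap (ZMod p) (AlgebraicClosure (ZMod p)))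
    have := red_pow (i := 0) (j := n+1) (by simpa using hq) r0
    rw [hq] at this
    rw [map_nsmul, pmap_RR]
    exact this.fun red_RR
  by_contra hc
  push Not at hc
  have := finite_pt (ZMod p)
  have ho : addOrderOf P ≠ 0 := (addOrderOf_pos P).ne'
  obtain ⟨a, m, hm, hom⟩ := Nat.exists_eq_two_pow_mul_odd ho
  obtain ⟨m', rfl⟩ := hm
  let w := (2 * m' + 1) • P
  have hw1 : 2 ^ (n+1) • w ≠ 0 := by
    simp only [w]; rw [smul_comm, hPR]; exact hc m'
  have hw2 : ∃ a, 2 ^ a • w = 0 := ⟨a, by simp only [w]; rw [smul_smul, ← hom, addOrderOf_nsmul_eq_zero]⟩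
  let b := Nat.find hw2
  have hb : 2 ^ b • w = 0 := Nat.find_spec hw2
  have hb' : ∀ c < b, 2 ^ c • w ≠ 0 := fun c hc => Nat.find_min hw2 hc
  have hbn : n + 1 < b := by
    by_contra hlt
    apply hw1
    obtain ⟨d, hd⟩ := Nat.exists_eq_add_of_le (show b ≤ n + 1 by omega)
    rw [hd, pow_add, mul_comm, mul_smul, hb, smul_zero]
  obtain ⟨d, hd⟩ := Nat.exists_eq_add_of_lt hbn
  let z := 2 ^ (d + 1) • w
  have hz1 : 2 ^ (n+1) • z = 0 := by
    simp only [z]; rw [smul_smul, ← pow_add, show n + 1 + (d + 1) = b by omega, hb]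
  have hz2 : 2 ^ n • z ≠ 0 := by
    simp only [z]; rw [smul_smul, ← pow_add]; exact hb' _ (by omega)
  obtain ⟨Q1, hQ1, hs1, s1⟩ := lift_fix hα S hh hn hPR
  obtain ⟨Q2, hQ2, hs2, s2⟩ := lift_fix hα S hh hn (P := P + z) (by rw [smul_add, hPR, hz1, add_zero])
  have hmem : 2 ^ n • (Q2 - Q1) ∈ EchoG.U (A := Pt L) n σ := by
    rw [EchoG.mem_U]
    refine ⟨?_, Q2 - Q1, ?_, rfl⟩
    · rw [smul_smul, ← pow_succ', smul_sub, hQ1, hQ2, sub_self]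
    · rw [smul_sub, hs1, hs2]
  have hbot := AddSubgroup.eq_bot_of_card_eq _ hU
  rw [hbot, AddSubgroup.mem_bot, smul_sub, sub_eq_zero] at hmem
  have t1 := red_pow (i := 1) (j := n) (by rw [add_comm]; exact hQ1) s1
  have t2 := red_pow (i := 1) (j := n) (by rw [add_comm]; exact hQ2) s2
  rw [hmem] at t2
  have := t2.fun t1
  rw [← map_nsmul, ← map_nsmul] at this
  have := pmap_inj _ this
  rw [smul_add] at this
  exact hz2 (by simpa using this)

end frob
end EchoE
end

section
open scoped Classical
open NumberField
namespace EchoE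

section c307
variable {k : Type*} [Field k] [Good k]

lemma spl307 (hp : (307 : k) = 0) : Spl (51 : k) 124 132 :=
  ⟨by linear_combination hp, by linear_combination (96) * hp, by linear_combination (2720) * hp⟩

lemma half307 (hp : (307 : k) = 0) (h0 : (238 : k) ≠ 0) : ∃ h, 2 • pt (233 : k) 238 h = RR k := by
  have h1 : (238 : k)^2 = cub (233) := by unfold cub; linear_combination (-40983) * hp
  refine ⟨h1, dbl_pt _ _ h0 (by linear_combination (-85996147) * hp) (by linear_combination (-114625) * hp)⟩

end c307

section c8629
variable {k : Type*} [Field k] [Good k]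

lemma spl8629 (hp : (8629 : k) = 0) : Spl (123 : k) 580 7926 :=
  ⟨by linear_combination hp, by linear_combination (654) * hp, by linear_combination (65528) * hp⟩

lemma c1 (hp : (8629 : k) = 0) (hne : ∀ n : ℕ, ¬ 8629 ∣ n → (n : k) ≠ 0) : ∃ h, 2 • pt (264 : k) 4179 h = RR k := by
  have h1 : (4179 : k)^2 = cub (264) := by unfold cub; linear_combination (-107) * hp
  have h0 : (4179 : k) ≠ 0 := by exact_mod_cast hne 4179 (by norm_num)
  exact ⟨h1, dbl_pt _ _ h0 (by linear_combination (-660096) * hp) (by linear_combination (-1902) * hp)⟩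

lemma c2 (hp : (8629 : k) = 0) (hne : ∀ n : ℕ, ¬ 8629 ∣ n → (n : k) ≠ 0) {h3 : (4179 : k)^2 = cub (264)} : ∃ h, 2 • pt (2579 : k) 4427 h = pt 264 4179 h3 := by
  have h1 : (4427 : k)^2 = cub (2579) := by unfold cub; linear_combination (-1985610) * hp
  have h0 : (4427 : k) ≠ 0 := by exact_mod_cast hne 4427 (by norm_num)
  exact ⟨h1, dbl_pt _ _ h0 (by linear_combination (-46091563037) * hp) (by linear_combination (-5344369) * hp)⟩

lemma c3 (hp : (8629 : k) = 0) (hne : ∀ n : ℕ, ¬ 8629 ∣ n → (n : k) ≠ 0) {h3 : (0 : k)^2 = cub (123)} : ∃ h, 2 • pt (3652 : k) 3465 h = pt 123 0 h3 := by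
  have h1 : (3465 : k)^2 = cub (3652) := by unfold cub; linear_combination (-5643171) * hp
  have h0 : (3465 : k) ≠ 0 := by exact_mod_cast hne 3465 (by norm_num)
  exact ⟨h1, dbl_pt _ _ h0 (by linear_combination (-185484362724) * hp) (by linear_combination (-16360614) * hp)⟩

lemma c4 (hp : (8629 : k) = 0) (hne : ∀ n : ℕ, ¬ 8629 ∣ n → (n : k) ≠ 0) {h3 : (0 : k)^2 = cub (580)} : ∃ h, 2 • pt (287 : k) 2470 h = pt 580 0 h3 := by
  have h1 : (2470 : k)^2 = cub (287) := by unfold cub; linear_combination (-2031) * hp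
  have h0 : (2470 : k) ≠ 0 := by exact_mod_cast hne 2470 (by norm_num)
  exact ⟨h1, dbl_pt _ _ h0 (by linear_combination (-3809989) * hp) (by linear_combination (9803) * hp)⟩

lemma c5 (hp : (8629 : k) = 0) (hne : ∀ n : ℕ, ¬ 8629 ∣ n → (n : k) ≠ 0) {h3 : (0 : k)^2 = cub (7926)} : ∃ h, 2 • pt (7635 : k) 3358 h = pt 7926 0 h3 := by
  have h1 : (3358 : k)^2 = cub (7635) := by unfold cub; linear_combination (-51576907) * hp
  have h0 : (3358 : k) ≠ 0 := by exact_mod_cast hne 3358 (by norm_num)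
  exact ⟨h1, dbl_pt _ _ h0 (by linear_combination (-3544076682357) * hp) (by linear_combination (5900165) * hp)⟩

lemma c6 (hp : (8629 : k) = 0) (hne : ∀ n : ℕ, ¬ 8629 ∣ n → (n : k) ≠ 0) {h3 : (3358 : k)^2 = cub (7635)} : ∃ h, 2 • pt (2822 : k) 6666 h = pt 7635 3358 h3 := by
  have h1 : (6666 : k)^2 = cub (2822) := by unfold cub; linear_combination (-2599252) * hp
  have h0 : (6666 : k) ≠ 0 := by exact_mod_cast hne 6666 (by norm_num)
  exact ⟨h1, dbl_pt _ _ h0 (by linear_combination (-65873198880) * hp) (by linear_combination (13341180) * hp)⟩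

lemma c7 (hp : (8629 : k) = 0) (hne : ∀ n : ℕ, ¬ 8629 ∣ n → (n : k) ≠ 0) {s : k} (hs : s^2 = 2) {h3 : (2470 : k)^2 = cub 287} (he : cub (580:k) = 0) :
    ∃ h h', 2 • pt (2411 + 4552 * s : k) (6737 + 1572 * s) h = pt 287 2470 h3 ∧
      pt (2411 + 4552 * s : k) (6737 + 1572 * s) h + tw 580 he = pt (2411 - 4552 * s : k) (6737 - 1572 * s) h' := by
  have h1 : (6737 + 1572*s : k)^2 = cub (2411 + 4552*s) := by unfold cub; linear_combination (-149870380848 - 94320644608*s) * hs + (-36355338 - 31058192*s) * hp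
  have h2 : (6737 - 1572*s : k)^2 = cub (2411 - 4552*s) := by unfold cub; linear_combination (-149870380848 + 94320644608*s) * hs + (-36355338 + 31058192*s) * hp
  have h0 : (6737 + 1572 * s : k) ≠ 0 := by
    intro h
    have h5 : ((6737^2 - 2 * 1572^2 : ℕ) : k) ≠ 0 := hne _ (by norm_num)
    apply h5
    have h6 : (6737^2 - 2 * 1572^2 : ℕ) = 40444801 := by norm_num
    rw [h6]; push_cast
    linear_combination (6737 - 1572 * s) * h + 1572^2 * hs
  have hx : (2411 + 4552 * s : k) ≠ 580 := by
    intro h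
    have h5 : ((38088847 : ℕ) : k) ≠ 0 := hne _ (by norm_num)
    apply h5
    push_cast
    linear_combination (-1) * ((2411 - 580 - 4552 * s) * h + 4552^2 * hs)
  exact ⟨h1, h2, dbl_pt _ _ h0 (by linear_combination (-14231610568449600 - 8186564678759424*s - 3864128168300544*s^2) * hs + (-3333689000529 - 2163367210624*s) * hp) (by linear_combination (-431773087584 - 282961933824*s) * hs + (-104352990 - 90986040*s) * hp), add_pt _ _ _ hx (by linear_combination (111930771824) * hs + (28036469 + 10433080*s) * hp) (by linear_combination (14311488) * hs + (458) * hp)⟩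

end c8629

end EchoE
end

section
open scoped Classical
open NumberField
namespace EchoE

instance fact7 : Fact (Nat.Prime 7) := ⟨by norm_num⟩
instance fact11 : Fact (Nat.Prime 11) := ⟨by norm_num⟩
instance fact307 : Fact (Nat.Prime 307) := ⟨by norm_num⟩
instance fact8629 : Fact (Nat.Prime 8629) := ⟨by norm_num⟩

lemma good_zmod {p : ℕ} [Fact p.Prime] (h : ¬ p ∣ 30) : Good (ZMod p) :=
  ⟨fun h0 => h ((ZMod.natCast_eq_zero_iff 30 p).1 (by exact_mod_cast h0))⟩

instance good7 : Good (ZMod 7) := good_zmod (by norm_num)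
instance good11 : Good (ZMod 11) := good_zmod (by norm_num)
instance good307 : Good (ZMod 307) := good_zmod (by norm_num)
instance good8629 : Good (ZMod 8629) := good_zmod (by norm_num)

lemma dec7 : ∀ y : ZMod 7, y ^ 3 - 48 * y + 272 ≠ 0 := by decide +kernel
lemma dec11 : ∀ a : ZMod 11, a ^ 4 + 96 * a ^ 2 - 2176 * a + 2304 - 4 * 16 * (a ^ 3 - 48 * a + 272) ≠ 0 := by decide +kernel
lemma dec11' : ∀ a b c : ZMod 11, a + b + c = 0 → a * b + a * c + b * c = -48 → a * b * c = -272 → False := by decide +kernel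

lemma smul_fix {L : Type} [Field L] [NumberField L] {σ : Gal(L/ℚ)} {x y : L} {h : y ^ 2 = cub x} : σ • pt x y h = pt x y h ↔ σ x = x ∧ σ y = y := pt_inj (h := map_cub (σ : L →+* L) h)

section frob
variable {L : Type} [Field L] [NumberField L] {p : ℕ} [Fact p.Prime] [Good (ZMod p)] [Good (AlgebraicClosure (ZMod p))]
  {α : 𝓞 L →+* AlgebraicClosure (ZMod p)} {σ : Gal(L/ℚ)} (hα : ∀ x, α x ^ p = α (σ • x))

include hα in
lemma fix_mem {x : 𝓞 L} (h : σ (x : L) = x) : ∃ y : ZMod p, algebraMap _ _ y = α x := by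
  apply EchoF.pow_p_mem
  rw [hα]
  congr 1
  exact RingOfIntegers.ext h

include hα in
lemma fix_of_red {B : Pt L} (hB : IsI B) (hs : σ • B = B) {j : ℕ} {Q : Pt L} (hQ : 2 ^ j • Q = B)
    {Q' : Pt (AlgebraicClosure (ZMod p))} (hr : Red α Q Q') (hf : pmap (frobenius _ p) Q' = Q') : σ • Q = Q := by
  have r2 := red_frob hα hr
  rw [hf] at r2
  refine red_uniqB hB (j := j) ?_ hQ r2 hr
  rw [← EchoG.smul_nsmul, hQ, hs]

lemma root_inj {e e' : 𝓞 L} (h : cub (e : L) = 0) (h' : cub (e' : L) = 0) (hee : α e = α e') : e = e' := by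
  by_contra hne
  have hne' : (e : L) - e' ≠ 0 := fun h0 => hne (RingOfIntegers.ext (sub_eq_zero.1 h0))
  have h1 : (e : L)^2 + e * e' + e'^2 = 48 := by
    apply mul_left_cancel₀ hne'
    unfold cub at h h'
    linear_combination h - h'
  have h2 : e ^ 2 + e * e' + e' ^ 2 = 48 := by
    apply RingOfIntegers.ext
    rw [show ((48 : 𝓞 L) : L) = 48 from map_ofNat _ _, ← h1]
    simp
  have h3 := congrArg α h2
  rw [map_add, map_add, map_mul, map_pow, map_pow, ← hee, map_ofNat] at h3
  exact sing (red_root (α := α) h) (by linear_combination h3)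

end frob

section
variable {L : Type} [Field L] [NumberField L] [IsGalois ℚ L]

lemma arith7 : ∃ g : Gal(L/ℚ), ∀ v : Pt L, 2 • v = 0 → g • v = v → v = 0 := by
  have := good_closure 7
  obtain ⟨α, σ, hα⟩ := EchoF.exists_frob L 7
  refine ⟨σ, fun v hv hs => ?_⟩
  rcases two_tors hv with h | ⟨e, he, rfl⟩
  · exact h
  exfalso
  have h0 : cub e = 0 := by rw [← he]; ring
  obtain ⟨e', rfl⟩ := isInt_root h0
  rw [smul_fix] at hs
  obtain ⟨y, hy⟩ := fix_mem hα hs.1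
  have h1 := red_root (α := α) h0
  rw [← hy] at h1
  have h2 : cub y = 0 := by
    apply (algebraMap (ZMod 7) (AlgebraicClosure (ZMod 7))).injective
    rw [map_zero, ← h1]; simp [cub, map_ofNat]
  exact dec7 y h2

lemma arith11 {e1 e2 e3 : L} (S : Spl e1 e2 e3) : ∃ g : Gal(L/ℚ), (∀ x : Pt L, 2 • x = RR L → g • x ≠ x) ∧ ∃ v : Pt L, 2 • v = 0 ∧ g • v ≠ v := by
  have := good_closure 11
  obtain ⟨α, σ, hα⟩ := EchoF.exists_frob L 11
  refine ⟨σ, fun x hx hs => ?_, ?_⟩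
  · obtain ⟨x', r⟩ := isI_red (α := α) (isI_X (j := 1) (Q := x) (by rw [pow_one]; exact hx))
    have r2 := red_double r (by rw [hx]; exact isI_RR)
    rw [hx] at r2
    have h2 := Red.fun r2 red_RR
    have r3 := red_frob hα r
    rw [hs] at r3
    obtain ⟨P, rfl⟩ := fix_frob (Red.fun r3 r)
    rw [← map_nsmul, ← pmap_RR (algebraMap (ZMod 11) _)] at h2
    have h3 := pmap_inj _ h2
    rcases pt_cases P with rfl | ⟨a, b, hab, rfl⟩
    · rw [smul_zero] at h3
      exact pt_ne_zero _ h3.symm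
    · have h4 := dbl_quartic h3
      exact dec11 a h4
  · by_contra! hc
    obtain ⟨a, b, c, rfl, rfl, rfl⟩ := S.int
    have key : ∀ e : 𝓞 L, cub (e : L) = 0 → ∃ y : ZMod 11, algebraMap _ _ y = α e := by
      intro e he
      have := hc (tw (e : L) he) (two_tw _ _)
      unfold tw at this
      rw [smul_fix] at this
      exact fix_mem hα this.1
    have S' := S.red α
    obtain ⟨a', ha⟩ := key a S.root
    obtain ⟨b', hb⟩ := key b S.rot.root
    obtain ⟨c', hc⟩ := key c S.rot.rot.root
    rw [← ha, ← hb, ← hc] at S'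
    obtain ⟨s1, s2, s3⟩ := S'
    have inj := (algebraMap (ZMod 11) (AlgebraicClosure (ZMod 11))).injective
    have t1 : a' + b' + c' = 0 := inj (by rw [map_add, map_add, s1, map_zero])
    have t2 : a' * b' + a' * c' + b' * c' = -48 := inj (by rw [map_add, map_add, map_mul, map_mul, map_mul, s2, map_neg, map_ofNat])
    have t3 : a' * b' * c' = -272 := inj (by rw [map_mul, map_mul, s3, map_neg, map_ofNat])
    exact dec11' _ _ _ t1 t2 t3
end
end EchoE
end

section
open scoped Classical
open NumberField
namespace EchoE

lemma four_nsmul {A : Type*} [AddCommGroup A] (z : A) : 2 • (2 • z) = 4 • z := by rw [smul_smul]; norm_num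

section gen
variable {A : Type*} [AddCommGroup A] {f : A →+ A} (hV : ∀ P, 2 • P = 0 → f P = P)

include hV in
lemma halves_fix {B Q0 : A} (h0 : 2 • Q0 = B) (hf : f Q0 = Q0) {Q : A} (hQ : 2 • Q = B) : f Q = Q := by
  have := hV (Q - Q0) (by rw [smul_sub, h0, hQ, sub_self])
  rw [map_sub, hf] at this
  exact sub_left_injective this

include hV in
lemma quart_fix (hh : ∀ T : A, 2 • T = 0 → ∃ Z, 2 • Z = T ∧ f Z = Z) {P : A} (hP : 4 • P = 0) : f P = P := by
  obtain ⟨Z, h1, h2⟩ := hh (2 • P) (by rw [four_nsmul, hP])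
  exact halves_fix hV h1 h2 rfl

include hV in
lemma quart_shift (hh : ∀ T : A, 2 • T = 0 → ∃ Z, 2 • Z = T ∧ f Z = Z) {B Q0 T : A} (h0 : 4 • Q0 = B) (hf : f Q0 = Q0 + T)
    {Q : A} (hQ : 4 • Q = B) : f Q = Q + T := by
  have := quart_fix hV hh (P := Q - Q0) (by rw [smul_sub, h0, hQ, sub_self])
  rw [map_sub, hf] at this
  rw [← sub_eq_iff_eq_add]
  rw [← sub_left_inj (a := Q0), ← this]
  abel
end gen

lemma Spl.fixV {k : Type*} [Field k] [Good k] {a b c : k} (S : Spl a b c) {φ : k →+* k} (ha : φ a = a) (hb : φ b = b) (hc : φ c = c)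
    (P : Pt k) (hP : 2 • P = 0) : pmap φ P = P := by
  rcases (S.tors P).1 hP with rfl | rfl | rfl | rfl
  · exact map_zero _
  all_goals rw [pmap_tw]; unfold tw; exact pt_congr (by assumption) rfl

lemma quarter {k : Type*} [Field k] [Good k] {z : Pt k} (h4 : 4 • z = 0) (h2 : 2 • z ≠ 0) :
    ∃ x y h e he, z = pt x y h ∧ 2 • z = tw e he ∧ (x - e) ^ 2 = 3 * e ^ 2 - 48 ∧ z + 2 • z = pt x (-y) ((neg_sq y).trans h) := by
  rcases two_tors (P := 2 • z) (by rw [four_nsmul, h4]) with h | ⟨e, he0, h⟩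
  · exact absurd h h2
  have he : cub e = 0 := by rw [← he0]; ring
  rcases pt_cases z with rfl | ⟨x, y, hxy, rfl⟩
  · exact absurd (smul_zero _) h2
  have hz : pt x y hxy + 2 • pt x y hxy = pt x (-y) ((neg_sq y).trans hxy) := by
    rw [← neg_pt hxy, eq_neg_iff_add_eq_zero, ← h4]; abel
  refine ⟨x, y, hxy, e, he, rfl, h, ?_, hz⟩
  have hx : x ≠ e := by
    rintro rfl
    have : y = 0 := by rw [he] at hxy; exact pow_eq_zero_iff (two_ne_zero) |>.1 hxy
    subst this
    exact h2 (dbl_zero _)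
  obtain ⟨x', y', h', k1, k2, k3⟩ := add_tw hxy he hx
  have h5 : 2 • pt x y hxy = tw e he := h
  rw [h5, k1] at hz
  rw [(pt_inj.1 hz).1] at k2
  rw [← k2]; ring

lemma cond_iff {L : Type} [Field L] [NumberField L] {γ : Gal(L/ℚ)} {x y : L} {h : y ^ 2 = cub x} {h' : (-y) ^ 2 = cub x}
     : (γ • pt x y h = pt x y h ∨ γ • pt x y h = pt x (-y) h') ↔ γ x = x := by
  have e1 : γ • pt x y h = pt x y h ↔ γ x = x ∧ γ y = y := smul_fix
  have e2 : γ • pt x y h = pt x (-y) h' ↔ γ x = x ∧ γ y = -y := pt_inj (h := map_cub (γ : L →+* L) h)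
  rw [e1, e2]
  constructor
  · rintro (h | h) <;> exact h.1
  · intro hx
    have : (γ y) ^ 2 = y ^ 2 := by rw [← map_pow, h]; simp [cub, hx, map_ofNat]
    rcases sq_eq_sq_iff_eq_or_eq_neg.1 this with h | h
    · exact Or.inl ⟨hx, h⟩
    · exact Or.inr ⟨hx, h⟩

lemma dec307 : ∀ y : ZMod 307, (y - 51) ^ 2 ≠ 3 * 51 ^ 2 - 48 ∧ (y - 124) ^ 2 ≠ 3 * 124 ^ 2 - 48 ∧ (y - 132) ^ 2 ≠ 3 * 132 ^ 2 - 48 := by decide +kernel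

section
variable {L : Type} [Field L] [NumberField L] [IsGalois ℚ L]

lemma arith307 : ∃ γ ∈ EchoG.Γ Gal(L/ℚ) (RR L) 0, ∀ z : Pt L, 4 • z = 0 → 2 • z ≠ 0 → γ • z ≠ z ∧ γ • z ≠ z + 2 • z := by
  have := good_closure 307
  obtain ⟨α, σ, hα⟩ := EchoF.exists_frob L 307
  have hp : (307 : AlgebraicClosure (ZMod 307)) = 0 := by exact_mod_cast CharP.cast_eq_zero (AlgebraicClosure (ZMod 307)) 307
  have h0 : (238 : AlgebraicClosure (ZMod 307)) ≠ 0 := by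
    have := (CharP.cast_eq_zero_iff (AlgebraicClosure (ZMod 307)) 307 238).not.2 (by norm_num)
    exact_mod_cast this
  have S' := spl307 hp
  refine ⟨σ, fun q hq => ?_, fun z h4 h2 => ?_⟩
  · obtain ⟨q', r⟩ := isI_red (α := α) (isI_X hq)
    refine fix_of_red hα isI_RR (smul_RR _) hq r ?_
    obtain ⟨h, k⟩ := half307 hp h0
    rw [zero_add, pow_one] at hq
    have r2 := red_double r (by rw [hq]; exact isI_RR)
    rw [hq] at r2
    refine halves_fix (S'.fixV (map_ofNat _ _) (map_ofNat _ _) (map_ofNat _ _)) k ?_ (Red.fun r2 red_RR)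
    rw [pmap_pt]
    exact pt_congr (map_ofNat _ _) (map_ofNat _ _)
  · obtain ⟨x, y, h, e, he, rfl, hz, hs, hz3⟩ := quarter h4 h2
    have hI := isI_half (hz ▸ isI_tw he)
    obtain ⟨x', y', h', hx⟩ := hI
    obtain ⟨rfl, rfl⟩ := pt_inj.1 hx
    obtain ⟨e', rfl⟩ := isInt_root he
    suffices h : ¬ σ (x' : L) = x' by
      rw [← cond_iff (h := h') (h' := by rw [neg_sq, h'])] at h
      rw [hz3]
      tauto
    intro hx
    obtain ⟨u, hu⟩ := fix_mem hα hx
    have h5 : (x' - e') ^ 2 = 3 * e' ^ 2 - 48 := by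
      apply RingOfIntegers.ext
      have e1 : algebraMap (𝓞 L) L ((x' - e') ^ 2) = algebraMap (𝓞 L) L (3 * e' ^ 2 - 48) := by
        rw [map_pow, map_sub, map_sub, map_mul, map_ofNat, map_ofNat, map_pow]
        exact hs
      exact e1
    have h6 := congrArg α h5
    rw [map_pow, map_sub, map_sub, map_mul, map_ofNat, map_ofNat, map_pow, ← hu] at h6
    have inj := (algebraMap (ZMod 307) (AlgebraicClosure (ZMod 307))).injective
    rcases S'.roots (red_root (α := α) he) with h7 | h7 | h7 <;> rw [h7] at h6
    · exact (dec307 u).1 (inj (by simpa [map_ofNat] using h6))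
    · exact (dec307 u).2.1 (inj (by simpa [map_ofNat] using h6))
    · exact (dec307 u).2.2 (inj (by simpa [map_ofNat] using h6))

omit [IsGalois ℚ L] in
lemma exists_rho {γ : Gal(L/ℚ)} {a b : L} {hab : b ^ 2 = cub a} (hq : 2 • pt a b hab = RR L) (ha : γ a = a) (hb : γ b = b)
    {e x : L} (he : cub e = 0) (hγ : γ e = e) (hs : (x - e) ^ 2 = 3 * e ^ 2 - 48) :
    ∃ ρ : L, ρ ^ 2 = 3 ∧ (γ ρ = ρ ↔ γ x = x) := by
  have hb0 := (dbl_inv hq).1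
  have hQ := dbl_quartic hq
  let r := ((a - e) ^ 2 - (3 * e ^ 2 - 48)) / (2 * b)
  let u := (e ^ 2 + e - 32) / 180
  have hr : r ^ 2 = 16 - e := by
    simp only [r]
    rw [div_pow, div_eq_iff (by simpa using hb0)]
    unfold cub at hab he
    linear_combination hQ + (4 * e + 8 * a) * he - 4 * (16 - e) * hab
  have hu : 16 - e = 3 * ((x - e) * u) ^ 2 := by
    rw [mul_pow, hs]
    simp only [u]
    unfold cub at he
    linear_combination (-(e^3+2*e^2-31*e-272)/3600) * he
  have h16 : (16 : L) - e ≠ 0 := by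
    intro h
    have : e = 16 := by linear_combination -h
    rw [this] at he
    norm_num [cub] at he
  have hr0 : r ≠ 0 := by intro h; rw [h] at hr; exact h16 (by rw [← hr]; ring)
  have hsu : (x - e) * u ≠ 0 := by intro h; rw [h] at hu; exact h16 (by rw [hu]; ring)
  have hγr : γ r = r := by simp [r, ha, hb, hγ, map_ofNat]
  have hγu : γ u = u := by simp [u, hγ, map_ofNat]
  refine ⟨r / ((x - e) * u), ?_, ?_⟩
  · rw [div_pow, hr, div_eq_iff (by exact pow_ne_zero 2 hsu)]; exact hu
  · rw [map_div₀, map_mul, map_sub, hγr, hγu, hγ]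
    constructor
    · intro h
      by_cases h0 : (γ x - e) * u = 0
      · exfalso
        rw [h0, div_zero] at h
        exact div_ne_zero hr0 hsu h.symm
      · rw [div_eq_div_iff h0 hsu] at h
        have h1 := mul_left_cancel₀ hr0 h
        have h2 := mul_right_cancel₀ (right_ne_zero_of_mul hsu) h1
        linear_combination -h2
    · intro h; rw [h]

omit [IsGalois ℚ L] in
lemma arithF4 (hh : ∃ q, 2 • q = RR L) : ∀ γ ∈ EchoG.Γ Gal(L/ℚ) (RR L) 0, ∀ z w : Pt L, 4 • z = 0 → 2 • z ≠ 0 → 4 • w = 0 → 2 • w ≠ 0 →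
    (γ • z = z ∨ γ • z = z + 2 • z) → (γ • w = w ∨ γ • w = w + 2 • w) := by
  intro γ hγ z w z4 z2 w4 w2
  obtain ⟨q, hq⟩ := hh
  have hΓ : ∀ q, 2 • q = RR L → γ • q = q := fun q h => hγ q (by rw [zero_add, pow_one]; exact h)
  have hV : ∀ v : Pt L, 2 • v = 0 → γ • v = v := by
    intro v hv
    have h1 := hΓ (q + v) (by rw [smul_add, hq, hv, add_zero])
    rw [smul_add, hΓ q hq] at h1
    exact add_left_cancel h1
  have hE : ∀ e : L, cub e = 0 → γ e = e := fun e he => (smul_fix.1 (hV (tw e he) (two_tw _ _))).1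
  obtain ⟨x, y, h, e, he, rfl, hz, hs, hz3⟩ := quarter z4 z2
  obtain ⟨x', y', h', e', he', rfl, hz', hs', hz3'⟩ := quarter w4 w2
  rw [hz3, hz3', cond_iff, cond_iff]
  rcases pt_cases q with rfl | ⟨a, b, hab, rfl⟩
  · rw [smul_zero] at hq
    exact absurd hq.symm (pt_ne_zero _)
  obtain ⟨ha, hb⟩ := smul_fix.1 (hΓ _ hq)
  obtain ⟨ρ, h1, h2⟩ := exists_rho hq ha hb he (hE e he) hs
  obtain ⟨ρ', h1', h2'⟩ := exists_rho hq ha hb he' (hE e' he') hs'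
  rw [← h2, ← h2']
  intro h
  rcases sq_eq_sq_iff_eq_or_eq_neg.1 (h1'.trans h1.symm) with rfl | rfl
  · exact h
  · rw [map_neg, h]
end
end EchoE
end

section
open scoped Classical
open NumberField
namespace EchoE

lemma dec8629 : (2 ^ 4314 + 1) = 8629 * ((2 ^ 4314 + 1) / 8629) := by decide +kernel

section
variable {L : Type} [Field L] [NumberField L] [IsGalois ℚ L]

lemma arith8629 {e1 e2 e3 : L} (S : Spl e1 e2 e3) : ∃ γ ∈ EchoG.Γ Gal(L/ℚ) (RR L) 1, ∃ e f : Pt L, 2 • e = 0 ∧ 2 • f = 0 ∧ e ≠ 0 ∧ f ≠ 0 ∧ e ≠ f ∧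
    (∀ z : Pt L, 4 • z = f → γ • z = z) ∧ (∀ z : Pt L, 4 • z = e → γ • z = z + e) := by
  have := good_closure 8629
  obtain ⟨α, σ, hα⟩ := EchoF.exists_frob L 8629
  set κ := AlgebraicClosure (ZMod 8629) with hκ
  have hp : (8629 : κ) = 0 := by exact_mod_cast CharP.cast_eq_zero κ 8629
  have hne : ∀ n : ℕ, ¬ 8629 ∣ n → (n : κ) ≠ 0 := fun n hn => (CharP.cast_eq_zero_iff κ 8629 n).not.2 hn
  have S' := spl8629 hp
  let φ : Pt κ →+ Pt κ := pmap (frobenius κ 8629)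
  have hV : ∀ P, 2 • P = 0 → φ P = P := S'.fixV (map_ofNat _ _) (map_ofNat _ _) (map_ofNat _ _)
  obtain ⟨h1, k1⟩ := c1 hp hne
  obtain ⟨h2, k2⟩ := c2 hp hne (h3 := h1)
  obtain ⟨h3, k3⟩ := c3 hp hne (h3 := by rw [S'.root]; ring)
  obtain ⟨h4, k4⟩ := c4 hp hne (h3 := by rw [S'.rot.root]; ring)
  obtain ⟨h5, k5⟩ := c5 hp hne (h3 := by rw [S'.rot.rot.root]; ring)
  obtain ⟨h6, k6⟩ := c6 hp hne (h3 := h5)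
  obtain ⟨s, hs⟩ := IsAlgClosed.exists_pow_nat_eq (2 : κ) (n := 2) (by norm_num)
  obtain ⟨h7, h7', k7, k7'⟩ := c7 hp hne hs (h3 := h4) S'.rot.root
  have hfr : ∀ {x y : κ} {h : y ^ 2 = cub x}, frobenius κ 8629 x = x → frobenius κ 8629 y = y → φ (pt x y h) = pt x y h := by
    intro x y h hx hy
    exact pt_congr (h := map_cub (frobenius κ 8629) h) hx hy
  have hhalf : ∀ T : Pt κ, 2 • T = 0 → ∃ Z, 2 • Z = T ∧ φ Z = Z := by
    intro T hT
    rcases (S'.tors T).1 hT with rfl | rfl | rfl | rfl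
    · exact ⟨0, smul_zero _, map_zero _⟩
    · exact ⟨_, k3, hfr (map_ofNat _ _) (map_ofNat _ _)⟩
    · exact ⟨_, k4, hfr (map_ofNat _ _) (map_ofNat _ _)⟩
    · exact ⟨_, k5, hfr (map_ofNat _ _) (map_ofNat _ _)⟩
  have hs2 : frobenius κ 8629 s = -s := by
    have h21 : (2 : κ) ^ 4314 = -1 := by
      have h := congrArg (Nat.cast : ℕ → κ) dec8629
      generalize (2 ^ 4314 + 1) / 8629 = m at h
      rw [Nat.cast_add, Nat.cast_pow, Nat.cast_mul] at h
      push_cast at h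
      rw [hp, zero_mul] at h
      linear_combination h
    rw [frobenius_def]
    calc s ^ 8629 = s ^ (2 * 4314 + 1) := by norm_num only
      _ = (s ^ 2) ^ 4314 * s := by rw [pow_succ, pow_mul]
      _ = -s := by rw [hs, h21]; ring
  -- quarter points
  have hq : ∀ {B : Pt L} (hB : IsI B) {z : Pt L} (hz : 4 • z = B) {B' : Pt κ} (hr : Red α B B') {z' : Pt κ} (r : Red α z z'), 4 • z' = B' := by
    intro B hB z hz B' hr z' r
    have h22 : (2:ℕ) ^ 2 = 4 := rfl
    have := red_powB (α := α) hB (j := 2) (i := 0) (Q := z) (Q' := z') (by rw [zero_add, h22]; exact hz) r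
    rw [h22, hz] at this
    exact Red.fun this hr
  have hfix : ∀ {B : Pt L} (hB : IsI B) (hσ : σ • B = B) {B' : Pt κ} (hr : Red α B B') {Q0 : Pt κ} (h0 : 4 • Q0 = B') (hφ : φ Q0 = Q0)
      {z : Pt L} (hz : 4 • z = B), σ • z = z := by
    intro B hB hσ B' hr Q0 h0 hφ z hz
    have hz2 : 2 ^ 2 • z = B := hz
    obtain ⟨z', r⟩ := isI_red (α := α) (isI_XB hB hz2)
    refine fix_of_red hα hB hσ hz2 r ?_
    have := quart_shift hV hhalf (T := 0) h0 (by rw [hφ, add_zero]) (hq hB hz hr r)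
    rw [add_zero] at this
    exact this
  obtain ⟨a, b, c, rfl, rfl, rfl⟩ := S.int
  have hex : ∀ t : κ, cub t = 0 → ∃ e : 𝓞 L, cub (e : L) = 0 ∧ α e = t := by
    intro t ht
    rcases (S.red α).roots ht with h | h | h
    · exact ⟨a, S.root, h.symm⟩
    · exact ⟨b, S.rot.root, h.symm⟩
    · exact ⟨c, S.rot.rot.root, h.symm⟩
  obtain ⟨e, he, hae⟩ := hex 580 S'.rot.root
  obtain ⟨f, hf, haf⟩ := hex 7926 S'.rot.rot.root
  have hσt : ∀ (e : 𝓞 L) (he : cub (e : L) = 0), frobenius κ 8629 (α e) = α e → σ • tw (e : L) he = tw (e : L) he := by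
    intro e he h
    rw [frobenius_def, hα] at h
    have h1 : cub ((σ • e : 𝓞 L) : L) = 0 := by
      have := map_cub (σ : L →+* L) (x := (e : L)) (y := 0) (by rw [he]; ring)
      rw [map_zero] at this
      have h2 : cub (σ (e : L)) = 0 := by
        rw [← zero_pow two_ne_zero]; exact this.symm
      exact h2
    have h3 := root_inj h1 he h
    unfold tw
    refine smul_fix.2 ⟨?_, map_zero _⟩
    exact congrArg (algebraMap (𝓞 L) L) h3
  have rte : Red α (tw (e : L) he) (tw 580 S'.rot.root) := by
    have := red_tw (α := α) he
    convert this using 2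
    exact hae.symm
  have rtf : Red α (tw (f : L) hf) (tw 7926 S'.rot.rot.root) := by
    have := red_tw (α := α) hf
    convert this using 2
    exact haf.symm
  have hse : σ • tw (e : L) he = tw (e : L) he := hσt e he (by rw [hae]; exact map_ofNat _ _)
  have hsf : σ • tw (f : L) hf = tw (f : L) hf := hσt f hf (by rw [haf]; exact map_ofNat _ _)
  refine ⟨σ, fun q hq' => ?_, tw e he, tw f hf, two_tw _ _, two_tw _ _, tw_ne _ _, tw_ne _ _, ?_, fun z hz => ?_, fun z hz => ?_⟩
  · refine hfix isI_RR (smul_RR _) red_RR (Q0 := pt 2579 4427 h2) ?_ (hfr (map_ofNat _ _) (map_ofNat _ _)) hq'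
    rw [← four_nsmul, k2, k1]
  · rw [Ne, tw_inj]
    intro h
    have : e = f := RingOfIntegers.ext h
    rw [this, haf] at hae
    exact S'.rot.ne hae.symm
  · refine hfix (isI_tw hf) hsf rtf (Q0 := pt 2822 6666 h6) ?_ (hfr (map_ofNat _ _) (map_ofNat _ _)) hz
    rw [← four_nsmul, k6, k5]; rfl
  · have hz2 : 2 ^ 2 • z = tw (e : L) he := hz
    have hI := isI_XB (isI_tw he) hz2
    obtain ⟨z', r⟩ := isI_red (α := α) hI
    have h0 : 4 • pt (2411 + 4552 * s : κ) (6737 + 1572 * s) h7 = tw 580 S'.rot.root := by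
      rw [← four_nsmul, k7, k4]; rfl
    have h00 : φ (pt (2411 + 4552 * s : κ) (6737 + 1572 * s) h7) = pt (2411 + 4552 * s : κ) (6737 + 1572 * s) h7 + tw 580 S'.rot.root := by
      rw [k7']
      refine pt_congr (h := map_cub (frobenius κ 8629) h7) ?_ ?_
      · change frobenius κ 8629 _ = _
        rw [map_add, map_mul, hs2, map_ofNat, map_ofNat]; ring
      · change frobenius κ 8629 _ = _
        rw [map_add, map_mul, hs2, map_ofNat, map_ofNat]; ring
    have h8 := quart_shift hV hhalf h0 h00 (hq (isI_tw he) hz rte r)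
    have r2 := red_frob hα r
    have h44 : 2 ^ 2 • (z + tw (e : L) he) = tw (e : L) he := by
      rw [smul_add, hz2, show (2:ℕ)^2 = 2 * 2 from rfl, mul_smul, two_tw, smul_zero, add_zero]
    refine red_uniqB (isI_tw he) (j := 2) ?_ h44 r2 ?_
    · rw [← EchoG.smul_nsmul, hz2, hse]
    · have h9 := hq (isI_tw he) hz rte r
      rw [show pmap (frobenius κ 8629) z' = _ from h8]
      have hI2 := isI_XB (isI_tw he) h44
      obtain ⟨x, y, h, rfl, rfl⟩ := r
      have h10 : cub (α e) = 0 := red_root he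
      have := red_add (α := α) he h10 (red_yB (isI_tw he) (j := 1) hz2) hI2
      convert this using 3
      exact hae.symm
end
end EchoE
end

section
open scoped Classical
open NumberField Filter Topology
namespace EchoE
open EchoP

lemma arith_all {L : Type} [Field L] [NumberField L] [IsGalois ℚ L] {e1 e2 e3 : L} (S : Spl e1 e2 e3) (hh : ∃ q, 2 • q = RR L) :
    EchoG.Arith Gal(L/ℚ) (RR L) :=
  ⟨arith7, arith11 S, arithF4 hh, arith307, arith8629 S⟩

section grp
variable {G A : Type} [Group G] [AddCommGroup A] [DistribMulAction G A]

lemma fix_gen {g h : G} (e : Subgroup.zpowers g = Subgroup.zpowers h) {q : A} (hq : g • q = q) : h • q = q := by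
  have h1 : Subgroup.zpowers g ≤ MulAction.stabilizer G q := by
    rw [Subgroup.zpowers_le]; exact hq
  exact h1 (e ▸ Subgroup.mem_zpowers h)

lemma fix_conj {g h : G} {q : A} (hq : g • q = q) : (h * g * h⁻¹) • (h • q) = h • q := by
  rw [smul_smul, inv_mul_cancel_right, mul_smul, hq]

lemma fix_conj' {g h : G} {q : A} (hq : (h * g * h⁻¹) • q = q) : g • (h⁻¹ • q) = h⁻¹ • q := by
  have := fix_conj (h := h⁻¹) hq
  rwa [show h⁻¹ * (h * g * h⁻¹) * h⁻¹⁻¹ = g by group] at this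

lemma U_triv {n : ℕ} {g : G} : Nat.card (EchoG.U (A := A) n g) = 1 ↔ ∀ y : A, g • y = y → 2 • (2 ^ n • y) = 0 → 2 ^ n • y = 0 := by
  rw [AddSubgroup.card_eq_one, AddSubgroup.eq_bot_iff_forall]
  constructor
  · intro h y hy h2
    exact h _ ⟨h2, y, hy, rfl⟩
  · rintro h v ⟨hv, y, hy, rfl⟩
    exact h y hy hv

lemma Al_conj {R : A} (hR : ∀ g : G, g • R = R) {n : ℕ} (g h : G) (H : EchoG.Al R n g) : EchoG.Al R n (h * g * h⁻¹) := by
  obtain ⟨q, hq, e⟩ := H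
  exact ⟨h • q, by rw [← EchoG.smul_nsmul, hq, hR], fix_conj e⟩

lemma Al_gen {R : A} {n : ℕ} (g h : G) (e : Subgroup.zpowers g = Subgroup.zpowers h) (H : EchoG.Al R n g) : EchoG.Al R n h := by
  obtain ⟨q, hq, e'⟩ := H
  exact ⟨q, hq, fix_gen e e'⟩

lemma U_conj {n : ℕ} (g h : G) (H : Nat.card (EchoG.U (A := A) n g) = 1) : Nat.card (EchoG.U (A := A) n (h * g * h⁻¹)) = 1 := by
  rw [U_triv] at H ⊢
  intro y hy h2
  have h3 := H (h⁻¹ • y) (fix_conj' hy) (by rw [← EchoG.smul_nsmul, ← EchoG.smul_nsmul, h2, smul_zero])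
  rw [← EchoG.smul_nsmul] at h3
  exact (smul_eq_zero_iff_eq _).1 h3

lemma U_gen {n : ℕ} (g h : G) (e : Subgroup.zpowers g = Subgroup.zpowers h) (H : Nat.card (EchoG.U (A := A) n g) = 1) : Nat.card (EchoG.U (A := A) n h) = 1 := by
  rw [U_triv] at H ⊢
  intro y hy h2
  exact H y (fix_gen e.symm hy) h2
end grp

noncomputable def ind (p : ℕ) : ℝ := if ∃ n : ℕ, (p : ℤ) ∣ (echo n).num then 1 else 0

lemma sandwich (n : ℕ) : ∃ (a d : ℕ → ℝ) (ma md : ℝ), HasMean a ma ∧ HasMean d md ∧ 179/336 - (1/2)^(n+1) ≤ ma ∧ md ≤ 179/336 + (1/2)^(n+1) ∧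
    ∀ p, p.Prime → 7 ≤ p → a p ≤ ind p ∧ ind p ≤ d p := by
  obtain ⟨L, _, _, _, ⟨e1, e2, e3, S⟩, hh⟩ := exists_L (n + 3)
  have B := base_of S hh
  have _ : Fintype Gal(L/ℚ) := Fintype.ofFinite _
  have H := arith_all S (hh 0 (by omega) (RR L) (Or.inr (by simp)))
  have M := EchoG.main B H (n := n) (by omega)
  have hex : ∀ p : ℕ, ∃ σ : Gal(L/ℚ), ∀ [Fact p.Prime], ∃ α : 𝓞 L →+* AlgebraicClosure (ZMod p), ∀ x, α x ^ p = α (σ • x) := by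
    intro p
    by_cases hp : p.Prime
    · have : Fact p.Prime := ⟨hp⟩
      obtain ⟨α, σ, h⟩ := EchoF.exists_frob L p
      exact ⟨σ, ⟨α, h⟩⟩
    · exact ⟨1, fun {h} => absurd h.out hp⟩
  choose φ hφ using hex
  have hG : (0 : ℝ) < Nat.card Gal(L/ℚ) := by exact_mod_cast Nat.card_pos
  refine ⟨_, _, _, _, EchoF.frob_density L φ (fun p => hφ p) {g | EchoG.Al (RR L) (n+1) g ∧ Nat.card (EchoG.U (A := Pt L) (n+1) g) = 1}
      (fun g h H => ⟨Al_conj smul_RR g h H.1, U_conj g h H.2⟩) (fun g h e H => ⟨Al_gen g h e H.1, U_gen g h e H.2⟩),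
    EchoF.frob_density L φ (fun p => hφ p) {g | EchoG.Al (RR L) (n+1) g} (fun g h H => Al_conj smul_RR g h H) (fun g h e H => Al_gen g h e H), ?_, ?_, ?_⟩
  · rw [le_div_iff₀ hG]; exact M.2
  · rw [div_le_iff₀ hG]; exact M.1
  · intro p hp h7
    have : Fact p.Prime := ⟨hp⟩
    have : Good (ZMod p) := good_zmod (by
      intro h
      have : p ∈ Nat.primeFactors 30 := by simp [hp, h]
      rw [show Nat.primeFactors 30 = {2, 3, 5} by decide +kernel] at this
      simp at this; omega)
    have := good_closure p
    obtain ⟨α, hα⟩ := hφ p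
    have h1 := squeeze1 hα S hh (n := n + 1) (by omega)
    have h2 := squeeze2 hα S hh (n := n + 1) (by omega)
    have h3 := echo_iff p
    rw [← h3] at h1 h2
    simp only [Set.mem_ofPred_eq, ind]
    constructor
    · split_ifs with c1 c2
      · exact le_rfl
      · exact absurd (h2 c1.1 c1.2) c2
      · norm_num
      · exact le_rfl
    · split_ifs with c1 c2
      · exact le_rfl
      · exact absurd (h1 c1) c2
      · norm_num
      · exact le_rfl

lemma mean_le {f g : ℕ → ℝ} (h : ∀ p, f p ≤ g p) (n : ℕ) :
    (∑ p ∈ Nat.primesLE n, f p) / (Nat.primesLE n).card ≤ (∑ p ∈ Nat.primesLE n, g p) / (Nat.primesLE n).card :=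
  div_le_div_of_nonneg_right (Finset.sum_le_sum fun p _ => h p) (Nat.cast_nonneg _)

lemma hasMean_ind : HasMean (fun p => if p.Prime then ind p else 0) (179/336) := by
  have hpow : Tendsto (fun n : ℕ => (1/2 : ℝ)^(n+1)) atTop (𝓝 0) :=
    (tendsto_pow_atTop_nhds_zero_of_lt_one (by norm_num) (by norm_num)).comp (tendsto_add_atTop_nat 1)
  unfold HasMean
  rw [tendsto_order]
  constructor
  · intro l hl
    obtain ⟨n, hn⟩ := (hpow.eventually_lt_const (sub_pos.2 hl)).exists
    obtain ⟨a, d, ma, md, ha, hd, h1, h2, h3⟩ := sandwich n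
    have ha' := ha.congr (g := fun p => if p.Prime ∧ 7 ≤ p then a p else 0) 7 (fun p h h' => by simp [h, h'])
    have := ha'.eventually_const_lt (u := l) (by linarith)
    filter_upwards [this] with x hx
    refine hx.trans_le (mean_le (fun p => ?_) x)
    split_ifs with c1 c2 c2
    · exact (h3 p c1.1 c1.2).1
    · exact absurd c1.1 c2
    · unfold ind; split_ifs <;> norm_num
    · exact le_rfl
  · intro l hl
    obtain ⟨n, hn⟩ := (hpow.eventually_lt_const (sub_pos.2 hl)).exists
    obtain ⟨a, d, ma, md, ha, hd, h1, h2, h3⟩ := sandwich n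
    have hd' := hd.congr (g := fun p => if p.Prime ∧ 7 ≤ p then d p else 1) 7 (fun p h h' => by simp [h, h'])
    have := hd'.eventually_lt_const (u := l) (by linarith)
    filter_upwards [this] with x hx
    refine (mean_le (fun p => ?_) x).trans_lt hx
    split_ifs with c1 c2 c2
    · exact (h3 p c2.1 c2.2).2
    · unfold ind; split_ifs <;> norm_num
    · exact absurd c2.1 c1
    · norm_num

end EchoE
end

/-- The density of primes dividing some term of the ECHO sequence is 179/336. -/
theorem density_of_primes_dividing_echo :
    Filter.Tendsto
      (fun x : ℕ =>
        (Nat.card {p : ℕ // p ≤ x ∧ p.Prime ∧ ∃ n : ℕ, (p : ℤ) ∣ (echo n).num} : ℝ) /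
          (Nat.card {p : ℕ // p ≤ x ∧ p.Prime} : ℝ))
      Filter.atTop (nhds (179 / 336)) := by
  classical
  refine Filter.Tendsto.congr (fun x => ?_) EchoE.hasMean_ind
  have h1 : Nat.card {p : ℕ // p ≤ x ∧ p.Prime} = (Nat.primesLE x).card := by
    exact Nat.subtype_card _ (fun p => Nat.mem_primesLE)
  have h2 : Nat.card {p : ℕ // p ≤ x ∧ p.Prime ∧ ∃ n : ℕ, (p : ℤ) ∣ (echo n).num} =
      ((Nat.primesLE x).filter (fun p : ℕ => ∃ n : ℕ, (p : ℤ) ∣ (echo n).num)).card := by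
    refine Nat.subtype_card _ (fun p => ?_)
    rw [Finset.mem_filter, Nat.mem_primesLE, and_assoc]
  rw [h1, h2]
  congr 1
  rw [Finset.natCast_card_filter]
  refine Finset.sum_congr rfl fun p hp => ?_
  have hp' := (Nat.mem_primesLE.1 hp).2
  simp only [if_pos hp', EchoE.ind]
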